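/- For every nonempty open primary basic semialgebraic set V ⊆ ℝ^m defined over ℤ, there exists a simplicial polytope P (in some dimension d, with some number n of vertices) such that V is stably equivalent to the realization space ℛ(P). -/

import Mathlib

noncomputable section

/-- A primary basic semialgebraic set in `ℝ^m` defined over `ℤ`: the solution set of finitely
many polynomial equalities and *strict* polynomial inequalities with integer coefficients. -/
def IsPrimaryBasicSemialgebraicZ {m : ℕ} (S : Set (Fin m → ℝ)) : Prop :=
  ∃ (k l : ℕ) (f : Fin k → MvPolynomial (Fin m) ℤ) (g : Fin l → MvPolynomial (Fin m) ℤ),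
    S = {x : Fin m → ℝ |
      (∀ i, MvPolynomial.aeval x (f i) = (0 : ℝ)) ∧
      (∀ j, (0 : ℝ) < MvPolynomial.aeval x (g j))}

/-- `S ⊆ ℝ^d` is a stable projection of `T ⊆ ℝ^{d+d'}`: the coordinate projection maps `T`
onto `S`, and over each `x ∈ S` the fiber of `T` is a nonempty set given by linear equalities
and strict linear inequalities in the fiber variables, whose coefficients depend polynomially
on `x` (i.e. the relative interior of a nonempty polyhedron depending polynomially on `x`). -/
def IsStableProjection {d d' : ℕ} (S : Set (Fin d → ℝ)) (T : Set (Fin (d + d') → ℝ)) : Prop :=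
  ∃ (k l : ℕ) (A : Fin k → Fin d' → MvPolynomial (Fin d) ℝ) (b : Fin k → MvPolynomial (Fin d) ℝ)
    (C : Fin l → Fin d' → MvPolynomial (Fin d) ℝ) (c : Fin l → MvPolynomial (Fin d) ℝ),
    (∀ x ∈ S, ∃ y : Fin d' → ℝ, Fin.append x y ∈ T) ∧
    ∀ (x : Fin d → ℝ) (y : Fin d' → ℝ),
      Fin.append x y ∈ T ↔
        x ∈ S ∧
        (∀ i, (∑ j, MvPolynomial.eval x (A i j) * y j) + MvPolynomial.eval x (b i) = 0) ∧
        (∀ i, 0 < (∑ j, MvPolynomial.eval x (C i j) * y j) + MvPolynomial.eval x (c i))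

/-- `f` is coordinatewise a rational function on `S` (denominators nonvanishing on `S`). -/
def IsRationalMapOn {d e : ℕ} (S : Set (Fin d → ℝ)) (f : (Fin d → ℝ) → Fin e → ℝ) : Prop :=
  ∀ i : Fin e, ∃ p q : MvPolynomial (Fin d) ℝ, ∀ x ∈ S,
    MvPolynomial.eval x q ≠ 0 ∧ f x i = MvPolynomial.eval x p / MvPolynomial.eval x q

/-- `S` and `T` are rationally equivalent: there are mutually inverse bijections between them
which are coordinatewise rational (hence in particular a homeomorphism). -/
def RationallyEquivalent {d e : ℕ} (S : Set (Fin d → ℝ)) (T : Set (Fin e → ℝ)) : Prop :=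
  ∃ (f : (Fin d → ℝ) → Fin e → ℝ) (g : (Fin e → ℝ) → Fin d → ℝ),
    IsRationalMapOn S f ∧ IsRationalMapOn T g ∧
    (∀ x ∈ S, f x ∈ T) ∧ (∀ y ∈ T, g y ∈ S) ∧
    (∀ x ∈ S, g (f x) = x) ∧ (∀ y ∈ T, f (g y) = y)

/-- One generating step of stable equivalence: a stable projection (in either direction,
symmetry being supplied by the generated equivalence) or a rational equivalence. -/
def StableStep (X Y : Σ d : ℕ, Set (Fin d → ℝ)) : Prop :=
  (∃ (d' : ℕ) (T : Set (Fin (X.1 + d') → ℝ)),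
      Y = ⟨X.1 + d', T⟩ ∧ IsStableProjection X.2 T) ∨
  RationallyEquivalent X.2 Y.2

/-- Stable equivalence: the equivalence relation generated by stable projections and
rational equivalences. -/
def StablyEquivalent (X Y : Σ d : ℕ, Set (Fin d → ℝ)) : Prop :=
  Relation.EqvGen StableStep X Y

/-- The index of the `c`-th coordinate of the `p`-th point in the flattening
`(ℝ^d)^n ≃ ℝ^{d·n}`. -/
def flatIdx {n d : ℕ} (p : Fin n) (c : Fin d) : Fin (d * n) :=
  ⟨d * p.1 + c.1, by
    have h1 : d * (p.1 + 1) ≤ d * n := Nat.mul_le_mul le_rfl p.2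
    have h2 : d * (p.1 + 1) = d * p.1 + d := by ring
    have h3 := c.2
    omega⟩

/-- Flatten a set of point configurations `(ℝ^d)^n` into a subset of `ℝ^{d·n}`. -/
def flat {n d : ℕ} (R : Set (Fin n → Fin d → ℝ)) : Set (Fin (d * n) → ℝ) :=
  {x | (fun (p : Fin n) (c : Fin d) => x (flatIdx p c)) ∈ R}

/-- `v '' S` is the set of extreme points of some face of the polytope `conv (range v)`;
the faces of a polytope `Q` are `Q` itself, `∅`, and the exposed faces of `Q`
(`∅` is exposed). -/
def IsVertexSetOfFace {n d : ℕ} (v : Fin n → Fin d → ℝ) (S : Finset (Fin n)) : Prop :=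
  ∃ F : Set (Fin d → ℝ),
    (F = convexHull ℝ (Set.range v) ∨ IsExposed ℝ (convexHull ℝ (Set.range v)) F) ∧
    Set.extremePoints ℝ F = v '' ↑S

/-- `v` lists the `n` vertices of a (full-dimensional) polytope in `ℝ^d`: the `v i` are
pairwise distinct, each is an extreme point of their convex hull, and they affinely
span `ℝ^d` (so the polytope has dimension `d`). -/
def IsPolytopeVertexList {n d : ℕ} (v : Fin n → Fin d → ℝ) : Prop :=
  Function.Injective v ∧
  (∀ i, v i ∈ Set.extremePoints ℝ (convexHull ℝ (Set.range v))) ∧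
  affineSpan ℝ (Set.range v) = ⊤

/-- The (normalized) realization space of the polytope with vertex list `v`, with respect to
the affine basis indexed by `B`: labeled point configurations `x` fixing the basis, all of
whose points are vertices of their convex hull, with the same vertex sets of faces as `v`. -/
def polytopeRealizationSpace {n d : ℕ} (v : Fin n → Fin d → ℝ) (B : Finset (Fin n)) :
    Set (Fin n → Fin d → ℝ) :=
  {x | (∀ i ∈ B, x i = v i) ∧
    (∀ i, x i ∈ Set.extremePoints ℝ (convexHull ℝ (Set.range x))) ∧
    ∀ S : Finset (Fin n), IsVertexSetOfFace x S ↔ IsVertexSetOfFace v S}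

/-- A `d`-polytope with vertex list `v` is neighborly if every set of at most `⌊d/2⌋`
vertices is the vertex set of a face. -/
def IsNeighborly {n d : ℕ} (v : Fin n → Fin d → ℝ) : Prop :=
  ∀ S : Finset (Fin n), S.card ≤ d / 2 → IsVertexSetOfFace v S

/-- A polytope is simplicial if all of its proper faces are simplices. -/
def IsSimplicialVertexList {n d : ℕ} (v : Fin n → Fin d → ℝ) : Prop :=
  ∀ F : Set (Fin d → ℝ), IsExposed ℝ (convexHull ℝ (Set.range v)) F →
    F ≠ convexHull ℝ (Set.range v) →
    ∃ s : Finset (Fin d → ℝ),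
      AffineIndependent ℝ (fun x : ↥s => (x : Fin d → ℝ)) ∧ F = convexHull ℝ ↑s

/-! ### Stable equivalence over arbitrary finite index types -/

/-- A real function of finitely many coordinates which is a polynomial. -/
def PolyFun {ι : Type} (F : (ι → ℝ) → ℝ) : Prop :=
  ∃ p : MvPolynomial ι ℝ, ∀ x, F x = MvPolynomial.eval x p

namespace PolyFun

variable {ι : Type} {F G : (ι → ℝ) → ℝ}

lemma const (c : ℝ) : PolyFun (fun _ : ι → ℝ => c) := ⟨MvPolynomial.C c, by simp⟩
lemma coord (i : ι) : PolyFun (fun x : ι → ℝ => x i) := ⟨MvPolynomial.X i, by simp⟩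
lemma add (hF : PolyFun F) (hG : PolyFun G) : PolyFun (fun x => F x + G x) := by
  obtain ⟨p, hp⟩ := hF; obtain ⟨q, hq⟩ := hG; exact ⟨p + q, by simp [hp, hq]⟩
lemma mul (hF : PolyFun F) (hG : PolyFun G) : PolyFun (fun x => F x * G x) := by
  obtain ⟨p, hp⟩ := hF; obtain ⟨q, hq⟩ := hG; exact ⟨p * q, by simp [hp, hq]⟩
lemma sub (hF : PolyFun F) (hG : PolyFun G) : PolyFun (fun x => F x - G x) := by
  obtain ⟨p, hp⟩ := hF; obtain ⟨q, hq⟩ := hG; exact ⟨p - q, by simp [hp, hq]⟩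
lemma neg (hF : PolyFun F) : PolyFun (fun x => - F x) := by
  obtain ⟨p, hp⟩ := hF; exact ⟨-p, by simp [hp]⟩
lemma sum {α : Type} (s : Finset α) {H : α → (ι → ℝ) → ℝ} (h : ∀ a, PolyFun (H a)) :
    PolyFun (fun x => ∑ a ∈ s, H a x) := by
  choose p hp using h
  exact ⟨∑ a ∈ s, p a, by simp [hp]⟩
lemma prod {α : Type} (s : Finset α) {H : α → (ι → ℝ) → ℝ} (h : ∀ a, PolyFun (H a)) :
    PolyFun (fun x => ∏ a ∈ s, H a x) := by
  choose p hp using h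
  exact ⟨∏ a ∈ s, p a, by simp [hp]⟩
lemma comp {κ : Type} {H : (κ → ℝ) → ℝ} (hH : PolyFun H) {φ : κ → (ι → ℝ) → ℝ}
    (hφ : ∀ k, PolyFun (φ k)) : PolyFun (fun x => H (fun k => φ k x)) := by
  obtain ⟨p, hp⟩ := hH
  choose q hq using hφ
  refine ⟨MvPolynomial.bind₁ q p, fun x => ?_⟩
  beta_reduce
  rw [hp]
  have : (fun k => φ k x) = fun k => MvPolynomial.eval x (q k) := by funext k; rw [hq]
  rw [this]
  simp only [MvPolynomial.eval, MvPolynomial.eval₂Hom_bind₁]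

end PolyFun

/-- A function which is affine in the second argument, with coefficients depending
polynomially on the first argument. -/
def IsAff {ι κ : Type} (F : (ι → ℝ) → (κ → ℝ) → ℝ) : Prop :=
  ∃ (_ : Fintype κ) (C : κ → (ι → ℝ) → ℝ) (c : (ι → ℝ) → ℝ),
    (∀ k, PolyFun (C k)) ∧ PolyFun c ∧ ∀ x y, F x y = (∑ k, C k x * y k) + c x

namespace IsAff

lemma exists_rep {ι κ : Type} [inst : Fintype κ] {F : (ι → ℝ) → (κ → ℝ) → ℝ} (h : IsAff F) :
    ∃ (C : κ → (ι → ℝ) → ℝ) (c : (ι → ℝ) → ℝ),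
      (∀ k, PolyFun (C k)) ∧ PolyFun c ∧ ∀ x y, F x y = (∑ k, C k x * y k) + c x := by
  obtain ⟨i, h⟩ := h
  cases Subsingleton.elim i inst
  exact h

variable {ι κ : Type} [Finite κ] {F G : (ι → ℝ) → (κ → ℝ) → ℝ}

lemma of_poly {p : (ι → ℝ) → ℝ} (hp : PolyFun p) : IsAff (fun x (_ : κ → ℝ) => p x) := by
  have := Fintype.ofFinite κ
  exact ⟨this, fun _ _ => 0, p, fun _ => PolyFun.const 0, hp, by simp⟩
lemma const (c : ℝ) : IsAff (fun (_ : ι → ℝ) (_ : κ → ℝ) => c) := of_poly (PolyFun.const c)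
lemma base (i : ι) : IsAff (fun (x : ι → ℝ) (_ : κ → ℝ) => x i) := of_poly (PolyFun.coord i)
lemma fib (k : κ) : IsAff (fun (_ : ι → ℝ) (y : κ → ℝ) => y k) := by
  classical
  have := Fintype.ofFinite κ
  exact ⟨this, fun j _ => if j = k then 1 else 0, fun _ => 0, fun _ => PolyFun.const _,
    PolyFun.const 0, by simp⟩
lemma elim (e : ι ⊕ κ) : IsAff (fun (x : ι → ℝ) (y : κ → ℝ) => Sum.elim x y e) := by
  rcases e with i | k
  · exact base i
  · exact fib k
lemma add (hF : IsAff F) (hG : IsAff G) : IsAff (fun x y => F x y + G x y) := by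
  obtain ⟨i1, C, c, hC, hc, h⟩ := hF
  obtain ⟨i2, D, d, hD, hd, h'⟩ := hG
  cases Subsingleton.elim i1 i2
  refine ⟨i1, fun k x => C k x + D k x, fun x => c x + d x, fun k => (hC k).add (hD k),
    hc.add hd, fun x y => ?_⟩
  beta_reduce; rw [h, h']; simp only [add_mul, Finset.sum_add_distrib]; ring
lemma poly_mul {p : (ι → ℝ) → ℝ} (hp : PolyFun p) (hF : IsAff F) :
    IsAff (fun x y => p x * F x y) := by
  obtain ⟨i1, C, c, hC, hc, h⟩ := hF
  refine ⟨i1, fun k x => p x * C k x, fun x => p x * c x, fun k => hp.mul (hC k),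
    hp.mul hc, fun x y => ?_⟩
  beta_reduce; rw [h]; simp only [mul_add, Finset.mul_sum, mul_assoc]
lemma mul_poly {p : (ι → ℝ) → ℝ} (hF : IsAff F) (hp : PolyFun p) :
    IsAff (fun x y => F x y * p x) := by
  have := poly_mul hp hF
  simpa only [mul_comm] using this
lemma neg (hF : IsAff F) : IsAff (fun x y => - F x y) := by
  have := poly_mul (PolyFun.const (-1)) hF
  simpa using this
lemma sub (hF : IsAff F) (hG : IsAff G) : IsAff (fun x y => F x y - G x y) := by
  have := hF.add hG.neg
  simpa only [sub_eq_add_neg] using this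

end IsAff

/-- A condition on `(x, y)` given by finitely many equations and strict inequalities which are
affine in `y` with coefficients polynomial in `x`. -/
def AffCond {ι κ : Type} (P : (ι → ℝ) → (κ → ℝ) → Prop) : Prop :=
  ∃ (α β : Type) (_ : Finite α) (_ : Finite β) (F : α → (ι → ℝ) → (κ → ℝ) → ℝ)
    (G : β → (ι → ℝ) → (κ → ℝ) → ℝ), (∀ a, IsAff (F a)) ∧ (∀ b, IsAff (G b)) ∧
    ∀ x y, P x y ↔ (∀ a, F a x y = 0) ∧ ∀ b, 0 < G b x y

namespace AffCond

variable {ι κ : Type} [Finite κ] {F G : (ι → ℝ) → (κ → ℝ) → ℝ} {P Q : (ι → ℝ) → (κ → ℝ) → Prop}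

lemma true : AffCond (fun (_ : ι → ℝ) (_ : κ → ℝ) => True) :=
  ⟨Empty, Empty, inferInstance, inferInstance, Empty.elim, Empty.elim, by simp, by simp, by simp⟩
lemma congr (h : ∀ x y, P x y ↔ Q x y) (hQ : AffCond Q) : AffCond P := by
  have : P = Q := by funext x y; exact propext (h x y)
  rwa [this]
lemma eq (hF : IsAff F) (hG : IsAff G) : AffCond (fun x y => F x y = G x y) :=
  ⟨Unit, Empty, inferInstance, inferInstance, fun _ x y => F x y - G x y, Empty.elim,
    fun _ => hF.sub hG, by simp, by simp [sub_eq_zero]⟩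
lemma lt (hF : IsAff F) (hG : IsAff G) : AffCond (fun x y => F x y < G x y) :=
  ⟨Empty, Unit, inferInstance, inferInstance, Empty.elim, fun _ x y => G x y - F x y,
    by simp, fun _ => hG.sub hF, by simp⟩
lemma sign (s : SignType) (hF : IsAff F) :
    AffCond (fun x y => SignType.sign (F x y) = s) := by
  rcases s with _ | _ | _
  · exact (AffCond.eq hF (IsAff.const 0)).congr fun x y => sign_eq_zero_iff
  · exact (AffCond.lt hF (IsAff.const 0)).congr fun x y => sign_eq_neg_one_iff
  · exact (AffCond.lt (IsAff.const 0) hF).congr fun x y => sign_eq_one_iff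
lemma and (hP : AffCond P) (hQ : AffCond Q) : AffCond (fun x y => P x y ∧ Q x y) := by
  obtain ⟨α, β, _, _, A, B, hA, hB, h⟩ := hP
  obtain ⟨α', β', _, _, A', B', hA', hB', h'⟩ := hQ
  refine ⟨α ⊕ α', β ⊕ β', inferInstance, inferInstance, Sum.elim A A', Sum.elim B B', ?_, ?_, ?_⟩
  · rintro (a | a); exacts [hA a, hA' a]
  · rintro (a | a); exacts [hB a, hB' a]
  · intro x y; simp [h, h']; tauto
lemma all {γ : Type} [Finite γ] {P : γ → (ι → ℝ) → (κ → ℝ) → Prop} (hP : ∀ c, AffCond (P c)) :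
    AffCond (fun x y => ∀ c, P c x y) := by
  choose α β _ _ A B hA hB h using hP
  refine ⟨(c : γ) × α c, (c : γ) × β c, inferInstance, inferInstance, fun s => A _ s.2,
    fun s => B _ s.2, fun s => hA _ s.2, fun s => hB _ s.2, fun x y => ?_⟩
  simp only [h, Sigma.forall, forall_and]
lemma imp {c : Prop} (hP : c → AffCond P) : AffCond (fun x y => c → P x y) := by
  by_cases hc : c
  · simpa [hc] using hP hc
  · simpa [hc] using AffCond.true

end AffCond

lemma stablyEquivalent_of_rational {d e : ℕ} {S : Set (Fin d → ℝ)} {T : Set (Fin e → ℝ)}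
    (h : RationallyEquivalent S T) : StablyEquivalent ⟨d, S⟩ ⟨e, T⟩ :=
  Relation.EqvGen.rel _ _ (Or.inr h)

lemma stablyEquivalent_fiber {d d' : ℕ} {S : Set (Fin d → ℝ)} {T : Set (Fin (d + d') → ℝ)}
    (P : (Fin d → ℝ) → (Fin d' → ℝ) → Prop) (hP : AffCond P)
    (hT : ∀ x y, Fin.append x y ∈ T ↔ x ∈ S ∧ P x y) (hne : ∀ x ∈ S, ∃ y, P x y) :
    StablyEquivalent ⟨d, S⟩ ⟨d + d', T⟩ := by
  refine Relation.EqvGen.rel _ _ (Or.inl ⟨d', T, rfl, ?_⟩)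
  obtain ⟨α, β, _, _, F, G, hF, hG, h⟩ := hP
  obtain ⟨k, ⟨ea⟩⟩ := Finite.exists_equiv_fin α
  obtain ⟨l, ⟨eb⟩⟩ := Finite.exists_equiv_fin β
  choose A b hA hb hFA using fun a => (hF a).exists_rep
  choose C c hC hc hGC using fun a => (hG a).exists_rep
  choose A' hA' using hA
  choose b' hb' using hb
  choose C' hC' using hC
  choose c' hc' using hc
  refine ⟨k, l, fun i => A' (ea.symm i), fun i => b' (ea.symm i), fun i => C' (eb.symm i),
    fun i => c' (eb.symm i), fun x hx => ?_, fun x y => ?_⟩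
  · obtain ⟨y, hy⟩ := hne x hx
    exact ⟨y, (hT x y).2 ⟨hx, hy⟩⟩
  · rw [hT, h]
    refine and_congr Iff.rfl (and_congr ?_ ?_)
    · rw [← ea.symm.forall_congr_right]
      refine forall_congr' fun i => ?_
      rw [hFA, hb']
      simp only [hA']
    · rw [← eb.symm.forall_congr_right]
      refine forall_congr' fun i => ?_
      rw [hGC, hc']
      simp only [hC']

/-- The copy of `S ⊆ ℝ^ι` in `ℝ^n` given by an enumeration of `ι`. -/
def relabel {ι κ : Type} (e : ι ≃ κ) (S : Set (ι → ℝ)) : Set (κ → ℝ) :=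
  {x | (fun i => x (e i)) ∈ S}

lemma stablyEquivalent_relabel {ι : Type} {m n : ℕ} (e : ι ≃ Fin m) (f : ι ≃ Fin n)
    (S : Set (ι → ℝ)) : StablyEquivalent ⟨m, relabel e S⟩ ⟨n, relabel f S⟩ := by
  refine stablyEquivalent_of_rational ⟨fun x i => x (e (f.symm i)), fun x i => x (f (e.symm i)),
    fun i => ⟨MvPolynomial.X (e (f.symm i)), 1, fun x _ => by simp⟩,
    fun i => ⟨MvPolynomial.X (f (e.symm i)), 1, fun x _ => by simp⟩, ?_, ?_, ?_, ?_⟩ <;>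
  simp [relabel]

/-- Stable equivalence of sets with coordinates indexed by finite types. -/
def SE {ι κ : Type} (S : Set (ι → ℝ)) (T : Set (κ → ℝ)) : Prop :=
  ∃ (m n : ℕ) (e : ι ≃ Fin m) (f : κ ≃ Fin n),
    StablyEquivalent ⟨m, relabel e S⟩ ⟨n, relabel f T⟩

namespace SE

variable {ι κ ρ : Type} {S : Set (ι → ℝ)} {T : Set (κ → ℝ)} {U : Set (ρ → ℝ)}

lemma refl [Finite ι] (S : Set (ι → ℝ)) : SE S S := by
  obtain ⟨m, ⟨e⟩⟩ := Finite.exists_equiv_fin ι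
  exact ⟨m, m, e, e, Relation.EqvGen.refl _⟩

lemma symm (h : SE S T) : SE T S := by
  obtain ⟨m, n, e, f, h⟩ := h
  exact ⟨n, m, f, e, Relation.EqvGen.symm _ _ h⟩

lemma trans (h : SE S T) (h' : SE T U) : SE S U := by
  obtain ⟨m, n, e, f, h⟩ := h
  obtain ⟨m', n', e', f', h'⟩ := h'
  exact ⟨m, n', e, f', (h.trans _ _ _ (stablyEquivalent_relabel f e' T)).trans _ _ _ h'⟩

lemma rational [Finite ι] [Finite κ] (f : (ι → ℝ) → κ → ℝ) (g : (κ → ℝ) → ι → ℝ)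
    (hf : ∀ k, ∃ p q : (ι → ℝ) → ℝ, PolyFun p ∧ PolyFun q ∧ ∀ x ∈ S, q x ≠ 0 ∧ f x k = p x / q x)
    (hg : ∀ i, ∃ p q : (κ → ℝ) → ℝ, PolyFun p ∧ PolyFun q ∧ ∀ x ∈ T, q x ≠ 0 ∧ g x i = p x / q x)
    (hST : ∀ x ∈ S, f x ∈ T) (hTS : ∀ y ∈ T, g y ∈ S)
    (hgf : ∀ x ∈ S, g (f x) = x) (hfg : ∀ y ∈ T, f (g y) = y) : SE S T := by
  obtain ⟨m, ⟨e⟩⟩ := Finite.exists_equiv_fin ι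
  obtain ⟨n, ⟨e'⟩⟩ := Finite.exists_equiv_fin κ
  refine ⟨m, n, e, e', stablyEquivalent_of_rational
    ⟨fun x k => f (fun i => x (e i)) (e'.symm k), fun x k => g (fun i => x (e' i)) (e.symm k),
      fun k => ?_, fun k => ?_, fun x hx => ?_, fun x hx => ?_, fun x hx => ?_, fun x hx => ?_⟩⟩
  · obtain ⟨p, q, hp, hq, h⟩ := hf (e'.symm k)
    obtain ⟨p', hp'⟩ := hp.comp (fun i => PolyFun.coord (e i))
    obtain ⟨q', hq'⟩ := hq.comp (fun i => PolyFun.coord (e i))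
    exact ⟨p', q', fun x hx => by rw [← hp', ← hq']; exact h _ hx⟩
  · obtain ⟨p, q, hp, hq, h⟩ := hg (e.symm k)
    obtain ⟨p', hp'⟩ := hp.comp (fun i => PolyFun.coord (e' i))
    obtain ⟨q', hq'⟩ := hq.comp (fun i => PolyFun.coord (e' i))
    exact ⟨p', q', fun x hx => by rw [← hp', ← hq']; exact h _ hx⟩
  · simpa [relabel] using hST _ hx
  · simpa [relabel] using hTS _ hx
  · funext k
    simpa using congrFun (hgf _ hx) (e.symm k)
  · funext k
    simpa using congrFun (hfg _ hx) (e'.symm k)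

lemma of_equiv [Finite ι] [Finite κ] (e : ι ≃ κ)
    (h : ∀ x : κ → ℝ, x ∈ T ↔ (fun i => x (e i)) ∈ S) : SE S T := by
  refine rational (fun x k => x (e.symm k)) (fun x i => x (e i))
    (fun k => ⟨fun x => x (e.symm k), fun _ => 1, PolyFun.coord _, PolyFun.const _, by simp⟩)
    (fun k => ⟨fun x => x (e k), fun _ => 1, PolyFun.coord _, PolyFun.const _, by simp⟩)
    ?_ ?_ ?_ ?_
  · intro x hx; rw [h]; simpa using hx
  · intro x hx; rwa [← h]
  · intro x _; simp
  · intro x _; simp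

/-- The basic step: `T` fibres over `S` with affine fibres. -/
lemma fiber [Finite ι] [Finite κ] {T : Set (ρ → ℝ)} (e : ρ ≃ ι ⊕ κ)
    (P : (ι → ℝ) → (κ → ℝ) → Prop) (hP : AffCond P)
    (hT : ∀ x y, (fun r => Sum.elim x y (e r)) ∈ T ↔ x ∈ S ∧ P x y)
    (hne : ∀ x ∈ S, ∃ y, P x y) : SE S T := by
  obtain ⟨m, ⟨f⟩⟩ := Finite.exists_equiv_fin ι
  obtain ⟨n, ⟨g⟩⟩ := Finite.exists_equiv_fin κ
  refine ⟨m, m + n, f, (e.trans (f.sumCongr g)).trans finSumFinEquiv,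
    stablyEquivalent_fiber (fun x y => P (fun i => x (f i)) (fun k => y (g k))) ?_ ?_ ?_⟩
  · obtain ⟨α, β, i1, i2, F, G, hF, hG, h⟩ := hP
    have key : ∀ H : (ι → ℝ) → (κ → ℝ) → ℝ, IsAff H →
        IsAff (fun (x : Fin m → ℝ) (y : Fin n → ℝ) => H (fun i => x (f i)) (fun k => y (g k))) := by
      rintro H ⟨i3, C, c, hC, hc, h⟩
      refine ⟨inferInstance, fun k x => C (g.symm k) (fun i => x (f i)),
        fun x => c (fun i => x (f i)), fun k => (hC _).comp (fun i => PolyFun.coord _),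
        hc.comp (fun i => PolyFun.coord _), fun x y => ?_⟩
      beta_reduce
      rw [h, ← g.sum_comp]
      simp
    exact ⟨α, β, i1, i2, fun a x y => F a _ _, fun a x y => G a _ _, fun a => key _ (hF a),
      fun a => key _ (hG a), fun x y => h _ _⟩
  · intro x y
    rw [relabel, Set.mem_ofPred_eq, relabel, Set.mem_ofPred_eq, ← hT]
    have : (fun i => Fin.append x y (((e.trans (f.sumCongr g)).trans finSumFinEquiv) i)) =
        fun r => Sum.elim (fun i => x (f i)) (fun k => y (g k)) (e r) := by
      funext r
      simp only [Equiv.trans_apply]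
      rcases e r with i | k <;> simp
    rw [this]
  · intro x hx
    obtain ⟨y, hy⟩ := hne _ hx
    exact ⟨fun k => y (g.symm k), by simpa using hy⟩

lemma stablyEquivalent {m n : ℕ} {S : Set (Fin m → ℝ)} {T : Set (Fin n → ℝ)} (h : SE S T) :
    StablyEquivalent ⟨m, S⟩ ⟨n, T⟩ := by
  obtain ⟨m', n', e, f, h⟩ := h
  have h1 := stablyEquivalent_relabel (Equiv.refl _) e S
  have h2 := stablyEquivalent_relabel f (Equiv.refl _) T
  exact (h1.trans _ _ _ h).trans _ _ _ h2

private lemma step_nonempty {X Y : Σ d : ℕ, Set (Fin d → ℝ)} (h : StableStep X Y) :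
    X.2.Nonempty ↔ Y.2.Nonempty := by
  rcases h with ⟨d', T, rfl, k, l, A, b, C, c, h1, h2⟩ | ⟨f, g, -, -, h1, h2, -, -⟩
  · constructor
    · rintro ⟨x, hx⟩
      obtain ⟨y, hy⟩ := h1 x hx
      exact ⟨_, hy⟩
    · rintro ⟨z, hz⟩
      have : z = Fin.append (fun i => z (Fin.castAdd d' i)) (fun i => z (Fin.natAdd X.1 i)) := by
        funext i; refine Fin.addCases (fun i => ?_) (fun i => ?_) i <;> simp
      rw [this] at hz
      exact ⟨_, ((h2 _ _).1 hz).1⟩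
  · exact ⟨fun ⟨x, hx⟩ => ⟨_, h1 x hx⟩, fun ⟨x, hx⟩ => ⟨_, h2 x hx⟩⟩

lemma nonempty (h : SE S T) (hS : S.Nonempty) : T.Nonempty := by
  obtain ⟨m, n, e, f, h⟩ := h
  have key : ∀ X Y : Σ d : ℕ, Set (Fin d → ℝ), StablyEquivalent X Y →
      (X.2.Nonempty ↔ Y.2.Nonempty) := by
    intro X Y h
    induction h with
    | rel _ _ h => exact step_nonempty h
    | refl => rfl
    | symm _ _ _ ih => exact ih.symm
    | trans _ _ _ _ _ ih ih' => exact ih.trans ih'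
  obtain ⟨x, hx⟩ := hS
  obtain ⟨y, hy⟩ := (key _ _ h).1 ⟨fun k => x (e.symm k), by simpa [relabel] using hx⟩
  exact ⟨_, hy⟩

end SE

/-! ### Nonnegative linear dependencies and their supports -/

section Circuits

variable {I : Type} [Fintype I] {M : Type} [AddCommGroup M] [Module ℝ M]

/-- `U` is the support of a nonnegative linear dependency of `G`. -/
def DepSupp (G : I → M) (U : Set I) : Prop :=
  ∃ c : I → ℝ, (∀ i, 0 ≤ c i) ∧ ∑ i, c i • G i = 0 ∧ ∀ i, i ∈ U ↔ c i ≠ 0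

/-- `S` is the support of a nonnegative linear dependency of `G`, which spans the space of all
linear dependencies supported in `S`. -/
def PosCirc (G : I → M) (S : Set I) : Prop :=
  ∃ c : I → ℝ, (∀ i, 0 ≤ c i) ∧ ∑ i, c i • G i = 0 ∧ (∀ i, i ∈ S ↔ c i ≠ 0) ∧ S.Nonempty ∧
    ∀ m : I → ℝ, (∀ i, i ∉ S → m i = 0) → ∑ i, m i • G i = 0 → ∃ t, ∀ i, m i = t * c i

lemma PosCirc.depSupp {G : I → M} {S : Set I} (h : PosCirc G S) : DepSupp G S := by
  obtain ⟨c, h1, h2, h3, -⟩ := h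
  exact ⟨c, h1, h2, h3⟩

lemma PosCirc.nonempty {G : I → M} {S : Set I} (h : PosCirc G S) : S.Nonempty := by
  obtain ⟨c, h1, h2, h3, h4, -⟩ := h
  exact h4

lemma PosCirc.eq_of_subset {G : I → M} {S T : Set I} (h : PosCirc G S) (hT : DepSupp G T)
    (hTS : T ⊆ S) (hne : T.Nonempty) : T = S := by
  obtain ⟨c, h1, h2, h3, h4, h5⟩ := h
  obtain ⟨m, k1, k2, k3⟩ := hT
  obtain ⟨t, ht⟩ := h5 m (fun i hi => by
    by_contra h
    exact hi (hTS ((k3 i).2 h))) k2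
  obtain ⟨i, hi⟩ := hne
  have ht0 : t ≠ 0 := by
    rintro rfl
    exact (k3 i).1 hi (by rw [ht]; simp)
  ext j
  rw [k3, h3, ht]
  simp [ht0]

lemma dep_reduce {G : I → M} {c m : I → ℝ} (hc : ∀ i, 0 ≤ c i) (hcG : ∑ i, c i • G i = 0)
    (hmG : ∑ i, m i • G i = 0) {k : I} (hk : 0 < m k) :
    ∃ t : ℝ, 0 ≤ t ∧ (∀ i, 0 ≤ c i - t * m i) ∧ ∑ i, (c i - t * m i) • G i = 0 ∧
      ∃ j, 0 < m j ∧ c j = t * m j := by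
  classical
  obtain ⟨j, hj, hmin⟩ := Finset.exists_min_image (Finset.univ.filter fun i => 0 < m i)
    (fun i => c i / m i) ⟨k, by simp [hk]⟩
  simp only [Finset.mem_filter, Finset.mem_univ, true_and] at hj hmin
  have ht : 0 ≤ c j / m j := div_nonneg (hc j) hj.le
  refine ⟨c j / m j, ht, fun i => ?_, ?_, j, hj, by field_simp⟩
  · rcases lt_or_ge 0 (m i) with hi | hi
    · have := (div_le_div_iff₀ hj hi).1 (hmin i hi)
      have h2 : c j / m j * m i ≤ c i := by
        rw [div_mul_eq_mul_div, div_le_iff₀ hj]; exact this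
      linarith
    · have := mul_nonpos_of_nonneg_of_nonpos ht hi
      linarith [hc i]
  · simp only [sub_smul, Finset.sum_sub_distrib, hcG, mul_smul, ← Finset.smul_sum, hmG]
    simp

lemma DepSupp.exists_minimal {G : I → M} {U : Set I} (hU : DepSupp G U) {j : I} (hj : j ∈ U) :
    ∃ T ⊆ U, j ∈ T ∧ PosCirc G T := by
  have hfin : {T : Set I | T ⊆ U ∧ j ∈ T ∧ DepSupp G T}.Finite := Set.toFinite _
  obtain ⟨T, hT⟩ := hfin.exists_minimal ⟨U, subset_rfl, hj, hU⟩
  obtain ⟨⟨hTU, hjT, c, hc0, hcG, hcT⟩, hmin⟩ := hT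
  have hmin' : ∀ T' : Set I, T' ⊆ T → j ∈ T' → DepSupp G T' → T ⊆ T' := fun T' h1 h2 h3 =>
    hmin ⟨h1.trans hTU, h2, h3⟩ h1
  refine ⟨T, hTU, hjT, c, hc0, hcG, hcT, ⟨j, hjT⟩, ?_⟩
  -- a nonzero nonnegative dependency supported in `T` is supported exactly on `T`
  have sub : ∀ m : I → ℝ, (∀ i, 0 ≤ m i) → ∑ i, m i • G i = 0 → (∀ i, i ∉ T → m i = 0) →
      (∃ k, m k ≠ 0) → ∀ i, i ∈ T → m i ≠ 0 := by
    rintro m hm hmG hmT ⟨k, hk⟩ i hi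
    have hkp : 0 < m k := lt_of_le_of_ne (hm k) (Ne.symm hk)
    have hsub : {i | m i ≠ 0} ⊆ T := fun i hi => by
      by_contra h; exact hi (hmT i h)
    by_cases hjm : m j ≠ 0
    · exact hmin' {i | m i ≠ 0} hsub hjm ⟨m, hm, hmG, fun i => Iff.rfl⟩ hi
    · exfalso
      push Not at hjm
      obtain ⟨t, ht, h1, h2, l, hl, hcl⟩ := dep_reduce hc0 hcG hmG hkp
      have hjj : c j - t * m j ≠ 0 := by rw [hjm]; simpa using (hcT j).1 hjT
      have hlT : l ∈ T := hsub hl.ne'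
      have := hmin' {i | c i - t * m i ≠ 0} (fun i hi => by
        by_contra h
        refine hi ?_
        have h3 : c i = 0 := by by_contra h'; exact h ((hcT i).2 h')
        rw [h3, hmT i h]; simp) hjj ⟨_, h1, h2, fun i => Iff.rfl⟩ hlT
      exact this (by rw [hcl]; simp)
  have key : ∀ m : I → ℝ, (∀ i, i ∉ T → m i = 0) → ∑ i, m i • G i = 0 → (∃ k, 0 < m k) →
      ∃ t, ∀ i, m i = t * c i := by
    rintro m hmT hmG ⟨k, hk⟩
    obtain ⟨t, ht, h1, h2, l, hl, hcl⟩ := dep_reduce hc0 hcG hmG hk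
    have hlT : l ∈ T := by by_contra h; exact hl.ne' (hmT l h)
    have hz : ∀ i, c i - t * m i = 0 := by
      by_contra hne
      push Not at hne
      exact sub _ h1 h2 (fun i hi => by
        have h3 : c i = 0 := by by_contra h'; exact hi ((hcT i).2 h')
        rw [h3, hmT i hi]; simp) hne l hlT (by rw [hcl]; simp)
    have ht0 : t ≠ 0 := by
      rintro rfl
      exact (hcT j).1 hjT (by simpa using hz j)
    refine ⟨t⁻¹, fun i => ?_⟩
    rw [sub_eq_zero.1 (hz i)]
    field_simp
  intro m hmT hmG
  by_cases hpos : ∃ k, 0 < m k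
  · exact key m hmT hmG hpos
  by_cases hneg : ∃ k, 0 < - m k
  · obtain ⟨t, ht⟩ := key (fun i => - m i) (fun i hi => by simp [hmT i hi]) (by simp [hmG]) hneg
    exact ⟨-t, fun i => by linarith [ht i]⟩
  · push Not at hpos hneg
    exact ⟨0, fun i => by linarith [hpos i, hneg i]⟩

/-- A family of positive circuits which is closed under pivots contains a subset of the support
of every nonzero nonnegative dependency. -/
lemma exists_circ_subset {G : I → M} {K : Set (Set I)} (hK : K.Nonempty)
    (hcirc : ∀ S ∈ K, PosCirc G S)
    (hpivot : ∀ S ∈ K, ∀ i, i ∉ S → ∃ j ∈ S, insert i (S \ {j}) ∈ K)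
    {U : Set I} (hU : DepSupp G U) (hne : U.Nonempty) : ∃ S ∈ K, S ⊆ U := by
  classical
  choose! c hc0 hcG hcS hcne hcu using hcirc
  obtain ⟨u, hu0, huG, huU⟩ := hU
  set f : (I → ℝ) → ℝ := fun m => ∑ i, if i ∈ U then 0 else m i with hf
  set g : (I → ℝ) → ℝ := fun m => ∑ i, m i with hg
  have gpos : ∀ m : I → ℝ, (∀ i, 0 ≤ m i) → (∃ i, m i ≠ 0) → 0 < g m := by
    rintro m hm ⟨i, hi⟩
    exact Finset.sum_pos' (fun i _ => hm i) ⟨i, Finset.mem_univ _, lt_of_le_of_ne (hm i) hi.symm⟩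
  have cpos : ∀ S ∈ K, 0 < g (c S) := by
    intro S hS
    refine gpos _ (hc0 S hS) ?_
    by_contra h
    push Not at h
    obtain ⟨i, hi⟩ := hcne S hS
    exact (hcS S hS i).1 hi (h i)
  obtain ⟨S, hS, hmin⟩ := (Set.toFinite K).exists_minimalFor (fun S => f (c S) / g (c S)) K hK
  have hmin' : ∀ T ∈ K, f (c S) / g (c S) ≤ f (c T) / g (c T) := by
    intro T hT
    rcases le_total (f (c S) / g (c S)) (f (c T) / g (c T)) with h | h
    · exact h
    · exact hmin hT h
  set ρ := f (c S) / g (c S) with hρ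
  have hν : ∀ i, ∃ ν : I → ℝ, i ∉ S → (ν i = 1 ∧ (∀ k, k ∉ S → k ≠ i → ν k = 0) ∧
      ∑ k, ν k • G k = 0 ∧ ρ * g ν ≤ f ν) := by
    intro i
    by_cases hi : i ∈ S
    · exact ⟨0, fun h => absurd hi h⟩
    obtain ⟨j, hj, hT⟩ := hpivot S hS i hi
    set T := insert i (S \ {j})
    have hci : c T i ≠ 0 := (hcS T hT i).1 (Set.mem_insert _ _)
    have hcip : 0 < c T i := lt_of_le_of_ne (hc0 T hT i) hci.symm
    refine ⟨fun k => (c T i)⁻¹ * c T k, fun _ => ⟨by field_simp, fun k hk hki => ?_, ?_, ?_⟩⟩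
    · have : c T k = 0 := by
        by_contra h
        rcases (hcS T hT k).2 h with h | h
        · exact hki h
        · exact hk h.1
      simp [this]
    · simp only [mul_smul, ← Finset.smul_sum, hcG T hT, smul_zero]
    · have e1 : g (fun k => (c T i)⁻¹ * c T k) = (c T i)⁻¹ * g (c T) := by
        simp [hg, Finset.mul_sum]
      have e2 : f (fun k => (c T i)⁻¹ * c T k) = (c T i)⁻¹ * f (c T) := by
        simp only [hf, Finset.mul_sum]
        refine Finset.sum_congr rfl fun k _ => ?_
        split_ifs <;> simp
      rw [e1, e2]
      have h1 := hmin' T hT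
      rw [le_div_iff₀ (cpos T hT)] at h1
      have : 0 < (c T i)⁻¹ := inv_pos.2 hcip
      nlinarith
  choose ν hν using hν
  obtain ⟨α, hα⟩ := hcu S hS (fun k => u k - ∑ i, if i ∈ S then 0 else u i * ν i k) (by
      intro k hk
      beta_reduce
      rw [Finset.sum_eq_single k]
      · simp [hk, (hν k hk).1]
      · intro i _ hik
        split_ifs with hi
        · rfl
        · rw [(hν i hi).2.1 k hk hik.symm, mul_zero]
      · simp) (by
      simp only [sub_smul, Finset.sum_sub_distrib, huG, Finset.sum_smul]
      rw [Finset.sum_comm, zero_sub, neg_eq_zero]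
      refine Finset.sum_eq_zero fun i _ => ?_
      by_cases hi : i ∈ S
      · simp [hi]
      · simp only [hi, if_false, mul_smul, ← Finset.smul_sum, (hν i hi).2.2.1, smul_zero])
  have hu : ∀ k, u k = α * c S k + ∑ i, if i ∈ S then 0 else u i * ν i k := fun k => by
    have := hα k; beta_reduce at this; linarith
  have lin : ∀ w : I → ℝ, ∑ k, w k * u k = α * ∑ k, w k * c S k +
      ∑ i, if i ∈ S then 0 else u i * ∑ k, w k * ν i k := by
    intro w
    have : ∀ k, w k * u k = α * (w k * c S k) + ∑ i, if i ∈ S then 0 else u i * (w k * ν i k) := by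
      intro k
      conv_lhs => rw [hu k]
      rw [mul_add, Finset.mul_sum]
      congr 1
      · ring
      · refine Finset.sum_congr rfl fun i _ => ?_
        split_ifs
        · simp
        · ring
    simp only [this, Finset.sum_add_distrib, ← Finset.mul_sum]
    rw [Finset.sum_comm]
    congr 1
    refine Finset.sum_congr rfl fun i _ => ?_
    split_ifs
    · simp
    · rw [Finset.mul_sum]
  have gl : ∀ m : I → ℝ, g m = ∑ k, (1 : ℝ) * m k := fun m => by simp [hg]
  have fl : ∀ m : I → ℝ, f m = ∑ k, (if k ∈ U then (0 : ℝ) else 1) * m k := fun m => by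
    simp only [hf]
    refine Finset.sum_congr rfl fun k _ => ?_
    split_ifs <;> simp
  have hgu := lin (fun _ => 1)
  have hfu := lin (fun k => if k ∈ U then (0 : ℝ) else 1)
  simp only [← gl] at hgu
  simp only [← fl] at hfu
  have hfu0 : f u = 0 := by
    simp only [hf]
    refine Finset.sum_eq_zero fun i _ => ?_
    split_ifs with h
    · rfl
    · by_contra h'; exact h ((huU i).2 h')
  have hgu0 : 0 < g u := by
    obtain ⟨i, hi⟩ := hne
    exact gpos u hu0 ⟨i, (huU i).1 hi⟩
  have hsum : ρ * (∑ i, if i ∈ S then 0 else u i * g (ν i)) ≤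
      ∑ i, if i ∈ S then 0 else u i * f (ν i) := by
    rw [Finset.mul_sum]
    refine Finset.sum_le_sum fun i _ => ?_
    split_ifs with h
    · simp
    · have := (hν i h).2.2.2
      nlinarith [hu0 i]
  have hfS : f (c S) = ρ * g (c S) := by rw [hρ]; field_simp [(cpos S hS).ne']
  have hρ0 : ρ * g u ≤ 0 := by
    rw [← hfu0, hfu, hgu, hfS]
    nlinarith
  have hρ1 : ρ ≤ 0 := by
    by_contra h
    push Not at h
    nlinarith [mul_pos h hgu0]
  have hf0 : f (c S) ≤ 0 := by rw [hfS]; exact mul_nonpos_of_nonpos_of_nonneg hρ1 (cpos S hS).le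
  refine ⟨S, hS, fun i hi => ?_⟩
  by_contra hiU
  have h1 : c S i ≠ 0 := (hcS S hS i).1 hi
  have : 0 < f (c S) := by
    refine Finset.sum_pos' (fun k _ => ?_) ⟨i, Finset.mem_univ _, ?_⟩
    · split_ifs
      · exact le_rfl
      · exact hc0 S hS k
    · rw [if_neg hiU]
      exact lt_of_le_of_ne (hc0 S hS i) h1.symm
  linarith

lemma DepSupp.union {G : I → M} {U V : Set I} (hU : DepSupp G U) (hV : DepSupp G V) :
    DepSupp G (U ∪ V) := by
  obtain ⟨c, h1, h2, h3⟩ := hU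
  obtain ⟨d, k1, k2, k3⟩ := hV
  refine ⟨fun i => c i + d i, fun i => add_nonneg (h1 i) (k1 i), ?_, fun i => ?_⟩
  · simp [add_smul, Finset.sum_add_distrib, h2, k2]
  · rw [Set.mem_union, h3, k3]
    have := h1 i; have := k1 i
    constructor
    · rintro (h | h) h'
      · exact h (by linarith)
      · exact h (by linarith)
    · intro h
      by_contra h'
      push Not at h'
      exact h (by simp [h'.1, h'.2])

lemma depSupp_empty (G : I → M) : DepSupp G ∅ := ⟨0, by simp, by simp, by simp⟩

/-- A union of supports is a support. -/
lemma depSupp_of_cover {G : I → M} {U : Set I}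
    (h : ∀ j ∈ U, ∃ T ⊆ U, j ∈ T ∧ DepSupp G T) : DepSupp G U := by
  have key : ∀ s : Finset I, ↑s ⊆ U → ∃ T ⊆ U, ↑s ⊆ T ∧ DepSupp G T := by
    classical
    intro s
    induction s using Finset.induction_on with
    | empty => exact fun _ => ⟨∅, by simp, by simp, depSupp_empty G⟩
    | insert a s _ ih =>
      intro hs
      obtain ⟨T, h1, h2, h3⟩ := ih (fun i hi => hs (by simp [Finset.mem_coe.1 hi]))
      obtain ⟨T', k1, k2, k3⟩ := h a (hs (by simp))
      refine ⟨T' ∪ T, Set.union_subset k1 h1, ?_, k3.union h3⟩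
      intro i hi
      simp only [Finset.coe_insert, Set.mem_insert_iff] at hi
      rcases hi with rfl | hi
      · exact Or.inl k2
      · exact Or.inr (h2 hi)
  obtain ⟨T, h1, h2, h3⟩ := key (Set.toFinite U).toFinset (by simp)
  have : T = U := h1.antisymm (by simpa using h2)
  rwa [← this]

/-- If the positive circuits of `G₀` are pivot-closed and are positive circuits of `G`, then `G`
and `G₀` have the same supports of nonnegative dependencies. -/
lemma depSupp_iff_of_circ {G G₀ : I → M} (hne : ∃ S, PosCirc G₀ S)
    (hcirc : ∀ S, PosCirc G₀ S → PosCirc G S)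
    (hpivot : ∀ S, PosCirc G₀ S → ∀ i, i ∉ S → ∃ j ∈ S, PosCirc G₀ (insert i (S \ {j})))
    (U : Set I) : DepSupp G U ↔ DepSupp G₀ U := by
  constructor
  · intro h
    refine depSupp_of_cover fun j hj => ?_
    obtain ⟨T, h1, h2, h3⟩ := h.exists_minimal hj
    obtain ⟨S, hS, hST⟩ := exists_circ_subset (K := {S | PosCirc G₀ S}) hne hcirc hpivot
      h3.depSupp ⟨j, h2⟩
    have := h3.eq_of_subset (hcirc S hS).depSupp hST hS.nonempty
    subst this
    exact ⟨S, h1, h2, hS.depSupp⟩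
  · intro h
    refine depSupp_of_cover fun j hj => ?_
    obtain ⟨T, h1, h2, h3⟩ := h.exists_minimal hj
    exact ⟨T, h1, h2, (hcirc T h3).depSupp⟩

lemma PosCirc.of_depSupp_iff {G G₀ : I → M} (h : ∀ U, DepSupp G U ↔ DepSupp G₀ U) {S : Set I}
    (hS : PosCirc G₀ S) : PosCirc G S := by
  obtain ⟨j, hj⟩ := hS.nonempty
  obtain ⟨T, h1, h2, h3⟩ := ((h S).2 hS.depSupp).exists_minimal hj
  have := hS.eq_of_subset ((h T).1 h3.depSupp) h1 ⟨j, h2⟩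
  rwa [← this]

end Circuits

/-! ### Determinants and circuits in `ℝ³` -/

section Geometry

/-- The determinant of three vectors in `ℝ³`. -/
def D3 (u v w : Fin 3 → ℝ) : ℝ :=
  u 0 * (v 1 * w 2 - v 2 * w 1) - u 1 * (v 0 * w 2 - v 2 * w 0) + u 2 * (v 0 * w 1 - v 1 * w 0)

lemma D3_swap₁ (u v w : Fin 3 → ℝ) : D3 v u w = - D3 u v w := by simp only [D3]; ring
lemma D3_swap₂ (u v w : Fin 3 → ℝ) : D3 u w v = - D3 u v w := by simp only [D3]; ring
lemma D3_rot (u v w : Fin 3 → ℝ) : D3 v w u = D3 u v w := by simp only [D3]; ring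
lemma D3_self₁ (u v : Fin 3 → ℝ) : D3 u u v = 0 := by simp only [D3]; ring
lemma D3_self₂ (u v : Fin 3 → ℝ) : D3 u v v = 0 := by simp only [D3]; ring
lemma D3_self₃ (u v : Fin 3 → ℝ) : D3 u v u = 0 := by simp only [D3]; ring

lemma D3_cramer (u v w z : Fin 3 → ℝ) (i : Fin 3) :
    D3 v w z * u i - D3 u w z * v i + D3 u v z * w i - D3 u v w * z i = 0 := by
  fin_cases i <;> simp [D3] <;> ring

lemma D3_plucker (a f t u v : Fin 3 → ℝ) :
    D3 a t f * D3 a u v = D3 a t u * D3 a f v - D3 a t v * D3 a f u := by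
  simp only [D3]; ring

lemma exists_dep_of_D3 {u v w : Fin 3 → ℝ} (h : D3 u v w = 0) :
    ∃ a b c : ℝ, (a ≠ 0 ∨ b ≠ 0 ∨ c ≠ 0) ∧ a • u + b • v + c • w = 0 := by
  have hdet : (Matrix.of ![u, v, w]).det = 0 := by
    rw [Matrix.det_fin_three]
    simp only [D3] at h
    simp
    linarith
  obtain ⟨x, hx, hx'⟩ := Matrix.exists_vecMul_eq_zero_iff.2 hdet
  refine ⟨x 0, x 1, x 2, ?_, ?_⟩
  · by_contra hc
    push Not at hc
    exact hx (by funext i; fin_cases i <;> simp [hc])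
  · funext i
    have := congrFun hx' i
    simpa [Matrix.vecMul, dotProduct, Fin.sum_univ_three] using this

variable {I : Type} [Fintype I] {G G₀ : I → Fin 3 → ℝ}

section
variable [DecidableEq I]

/-- The function on `I` with prescribed values at four indices, vanishing elsewhere. -/
def four (i j k l : I) (a b c d : ℝ) : I → ℝ :=
  Pi.single i a + Pi.single j b + Pi.single k c + Pi.single l d

lemma four_sum (i j k l : I) (a b c d : ℝ) :
    ∑ x, four i j k l a b c d x • G x = a • G i + b • G j + c • G k + d • G l := by
  simp only [four, Pi.add_apply, add_smul, Finset.sum_add_distrib]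
  have : ∀ (i : I) (a : ℝ), ∑ x, (Pi.single i a : I → ℝ) x • G x = a • G i := by
    intro i a
    rw [Finset.sum_eq_single i]
    · simp
    · intro b _ hb; simp [Pi.single_eq_of_ne hb]
    · simp
  simp only [this]

end

/-- Four indices are pairwise distinct. -/
def Dist4 (i j k l : I) : Prop := i ≠ j ∧ i ≠ k ∧ i ≠ l ∧ j ≠ k ∧ j ≠ l ∧ k ≠ l

lemma sum_of_support {i j k l : I} (h : Dist4 i j k l) {m : I → ℝ}
    (hm : ∀ x, x ∉ ({i, j, k, l} : Set I) → m x = 0) :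
    ∑ x, m x • G x = m i • G i + m j • G j + m k • G k + m l • G l := by
  classical
  obtain ⟨h1, h2, h3, h4, h5, h6⟩ := h
  rw [← four_sum]
  refine Finset.sum_congr rfl fun x _ => ?_
  congr 1
  simp only [four, Pi.add_apply, Pi.single_apply]
  by_cases hi : x = i
  · subst hi; simp [h1, h2, h3]
  by_cases hj : x = j
  · subst hj; simp [h1.symm, h4, h5]
  by_cases hk : x = k
  · subst hk; simp [h2.symm, h4.symm, h6]
  by_cases hl : x = l
  · subst hl; simp [h3.symm, h5.symm, h6.symm]
  simp [hi, hj, hk, hl, hm]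

lemma posCirc_of_D3 {i j k l : I} (h : Dist4 i j k l) (s : ℝ)
    (h1 : 0 < s * D3 (G j) (G k) (G l)) (h2 : 0 < -(s * D3 (G i) (G k) (G l)))
    (h3 : 0 < s * D3 (G i) (G j) (G l)) (h4 : 0 < -(s * D3 (G i) (G j) (G k))) :
    PosCirc G {i, j, k, l} := by
  classical
  obtain ⟨n1, n2, n3, n4, n5, n6⟩ := id h
  have hs : s ≠ 0 := by rintro rfl; simp at h1
  set c := four i j k l (s * D3 (G j) (G k) (G l)) (-(s * D3 (G i) (G k) (G l)))
    (s * D3 (G i) (G j) (G l)) (-(s * D3 (G i) (G j) (G k))) with hc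
  have ci : c i = s * D3 (G j) (G k) (G l) := by simp [hc, four, n1, n2, n3]
  have cj : c j = -(s * D3 (G i) (G k) (G l)) := by simp [hc, four, n1.symm, n4, n5]
  have ck : c k = s * D3 (G i) (G j) (G l) := by simp [hc, four, n2.symm, n4.symm, n6]
  have cl : c l = -(s * D3 (G i) (G j) (G k)) := by simp [hc, four, n3.symm, n5.symm, n6.symm]
  have c0 : ∀ x, x ∉ ({i, j, k, l} : Set I) → c x = 0 := by
    intro x hx
    simp only [Set.mem_insert_iff, Set.mem_singleton_iff, not_or] at hx
    simp [hc, four, hx]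
  have hpos : ∀ x ∈ ({i, j, k, l} : Set I), 0 < c x := by
    intro x hx
    simp only [Set.mem_insert_iff, Set.mem_singleton_iff] at hx
    rcases hx with rfl | rfl | rfl | rfl
    · rwa [ci]
    · rwa [cj]
    · rwa [ck]
    · rwa [cl]
  refine ⟨c, fun x => ?_, ?_, fun x => ⟨fun hx => (hpos x hx).ne', fun hx => ?_⟩,
    ⟨i, by simp⟩, fun m hm hmG => ?_⟩
  · by_cases hx : x ∈ ({i, j, k, l} : Set I)
    · exact (hpos x hx).le
    · exact (c0 x hx).ge
  · rw [hc, four_sum]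
    funext x
    have := D3_cramer (G i) (G j) (G k) (G l) x
    simp only [Pi.add_apply, Pi.smul_apply, smul_eq_mul, Pi.zero_apply]
    linear_combination s * this
  · by_contra h'; exact hx (c0 x h')
  · rw [sum_of_support h hm] at hmG
    have e : ∀ x, m i * G i x + m j * G j x + m k * G k x + m l * G l x = 0 := fun x => by
      have := congrFun hmG x
      simpa using this
    have e0 := e 0
    have e1 := e 1
    have e2 := e 2
    have d1 : m i * D3 (G i) (G k) (G l) + m j * D3 (G j) (G k) (G l) = 0 := by
      simp only [D3]
      linear_combination (G k 1 * G l 2 - G k 2 * G l 1) * e0 -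
        (G k 0 * G l 2 - G k 2 * G l 0) * e1 + (G k 0 * G l 1 - G k 1 * G l 0) * e2
    have d2 : m i * D3 (G i) (G j) (G l) - m k * D3 (G j) (G k) (G l) = 0 := by
      simp only [D3]
      linear_combination (G j 1 * G l 2 - G j 2 * G l 1) * e0 -
        (G j 0 * G l 2 - G j 2 * G l 0) * e1 + (G j 0 * G l 1 - G j 1 * G l 0) * e2
    have d3 : m i * D3 (G i) (G j) (G k) + m l * D3 (G j) (G k) (G l) = 0 := by
      simp only [D3]
      linear_combination (G j 1 * G k 2 - G j 2 * G k 1) * e0 -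
        (G j 0 * G k 2 - G j 2 * G k 0) * e1 + (G j 0 * G k 1 - G j 1 * G k 0) * e2
    have hD : D3 (G j) (G k) (G l) ≠ 0 := by intro h'; rw [h'] at h1; simp at h1
    refine ⟨m i / (s * D3 (G j) (G k) (G l)), fun x => ?_⟩
    by_cases hx : x ∈ ({i, j, k, l} : Set I)
    · simp only [Set.mem_insert_iff, Set.mem_singleton_iff] at hx
      rcases hx with rfl | rfl | rfl | rfl
      · rw [ci]; field_simp
      · rw [cj]; field_simp; linarith
      · rw [ck]; field_simp; linarith
      · rw [cl]; field_simp; linarith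
    · rw [hm x hx, c0 x hx, mul_zero]

lemma PosCirc.D3_signs {i j k l : I} (h : Dist4 i j k l) (hS : PosCirc G {i, j, k, l}) :
    ∃ s : ℝ, 0 < s * D3 (G j) (G k) (G l) ∧ 0 < -(s * D3 (G i) (G k) (G l)) ∧
      0 < s * D3 (G i) (G j) (G l) ∧ 0 < -(s * D3 (G i) (G j) (G k)) := by
  classical
  obtain ⟨n1, n2, n3, n4, n5, n6⟩ := id h
  obtain ⟨c, h1, h2, h3, -, h5⟩ := hS
  have cpos : ∀ x ∈ ({i, j, k, l} : Set I), 0 < c x := fun x hx =>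
    lt_of_le_of_ne (h1 x) ((h3 x).1 hx).symm
  have key : ∀ a b c' d : ℝ, a • G i + b • G j + c' • G k + d • G l = 0 →
      ∃ t, a = t * c i ∧ b = t * c j ∧ c' = t * c k ∧ d = t * c l := by
    intro a b c' d hd
    obtain ⟨t, ht⟩ := h5 (four i j k l a b c' d) (by
      intro x hx
      simp only [Set.mem_insert_iff, Set.mem_singleton_iff, not_or] at hx
      simp [four, hx]) (by rw [four_sum, hd])
    refine ⟨t, ?_, ?_, ?_, ?_⟩ <;> rw [← ht] <;>
      simp [four, n1, n2, n3, n4, n5, n6, n1.symm, n2.symm, n3.symm, n4.symm, n5.symm, n6.symm]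
  obtain ⟨t, t1, t2, t3, t4⟩ := key (D3 (G j) (G k) (G l)) (-D3 (G i) (G k) (G l))
    (D3 (G i) (G j) (G l)) (-D3 (G i) (G j) (G k)) (by
      funext x
      have := D3_cramer (G i) (G j) (G k) (G l) x
      simp only [Pi.add_apply, Pi.smul_apply, smul_eq_mul, Pi.zero_apply]
      linear_combination this)
  have ht : t ≠ 0 := by
    rintro rfl
    obtain ⟨a, b, e, hne, hab⟩ := exists_dep_of_D3 (show D3 (G j) (G k) (G l) = 0 by simpa using t1)
    obtain ⟨t', s1, s2, s3, s4⟩ := key 0 a b e (by simpa using hab)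
    have : t' = 0 := by
      rcases mul_eq_zero.1 s1.symm with h | h
      · exact h
      · exact absurd h (cpos i (by simp)).ne'
    subst this
    simp at s2 s3 s4
    tauto
  refine ⟨t, ?_, ?_, ?_, ?_⟩
  · rw [t1]; have := cpos i (by simp); have := sq_pos_of_ne_zero ht; nlinarith
  · have := cpos j (by simp); have := sq_pos_of_ne_zero ht; rw [← mul_neg, t2]; nlinarith
  · rw [t3]; have := cpos k (by simp); have := sq_pos_of_ne_zero ht; nlinarith
  · have := cpos l (by simp); have := sq_pos_of_ne_zero ht; rw [← mul_neg, t4]; nlinarith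

/-- Every nonzero nonnegative dependency involves at least four vectors. -/
def Simplicial3 (G : I → Fin 3 → ℝ) : Prop :=
  ∀ U, DepSupp G U → U.Nonempty → 4 ≤ U.ncard

lemma Simplicial3.exists_four (hG : Simplicial3 G) {S : Set I} (hS : PosCirc G S) :
    ∃ i j k l, Dist4 i j k l ∧ S = {i, j, k, l} := by
  classical
  have h4 := hG S hS.depSupp hS.nonempty
  obtain ⟨t, htS, ht⟩ := Set.exists_subset_card_eq (s := S) (n := 4) h4
  obtain ⟨i, j, k, l, n1, n2, n3, n4, n5, n6, rfl⟩ := Set.ncard_eq_four.1 ht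
  have hd : Dist4 i j k l := ⟨n1, n2, n3, n4, n5, n6⟩
  refine ⟨i, j, k, l, hd, ?_⟩
  obtain ⟨a, b, e, f, hne, hab⟩ : ∃ a b e f : ℝ, (a ≠ 0 ∨ b ≠ 0 ∨ e ≠ 0 ∨ f ≠ 0) ∧
      a • G i + b • G j + e • G k + f • G l = 0 := by
    by_cases hD : D3 (G j) (G k) (G l) = 0
    · obtain ⟨a, b, e, hne, hab⟩ := exists_dep_of_D3 hD
      exact ⟨0, a, b, e, Or.inr hne, by simpa using hab⟩
    · refine ⟨D3 (G j) (G k) (G l), -D3 (G i) (G k) (G l), D3 (G i) (G j) (G l),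
        -D3 (G i) (G j) (G k), Or.inl hD, ?_⟩
      funext x
      have := D3_cramer (G i) (G j) (G k) (G l) x
      simp only [Pi.add_apply, Pi.smul_apply, smul_eq_mul, Pi.zero_apply]
      linear_combination this
  obtain ⟨c, h1, h2, h3, -, h5⟩ := hS
  have z : ∀ x, x ∉ ({i, j, k, l} : Set I) → four i j k l a b e f x = 0 := by
    intro x hx
    simp only [Set.mem_insert_iff, Set.mem_singleton_iff, not_or] at hx
    simp [four, hx]
  obtain ⟨t, ht⟩ := h5 (four i j k l a b e f) (fun x hx => z x fun h => hx (htS h))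
    (by rw [four_sum, hab])
  have ht0 : t ≠ 0 := by
    rintro rfl
    have hi := ht i
    have hj := ht j
    have hk := ht k
    have hl := ht l
    simp [four, n1, n2, n3, n4, n5, n6, n1.symm, n2.symm, n3.symm, n4.symm, n5.symm, n6.symm]
      at hi hj hk hl
    tauto
  refine Set.Subset.antisymm (fun x hx => ?_) htS
  by_contra hx'
  have := ht x
  rw [z x hx'] at this
  rcases mul_eq_zero.1 this.symm with h | h
  · exact ht0 h
  · exact (h3 x).1 hx h

lemma Simplicial3.pivot (hG : Simplicial3 G) {S : Set I} (hS : PosCirc G S) {x : I}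
    (hx : x ∉ S) : ∃ j ∈ S, PosCirc G (insert x (S \ {j})) := by
  classical
  obtain ⟨i, j, k, l, hd, hSe⟩ := hG.exists_four hS
  obtain ⟨s, h1, h2, h3, h4⟩ := PosCirc.D3_signs hd (hSe ▸ hS)
  have hD : D3 (G i) (G j) (G k) ≠ 0 := by intro h'; rw [h'] at h4; simp at h4
  obtain ⟨c, c1, c2, c3, c4, c5⟩ := hS
  have xi : x ∉ ({i, j, k, l} : Set I) := hSe ▸ hx
  simp only [Set.mem_insert_iff, Set.mem_singleton_iff, not_or] at xi
  set m := four x i j k 1 (-(D3 (G x) (G j) (G k) / D3 (G i) (G j) (G k)))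
    (-(D3 (G i) (G x) (G k) / D3 (G i) (G j) (G k)))
    (-(D3 (G i) (G j) (G x) / D3 (G i) (G j) (G k))) with hm
  have mx : m x = 1 := by simp [hm, four, xi]
  have m0 : ∀ y, y ∉ S → y ≠ x → m y = 0 := by
    intro y hy hyx
    rw [hSe] at hy
    simp only [Set.mem_insert_iff, Set.mem_singleton_iff, not_or] at hy
    simp [hm, four, hy, hyx]
  have mG : ∑ y, m y • G y = 0 := by
    rw [hm, four_sum]
    funext y
    have := D3_cramer (G x) (G i) (G j) (G k) y
    have e1 : D3 (G i) (G x) (G k) = - D3 (G x) (G i) (G k) := D3_swap₁ _ _ _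
    have e2 : D3 (G i) (G j) (G x) = D3 (G x) (G i) (G j) := D3_rot _ _ _
    simp only [Pi.add_apply, Pi.smul_apply, smul_eq_mul, Pi.zero_apply, e1, e2]
    field_simp
    linear_combination this
  -- shift `m` by a large multiple of `c`
  obtain ⟨T, hT⟩ : ∃ T : ℝ, ∀ y, 0 ≤ m y + T * c y := by
    have : ∀ y, ∃ T : ℝ, ∀ T' ≥ T, 0 ≤ m y + T' * c y := by
      intro y
      by_cases hy : y ∈ S
      · have hcy : 0 < c y := lt_of_le_of_ne (c1 y) ((c3 y).1 hy).symm
        refine ⟨-m y / c y, fun T' hT' => ?_⟩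
        have := (div_le_iff₀ hcy).1 hT'
        linarith
      · have hcy : c y = 0 := by by_contra h; exact hy ((c3 y).2 h)
        refine ⟨0, fun T' _ => ?_⟩
        rw [hcy]
        by_cases hyx : y = x
        · rw [hyx, mx]; simp
        · rw [m0 y hy hyx]; simp
    choose T hT using this
    obtain ⟨M, hM⟩ := (Set.finite_range T).bddAbove
    exact ⟨M, fun y => hT y M (hM ⟨y, rfl⟩)⟩
  obtain ⟨p, hp⟩ := c4
  obtain ⟨t, -, t1, t2, q, hq, hqt⟩ := dep_reduce (c := fun y => m y + T * c y) (m := c) hT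
    (by simp only [add_smul, Finset.sum_add_distrib, mG, mul_smul, ← Finset.smul_sum, c2]; simp)
    c2 (lt_of_le_of_ne (c1 p) ((c3 p).1 hp).symm)
  have hqS : q ∈ S := (c3 q).2 hq.ne'
  refine ⟨q, hqS, ?_⟩
  have hcx : c x = 0 := by by_contra h; exact hx ((c3 x).2 h)
  have hU : DepSupp G {y | m y + T * c y - t * c y ≠ 0} := ⟨_, t1, t2, fun _ => Iff.rfl⟩
  have hsub : {y | m y + T * c y - t * c y ≠ 0} ⊆ insert x (S \ {q}) := by
    intro y hy
    by_cases hyx : y = x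
    · exact Or.inl hyx
    · refine Or.inr ⟨?_, ?_⟩
      · by_contra hyS
        have hcy : c y = 0 := by by_contra h; exact hyS ((c3 y).2 h)
        exact hy (by rw [m0 y hyS hyx, hcy]; simp)
      · rintro rfl
        exact hy (by rw [hqt]; simp)
  obtain ⟨V, hVU, hxV, hV⟩ := hU.exists_minimal (j := x) (by simp [mx, hcx])
  have hcard : (insert x (S \ {q})).ncard = 4 := by
    rw [Set.ncard_insert_of_notMem (fun h => hx h.1), Set.ncard_sdiff_singleton_of_mem hqS, hSe]
    have : ({i, j, k, l} : Set I).ncard = 4 := Set.ncard_eq_four.2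
      ⟨i, j, k, l, hd.1, hd.2.1, hd.2.2.1, hd.2.2.2.1, hd.2.2.2.2.1, hd.2.2.2.2.2, rfl⟩
    rw [this]
  have : V = insert x (S \ {q}) := by
    refine Set.eq_of_subset_of_ncard_le (hVU.trans hsub) ?_
    rw [hcard]
    exact hG V hV.depSupp hV.nonempty
  rwa [← this]

/-- If two configurations have the same positive circuits, and the determinants agree in sign on
one circuit, then they agree in sign on all triples contained in circuits. -/
lemma D3_agree (hG₀ : Simplicial3 G₀) (h : ∀ U, DepSupp G U ↔ DepSupp G₀ U)
    {i₀ j₀ k₀ l₀ : I} (hd₀ : Dist4 i₀ j₀ k₀ l₀) (hS₀ : PosCirc G₀ {i₀, j₀, k₀, l₀})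
    (hsign : 0 < D3 (G i₀) (G j₀) (G k₀) * D3 (G₀ i₀) (G₀ j₀) (G₀ k₀))
    {i j k l : I} (hd : Dist4 i j k l) (hS : PosCirc G₀ {i, j, k, l}) :
    0 < D3 (G i) (G j) (G k) * D3 (G₀ i) (G₀ j) (G₀ k) := by
  have all : ∀ i j k l : I, Dist4 i j k l → PosCirc G₀ {i, j, k, l} →
      0 < D3 (G i) (G j) (G k) * D3 (G₀ i) (G₀ j) (G₀ k) →
      0 < D3 (G j) (G k) (G l) * D3 (G₀ j) (G₀ k) (G₀ l) ∧
      0 < D3 (G i) (G k) (G l) * D3 (G₀ i) (G₀ k) (G₀ l) ∧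
      0 < D3 (G i) (G j) (G l) * D3 (G₀ i) (G₀ j) (G₀ l) := by
    intro i j k l hd hS hs
    obtain ⟨s, h1, h2, h3, h4⟩ := PosCirc.D3_signs hd hS
    obtain ⟨t, k1, k2, k3, k4⟩ := PosCirc.D3_signs hd (hS.of_depSupp_iff h)
    have st : 0 < s * t := by
      have := mul_pos h4 k4
      by_contra hst
      nlinarith
    refine ⟨?_, ?_, ?_⟩
    · have := mul_pos h1 k1; by_contra hc; nlinarith
    · have := mul_pos h2 k2; by_contra hc; nlinarith
    · have := mul_pos h3 k3; by_contra hc; nlinarith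
  have sw1 : ∀ i j k : I, D3 (G j) (G i) (G k) * D3 (G₀ j) (G₀ i) (G₀ k) =
      D3 (G i) (G j) (G k) * D3 (G₀ i) (G₀ j) (G₀ k) := by
    intro i j k; rw [D3_swap₁, D3_swap₁ (G₀ i)]; ring
  have sw2 : ∀ i j k : I, D3 (G i) (G k) (G j) * D3 (G₀ i) (G₀ k) (G₀ j) =
      D3 (G i) (G j) (G k) * D3 (G₀ i) (G₀ j) (G₀ k) := by
    intro i j k; rw [D3_swap₂, D3_swap₂ (G₀ i)]; ring
  -- the circuits all of whose triples agree
  set K : Set (Set I) := {S | PosCirc G₀ S ∧ ∀ i j k, i ∈ S → j ∈ S → k ∈ S → i ≠ j → i ≠ k →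
    j ≠ k → 0 < D3 (G i) (G j) (G k) * D3 (G₀ i) (G₀ j) (G₀ k)} with hK
  have mk : ∀ i j k l : I, Dist4 i j k l → PosCirc G₀ {i, j, k, l} →
      0 < D3 (G i) (G j) (G k) * D3 (G₀ i) (G₀ j) (G₀ k) → {i, j, k, l} ∈ K := by
    intro i j k l hd hS hs
    obtain ⟨a1, a2, a3⟩ := all i j k l hd hS hs
    refine ⟨hS, fun x y z hx hy hz nxy nxz nyz => ?_⟩
    simp only [Set.mem_insert_iff, Set.mem_singleton_iff] at hx hy hz
    have r1 := sw1
    have r2 := sw2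
    rcases hx with rfl | rfl | rfl | rfl <;> rcases hy with rfl | rfl | rfl | rfl <;>
      (first | exact absurd rfl nxy | skip) <;> rcases hz with rfl | rfl | rfl | rfl <;>
      (first | exact absurd rfl nxz | exact absurd rfl nyz | skip) <;>
      first
        | assumption
        | (rw [sw1]; assumption)
        | (rw [sw2]; assumption)
        | (rw [sw1, sw2]; assumption)
        | (rw [sw2, sw1]; assumption)
        | (rw [sw1, sw2, sw1]; assumption)
  obtain ⟨S, ⟨hSK, hSa⟩, hST⟩ := exists_circ_subset (G := G₀) (K := K)
    ⟨_, mk i₀ j₀ k₀ l₀ hd₀ hS₀ hsign⟩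
    (fun S hS => hS.1) (by
      rintro S ⟨hS, hSa⟩ x hx
      obtain ⟨q, hq, hpc⟩ := hG₀.pivot hS hx
      refine ⟨q, hq, ?_⟩
      have hcard : (S \ {q}).ncard = 3 := by
        obtain ⟨i, j, k, l, hd, hSe⟩ := hG₀.exists_four hS
        have : S.ncard = 4 := hSe ▸ Set.ncard_eq_four.2
          ⟨i, j, k, l, hd.1, hd.2.1, hd.2.2.1, hd.2.2.2.1, hd.2.2.2.2.1, hd.2.2.2.2.2, rfl⟩
        rw [Set.ncard_sdiff_singleton_of_mem hq, this]
      obtain ⟨i, j, k, n1, n2, n3, he⟩ := Set.ncard_eq_three.1 hcard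
      have hm : ∀ y ∈ ({i, j, k} : Set I), y ∈ S := fun y hy => (he ▸ hy : y ∈ S \ {q}).1
      have hi := hm i (by simp)
      have hj := hm j (by simp)
      have hk := hm k (by simp)
      have e : insert x (S \ {q}) = {i, j, k, x} := by
        rw [he]; ext y; simp only [Set.mem_insert_iff, Set.mem_singleton_iff]; tauto
      rw [e] at hpc ⊢
      refine mk i j k x ⟨n1, n2, ?_, n3, ?_, ?_⟩ hpc (hSa i j k hi hj hk n1 n2 n3)
      · rintro rfl; exact hx hi
      · rintro rfl; exact hx hj
      · rintro rfl; exact hx hk) hS.depSupp hS.nonempty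
  have := hS.eq_of_subset hSK.depSupp hST hSK.nonempty
  subst this
  exact hSa i j k (by simp) (by simp) (by simp) hd.1 hd.2.1 hd.2.2.2.1

/-- A finite set of vectors without nonnegative dependencies lies in an open half-space. -/
lemma exists_pos_functional {J : Type} [Finite J] (v : J → Fin 3 → ℝ)
    (h : ∀ c : J → ℝ, (∀ j, 0 ≤ c j) → (∀ [Fintype J], ∑ j, c j • v j = 0) → ∀ j, c j = 0) :
    ∃ ψ : Fin 3 → ℝ, ∀ j, 0 < ψ ⬝ᵥ v j := by
  have := Fintype.ofFinite J
  by_cases hJ : IsEmpty J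
  · exact ⟨0, fun j => hJ.elim j⟩
  have h0 : (0 : Fin 3 → ℝ) ∉ convexHull ℝ (Set.range v) := by
    intro hmem
    rw [convexHull_range_eq_exists_affineCombination] at hmem
    obtain ⟨s, w, hw, hw1, hw2⟩ := hmem
    classical
    rw [Finset.affineCombination_eq_linear_combination _ _ _ hw1] at hw2
    have := h (fun j => if j ∈ s then w j else 0) (fun j => by
      split_ifs with hj
      · exact hw j hj
      · exact le_rfl) (by
      intro inst
      simp only [ite_smul, zero_smul, Finset.sum_ite_mem, Finset.univ_inter]
      exact hw2)
    have h1 : ∑ j ∈ s, w j = 0 := Finset.sum_eq_zero fun j hj => by simpa [hj] using this j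
    linarith
  have hcl : IsClosed (convexHull ℝ (Set.range v)) :=
    ((Set.finite_range v).isCompact_convexHull (𝕜 := ℝ)).isClosed
  obtain ⟨f, u, hu, hf⟩ := geometric_hahn_banach_point_closed (convex_convexHull ℝ _) hcl h0
  refine ⟨fun i => f (Pi.single i 1), fun j => ?_⟩
  have hfj := hf (v j) (subset_convexHull ℝ _ ⟨j, rfl⟩)
  have : f (v j) = (fun i => f (Pi.single i 1)) ⬝ᵥ v j := by
    conv_lhs => rw [← Finset.univ_sum_single (v j)]
    rw [map_sum]
    simp only [dotProduct]
    refine Finset.sum_congr rfl fun i _ => ?_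
    have : (Pi.single i (v j i) : Fin 3 → ℝ) = v j i • Pi.single i 1 := by
      rw [← Pi.single_smul]; simp
    rw [this, map_smul, smul_eq_mul, mul_comm]
  rw [← this]
  simp at hu
  linarith

end Geometry

/-! ### Sign patterns of configurations of white, coloured and black vectors -/

section Patterns

variable {A Λ J : Type}

/-- Sign data for configurations of white vectors (indexed by `A`), coloured vectors (indexed by
`Λ`, each with a white home) and black vectors (indexed by `J`). -/
structure Pattern (A Λ J : Type) where
  home : Λ → A
  om : A → A → ℝ
  chi : A → A → A → ℝ
  sg : Λ → J → ℝ

/-- The home of a white vector is itself, black vectors have no home. -/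
def Pattern.hm (P : Pattern A Λ J) : A ⊕ (Λ ⊕ J) → Option A
  | .inl a => some a
  | .inr (.inl l) => some (P.home l)
  | .inr (.inr _) => none

/-- Index of a white vector. -/
abbrev wh (a : A) : A ⊕ (Λ ⊕ J) := .inl a
/-- Index of a coloured vector. -/
abbrev co (l : Λ) : A ⊕ (Λ ⊕ J) := .inr (.inl l)
/-- Index of a black vector. -/
abbrev bl (j : J) : A ⊕ (Λ ⊕ J) := .inr (.inr j)

/-- White vectors are counted negatively. -/
def eps : A ⊕ (Λ ⊕ J) → ℝ := Sum.elim (fun _ => -1) (fun _ => 1)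

/-- The vectors of a configuration, the white ones reversed. -/
def sgn (V : A ⊕ (Λ ⊕ J) → Fin 3 → ℝ) : A ⊕ (Λ ⊕ J) → Fin 3 → ℝ := fun i => eps i • V i

/-- The determinants of a configuration have the signs prescribed by a pattern. -/
structure Pattern.Spec (P : Pattern A Λ J) (V : A ⊕ (Λ ⊕ J) → Fin 3 → ℝ) : Prop where
  own : ∀ l j, 0 < P.sg l j * D3 (V (wh (P.home l))) (V (co l)) (V (bl j))
  forB : ∀ a a' u j, a ≠ a' → P.hm u = some a' → 0 < P.om a a' * D3 (V (wh a)) (V u) (V (bl j))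
  ownFor : ∀ l a' u, P.home l ≠ a' → P.hm u = some a' →
    0 < P.om (P.home l) a' * D3 (V (wh (P.home l))) (V (co l)) (V u)
  forFor : ∀ a a' a'' u v, a ≠ a' → a ≠ a'' → a' ≠ a'' → P.hm u = some a' → P.hm v = some a'' →
    0 < P.chi a a' a'' * D3 (V (wh a)) (V u) (V v)

/-- Conditions ensuring that the circuits of a configuration determine its pattern. -/
structure Pattern.Good (P : Pattern A Λ J) : Prop where
  om_cases : ∀ a a', P.om a a' = 1 ∨ P.om a a' = -1
  chi_cases : ∀ a a' a'', P.chi a a' a'' = 1 ∨ P.chi a a' a'' = -1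
  sg_cases : ∀ l j, P.sg l j = 1 ∨ P.sg l j = -1
  om_anti : ∀ a a', a ≠ a' → P.om a' a = - P.om a a'
  chi_rot : ∀ x y z, x ≠ y → x ≠ z → y ≠ z → P.chi y z x = P.chi x y z
  chi_swap : ∀ x y z, x ≠ y → x ≠ z → y ≠ z → P.chi y x z = - P.chi x y z
  not_all : ∀ x y z, x ≠ y → x ≠ z → y ≠ z → P.om x y = - P.chi x y z →
    P.om y z = - P.chi x y z → P.om z x = - P.chi x y z → False
  exists_color : ∀ a, ∃ l, P.home l = a
  exists_other : ∀ a : A, ∃ a', a ≠ a'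
  both_sides : ∀ l s, s = 1 ∨ s = -1 → ∃ j, P.sg l j = s
  white_white : ∀ a a' j, a ≠ a' →
    (∃ x, x ≠ a ∧ x ≠ a' ∧ P.om x a = P.om a a' ∧ P.om a' x = P.om a a' ∧
      P.chi x a a' = P.om a a') ∨
    (∃ l, P.home l = a ∧ P.sg l j = P.om a a') ∨ ∃ l, P.home l = a' ∧ P.sg l j = P.om a' a
  white_color : ∀ a l j, a ≠ P.home l →
    (∃ l₀, P.home l₀ = a ∧ P.sg l₀ j = - P.om a (P.home l)) ∨
    P.sg l j = P.om (P.home l) a ∨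
    ∃ j₂, P.sg l j₂ = P.om (P.home l) a ∧ ∃ l₀, P.home l₀ = a ∧ P.sg l₀ j₂ = - P.om a (P.home l)

section aux

lemma sgn_wh (V : A ⊕ (Λ ⊕ J) → Fin 3 → ℝ) (a : A) : sgn V (wh a) = - V (wh a) := by
  simp [sgn, eps]
lemma sgn_inr (V : A ⊕ (Λ ⊕ J) → Fin 3 → ℝ) (u : Λ ⊕ J) : sgn V (.inr u) = V (.inr u) := by
  simp [sgn, eps]

lemma D3_smul (a b c : ℝ) (u v w : Fin 3 → ℝ) :
    D3 (a • u) (b • v) (c • w) = a * b * c * D3 u v w := by simp [D3]; ring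
lemma D3_neg₁ (u v w : Fin 3 → ℝ) : D3 (-u) v w = - D3 u v w := by simp [D3]; ring
lemma D3_neg₂ (u v w : Fin 3 → ℝ) : D3 u (-v) w = - D3 u v w := by simp [D3]; ring
lemma D3_neg₃ (u v w : Fin 3 → ℝ) : D3 u v (-w) = - D3 u v w := by simp [D3]; ring

lemma D3_rel {α β γ δ : ℝ} {u v w z : Fin 3 → ℝ} (h : α • u + β • v + γ • w + δ • z = 0)
    (x y : Fin 3 → ℝ) :
    α * D3 x y u + β * D3 x y v + γ * D3 x y w + δ * D3 x y z = 0 := by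
  have e : ∀ i, α * u i + β * v i + γ * w i + δ * z i = 0 := fun i => by
    simpa using congrFun h i
  simp only [D3]
  linear_combination (x 1 * y 2 - x 2 * y 1) * e 0 - (x 0 * y 2 - x 2 * y 0) * e 1 +
    (x 0 * y 1 - x 1 * y 0) * e 2

lemma sign_of_agr {s x y : ℝ} (h : 0 < x * y) (hs : 0 < s * y) : 0 < s * x := by
  have h1 := mul_pos h hs
  have h2 : 0 < y ^ 2 := by
    have : y ≠ 0 := by rintro rfl; simp at h
    positivity
  by_contra hc
  nlinarith

variable [Fintype A] [Fintype Λ] [Fintype J]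

lemma PosCirc.rel {I : Type} [Fintype I] {G : I → Fin 3 → ℝ} {i j k l : I} (h : Dist4 i j k l)
    (hS : PosCirc G {i, j, k, l}) : ∃ α β γ δ : ℝ, 0 < α ∧ 0 < β ∧ 0 < γ ∧ 0 < δ ∧
      α • G i + β • G j + γ • G k + δ • G l = 0 := by
  obtain ⟨c, h1, h2, h3, -, -⟩ := hS
  have cpos : ∀ x ∈ ({i, j, k, l} : Set I), 0 < c x := fun x hx =>
    lt_of_le_of_ne (h1 x) ((h3 x).1 hx).symm
  refine ⟨c i, c j, c k, c l, cpos i (by simp), cpos j (by simp), cpos k (by simp),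
    cpos l (by simp), ?_⟩
  rw [← sum_of_support h fun x hx => ?_]
  · exact h2
  · by_contra h'; exact hx ((h3 x).2 h')

/-- A white vector in the interior of the triangle spanned by three nonwhite ones. -/
lemma posCirc_one_white {V : A ⊕ (Λ ⊕ J) → Fin 3 → ℝ} {ψ : Fin 3 → ℝ} (hψ : ∀ i, 0 < ψ ⬝ᵥ V i)
    {a : A} {u v t : Λ ⊕ J} (huv : u ≠ v) (hut : u ≠ t) (hvt : v ≠ t) (s : ℝ)
    (h1 : 0 < s * D3 (V (wh a)) (V (.inr u)) (V (.inr v)))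
    (h2 : 0 < s * D3 (V (wh a)) (V (.inr v)) (V (.inr t)))
    (h3 : 0 < s * D3 (V (wh a)) (V (.inr t)) (V (.inr u))) :
    PosCirc (sgn V) {wh a, .inr u, .inr v, .inr t} := by
  have hd : Dist4 (wh a : A ⊕ (Λ ⊕ J)) (.inr u) (.inr v) (.inr t) := by
    refine ⟨?_, ?_, ?_, ?_, ?_, ?_⟩ <;> simp [huv, hut, hvt]
  have key : D3 (V (.inr u)) (V (.inr v)) (V (.inr t)) * (ψ ⬝ᵥ V (wh a)) =
      D3 (V (wh a)) (V (.inr v)) (V (.inr t)) * (ψ ⬝ᵥ V (.inr u)) +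
      D3 (V (wh a)) (V (.inr t)) (V (.inr u)) * (ψ ⬝ᵥ V (.inr v)) +
      D3 (V (wh a)) (V (.inr u)) (V (.inr v)) * (ψ ⬝ᵥ V (.inr t)) := by
    simp only [dotProduct, Fin.sum_univ_three, D3]; ring
  have p1 := mul_pos h2 (hψ (.inr u))
  have p2 := mul_pos h3 (hψ (.inr v))
  have p3 := mul_pos h1 (hψ (.inr t))
  have p4 : 0 < s * D3 (V (.inr u)) (V (.inr v)) (V (.inr t)) := by
    refine pos_of_mul_pos_left (b := ψ ⬝ᵥ V (wh a)) ?_ (hψ (wh a)).le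
    rw [mul_assoc, key]
    linarith
  refine posCirc_of_D3 hd s ?_ ?_ ?_ ?_
  · simpa only [sgn_inr] using p4
  · simp only [sgn_inr, sgn_wh, D3_neg₁]; linarith
  · simp only [sgn_inr, sgn_wh, D3_neg₁]; rw [D3_swap₂]; linarith
  · simp only [sgn_inr, sgn_wh, D3_neg₁]; linarith

end aux

variable [Fintype A] [Fintype Λ] [Fintype J] {P : Pattern A Λ J} (hP : P.Good)
  {V : A ⊕ (Λ ⊕ J) → Fin 3 → ℝ} (hV : P.Spec V) {ψ : Fin 3 → ℝ} (hψ : ∀ i, 0 < ψ ⬝ᵥ V i)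

section
include hP hV

lemma Pattern.Spec.wwb {a a' : A} (h : a ≠ a') (j : J) :
    0 < P.om a a' * D3 (V (wh a)) (V (wh a')) (V (bl j)) := hV.forB a a' (wh a') j h rfl

lemma Pattern.Spec.black_black {l : Λ} {j j' : J} (h : P.sg l j' = - P.sg l j) :
    0 < P.sg l j * D3 (V (wh (P.home l))) (V (bl j)) (V (bl j')) := by
  obtain ⟨a', ha'⟩ := hP.exists_other (P.home l)
  have e := D3_plucker (V (wh (P.home l))) (V (wh a')) (V (co l)) (V (bl j)) (V (bl j'))
  have h1 := hV.ownFor l a' (wh a') ha' rfl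
  have h2 := hV.own l j
  have h3 := hV.own l j'
  have h4 := hV.forB _ a' (wh a') j ha' rfl
  have h5 := hV.forB _ a' (wh a') j' ha' rfl
  rw [h] at h3
  have h6 := mul_pos h2 h5
  have h7 := mul_pos h3 h4
  have h8 : 0 < (P.sg l j * D3 (V (wh (P.home l))) (V (bl j)) (V (bl j'))) *
      (P.om (P.home l) a' * D3 (V (wh (P.home l))) (V (co l)) (V (wh a'))) := by
    have : (P.sg l j * D3 (V (wh (P.home l))) (V (bl j)) (V (bl j'))) *
      (P.om (P.home l) a' * D3 (V (wh (P.home l))) (V (co l)) (V (wh a'))) =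
      P.sg l j * P.om (P.home l) a' * (D3 (V (wh (P.home l))) (V (co l)) (V (wh a')) *
        D3 (V (wh (P.home l))) (V (bl j)) (V (bl j'))) := by ring
    rw [this, e]
    linarith
  exact pos_of_mul_pos_left h8 h1.le

include hψ

lemma circ_cbb {l : Λ} {j j' : J} (h : P.sg l j' = - P.sg l j) :
    PosCirc (sgn V) {wh (P.home l), co l, bl j, bl j'} := by
  have h1 := hV.own l j
  have h2 := hV.own l j'
  have h3 := hV.black_black hP h
  have hj : j ≠ j' := by
    rintro rfl
    rcases hP.sg_cases l j with h' | h' <;> rw [h'] at h <;> norm_num at h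
  rw [h] at h2
  rw [D3_swap₂] at h2
  exact posCirc_one_white hψ (by simp) (by simp) (by simpa using hj) _ h1 h3 (by linarith)

lemma circ_ccb {l m : Λ} {j : J} (h : P.home l ≠ P.home m)
    (hs : P.sg l j = - P.om (P.home l) (P.home m)) :
    PosCirc (sgn V) {wh (P.home l), co l, co m, bl j} := by
  have h1 := hV.ownFor l _ (co m) h rfl
  have h2 := hV.forB _ _ (co m) j h rfl
  have h3 := hV.own l j
  rw [hs] at h3
  rw [D3_swap₂] at h3
  exact posCirc_one_white hψ (by rintro ⟨rfl⟩; exact h rfl) (by simp) (by simp) _ h1 h2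
    (by linarith)

lemma circ_ccc {k m l : Λ} (h1 : P.home k ≠ P.home m) (h2 : P.home k ≠ P.home l)
    (h3 : P.home m ≠ P.home l)
    (e1 : P.chi (P.home k) (P.home m) (P.home l) = P.om (P.home k) (P.home m))
    (e2 : P.om (P.home k) (P.home l) = - P.om (P.home k) (P.home m)) :
    PosCirc (sgn V) {wh (P.home k), co k, co m, co l} := by
  have k1 := hV.ownFor k _ (co m) h1 rfl
  have k2 := hV.forFor _ _ _ (co m) (co l) h1 h2 h3 rfl rfl
  have k3 := hV.ownFor k _ (co l) h2 rfl
  rw [e1] at k2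
  rw [e2, D3_swap₂] at k3
  exact posCirc_one_white hψ (by rintro ⟨rfl⟩; exact h1 rfl) (by rintro ⟨rfl⟩; exact h2 rfl)
    (by rintro ⟨rfl⟩; exact h3 rfl) _ k1 k2 (by linarith)

lemma circ_bcc {x : A} {m l : Λ} (j : J) (h1 : x ≠ P.home m) (h2 : x ≠ P.home l)
    (h3 : P.home m ≠ P.home l)
    (e1 : P.om x (P.home l) = P.chi x (P.home m) (P.home l))
    (e2 : P.om x (P.home m) = - P.chi x (P.home m) (P.home l)) :
    PosCirc (sgn V) {wh x, bl j, co m, co l} := by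
  have k1 := hV.forB _ _ (co m) j h1 rfl
  have k2 := hV.forFor _ _ _ (co m) (co l) h1 h2 h3 rfl rfl
  have k3 := hV.forB _ _ (co l) j h2 rfl
  rw [e1] at k3
  rw [e2, D3_swap₂] at k1
  exact posCirc_one_white hψ (by simp) (by simp) (by rintro ⟨rfl⟩; exact h3 rfl) _
    (by linarith) k2 k3

omit hψ

lemma circ_wcb {a' : A} {l : Λ} {j : J} (h : P.home l ≠ a') (hs : P.sg l j = P.om (P.home l) a') :
    PosCirc (sgn V) {wh (P.home l), wh a', co l, bl j} := by
  have k1 := hV.ownFor l a' (wh a') h rfl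
  have k2 := hV.wwb hP h j
  have k3 := hV.own l j
  have k4 := hV.forB _ _ (co l) j h.symm rfl
  rw [hs] at k3
  rw [hP.om_anti _ _ h] at k4
  rw [D3_swap₂] at k1
  refine posCirc_of_D3 ⟨by simpa using h, by simp, by simp, by simp, by simp, by simp⟩
    (P.om (P.home l) a') ?_ ?_ ?_ ?_ <;>
    simp only [sgn_wh, sgn_inr, D3_neg₁, D3_neg₂, D3_neg₃] <;> linarith

lemma circ_wwwb {x a a' : A} (j : J) (h1 : x ≠ a) (h2 : x ≠ a') (h3 : a ≠ a')
    (e1 : P.om x a = P.om a a') (e2 : P.om a' x = P.om a a') (e3 : P.chi x a a' = P.om a a') :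
    PosCirc (sgn V) {wh x, wh a, wh a', bl j} := by
  have k1 := hV.wwb hP h1 j
  have k2 := hV.wwb hP h3 j
  have k3 := hV.wwb hP h2.symm j
  have k4 := hV.forFor _ _ _ (wh a) (wh a') h1 h2 h3 rfl rfl
  rw [e1] at k1
  rw [e2, D3_swap₁] at k3
  rw [e3] at k4
  refine posCirc_of_D3 ⟨by simpa using h1, by simpa using h2, by simp, by simpa using h3,
    by simp, by simp⟩ (P.om a a') ?_ ?_ ?_ ?_ <;>
    simp only [sgn_wh, sgn_inr, D3_neg₁, D3_neg₂, D3_neg₃] <;> linarith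

lemma circ_wwwc {x y : A} {l : Λ} (h1 : x ≠ y) (h2 : x ≠ P.home l) (h3 : y ≠ P.home l)
    (e1 : P.om y (P.home l) = - P.om x y) (e2 : P.om (P.home l) x = - P.om x y)
    (e3 : P.chi x y (P.home l) = P.om x y) :
    PosCirc (sgn V) {wh x, wh y, wh (P.home l), co l} := by
  have k1 := hV.forFor _ _ _ (wh y) (co l) h1 h2 h3 rfl rfl
  have k2 := hV.ownFor l x (wh x) h2.symm rfl
  have k3 := hV.ownFor l y (wh y) h3.symm rfl
  have k4 := hV.forFor _ _ _ (wh y) (wh (P.home l)) h1 h2 h3 rfl rfl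
  rw [e3] at k1 k4
  rw [e2, ← D3_rot, ← D3_rot] at k2
  rw [hP.om_anti _ _ h3, e1, ← D3_rot, ← D3_rot] at k3
  refine posCirc_of_D3 ⟨by simpa using h1, by simpa using h2, by simp, by simpa using h3,
    by simp, by simp⟩ (P.om x y) ?_ ?_ ?_ ?_ <;>
    simp only [sgn_wh, sgn_inr, D3_neg₁, D3_neg₂, D3_neg₃] <;> linarith

end

end Patterns

/-! ### The circuits determine the pattern -/

section CircuitsToPattern

variable {A Λ J : Type} [Fintype A] [Fintype Λ] [Fintype J]

/-- Two configurations have the same circuits, and determinants of triples contained in circuits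
have the same signs. -/
def Agree (V V₀ : A ⊕ (Λ ⊕ J) → Fin 3 → ℝ) : Prop :=
  ∀ i j k l, Dist4 i j k l → PosCirc (sgn V₀) {i, j, k, l} → PosCirc (sgn V) {i, j, k, l} ∧
    0 < D3 (V i) (V j) (V k) * D3 (V₀ i) (V₀ j) (V₀ k)

lemma eps_mul_self (i : A ⊕ (Λ ⊕ J)) : eps i * eps i = 1 := by
  rcases i with a | u <;> simp [eps]

lemma D3_sgn_mul (V V₀ : A ⊕ (Λ ⊕ J) → Fin 3 → ℝ) (i j k : A ⊕ (Λ ⊕ J)) :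
    D3 (sgn V i) (sgn V j) (sgn V k) * D3 (sgn V₀ i) (sgn V₀ j) (sgn V₀ k) =
      D3 (V i) (V j) (V k) * D3 (V₀ i) (V₀ j) (V₀ k) := by
  simp only [sgn, D3_smul]
  linear_combination (D3 (V i) (V j) (V k) * D3 (V₀ i) (V₀ j) (V₀ k)) *
    ((eps_mul_self i) * (eps j * eps j * (eps k * eps k)) + (eps_mul_self j) * (eps k * eps k) +
      eps_mul_self k)

lemma agree_of_depSupp {V V₀ : A ⊕ (Λ ⊕ J) → Fin 3 → ℝ} (hG₀ : Simplicial3 (sgn V₀))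
    (h : ∀ U, DepSupp (sgn V) U ↔ DepSupp (sgn V₀) U) {i₀ j₀ k₀ l₀ : A ⊕ (Λ ⊕ J)}
    (hd₀ : Dist4 i₀ j₀ k₀ l₀) (hS₀ : PosCirc (sgn V₀) {i₀, j₀, k₀, l₀})
    (hsign : 0 < D3 (V i₀) (V j₀) (V k₀) * D3 (V₀ i₀) (V₀ j₀) (V₀ k₀)) : Agree V V₀ := by
  intro i j k l hd hS
  refine ⟨hS.of_depSupp_iff h, ?_⟩
  rw [← D3_sgn_mul] at hsign ⊢
  exact D3_agree hG₀ h hd₀ hS₀ hsign hd hS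

variable {P : Pattern A Λ J} (hP : P.Good) {V V₀ : A ⊕ (Λ ⊕ J) → Fin 3 → ℝ}
  (hV₀ : P.Spec V₀) {ψ : Fin 3 → ℝ} (hψ : ∀ i, 0 < ψ ⬝ᵥ V₀ i) (hag : Agree V V₀)

section
include hag

lemma Agree.perm {i j k l : A ⊕ (Λ ⊕ J)} (hd : Dist4 i j k l)
    (hS : PosCirc (sgn V₀) {i, j, k, l}) :
    0 < D3 (V i) (V j) (V l) * D3 (V₀ i) (V₀ j) (V₀ l) ∧
    0 < D3 (V i) (V k) (V l) * D3 (V₀ i) (V₀ k) (V₀ l) ∧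
    0 < D3 (V j) (V k) (V l) * D3 (V₀ j) (V₀ k) (V₀ l) := by
  obtain ⟨h1, h2, h3, h4, h5, h6⟩ := hd
  refine ⟨(hag i j l k ⟨h1, h3, h2, h5, h4, h6.symm⟩ ?_).2,
    (hag i k l j ⟨h2, h3, h1, h6, h4.symm, h5.symm⟩ ?_).2,
    (hag j k l i ⟨h4, h5, h1.symm, h6, h2.symm, h3.symm⟩ ?_).2⟩ <;>
  · convert hS using 1
    ext x; simp only [Set.mem_insert_iff, Set.mem_singleton_iff]; tauto

end

section
include hP hV₀ hψ hag

lemma agree_own (l : Λ) (j : J) : 0 < P.sg l j * D3 (V (wh (P.home l))) (V (co l)) (V (bl j)) := by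
  obtain ⟨j', hj'⟩ := hP.both_sides l (- P.sg l j)
    (by rcases hP.sg_cases l j with h | h <;> simp [h])
  have hj : j ≠ j' := by
    rintro rfl
    rcases hP.sg_cases l j with h' | h' <;> rw [h'] at hj' <;> norm_num at hj'
  have := (hag _ _ _ _ ⟨by simp, by simp, by simp, by simp, by simp, by simpa using hj⟩
    (circ_cbb hP hV₀ hψ hj')).2
  exact sign_of_agr this (hV₀.own l j)

/-- A white vector is a positive combination of a coloured vector of its pencil and two black
vectors. -/
lemma agree_expand (l : Λ) : ∃ (j j' : J) (α β γ : ℝ), 0 < α ∧ 0 < β ∧ 0 < γ ∧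
    ∀ x y, D3 x y (V (wh (P.home l))) = α * D3 x y (V (co l)) + β * D3 x y (V (bl j)) +
      γ * D3 x y (V (bl j')) := by
  obtain ⟨j, hj⟩ := hP.both_sides l 1 (Or.inl rfl)
  obtain ⟨j', hj'⟩ := hP.both_sides l (-1) (Or.inr rfl)
  have hjj : j ≠ j' := by rintro rfl; rw [hj] at hj'; norm_num at hj'
  have hd : Dist4 (wh (P.home l) : A ⊕ (Λ ⊕ J)) (co l) (bl j) (bl j') :=
    ⟨by simp, by simp, by simp, by simp, by simp, by simpa using hjj⟩
  obtain ⟨a, b, c, d, ha, hb, hc, hdd, hr⟩ := PosCirc.rel hd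
    (hag _ _ _ _ hd (circ_cbb hP hV₀ hψ (by rw [hj, hj']))).1
  refine ⟨j, j', b / a, c / a, d / a, by positivity, by positivity, by positivity, fun x y => ?_⟩
  have := D3_rel hr x y
  simp only [sgn_wh, sgn_inr, D3_neg₃] at this
  field_simp
  linarith

lemma agree_ownFor (l : Λ) (a' : A) (u : A ⊕ (Λ ⊕ J)) (h : P.home l ≠ a')
    (hu : P.hm u = some a') :
    0 < P.om (P.home l) a' * D3 (V (wh (P.home l))) (V (co l)) (V u) := by
  refine sign_of_agr ?_ (hV₀.ownFor l a' u h hu)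
  rcases u with a | m | j
  · cases Option.some.inj hu
    obtain ⟨j, hj⟩ := hP.both_sides l (P.om (P.home l) a') (hP.om_cases _ _)
    have := (hag _ _ _ _ ⟨by simpa using h, by simp, by simp, by simp, by simp, by simp⟩
      (circ_wcb hP hV₀ h hj)).2
    rw [D3_swap₂ (V (wh (P.home l))) _ _, D3_swap₂ (V₀ (wh (P.home l))) _ _] at this
    linarith
  · cases Option.some.inj hu
    obtain ⟨j, hj⟩ := hP.both_sides l (- P.om (P.home l) (P.home m))
      (by rcases hP.om_cases (P.home l) (P.home m) with h | h <;> simp [h])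
    exact (hag _ _ _ _ ⟨by simp, by simp, by simp, by simp; rintro rfl; exact h rfl, by simp,
      by simp⟩ (circ_ccb hP hV₀ hψ h hj)).2
  · simp [Pattern.hm] at hu

omit hψ in
lemma agree_wwb {a a' : A} (h : a ≠ a') (j : J) :
    0 < P.om a a' * D3 (V (wh a)) (V (wh a')) (V (bl j)) := by
  refine sign_of_agr ?_ (hV₀.wwb hP h j)
  rcases hP.white_white a a' j h with ⟨x, h1, h2, e1, e2, e3⟩ | ⟨l, rfl, hl⟩ | ⟨l, rfl, hl⟩
  · exact (Agree.perm hag ⟨by simpa using h1, by simpa using h2, by simp, by simpa using h,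
      by simp, by simp⟩ (circ_wwwb hP hV₀ j h1 h2 h e1 e2 e3)).2.2
  · exact (Agree.perm hag ⟨by simpa using h, by simp, by simp, by simp, by simp, by simp⟩
      (circ_wcb hP hV₀ h hl)).1
  · have := (Agree.perm hag ⟨by simpa using h.symm, by simp, by simp, by simp, by simp, by simp⟩
      (circ_wcb hP hV₀ h.symm hl)).1
    rw [D3_swap₁, D3_swap₁ (V₀ (wh a))] at this
    linarith

lemma agree_wcb {a : A} {l : Λ} (h : a ≠ P.home l) (j : J) :
    0 < P.om a (P.home l) * D3 (V (wh a)) (V (co l)) (V (bl j)) := by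
  by_cases hc1 : ∃ l₀, P.home l₀ = a ∧ P.sg l₀ j = - P.om a (P.home l)
  · obtain ⟨l₀, rfl, hl₀⟩ := hc1
    refine sign_of_agr ?_ (hV₀.forB _ _ (co l) j h rfl)
    exact (Agree.perm hag ⟨by simp, by simp, by simp, by simp; rintro rfl; exact h rfl, by simp,
      by simp⟩ (circ_ccb hP hV₀ hψ h hl₀)).2.1
  rcases hP.white_color a l j h with hc | hc | ⟨j₂, hj₂, l₀, rfl, hl₀⟩
  · exact absurd hc hc1
  · refine sign_of_agr ?_ (hV₀.forB _ _ (co l) j h rfl)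
    exact (Agree.perm hag ⟨by simpa using h.symm, by simp, by simp, by simp, by simp, by simp⟩
      (circ_wcb hP hV₀ h.symm hc)).2.2
  · have hl₀j : P.sg l₀ j = P.om (P.home l₀) (P.home l) := by
      rcases hP.sg_cases l₀ j with e | e <;>
        rcases hP.om_cases (P.home l₀) (P.home l) with e' | e' <;>
        simp_all
    have hd : Dist4 (wh (P.home l) : A ⊕ (Λ ⊕ J)) (wh (P.home l₀)) (co l) (bl j₂) :=
      ⟨by simpa using h.symm, by simp, by simp, by simp, by simp, by simp⟩
    obtain ⟨α, β, γ, δ, hα, hβ, hγ, hδ, hr⟩ := PosCirc.rel hd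
      (hag _ _ _ _ hd (circ_wcb hP hV₀ h.symm hj₂)).1
    have r := D3_rel hr (V (wh (P.home l₀))) (V (bl j))
    simp only [sgn_wh, sgn_inr, D3_neg₃, D3_self₃] at r
    have e := D3_plucker (V (wh (P.home l₀))) (V (wh (P.home l))) (V (co l₀)) (V (bl j₂)) (V (bl j))
    have k1 := agree_ownFor hP hV₀ hψ hag l₀ _ (wh (P.home l)) h rfl
    have k2 := agree_own hP hV₀ hψ hag l₀ j₂
    have k3 := agree_own hP hV₀ hψ hag l₀ j
    have k4 := agree_wwb hP hV₀ hag h j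
    have k5 := agree_wwb hP hV₀ hag h j₂
    rw [hl₀] at k2
    rw [hl₀j] at k3
    rw [D3_swap₂ _ (V (wh (P.home l))) (V (bl j))] at r
    rw [D3_swap₂ _ (V (co l)) (V (bl j))] at r
    rw [D3_swap₂ _ (V (bl j₂)) (V (bl j))] at r
    set X := D3 (V (wh (P.home l₀))) (V (bl j₂)) (V (bl j)) with hX
    have hXneg : 0 < -(P.om (P.home l₀) (P.home l) * X) := by
      have q1 := mul_pos k2 k4
      have q2 := mul_pos k3 k5
      rcases hP.om_cases (P.home l₀) (P.home l) with ho | ho <;> rw [ho] at k1 q1 q2 ⊢ <;>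
      · by_contra hcon
        nlinarith
    have q3 := mul_pos hα k4
    have q4 := mul_pos hδ hXneg
    rcases hP.om_cases (P.home l₀) (P.home l) with ho | ho <;> rw [ho] at q3 q4 ⊢ <;>
    · by_contra hcon
      nlinarith

lemma agree_ownFor₂ {x y a : A} {l : Λ} (hl : P.home l = a) (hxy : x ≠ y) (hxa : x ≠ a)
    (hya : y ≠ a) (e1 : P.chi x y a = P.om x y) (e2 : P.om x a = - P.om x y) :
    0 < P.om x y * D3 (V (wh x)) (V (wh y)) (V (co l)) := by
  subst hl
  obtain ⟨k, rfl⟩ := hP.exists_color x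
  obtain ⟨m, rfl⟩ := hP.exists_color y
  have hd : Dist4 (wh (P.home k) : A ⊕ (Λ ⊕ J)) (co k) (co m) (co l) := by
    refine ⟨by simp, by simp, by simp, ?_, ?_, ?_⟩ <;> simp <;> rintro rfl
    · exact hxy rfl
    · exact hxa rfl
    · exact hya rfl
  obtain ⟨α, β, γ, δ, hα, hβ, hγ, hδ, hr⟩ := PosCirc.rel hd
    (hag _ _ _ _ hd (circ_ccc hP hV₀ hψ hxy hxa hya e1 e2)).1
  have r := D3_rel hr (V (wh (P.home k))) (V (wh (P.home m)))
  simp only [sgn_wh, sgn_inr, D3_neg₃, D3_self₃] at r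
  have k1 := agree_ownFor hP hV₀ hψ hag k _ (wh (P.home m)) hxy rfl
  have k2 := agree_ownFor hP hV₀ hψ hag m _ (wh (P.home k)) hxy.symm rfl
  rw [D3_swap₂] at k1
  rw [D3_rot (V (wh (P.home k))), hP.om_anti _ _ hxy] at k2
  have q1 := mul_pos hβ k1
  have q2 := mul_pos hγ k2
  rcases hP.om_cases (P.home k) (P.home m) with ho | ho <;> rw [ho] at q1 q2 ⊢ <;>
  · by_contra hcon
    nlinarith

/-- Three whites, in the case where both sides at the first one have the sign of the triple. -/
lemma agree_www₁ {x y a : A} (hxy : x ≠ y) (hxa : x ≠ a) (hya : y ≠ a)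
    (e1 : P.om x y = P.chi x y a) (e2 : P.om a x = P.chi x y a) :
    0 < P.chi x y a * D3 (V (wh x)) (V (wh y)) (V (wh a)) := by
  obtain ⟨l, rfl⟩ := hP.exists_color a
  obtain ⟨j, j', α, β, γ, hα, hβ, hγ, hr⟩ := agree_expand hP hV₀ hψ hag l
  have k1 := agree_ownFor₂ hP hV₀ hψ hag rfl hxy hxa hya e1.symm
    (by rw [hP.om_anti _ _ hxa.symm, e2, e1])
  have k2 := agree_wwb hP hV₀ hag hxy j
  have k3 := agree_wwb hP hV₀ hag hxy j'
  rw [hr]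
  rw [e1] at k1 k2 k3
  have q1 := mul_pos hα k1
  have q2 := mul_pos hβ k2
  have q3 := mul_pos hγ k3
  linarith

lemma agree_wwwc {x y : A} {l : Λ} (h1 : x ≠ y) (h2 : x ≠ P.home l) (h3 : y ≠ P.home l)
    (e1 : P.om y (P.home l) = - P.om x y) (e2 : P.om (P.home l) x = - P.om x y)
    (e3 : P.chi x y (P.home l) = P.om x y) :
    0 < P.chi x y (P.home l) * D3 (V (wh x)) (V (wh y)) (V (wh (P.home l))) ∧
    0 < P.chi x y (P.home l) * D3 (V (wh x)) (V (wh y)) (V (co l)) := by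
  have hd : Dist4 (wh x : A ⊕ (Λ ⊕ J)) (wh y) (wh (P.home l)) (co l) :=
    ⟨by simpa using h1, by simpa using h2, by simp, by simpa using h3, by simp, by simp⟩
  have hc := circ_wwwc hP hV₀ h1 h2 h3 e1 e2 e3
  exact ⟨sign_of_agr (hag _ _ _ _ hd hc).2
    (hV₀.forFor _ _ _ (wh y) (wh (P.home l)) h1 h2 h3 rfl rfl),
    sign_of_agr (hag.perm hd hc).1 (hV₀.forFor _ _ _ (wh y) (co l) h1 h2 h3 rfl rfl)⟩

lemma agree_www {x y a : A} (hxy : x ≠ y) (hxa : x ≠ a) (hya : y ≠ a) :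
    0 < P.chi x y a * D3 (V (wh x)) (V (wh y)) (V (wh a)) := by
  have r1 := hP.chi_rot x y a hxy hxa hya
  have r2 := hP.chi_rot y a x hya hxy.symm hxa.symm
  have dich : ∀ {s c : ℝ}, (s = 1 ∨ s = -1) → (c = 1 ∨ c = -1) → s = c ∨ s = -c := by
    rintro s c (rfl | rfl) (rfl | rfl) <;> norm_num
  have hc := hP.chi_cases x y a
  rcases dich (hP.om_cases x y) hc with e1 | e1 <;> rcases dich (hP.om_cases y a) hc with e2 | e2 <;>
    rcases dich (hP.om_cases a x) hc with e3 | e3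
  · exact agree_www₁ hP hV₀ hψ hag hxy hxa hya e1 e3
  · have := agree_www₁ hP hV₀ hψ hag hya hxy.symm hxa.symm (by rw [r1, e2]) (by rw [r1, e1])
    rwa [r1, D3_rot] at this
  · exact agree_www₁ hP hV₀ hψ hag hxy hxa hya e1 e3
  · obtain ⟨l, rfl⟩ := hP.exists_color a
    exact (agree_wwwc hP hV₀ hψ hag hxy hxa hya (by rw [e2, e1]) (by rw [e3, e1]) e1.symm).1
  · have := agree_www₁ hP hV₀ hψ hag hxa.symm hya.symm hxy (by rw [r2, r1, e3]) (by rw [r2, r1, e2])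
    rwa [r2, r1, D3_rot, D3_rot] at this
  · obtain ⟨l, rfl⟩ := hP.exists_color x
    have := (agree_wwwc hP hV₀ hψ hag hya hxy.symm hxa.symm (by rw [e3, e2]) (by rw [e1, e2])
      (by rw [r1, e2])).1
    rwa [r1, D3_rot] at this
  · obtain ⟨l, rfl⟩ := hP.exists_color y
    have := (agree_wwwc hP hV₀ hψ hag hxa.symm hya.symm hxy (by rw [e1, e3]) (by rw [e2, e3])
      (by rw [r2, r1, e3])).1
    rwa [r2, r1, D3_rot, D3_rot] at this
  · exact (hP.not_all x y a hxy hxa hya e1 e2 e3).elim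

lemma agree_wwc {x y : A} {l : Λ} (hxy : x ≠ y) (hxa : x ≠ P.home l) (hya : y ≠ P.home l) :
    0 < P.chi x y (P.home l) * D3 (V (wh x)) (V (wh y)) (V (co l)) := by
  have dich : ∀ {s c : ℝ}, (s = 1 ∨ s = -1) → (c = 1 ∨ c = -1) → s = c ∨ s = -c := by
    rintro s c (rfl | rfl) (rfl | rfl) <;> norm_num
  have hc := hP.chi_cases x y (P.home l)
  rcases dich (hP.om_cases x y) hc with e1 | e1
  · rcases dich (hP.om_cases (P.home l) x) hc with e3 | e3
    · have := agree_ownFor₂ hP hV₀ hψ hag rfl hxy hxa hya e1.symm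
        (by rw [hP.om_anti _ _ hxa.symm, e3, e1])
      rwa [e1] at this
    rcases dich (hP.om_cases y (P.home l)) hc with e2 | e2
    · have := agree_ownFor₂ hP hV₀ hψ hag rfl hxy.symm hya hxa
        (by rw [hP.chi_swap _ _ _ hxy hxa hya, hP.om_anti _ _ hxy, e1])
        (by rw [hP.om_anti _ _ hxy, e1, e2, neg_neg])
      rw [hP.om_anti _ _ hxy, e1, D3_swap₁] at this
      linarith
    · exact (agree_wwwc hP hV₀ hψ hag hxy hxa hya (by rw [e2, e1]) (by rw [e3, e1]) e1.symm).2
  · obtain ⟨j, j', α, β, γ, hα, hβ, hγ, hr⟩ := agree_expand hP hV₀ hψ hag l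
    have k1 := agree_www hP hV₀ hψ hag hxy hxa hya
    have k2 := agree_wwb hP hV₀ hag hxy j
    have k3 := agree_wwb hP hV₀ hag hxy j'
    rw [hr] at k1
    rw [e1] at k2 k3
    have q2 := mul_pos hβ k2
    have q3 := mul_pos hγ k3
    refine pos_of_mul_pos_right (a := α) ?_ hα.le
    linarith

lemma agree_wcc {x : A} {m l : Λ} (hxy : x ≠ P.home m) (hxa : x ≠ P.home l)
    (hya : P.home m ≠ P.home l) :
    0 < P.chi x (P.home m) (P.home l) * D3 (V (wh x)) (V (co m)) (V (co l)) := by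
  have dich : ∀ {s c : ℝ}, (s = 1 ∨ s = -1) → (c = 1 ∨ c = -1) → s = c ∨ s = -c := by
    rintro s c (rfl | rfl) (rfl | rfl) <;> norm_num
  have hc := hP.chi_cases x (P.home m) (P.home l)
  have hlm : m ≠ l := by rintro rfl; exact hya rfl
  rcases dich (hP.om_cases x (P.home m)) hc with e1 | e1 <;>
    rcases dich (hP.om_cases x (P.home l)) hc with e2 | e2
  · obtain ⟨j, j', α, β, γ, hα, hβ, hγ, hr⟩ := agree_expand hP hV₀ hψ hag m
    have k1 := agree_wwc hP hV₀ hψ hag hxy hxa hya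
    have k2 := agree_wcb hP hV₀ hψ hag hxa j
    have k3 := agree_wcb hP hV₀ hψ hag hxa j'
    have hr' := hr (V (wh x)) (V (co l))
    rw [D3_swap₂, hr'] at k1
    rw [e2] at k2 k3
    have q2 := mul_pos hβ k2
    have q3 := mul_pos hγ k3
    rw [D3_swap₂]
    refine pos_of_mul_pos_right (a := α) ?_ hα.le
    linarith
  · obtain ⟨k, rfl⟩ := hP.exists_color x
    refine sign_of_agr ?_ (hV₀.forFor _ _ _ (co m) (co l) hxy hxa hya rfl rfl)
    refine (Agree.perm hag ⟨by simp, by simp, by simp, ?_, ?_, by simpa using hlm⟩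
      (circ_ccc hP hV₀ hψ hxy hxa hya e1.symm (by rw [e1, e2]))).2.1
    · simp; rintro rfl; exact hxy rfl
    · simp; rintro rfl; exact hxa rfl
  · obtain ⟨j, -⟩ := hP.both_sides m 1 (Or.inl rfl)
    refine sign_of_agr ?_ (hV₀.forFor _ _ _ (co m) (co l) hxy hxa hya rfl rfl)
    exact (Agree.perm hag ⟨by simp, by simp, by simp, by simp, by simp, by simpa using hlm⟩
      (circ_bcc hP hV₀ hψ j hxy hxa hya e2 e1)).2.1
  · obtain ⟨j, j', α, β, γ, hα, hβ, hγ, hr⟩ := agree_expand hP hV₀ hψ hag l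
    have k1 := agree_wwc hP hV₀ hψ hag hxa hxy hya.symm
    have k2 := agree_wcb hP hV₀ hψ hag hxy j
    have k3 := agree_wcb hP hV₀ hψ hag hxy j'
    have c1 : P.chi x (P.home l) (P.home m) = - P.chi x (P.home m) (P.home l) := by
      rw [← hP.chi_rot x (P.home m) (P.home l) hxy hxa hya,
        ← hP.chi_swap (P.home m) (P.home l) x hya hxy.symm hxa.symm,
        hP.chi_rot x (P.home l) (P.home m) hxa hxy hya.symm |>.symm]
    have hr' := hr (V (wh x)) (V (co m))
    rw [c1, D3_swap₂, hr'] at k1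
    rw [e1] at k2 k3
    have q2 := mul_pos hβ k2
    have q3 := mul_pos hγ k3
    refine pos_of_mul_pos_right (a := α) ?_ hα.le
    linarith

/-- The pattern of a configuration is determined by its circuits. -/
lemma Agree.spec : P.Spec V where
  own := agree_own hP hV₀ hψ hag
  forB := by
    rintro a a' (x | l | j') j h hu
    · cases Option.some.inj hu; exact agree_wwb hP hV₀ hag h j
    · cases Option.some.inj hu; exact agree_wcb hP hV₀ hψ hag h j
    · simp [Pattern.hm] at hu
  ownFor := agree_ownFor hP hV₀ hψ hag
  forFor := by
    rintro a a' a'' (x | l | j) (y | m | j') h1 h2 h3 hu hv <;>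
      (try simp [Pattern.hm] at hu) <;> (try simp [Pattern.hm] at hv) <;> subst hu <;> subst hv
    · exact agree_www hP hV₀ hψ hag h1 h2 h3
    · exact agree_wwc hP hV₀ hψ hag h1 h2 h3
    · have := agree_wwc hP hV₀ hψ hag h2 h1 h3.symm
      have c2 := hP.chi_rot a y (P.home l) h2 h1 h3.symm
      have c3 := hP.chi_swap y (P.home l) a h3.symm h2.symm h1.symm
      have c4 := hP.chi_rot (P.home l) y a h3 h1.symm h2.symm
      have c5 := hP.chi_rot a (P.home l) y h1 h2 h3
      rw [D3_swap₂]
      rw [show P.chi a (P.home l) y = - P.chi a y (P.home l) by linarith]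
      linarith
    · exact agree_wcc hP hV₀ hψ hag h1 h2 h3

end

end CircuitsToPattern

/-! ### The pattern determines the circuits -/

section PatternToCircuits

variable {A Λ J : Type} [Fintype A] [Fintype Λ] [Fintype J]

lemma Simplicial3.dist4 {I : Type} [Fintype I] {G : I → Fin 3 → ℝ} (hG : Simplicial3 G)
    {i j k l : I} (hS : PosCirc G {i, j, k, l}) : Dist4 i j k l := by
  classical
  have h4 := hG _ hS.depSupp hS.nonempty
  have h3 : ∀ x y z : I, ({i, j, k, l} : Set I) = {x, y, z} → False := by
    intro x y z h
    rw [h] at h4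
    have : (({x, y, z} : Finset I) : Set I).ncard ≤ 3 := by
      rw [Set.ncard_coe_finset]; exact Finset.card_le_three
    simp only [Finset.coe_insert, Finset.coe_singleton] at this
    omega
  refine ⟨?_, ?_, ?_, ?_, ?_, ?_⟩
  · rintro rfl; exact h3 i k l (by ext; simp)
  · rintro rfl; exact h3 i j l (by ext; simp; tauto)
  · rintro rfl; exact h3 i j k (by ext; simp; tauto)
  · rintro rfl; exact h3 i j l (by ext; simp)
  · rintro rfl; exact h3 i j k (by ext; simp; tauto)
  · rintro rfl; exact h3 i j k (by ext; simp)

variable {P : Pattern A Λ J} (hP : P.Good) {V V₀ : A ⊕ (Λ ⊕ J) → Fin 3 → ℝ}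

lemma Pattern.hm_eq_home {a : A} {u : A ⊕ (Λ ⊕ J)} (hu : u ≠ wh a) (h : P.hm u = some a) :
    ∃ l, u = co l ∧ P.home l = a := by
  rcases u with x | l | j
  · cases Option.some.inj h; exact absurd rfl hu
  · exact ⟨l, rfl, Option.some.inj h⟩
  · simp [Pattern.hm] at h

lemma Pattern.hm_eq_none {u : A ⊕ (Λ ⊕ J)} (h : P.hm u = none) : ∃ j, u = bl j := by
  rcases u with x | l | j
  · simp [Pattern.hm] at h
  · simp [Pattern.hm] at h
  · exact ⟨j, rfl⟩

include hP in
/-- The sign of a determinant involving a vector foreign to a given white vector only depends on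
the homes. -/
lemma Pattern.Good.sign_foreign {a a' : A} (h : Option A) (ha : a ≠ a') (hh : h ≠ some a') :
    ∃ s : ℝ, ∀ V, P.Spec V → ∀ u f, u ≠ wh a → P.hm u = h → P.hm f = some a' →
      0 < s * D3 (V (wh a)) (V u) (V f) := by
  rcases h with _ | x
  · refine ⟨- P.om a a', fun V hV u f hua hu hf => ?_⟩
    obtain ⟨j, rfl⟩ := Pattern.hm_eq_none hu
    have := hV.forB a a' f j ha hf
    rw [D3_swap₂]
    linarith
  · by_cases hx : x = a
    · subst hx
      refine ⟨P.om x a', fun V hV u f hua hu hf => ?_⟩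
      obtain ⟨l, rfl, rfl⟩ := Pattern.hm_eq_home hua hu
      exact hV.ownFor l a' f ha hf
    · refine ⟨P.chi a x a', fun V hV u f hua hu hf => ?_⟩
      exact hV.forFor a x a' u f (Ne.symm hx) ha (fun h => hh (by rw [h])) hu hf

include hP in
lemma Pattern.Spec.agr (hV : P.Spec V) (hV₀ : P.Spec V₀) {a : A} {u v : A ⊕ (Λ ⊕ J)}
    (hu : u ≠ wh a) (hv : v ≠ wh a) (huv : P.hm u ≠ P.hm v) :
    0 < D3 (V (wh a)) (V u) (V v) * D3 (V₀ (wh a)) (V₀ u) (V₀ v) := by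
  have pos : ∀ {s x y : ℝ}, 0 < s * x → 0 < s * y → 0 < x * y := by
    intro s x y h1 h2
    have := mul_pos h1 h2
    have hs : s ≠ 0 := by rintro rfl; simp at h1
    have : 0 < s ^ 2 * (x * y) := by nlinarith
    exact pos_of_mul_pos_right this (by positivity)
  have fo : ∀ u v, u ≠ wh a → v ≠ wh a → P.hm u ≠ P.hm v → (∃ a', a ≠ a' ∧ P.hm v = some a') →
      0 < D3 (V (wh a)) (V u) (V v) * D3 (V₀ (wh a)) (V₀ u) (V₀ v) := by
    rintro u v hu hv huv ⟨a', ha', hva'⟩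
    obtain ⟨s, hs⟩ := hP.sign_foreign (P.hm u) ha' (by rw [← hva']; exact huv)
    exact pos (hs V hV u v hu rfl hva') (hs V₀ hV₀ u v hu rfl hva')
  have ow : ∀ u v, u ≠ wh a → P.hm u = some a → P.hm v = none →
      0 < D3 (V (wh a)) (V u) (V v) * D3 (V₀ (wh a)) (V₀ u) (V₀ v) := by
    intro u v hu h1 h2
    obtain ⟨l, rfl, rfl⟩ := Pattern.hm_eq_home hu h1
    obtain ⟨j, rfl⟩ := Pattern.hm_eq_none h2
    exact pos (hV.own l j) (hV₀.own l j)
  have sw : 0 < D3 (V (wh a)) (V v) (V u) * D3 (V₀ (wh a)) (V₀ v) (V₀ u) →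
      0 < D3 (V (wh a)) (V u) (V v) * D3 (V₀ (wh a)) (V₀ u) (V₀ v) := by
    intro h; rw [D3_swap₂, D3_swap₂ (V₀ (wh a))] at h; linarith
  rcases hhu : P.hm u with _ | x <;> rcases hhv : P.hm v with _ | y
  · exact absurd (hhu.trans hhv.symm) huv
  · by_cases hy : y = a
    · subst hy; exact sw (ow v u hv hhv hhu)
    · exact fo u v hu hv huv ⟨y, Ne.symm hy, hhv⟩
  · by_cases hx : x = a
    · subst hx; exact ow u v hu hhu hhv
    · exact sw (fo v u hv hu huv.symm ⟨x, Ne.symm hx, hhu⟩)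
  · by_cases hy : y = a
    · by_cases hx : x = a
      · exact absurd (by rw [hhu, hhv, hx, hy]) huv
      · exact sw (fo v u hv hu huv.symm ⟨x, Ne.symm hx, hhu⟩)
    · exact fo u v hu hv huv ⟨y, Ne.symm hy, hhv⟩

/-- Any class of vectors of the same home is on one side of some line through a white vector. -/
lemma Pattern.exists_witness (hP : P.Good) (a : A) (h : Option A) :
    ∃ (f : A ⊕ (Λ ⊕ J)) (s : ℝ), ∀ V, P.Spec V → ∀ u, u ≠ wh a → P.hm u = h →
      0 < s * D3 (V (wh a)) (V u) (V f) := by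
  obtain ⟨a', ha'⟩ := hP.exists_other a
  obtain ⟨l, hl⟩ := hP.exists_color a
  obtain ⟨j, -⟩ := hP.both_sides l 1 (Or.inl rfl)
  by_cases hh : h = none ∨ h = some a
  · obtain ⟨s, hs⟩ := hP.sign_foreign h ha' (by rintro rfl; simp at hh; exact ha' hh.symm)
    exact ⟨wh a', s, fun V hV u hu hhu => hs V hV u _ hu hhu rfl⟩
  · rcases h with _ | x
    · simp at hh
    · have hx : a ≠ x := by rintro rfl; simp at hh
      obtain ⟨s, hs⟩ := hP.sign_foreign none hx (by simp)
      refine ⟨bl j, -s, fun V hV u hu hhu => ?_⟩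
      have := hs V hV (bl j) u (by simp) rfl hhu
      rw [D3_swap₂]
      linarith

lemma ww_ne_zero (hP : P.Good) (hV : P.Spec V) {a a' : A} (h : a ≠ a') (u : Λ ⊕ J) :
    D3 (V (wh a)) (V (wh a')) (V (.inr u)) ≠ 0 := by
  by_cases h1 : P.hm (.inr u) = some a'
  · have := hV.agr hP hV (a := a') (u := wh a) (v := .inr u) (by simpa using h) (by simp)
      (by rw [h1]; simpa [Pattern.hm] using h)
    rw [D3_swap₁]
    intro h0
    rw [neg_eq_zero] at h0
    rw [h0] at this
    simp at this
  · have := hV.agr hP hV (a := a) (u := wh a') (v := .inr u) (by simpa using h.symm) (by simp)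
      (fun h => h1 h.symm)
    intro h0
    rw [h0] at this
    simp at this

section psi
variable {ψ : Fin 3 → ℝ} (hψ : ∀ i, 0 < ψ ⬝ᵥ V i)
include hψ

/-- A nonnegative dependency involves a white and a nonwhite vector. -/
lemma DepSupp.white_nonwhite {U : Set (A ⊕ (Λ ⊕ J))} (hU : DepSupp (sgn V) U) (hne : U.Nonempty) :
    (∃ a, wh a ∈ U) ∧ ∃ u : Λ ⊕ J, .inr u ∈ U := by
  obtain ⟨c, h0, h1, h2⟩ := hU
  have hs : ∑ i, c i * (eps i * (ψ ⬝ᵥ V i)) = 0 := by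
    have := congrArg (fun x => ψ ⬝ᵥ x) h1
    simp only [dotProduct_sum, dotProduct_smul, sgn, dotProduct_zero, smul_eq_mul] at this
    exact this
  obtain ⟨i, hi⟩ := hne
  have hci : 0 < c i := lt_of_le_of_ne (h0 i) ((h2 i).1 hi).symm
  constructor
  · by_contra hno
    push Not at hno
    have hp : ∀ i, 0 ≤ c i * (eps i * (ψ ⬝ᵥ V i)) := by
      rintro (a | u)
      · have : c (.inl a) = 0 := by by_contra h; exact hno a ((h2 _).2 h)
        simp [this]
      · have := (hψ (.inr u)).le
        have := h0 (.inr u)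
        simp only [eps, Sum.elim_inr, one_mul]
        positivity
    have := (Finset.sum_eq_zero_iff_of_nonneg fun i _ => hp i).1 hs i (Finset.mem_univ _)
    rcases mul_eq_zero.1 this with h | h
    · exact hci.ne' h
    · rcases mul_eq_zero.1 h with h | h
      · have := eps_mul_self i; rw [h] at this; simp at this
      · exact (hψ i).ne' h
  · by_contra hno
    push Not at hno
    have hp : ∀ i, c i * (eps i * (ψ ⬝ᵥ V i)) ≤ 0 := by
      rintro (a | u)
      · have := (hψ (.inl a)).le
        have := h0 (.inl a)
        simp only [eps, Sum.elim_inl]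
        have : 0 ≤ c (.inl a) * (ψ ⬝ᵥ V (.inl a)) := by positivity
        linarith
      · have : c (.inr u) = 0 := by by_contra h; exact hno u ((h2 _).2 h)
        simp [this]
    have := (Finset.sum_eq_zero_iff_of_nonpos fun i _ => hp i).1 hs i (Finset.mem_univ _)
    rcases mul_eq_zero.1 this with h | h
    · exact hci.ne' h
    · rcases mul_eq_zero.1 h with h | h
      · have := eps_mul_self i; rw [h] at this; simp at this
      · exact (hψ i).ne' h

include hP in
lemma Pattern.Spec.simplicial3 (hV : P.Spec V) : Simplicial3 (sgn V) := by
  classical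
  intro U hU hne
  obtain ⟨⟨a, ha⟩, u, hu⟩ := hU.white_nonwhite hψ hne
  by_contra hcard
  push Not at hcard
  obtain ⟨x, hx⟩ : ∃ x, U ⊆ {wh a, .inr u, x} := by
    have h1 : (U \ {wh a, .inr u}).ncard ≤ 1 := by
      have e : ({wh a, .inr u} : Set (A ⊕ (Λ ⊕ J))) ⊆ U := by
        rintro y (rfl | rfl); exacts [ha, hu]
      rw [Set.ncard_sdiff e, Set.ncard_pair (by simp)]
      omega
    rcases (Set.ncard_le_one_iff_eq (Set.toFinite _)).1 h1 with h | ⟨x, h⟩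
    · refine ⟨wh a, fun y hy => ?_⟩
      have := Set.sdiff_eq_empty.1 h hy
      simp at this ⊢; tauto
    · refine ⟨x, fun y hy => ?_⟩
      by_cases hy' : y ∈ ({wh a, .inr u} : Set (A ⊕ (Λ ⊕ J)))
      · simp at hy' ⊢; tauto
      · have : y ∈ U \ {wh a, .inr u} := ⟨hy, hy'⟩
        rw [h] at this
        simp at this ⊢; tauto
  obtain ⟨c, h0, h1, h2⟩ := hU
  have hca : 0 < c (wh a) := lt_of_le_of_ne (h0 _) ((h2 _).1 ha).symm
  have hcu : 0 < c (.inr u) := lt_of_le_of_ne (h0 _) ((h2 _).1 hu).symm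
  obtain ⟨γ, hγ, hγx, hr⟩ : ∃ γ : ℝ, 0 ≤ γ ∧ (x = wh a → γ = 0) ∧
      c (wh a) • sgn V (wh a) + c (.inr u) • sgn V (.inr u) + γ • sgn V x = 0 := by
    refine ⟨if x = wh a ∨ x = .inr u then 0 else c x, ?_, ?_, ?_⟩
    · split_ifs; exacts [le_rfl, h0 x]
    · intro h; simp [h]
    · rw [← h1]
      symm
      have hsub : ∀ y, y ∉ ({wh a, .inr u, x} : Finset (A ⊕ (Λ ⊕ J))) → c y • sgn V y = 0 := by
        intro y hy
        have : c y = 0 := by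
          by_contra h
          have := hx ((h2 y).2 h)
          simp at this hy
          tauto
        simp [this]
      rw [← Finset.sum_subset (Finset.subset_univ _) fun y _ hy => hsub y hy]
      split_ifs with hxx
      · have : ({wh a, .inr u, x} : Finset (A ⊕ (Λ ⊕ J))) = {wh a, .inr u} := by
          ext y; simp; rcases hxx with rfl | rfl <;> tauto
        rw [this, Finset.sum_pair (by simp)]
        simp
      · push Not at hxx
        rw [Finset.sum_insert (by simp; exact fun h => hxx.1 h.symm),
          Finset.sum_pair (Ne.symm hxx.2), add_assoc]
  have hr' : c (wh a) • sgn V (wh a) + c (.inr u) • sgn V (.inr u) + γ • sgn V x +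
      (0 : ℝ) • sgn V x = 0 := by rw [hr]; simp
  obtain ⟨f, s, hf⟩ := Pattern.exists_witness hP a (P.hm (.inr u))
  have rf := D3_rel hr' (V (wh a)) (V f)
  simp only [sgn_wh, sgn_inr, D3_neg₃, D3_self₃] at rf
  rw [D3_swap₂] at rf
  have hfu := hf V hV (.inr u) (by simp) rfl
  by_cases hγ0 : γ = 0
  · rw [hγ0] at rf
    have : D3 (V (wh a)) (V (.inr u)) (V f) = 0 := by
      have h3 : c (.inr u) * D3 (V (wh a)) (V (.inr u)) (V f) = 0 := by linarith
      exact (mul_eq_zero.1 h3).resolve_left hcu.ne'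
    rw [this] at hfu
    simp at hfu
  have hγp : 0 < γ := lt_of_le_of_ne hγ (Ne.symm hγ0)
  rcases x with a' | v
  · have haa : a ≠ a' := by rintro rfl; exact hγ0 (hγx rfl)
    have r := D3_rel hr' (V (wh a)) (V (wh a'))
    simp only [sgn_wh, sgn_inr, D3_neg₃, D3_self₃, D3_self₂] at r
    have := ww_ne_zero hP hV haa u
    have h3 : c (.inr u) * D3 (V (wh a)) (V (wh a')) (V (.inr u)) = 0 := by linarith
    exact this ((mul_eq_zero.1 h3).resolve_left hcu.ne')
  · rw [sgn_inr] at rf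
    by_cases hh : P.hm (.inr u) = P.hm (.inr v)
    · have hfv := hf V hV (.inr v) (by simp) hh.symm
      rw [D3_swap₂ _ (V (.inr v))] at rf
      have q1 := mul_pos hcu hfu
      have q2 := mul_pos hγp hfv
      have : s * (c (.inr u) * D3 (V (wh a)) (V (.inr u)) (V f) +
          γ * D3 (V (wh a)) (V (.inr v)) (V f)) = 0 := by
        have : c (.inr u) * D3 (V (wh a)) (V (.inr u)) (V f) +
          γ * D3 (V (wh a)) (V (.inr v)) (V f) = 0 := by linarith
        rw [this, mul_zero]
      linarith
    · have := hV.agr hP hV (a := a) (by simp) (by simp) hh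
      have r := D3_rel hr' (V (wh a)) (V (.inr u))
      simp only [sgn_wh, sgn_inr, D3_neg₃, D3_self₃, D3_self₂] at r
      have h3 : γ * D3 (V (wh a)) (V (.inr u)) (V (.inr v)) = 0 := by linarith
      rw [(mul_eq_zero.1 h3).resolve_left hγ0] at this
      simp at this

end psi

lemma posCirc_of_agr {i j k l : A ⊕ (Λ ⊕ J)} (hd : Dist4 i j k l)
    (hS : PosCirc (sgn V₀) {i, j, k, l})
    (h1 : 0 < D3 (V j) (V k) (V l) * D3 (V₀ j) (V₀ k) (V₀ l))
    (h2 : 0 < D3 (V i) (V k) (V l) * D3 (V₀ i) (V₀ k) (V₀ l))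
    (h3 : 0 < D3 (V i) (V j) (V l) * D3 (V₀ i) (V₀ j) (V₀ l))
    (h4 : 0 < D3 (V i) (V j) (V k) * D3 (V₀ i) (V₀ j) (V₀ k)) : PosCirc (sgn V) {i, j, k, l} := by
  obtain ⟨s, k1, k2, k3, k4⟩ := PosCirc.D3_signs hd hS
  rw [← D3_sgn_mul] at h1 h2 h3 h4
  rw [← neg_mul] at k2 k4
  refine posCirc_of_D3 hd s (sign_of_agr h1 k1) ?_ (sign_of_agr h3 k3) ?_
  · rw [← neg_mul]; exact sign_of_agr h2 k2
  · rw [← neg_mul]; exact sign_of_agr h4 k4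

lemma D3_three_term (a f u v t : Fin 3 → ℝ) :
    D3 a v t * D3 a u f + D3 a t u * D3 a v f + D3 a u v * D3 a t f = 0 := by
  simp only [D3]; ring

section
variable {ψ ψ₀ : Fin 3 → ℝ} (hV : P.Spec V) (hV₀ : P.Spec V₀) (hψ : ∀ i, 0 < ψ ⬝ᵥ V i)
  (hψ₀ : ∀ i, 0 < ψ₀ ⬝ᵥ V₀ i)
include hP hV hV₀

lemma agr_pair {a : A} {u v t : Λ ⊕ J} {s : ℝ}
    (h1 : 0 < s * D3 (V₀ (wh a)) (V₀ (.inr u)) (V₀ (.inr v)))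
    (h2 : 0 < s * D3 (V₀ (wh a)) (V₀ (.inr v)) (V₀ (.inr t)))
    (h3 : 0 < s * D3 (V₀ (wh a)) (V₀ (.inr t)) (V₀ (.inr u))) :
    0 < D3 (V (wh a)) (V (.inr u)) (V (.inr v)) *
      D3 (V₀ (wh a)) (V₀ (.inr u)) (V₀ (.inr v)) := by
  by_cases huv : P.hm (.inr u) ≠ P.hm (.inr v)
  · exact hV.agr hP hV₀ (by simp) (by simp) huv
  push Not at huv
  by_cases hut : P.hm (.inr t) = P.hm (.inr u)
  · exfalso
    obtain ⟨f, r, hf⟩ := Pattern.exists_witness hP a (P.hm (.inr u))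
    have e := D3_three_term (V₀ (wh a)) (V₀ f) (V₀ (.inr u)) (V₀ (.inr v)) (V₀ (.inr t))
    have f1 := mul_pos h2 (hf V₀ hV₀ (.inr u) (by simp) rfl)
    have f2 := mul_pos h3 (hf V₀ hV₀ (.inr v) (by simp) huv.symm)
    have f3 := mul_pos h1 (hf V₀ hV₀ (.inr t) (by simp) hut)
    have : s * r * (D3 (V₀ (wh a)) (V₀ (.inr v)) (V₀ (.inr t)) *
      D3 (V₀ (wh a)) (V₀ (.inr u)) (V₀ f) + D3 (V₀ (wh a)) (V₀ (.inr t)) (V₀ (.inr u)) *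
      D3 (V₀ (wh a)) (V₀ (.inr v)) (V₀ f) + D3 (V₀ (wh a)) (V₀ (.inr u)) (V₀ (.inr v)) *
      D3 (V₀ (wh a)) (V₀ (.inr t)) (V₀ f)) = 0 := by rw [e, mul_zero]
    linarith
  -- the vectors `u`, `v` are on opposite sides of `t`
  have opp : ∀ r : ℝ, 0 < r * D3 (V₀ (wh a)) (V₀ (.inr u)) (V₀ (.inr t)) →
      0 < r * D3 (V₀ (wh a)) (V₀ (.inr v)) (V₀ (.inr t)) → False := by
    intro r r1 r2
    rw [D3_swap₂] at r1
    have q1 := mul_pos r1 h2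
    have q2 := mul_pos r2 h3
    nlinarith
  have hu0 : P.hm (.inr u) = none ∨ P.hm (.inr u) = some a := by
    by_contra hcon
    push Not at hcon
    obtain ⟨x, hx⟩ := Option.ne_none_iff_exists'.1 hcon.1
    have hxa : a ≠ x := by rintro rfl; exact hcon.2 hx
    obtain ⟨r, hr⟩ := hP.sign_foreign (P.hm (.inr t)) hxa (by rw [← hx]; exact hut)
    have r1 := hr V₀ hV₀ (.inr t) (.inr u) (by simp) rfl hx
    have r2 := hr V₀ hV₀ (.inr t) (.inr v) (by simp) rfl (huv ▸ hx)
    rw [D3_swap₂] at r1 r2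
    exact opp (-r) (by linarith) (by linarith)
  have ht0 : P.hm (.inr t) = none ∨ P.hm (.inr t) = some a := by
    by_contra hcon
    push Not at hcon
    obtain ⟨x, hx⟩ := Option.ne_none_iff_exists'.1 hcon.1
    have hxa : a ≠ x := by rintro rfl; exact hcon.2 hx
    obtain ⟨r, hr⟩ := hP.sign_foreign (P.hm (.inr u)) hxa (by rw [← hx]; exact Ne.symm hut)
    exact opp r (hr V₀ hV₀ (.inr u) (.inr t) (by simp) rfl hx)
      (hr V₀ hV₀ (.inr v) (.inr t) (by simp) huv.symm hx)
  obtain ⟨a', ha'⟩ := hP.exists_other a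
  have nf : ∀ h : Option A, h = none ∨ h = some a → h ≠ some a' := by
    rintro h (rfl | rfl) h'
    · simp at h'
    · exact ha' (Option.some.inj h')
  have nfw : (wh a' : A ⊕ (Λ ⊕ J)) ≠ wh a := by simpa using ha'.symm
  have g1 := hV.agr hP hV₀ (a := a) (u := .inr t) (v := wh a') (by simp) nfw (nf _ ht0)
  have g2 := hV.agr hP hV₀ (a := a) (u := wh a') (v := .inr u) nfw (by simp)
    (nf _ hu0).symm
  have g3 := hV.agr hP hV₀ (a := a) (u := wh a') (v := .inr v) nfw (by simp)
    (nf _ (huv ▸ hu0)).symm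
  have g4 := hV.agr hP hV₀ (a := a) (u := .inr t) (v := .inr u) (by simp) (by simp) hut
  have g5 := hV.agr hP hV₀ (a := a) (u := .inr t) (v := .inr v) (by simp) (by simp)
    (by rw [← huv]; exact hut)
  have g6 : 0 < D3 (V₀ (wh a)) (V₀ (wh a')) (V₀ (.inr u)) *
      D3 (V₀ (wh a)) (V₀ (wh a')) (V₀ (.inr v)) := by
    obtain ⟨r, hr⟩ := hP.sign_foreign (P.hm (.inr u)) ha' (nf _ hu0)
    have r1 := hr V₀ hV₀ (.inr u) (wh a') (by simp) rfl rfl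
    have r2 := hr V₀ hV₀ (.inr v) (wh a') (by simp) huv.symm rfl
    rw [D3_swap₂] at r1 r2
    have := mul_pos r1 r2
    by_contra hcon
    nlinarith [mul_self_nonneg r]
  have g7 : 0 < - (D3 (V₀ (wh a)) (V₀ (.inr t)) (V₀ (.inr u)) *
      D3 (V₀ (wh a)) (V₀ (.inr t)) (V₀ (.inr v))) := by
    rw [D3_swap₂] at h2
    have := mul_pos h2 h3
    by_contra hcon
    nlinarith [mul_self_nonneg s]
  have e := D3_plucker (V (wh a)) (V (wh a')) (V (.inr t)) (V (.inr u)) (V (.inr v))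
  have e₀ := D3_plucker (V₀ (wh a)) (V₀ (wh a')) (V₀ (.inr t)) (V₀ (.inr u)) (V₀ (.inr v))
  have real : ∀ {T X Y Z p q T' X' Y' Z' p' q' : ℝ}, T * X = Y * p - Z * q →
      T' * X' = Y' * p' - Z' * q' → 0 < T * T' → 0 < p * p' → 0 < q * q' → 0 < Y * Y' →
      0 < Z * Z' → 0 < q' * p' → 0 < -(Y' * Z') → 0 < X * X' := by
    intro T X Y Z p q T' X' Y' Z' p' q' e1 e2 hT hp hq hY hZ hpq hYZ
    have m1 : 0 < -(Y * Z') := by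
      have := mul_pos hY hYZ
      have : 0 < Y' ^ 2 * -(Y * Z') := by linarith
      exact pos_of_mul_pos_right this (by positivity)
    have m2 : 0 < -(Z * Y') := by
      have := mul_pos hZ hYZ
      have : 0 < Z' ^ 2 * -(Z * Y') := by linarith
      exact pos_of_mul_pos_right this (by positivity)
    have m3 : 0 < p * q' := by
      have := mul_pos hp hpq
      have : 0 < p' ^ 2 * (p * q') := by linarith
      exact pos_of_mul_pos_right this (by positivity)
    have m4 : 0 < q * p' := by
      have := mul_pos hq hpq
      have : 0 < q' ^ 2 * (q * p') := by linarith
      exact pos_of_mul_pos_right this (by positivity)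
    have : 0 < (T * T') * (X * X') := by
      have : (T * T') * (X * X') = (Y * p - Z * q) * (Y' * p' - Z' * q') := by
        rw [← e1, ← e2]; ring
      rw [this]
      have := mul_pos hY hp
      have := mul_pos hZ hq
      have := mul_pos m1 m3
      have := mul_pos m2 m4
      linarith
    exact pos_of_mul_pos_right this hT.le
  exact real e e₀ g1 g3 g2 g4 g5 g6 g7

include hψ in
lemma transfer_one {a : A} {u v t : Λ ⊕ J} (hd : Dist4 (wh a) (.inr u) (.inr v) (.inr t))
    (hS : PosCirc (sgn V₀) {wh a, .inr u, .inr v, .inr t}) :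
    PosCirc (sgn V) {wh a, .inr u, .inr v, .inr t} := by
  obtain ⟨s, k1, k2, k3, k4⟩ := PosCirc.D3_signs hd hS
  simp only [sgn_wh, sgn_inr, D3_neg₁] at k1 k2 k3 k4
  have m1 : 0 < s * D3 (V₀ (wh a)) (V₀ (.inr u)) (V₀ (.inr v)) := by linarith
  have m2 : 0 < s * D3 (V₀ (wh a)) (V₀ (.inr v)) (V₀ (.inr t)) := by linarith
  have m3 : 0 < s * D3 (V₀ (wh a)) (V₀ (.inr t)) (V₀ (.inr u)) := by rw [D3_swap₂]; linarith
  obtain ⟨-, -, -, n1, n2, n3⟩ := hd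
  exact posCirc_one_white hψ (by simpa using n1) (by simpa using n2) (by simpa using n3) s
    (sign_of_agr (agr_pair hP hV hV₀ m1 m2 m3) m1)
    (sign_of_agr (agr_pair hP hV hV₀ m2 m3 m1) m2) (sign_of_agr (agr_pair hP hV hV₀ m3 m1 m2) m3)

lemma agr_wwu {a a' : A} (h : a ≠ a') (u : Λ ⊕ J) :
    0 < D3 (V (wh a)) (V (wh a')) (V (.inr u)) * D3 (V₀ (wh a)) (V₀ (wh a')) (V₀ (.inr u)) := by
  by_cases h1 : P.hm (.inr u) = some a'
  · have := hV.agr hP hV₀ (a := a') (u := wh a) (v := .inr u) (by simpa using h) (by simp)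
      (by rw [h1]; simpa [Pattern.hm] using h)
    rw [D3_swap₁, D3_swap₁ (V₀ (wh a))] at this
    linarith
  · exact hV.agr hP hV₀ (a := a) (u := wh a') (v := .inr u) (by simpa using h.symm) (by simp)
      (fun h => h1 h.symm)

lemma transfer_two {a a' : A} {u v : Λ ⊕ J} (hd : Dist4 (wh a) (wh a') (.inr u) (.inr v))
    (hS : PosCirc (sgn V₀) {wh a, wh a', .inr u, .inr v}) :
    PosCirc (sgn V) {wh a, wh a', .inr u, .inr v} := by
  have haa : a ≠ a' := by simpa using hd.1
  by_cases huv : P.hm (.inr u) = P.hm (.inr v)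
  · exfalso
    obtain ⟨α, β, γ, δ, hα, hβ, hγ, hδ, hr⟩ := PosCirc.rel hd hS
    have r := D3_rel hr (V₀ (wh a)) (V₀ (wh a'))
    simp only [sgn_wh, sgn_inr, D3_neg₃, D3_self₃, D3_self₂] at r
    have same : ∃ s : ℝ, 0 < s * D3 (V₀ (wh a)) (V₀ (wh a')) (V₀ (.inr u)) ∧
        0 < s * D3 (V₀ (wh a)) (V₀ (wh a')) (V₀ (.inr v)) := by
      by_cases h1 : P.hm (.inr u) = some a'
      · obtain ⟨s, hs⟩ := hP.sign_foreign (P.hm (.inr u)) haa.symm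
          (by rw [h1]; simpa using haa.symm)
        have q1 := hs V₀ hV₀ (.inr u) (wh a) (by simp) rfl rfl
        have q2 := hs V₀ hV₀ (.inr v) (wh a) (by simp) huv.symm rfl
        exact ⟨s, by rw [D3_rot] at q1; exact q1, by rw [D3_rot] at q2; exact q2⟩
      · obtain ⟨s, hs⟩ := hP.sign_foreign (P.hm (.inr u)) haa h1
        have q1 := hs V₀ hV₀ (.inr u) (wh a') (by simp) rfl rfl
        have q2 := hs V₀ hV₀ (.inr v) (wh a') (by simp) huv.symm rfl
        rw [D3_swap₂] at q1 q2
        exact ⟨-s, by linarith, by linarith⟩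
    obtain ⟨s, s1, s2⟩ := same
    have q1 := mul_pos hγ s1
    have q2 := mul_pos hδ s2
    have : s * (γ * D3 (V₀ (wh a)) (V₀ (wh a')) (V₀ (.inr u)) +
        δ * D3 (V₀ (wh a)) (V₀ (wh a')) (V₀ (.inr v))) = 0 := by
      have : γ * D3 (V₀ (wh a)) (V₀ (wh a')) (V₀ (.inr u)) +
        δ * D3 (V₀ (wh a)) (V₀ (wh a')) (V₀ (.inr v)) = 0 := by linarith
      rw [this, mul_zero]
    linarith
  · exact posCirc_of_agr hd hS (hV.agr hP hV₀ (by simp) (by simp) huv)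
      (hV.agr hP hV₀ (by simp) (by simp) huv) (agr_wwu hP hV hV₀ haa v) (agr_wwu hP hV hV₀ haa u)

lemma transfer_three {a a' a'' : A} {u : Λ ⊕ J} (hd : Dist4 (wh a) (wh a') (wh a'') (.inr u))
    (hS : PosCirc (sgn V₀) {wh a, wh a', wh a'', .inr u}) :
    PosCirc (sgn V) {wh a, wh a', wh a'', .inr u} := by
  have h1 : a ≠ a' := by simpa using hd.1
  have h2 : a ≠ a'' := by simpa using hd.2.1
  have h3 : a' ≠ a'' := by simpa using hd.2.2.2.1
  exact posCirc_of_agr hd hS (agr_wwu hP hV hV₀ h3 u) (agr_wwu hP hV hV₀ h2 u)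
    (agr_wwu hP hV hV₀ h1 u) (hV.agr hP hV₀ (by simpa using h1.symm) (by simpa using h2.symm)
      (by simpa [Pattern.hm] using h3))

include hψ hψ₀

lemma transfer_circ {S : Set (A ⊕ (Λ ⊕ J))} (hS : PosCirc (sgn V₀) S) : PosCirc (sgn V) S := by
  have hsim := hV₀.simplicial3 hP hψ₀
  obtain ⟨⟨a, ha⟩, u, hu⟩ := hS.depSupp.white_nonwhite hψ₀ hS.nonempty
  obtain ⟨i, j, k, l, -, rfl⟩ := hsim.exists_four hS
  have perm : ∀ i' j' k' l' : A ⊕ (Λ ⊕ J), ({i, j, k, l} : Set _) = {i', j', k', l'} →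
      (Dist4 i' j' k' l' → PosCirc (sgn V₀) {i', j', k', l'} →
        PosCirc (sgn V) {i', j', k', l'}) → PosCirc (sgn V) {i, j, k, l} := by
    intro i' j' k' l' h hh
    rw [h] at hS ⊢
    exact hh (hsim.dist4 hS) hS
  have p2 : ∀ i j k l : A ⊕ (Λ ⊕ J), ({i, j, k, l} : Set _) = {j, i, k, l} := by
    intros; ext; simp; tauto
  have p3 : ∀ i j k l : A ⊕ (Λ ⊕ J), ({i, j, k, l} : Set _) = {k, j, i, l} := by
    intros; ext; simp; tauto
  have p4 : ∀ i j k l : A ⊕ (Λ ⊕ J), ({i, j, k, l} : Set _) = {l, j, k, i} := by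
    intros; ext; simp; tauto
  have p23 : ∀ i j k l : A ⊕ (Λ ⊕ J), ({i, j, k, l} : Set _) = {i, k, j, l} := by
    intros; ext; simp; tauto
  have p24 : ∀ i j k l : A ⊕ (Λ ⊕ J), ({i, j, k, l} : Set _) = {i, l, k, j} := by
    intros; ext; simp; tauto
  have p34 : ∀ i j k l : A ⊕ (Λ ⊕ J), ({i, j, k, l} : Set _) = {i, j, l, k} := by
    intros; ext; simp; tauto
  rcases i with i | i <;> rcases j with j | j <;> rcases k with k | k <;> rcases l with l | l
  · simp at hu
  · exact perm _ _ _ _ rfl (transfer_three hP hV hV₀)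
  · exact perm _ _ _ _ (p34 _ _ _ _) (transfer_three hP hV hV₀)
  · exact perm _ _ _ _ rfl (transfer_two hP hV hV₀)
  · exact perm _ _ _ _ (p24 _ _ _ _) (transfer_three hP hV hV₀)
  · exact perm _ _ _ _ (p23 _ _ _ _) (transfer_two hP hV hV₀)
  · exact perm _ _ _ _ (p24 _ _ _ _) (transfer_two hP hV hV₀)
  · exact perm _ _ _ _ rfl (transfer_one hP hV hV₀ hψ)
  · exact perm _ _ _ _ (p4 _ _ _ _) (transfer_three hP hV hV₀)
  · exact perm _ _ _ _ (p3 _ _ _ _) (transfer_two hP hV hV₀)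
  · exact perm _ _ _ _ (p4 _ _ _ _) (transfer_two hP hV hV₀)
  · exact perm _ _ _ _ (p2 _ _ _ _) (transfer_one hP hV hV₀ hψ)
  · exact perm _ _ _ _ ((p3 _ _ _ _).trans (p24 _ _ _ _)) (transfer_two hP hV hV₀)
  · exact perm _ _ _ _ (p3 _ _ _ _) (transfer_one hP hV hV₀ hψ)
  · exact perm _ _ _ _ (p4 _ _ _ _) (transfer_one hP hV hV₀ hψ)
  · simp at ha

lemma Pattern.Spec.depSupp_iff (hne : ∃ S, PosCirc (sgn V₀) S) (U : Set (A ⊕ (Λ ⊕ J))) :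
    DepSupp (sgn V) U ↔ DepSupp (sgn V₀) U :=
  depSupp_iff_of_circ hne (fun _ hS => transfer_circ hP hV hV₀ hψ hψ₀ hS)
    (fun _ hS _ hi => (hV₀.simplicial3 hP hψ₀).pivot hS hi) U

end

/-- The functional exists as soon as the coloured and black vectors have no dependency. -/
lemma exists_functional (hP : P.Good) (hV₀ : P.Spec V₀) {ψ₀ : Fin 3 → ℝ}
    (hψ₀ : ∀ i, 0 < ψ₀ ⬝ᵥ V₀ i) (hag : Agree V V₀)
    (h : ∀ U, DepSupp (sgn V) U ↔ DepSupp (sgn V₀) U) : ∃ ψ : Fin 3 → ℝ, ∀ i, 0 < ψ ⬝ᵥ V i := by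
  obtain ⟨ψ, hψ⟩ := exists_pos_functional (fun u : Λ ⊕ J => V (.inr u)) (by
    intro c hc hs u
    by_contra hcu
    have hd : DepSupp (sgn V) {i | Sum.elim (fun _ => 0) c i ≠ 0} := by
      refine ⟨Sum.elim (fun _ => 0) c, ?_, ?_, fun i => Iff.rfl⟩
      · rintro (a | u); exacts [le_rfl, hc u]
      · simp only [Fintype.sum_sum_type (α₁ := A), Sum.elim_inl, Sum.elim_inr, zero_smul,
          Finset.sum_const_zero, zero_add, sgn_inr]
        exact hs
    obtain ⟨⟨a, ha⟩, -⟩ := ((h _).1 hd).white_nonwhite hψ₀ ⟨.inr u, hcu⟩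
    simp at ha)
  refine ⟨ψ, ?_⟩
  rintro (a | u)
  · obtain ⟨l, rfl⟩ := hP.exists_color a
    obtain ⟨j, hj⟩ := hP.both_sides l 1 (Or.inl rfl)
    obtain ⟨j', hj'⟩ := hP.both_sides l (-1) (Or.inr rfl)
    have hjj : j ≠ j' := by rintro rfl; rw [hj] at hj'; norm_num at hj'
    have hd : Dist4 (wh (P.home l) : A ⊕ (Λ ⊕ J)) (co l) (bl j) (bl j') :=
      ⟨by simp, by simp, by simp, by simp, by simp, by simpa using hjj⟩
    obtain ⟨α, β, γ, δ, hα, hβ, hγ, hδ, hr⟩ := PosCirc.rel hd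
      (hag _ _ _ _ hd (circ_cbb hP hV₀ hψ₀ (by rw [hj, hj']))).1
    have := congrArg (fun x => ψ ⬝ᵥ x) hr
    simp only [dotProduct_add, dotProduct_smul, sgn_wh, sgn_inr, dotProduct_neg, smul_eq_mul,
      dotProduct_zero] at this
    have q1 := mul_pos hβ (hψ (.inl l))
    have q2 := mul_pos hγ (hψ (.inr j))
    have q3 := mul_pos hδ (hψ (.inr j'))
    refine pos_of_mul_pos_right (a := α) ?_ hα.le
    linarith
  · exact hψ u

/-- Configurations with a given pattern are characterised by their circuits. -/
theorem depSupp_iff_spec (hP : P.Good) (hV₀ : P.Spec V₀) {ψ₀ : Fin 3 → ℝ}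
    (hψ₀ : ∀ i, 0 < ψ₀ ⬝ᵥ V₀ i) {x a a' : A} (h1 : x ≠ a) (h2 : x ≠ a') (h3 : a ≠ a')
    (e1 : P.om x a = P.om a a') (e2 : P.om a' x = P.om a a') (e3 : P.chi x a a' = P.om a a')
    (hx : V (wh x) = V₀ (wh x)) (ha : V (wh a) = V₀ (wh a)) (ha' : V (wh a') = V₀ (wh a')) :
    (∀ U, DepSupp (sgn V) U ↔ DepSupp (sgn V₀) U) ↔
      P.Spec V ∧ ∃ ψ : Fin 3 → ℝ, ∀ i, 0 < ψ ⬝ᵥ V i := by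
  obtain ⟨l, -⟩ := hP.exists_color x
  obtain ⟨j, -⟩ := hP.both_sides l 1 (Or.inl rfl)
  have hd : Dist4 (wh x : A ⊕ (Λ ⊕ J)) (wh a) (wh a') (bl j) :=
    ⟨by simpa using h1, by simpa using h2, by simp, by simpa using h3, by simp, by simp⟩
  have hc := circ_wwwb hP hV₀ j h1 h2 h3 e1 e2 e3
  constructor
  · intro h
    have hag : Agree V V₀ := agree_of_depSupp (hV₀.simplicial3 hP hψ₀) h hd hc (by
      rw [hx, ha, ha']
      have := hV₀.forFor x a a' (wh a) (wh a') h1 h2 h3 rfl rfl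
      refine mul_self_pos.2 fun h0 => ?_
      rw [h0] at this
      simp at this)
    exact ⟨hag.spec hP hV₀ hψ₀, exists_functional hP hV₀ hψ₀ hag h⟩
  · rintro ⟨hV, ψ, hψ⟩
    exact hV.depSupp_iff hP hV₀ hψ hψ₀ ⟨_, hc⟩

end PatternToCircuits

/-! ### Faces of polytopes and nonnegative affine functions -/

section Faces

variable {N : Type} {d : ℕ}

/-- `S` is the zero set of a nonnegative affine function on the points `x`. -/
def AffSup (x : N → Fin d → ℝ) (S : Set N) : Prop :=
  ∃ (a : Fin d → ℝ) (c : ℝ), (∀ i, 0 ≤ a ⬝ᵥ x i + c) ∧ ∀ i, i ∈ S ↔ a ⬝ᵥ x i + c = 0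

lemma affine_nonneg_of_mem_convexHull {x : N → Fin d → ℝ} {a : Fin d → ℝ} {c : ℝ}
    (h : ∀ i, 0 ≤ a ⬝ᵥ x i + c) {p : Fin d → ℝ} (hp : p ∈ convexHull ℝ (Set.range x)) :
    0 ≤ a ⬝ᵥ p + c := by
  have hc : Convex ℝ {p : Fin d → ℝ | 0 ≤ a ⬝ᵥ p + c} := by
    intro p hp q hq s t hs ht hst
    simp only [Set.mem_ofPred_eq, dotProduct_add, dotProduct_smul, smul_eq_mul] at *
    have : c = s * c + t * c := by rw [← add_mul, hst, one_mul]
    nlinarith [mul_nonneg hs hp, mul_nonneg ht hq]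
  exact convexHull_min (by rintro _ ⟨i, rfl⟩; exact h i) hc hp

lemma mem_convexHull_zeros {x : N → Fin d → ℝ} {a : Fin d → ℝ} {c : ℝ}
    (h : ∀ i, 0 ≤ a ⬝ᵥ x i + c) {p : Fin d → ℝ} (hp : p ∈ convexHull ℝ (Set.range x))
    (h0 : a ⬝ᵥ p + c = 0) : p ∈ convexHull ℝ (x '' {i | a ⬝ᵥ x i + c = 0}) := by
  obtain ⟨ι, _, w, z, hw, hw1, hz, rfl⟩ := mem_convexHull_iff_exists_fintype.1 hp
  have hz' : ∀ i, 0 ≤ a ⬝ᵥ z i + c := by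
    intro i
    obtain ⟨j, hj⟩ := hz i
    rw [← hj]
    exact h j
  have hs : ∑ i, w i * (a ⬝ᵥ z i + c) = 0 := by
    rw [← h0, dotProduct_sum]
    simp only [mul_add, Finset.sum_add_distrib, dotProduct_smul, smul_eq_mul]
    rw [← Finset.sum_mul, hw1, one_mul]
  have hs' := (Finset.sum_eq_zero_iff_of_nonneg
    (fun i _ => mul_nonneg (hw i) (hz' i))).1 hs
  have hne : ∃ i, w i ≠ 0 := by
    by_contra hcon
    push Not at hcon
    simp [hcon] at hw1
  obtain ⟨i₀, hi₀⟩ := hne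
  have hz0 : ∀ i, w i ≠ 0 → a ⬝ᵥ z i + c = 0 := fun i hi => by
    simpa [hi] using hs' i (Finset.mem_univ i)
  refine mem_convexHull_of_exists_fintype w (fun i => if w i = 0 then z i₀ else z i) hw hw1
    (fun i => ?_) ?_
  · have key : ∀ i, w i ≠ 0 → z i ∈ x '' {i | a ⬝ᵥ x i + c = 0} := by
      intro i hi
      obtain ⟨j, hj⟩ := hz i
      refine ⟨j, ?_, hj⟩
      have := hz0 i hi
      rw [← hj] at this
      exact this
    by_cases hi : w i = 0
    · simpa only [hi, if_true] using key i₀ hi₀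
    · simpa only [hi, if_false] using key i hi
  · refine Finset.sum_congr rfl fun i _ => ?_
    by_cases hi : w i = 0 <;> simp [hi]

/-- The set of points where a nonnegative affine function vanishes is exposed. -/
lemma isExposed_zeros {x : N → Fin d → ℝ} {a : Fin d → ℝ} {c : ℝ}
    (h : ∀ i, 0 ≤ a ⬝ᵥ x i + c) :
    IsExposed ℝ (convexHull ℝ (Set.range x))
      {p | p ∈ convexHull ℝ (Set.range x) ∧ a ⬝ᵥ p + c = 0} := by
  rintro ⟨p₀, hp₀, hp₀'⟩
  let L : (Fin d → ℝ) →ₗ[ℝ] ℝ :=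
    { toFun := fun p => - (a ⬝ᵥ p)
      map_add' := fun p q => by simp [dotProduct_add]; ring
      map_smul' := fun s p => by simp }
  refine ⟨L.toContinuousLinearMap, ?_⟩
  ext p
  simp only [Set.mem_ofPred_eq]
  refine and_congr_right fun hp => ⟨fun h0 y hy => ?_, fun h1 => ?_⟩
  · have := affine_nonneg_of_mem_convexHull h hy
    change - (a ⬝ᵥ y) ≤ - (a ⬝ᵥ p)
    linarith
  · have h2 : - (a ⬝ᵥ p₀) ≤ - (a ⬝ᵥ p) := h1 p₀ hp₀
    have := affine_nonneg_of_mem_convexHull h hp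
    linarith

/-- Every exposed face is empty or the zero set of a nonnegative affine function. -/
lemma IsExposed.exists_affine {x : N → Fin d → ℝ} {F : Set (Fin d → ℝ)}
    (hF : IsExposed ℝ (convexHull ℝ (Set.range x)) F) (hne : F.Nonempty) :
    ∃ (a : Fin d → ℝ) (c : ℝ), (∀ i, 0 ≤ a ⬝ᵥ x i + c) ∧
      F = {p | p ∈ convexHull ℝ (Set.range x) ∧ a ⬝ᵥ p + c = 0} := by
  obtain ⟨L, hL⟩ := hF hne
  have key : ∀ p, L p = - ((fun j => - L (Pi.single j 1)) ⬝ᵥ p) := by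
    intro p
    conv_lhs => rw [← Finset.univ_sum_single p]
    rw [map_sum, dotProduct, ← Finset.sum_neg_distrib]
    refine Finset.sum_congr rfl fun j _ => ?_
    have : (Pi.single j (p j) : Fin d → ℝ) = p j • Pi.single j 1 := by
      ext k; simp [Pi.single_apply]
    rw [this, map_smul]
    simp [mul_comm]
  obtain ⟨p₀, hp₀⟩ := hne
  have hp₀' := hp₀
  rw [hL] at hp₀'
  refine ⟨fun j => - L (Pi.single j 1), L p₀, fun i => ?_, ?_⟩
  · have := hp₀'.2 (x i) (subset_convexHull ℝ _ ⟨i, rfl⟩)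
    have := key (x i)
    linarith
  · ext p
    have hk := key p
    constructor
    · intro hp
      have h1 := hp
      rw [hL] at h1
      refine ⟨h1.1, ?_⟩
      have h2 := h1.2 p₀ hp₀'.1
      have h3 := hp₀'.2 p h1.1
      linarith
    · rintro ⟨h1, h2⟩
      rw [hL]
      refine ⟨h1, fun y hy => ?_⟩
      have := hp₀'.2 y hy
      linarith

lemma mem_extremePoints_of_affSup {x : N → Fin d → ℝ} {i : N} (h : AffSup x {i}) :
    x i ∈ Set.extremePoints ℝ (convexHull ℝ (Set.range x)) := by
  obtain ⟨a, c, h0, h1⟩ := h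
  have e : {i' | a ⬝ᵥ x i' + c = 0} = {i} := by
    ext j
    exact (h1 j).symm
  have hi := (h1 i).1 rfl
  refine exposedPoints_subset_extremePoints (mem_exposedPoints_iff_exposed_singleton.2 ?_)
  have : {p | p ∈ convexHull ℝ (Set.range x) ∧ a ⬝ᵥ p + c = 0} = {x i} := by
    ext p
    constructor
    · rintro ⟨k1, k2⟩
      have := mem_convexHull_zeros h0 k1 k2
      rw [e] at this
      simpa using this
    · rintro rfl
      exact ⟨subset_convexHull ℝ _ ⟨i, rfl⟩, hi⟩
  rw [← this]
  exact isExposed_zeros h0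

lemma injective_of_affSup {x : N → Fin d → ℝ} (h : ∀ i, AffSup x {i}) : Function.Injective x := by
  intro i j hij
  obtain ⟨a, c, -, h1⟩ := h i
  have := (h1 i).1 rfl
  rw [hij] at this
  exact ((h1 j).2 this).symm

lemma isVertexSetOfFace_iff {n : ℕ} {x : Fin n → Fin d → ℝ} (hinj : Function.Injective x)
    (hext : ∀ i, x i ∈ Set.extremePoints ℝ (convexHull ℝ (Set.range x))) (S : Finset (Fin n)) :
    IsVertexSetOfFace x S ↔ AffSup x (↑S : Set (Fin n)) := by
  have hE : Set.extremePoints ℝ (convexHull ℝ (Set.range x)) = Set.range x :=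
    Set.Subset.antisymm extremePoints_convexHull_subset (by rintro _ ⟨i, rfl⟩; exact hext i)
  have hexp : ∀ (a : Fin d → ℝ) (c : ℝ), (∀ i, 0 ≤ a ⬝ᵥ x i + c) → Set.extremePoints ℝ
      {p | p ∈ convexHull ℝ (Set.range x) ∧ a ⬝ᵥ p + c = 0} = x '' {i | a ⬝ᵥ x i + c = 0} := by
    intro a c h
    rw [(isExposed_zeros h).isExtreme.extremePoints_eq, hE]
    ext p
    constructor
    · rintro ⟨⟨-, h1⟩, i, rfl⟩
      exact ⟨i, h1, rfl⟩
    · rintro ⟨i, hi, rfl⟩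
      exact ⟨⟨subset_convexHull ℝ _ ⟨i, rfl⟩, hi⟩, i, rfl⟩
  constructor
  · rintro ⟨F, hF | hF, hS⟩
    · rw [hF, hE, ← Set.image_univ] at hS
      have := hinj.image_injective hS
      exact ⟨0, 0, by simp, by simp [← this]⟩
    · rcases F.eq_empty_or_nonempty with rfl | hne
      · have : (↑S : Set (Fin n)) = ∅ := by
          rw [extremePoints_empty] at hS
          simpa using hS.symm
        exact ⟨0, 1, by simp, by simp [this]⟩
      · obtain ⟨a, c, h0, rfl⟩ := hF.exists_affine hne
        rw [hexp a c h0] at hS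
        have := hinj.image_injective hS
        exact ⟨a, c, h0, fun i => by rw [← this]; rfl⟩
  · rintro ⟨a, c, h0, h1⟩
    refine ⟨_, Or.inr (isExposed_zeros h0), ?_⟩
    rw [hexp a c h0]
    congr 1
    ext i
    exact (h1 i).symm

/-- A polytope is simplicial if the vertices on every proper face are affinely independent. -/
lemma isSimplicialVertexList_of {n : ℕ} {x : Fin n → Fin d → ℝ}
    (h : ∀ S : Set (Fin n), AffSup x S → S ≠ Set.univ → ∀ w : Fin n → ℝ,
      (∀ i ∉ S, w i = 0) → ∑ i, w i = 0 → ∑ i, w i • x i = 0 → ∀ i, w i = 0) :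
    IsSimplicialVertexList x := by
  classical
  intro F hF hFne
  rcases F.eq_empty_or_nonempty with rfl | hne
  · refine ⟨∅, ?_, by simp⟩
    exact affineIndependent_of_subsingleton ℝ _
  obtain ⟨a, c, h0, rfl⟩ := hF.exists_affine hne
  set S : Set (Fin n) := {i | a ⬝ᵥ x i + c = 0} with hS
  have hSu : S ≠ Set.univ := by
    intro hu
    refine hFne (Set.Subset.antisymm (fun p hp => hp.1) fun p hp => ⟨hp, ?_⟩)
    have h1 : ∀ i, 0 ≤ (-a) ⬝ᵥ x i + (-c) := fun i => by
      have : i ∈ S := hu ▸ Set.mem_univ i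
      have : a ⬝ᵥ x i + c = 0 := this
      simp only [neg_dotProduct]
      linarith
    have h2 := affine_nonneg_of_mem_convexHull h1 hp
    have h3 := affine_nonneg_of_mem_convexHull h0 hp
    simp only [neg_dotProduct] at h2
    linarith
  have hind := h S ⟨a, c, h0, fun i => Iff.rfl⟩ hSu
  have haff : AffineIndependent ℝ (fun i : S => x i) := by
    rw [affineIndependent_iff]
    intro s w hw hwx
    have hsum : ∀ {M : Type} [AddCommMonoid M] (f : Fin n → M), (∀ i ∉ S, f i = 0) →
        (∀ i (hi : i ∈ S), (⟨i, hi⟩ : S) ∉ s → f i = 0) →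
        ∑ i, f i = ∑ i ∈ s, f i := by
      intro M _ f hf hf'
      refine Eq.trans ?_ (Finset.sum_map s (Function.Embedding.subtype (· ∈ S)) f)
      symm
      refine Finset.sum_subset (Finset.subset_univ _) fun i _ hi => ?_
      by_cases hiS : i ∈ S
      · refine hf' i hiS fun hs => hi ?_
        exact Finset.mem_map.2 ⟨⟨i, hiS⟩, hs, rfl⟩
      · exact hf i hiS
    let w' : Fin n → ℝ := fun i => if hi : i ∈ S then (if (⟨i, hi⟩ : S) ∈ s then w ⟨i, hi⟩ else 0)
      else 0
    have hw' : ∀ i ∈ s, w' i = w i := fun i hi => by simp [w', hi]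
    have h1 := hind w' (fun i hi => by simp [w', hi]) (by
      rw [hsum w' (fun i hi => by simp [w', hi]) (fun i hi hs => by simp [w', hi, hs]), ← hw]
      exact Finset.sum_congr rfl hw') (by
      rw [hsum (fun i => w' i • x i) (fun i hi => by simp [w', hi])
        (fun i hi hs => by simp [w', hi, hs]), ← hwx]
      exact Finset.sum_congr rfl fun i hi => by rw [hw' i hi])
    intro i hi
    rw [← hw' i hi]
    exact h1 i
  refine ⟨S.toFinite.toFinset.image x, ?_, ?_⟩
  · have h1 := haff.range
    have e : Set.range (fun i : S => x i) = ↑(S.toFinite.toFinset.image x) := by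
      ext p; simp [hS]
    rw [e] at h1
    exact h1
  · have e : (↑(S.toFinite.toFinset.image x) : Set (Fin d → ℝ)) = x '' S := by simp [hS]
    rw [e]
    apply Set.Subset.antisymm
    · rintro p ⟨hp, hp0⟩
      exact mem_convexHull_zeros h0 hp hp0
    · intro p hp
      refine ⟨convexHull_mono (Set.image_subset_range _ _) hp, ?_⟩
      have hc : Convex ℝ {p : Fin d → ℝ | a ⬝ᵥ p + c = 0} := by
        intro p hp q hq s t hs ht hst
        simp only [Set.mem_ofPred_eq, dotProduct_add, dotProduct_smul, smul_eq_mul] at *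
        linear_combination s * hp + t * hq - c * (hst - 1) + c * (1 - 1)
      refine convexHull_min ?_ hc hp
      rintro _ ⟨i, hi, rfl⟩
      exact hi

end Faces

/-! ### Gale duality -/

section Gale

variable {Q : Type} [Fintype Q] {d : ℕ}

/-- The vector configuration consisting of the negative basis vectors and the rows of `g`. -/
def galeVec (g : Q → Fin 3 → ℝ) : Fin 3 ⊕ Q → Fin 3 → ℝ :=
  Sum.elim (fun i => - Pi.single i 1) g

/-- Supports of nonnegative dependencies of `galeVec g`, in terms of the rows of `g`. -/
def GSup (g : Q → Fin 3 → ℝ) (U : Set (Fin 3 ⊕ Q)) : Prop :=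
  ∃ lam : Q → ℝ, (∀ q, 0 ≤ lam q) ∧ (∀ i, 0 ≤ ∑ q, lam q * g q i) ∧
    (∀ q, .inr q ∈ U ↔ lam q ≠ 0) ∧ ∀ i, .inl i ∈ U ↔ ∑ q, lam q * g q i ≠ 0

lemma depSupp_galeVec (g : Q → Fin 3 → ℝ) (U : Set (Fin 3 ⊕ Q)) :
    DepSupp (galeVec g) U ↔ GSup g U := by
  have key : ∀ c : Fin 3 ⊕ Q → ℝ, (∑ k, c k • galeVec g k = 0 ↔
      ∀ i, c (.inl i) = ∑ q, c (.inr q) * g q i) := by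
    intro c
    rw [funext_iff]
    refine forall_congr' fun i => ?_
    simp only [Fintype.sum_sum_type, galeVec, Sum.elim_inl, Sum.elim_inr, Pi.add_apply,
      Finset.sum_apply, Pi.smul_apply, Pi.neg_apply, smul_eq_mul, Pi.zero_apply, Pi.single_apply,
      mul_neg, mul_ite, mul_one, mul_zero, Finset.sum_neg_distrib, Finset.sum_ite_eq,
      Finset.mem_univ, if_true]
    constructor <;> intro h <;> linarith
  constructor
  · rintro ⟨c, h0, h1, h2⟩
    have hk := (key c).1 h1
    exact ⟨fun q => c (.inr q), fun q => h0 _, fun i => by rw [← hk]; exact h0 _,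
      fun q => h2 _, fun i => by rw [← hk]; exact h2 _⟩
  · rintro ⟨lam, h0, h1, h2, h3⟩
    refine ⟨Sum.elim (fun i => ∑ q, lam q * g q i) lam, ?_, (key _).2 fun i => rfl, ?_⟩
    · rintro (i | q)
      exacts [h1 i, h0 q]
    · rintro (i | q)
      exacts [h3 i, h2 q]

lemma GSup.scale {g A : Q → Fin 3 → ℝ} {lam : Q → ℝ} {mu : Fin 3 → ℝ} (hl : ∀ q, 0 < lam q)
    (hm : ∀ i, 0 < mu i) (h : ∀ q i, A q i = lam q * g q i * mu i) {U : Set (Fin 3 ⊕ Q)}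
    (hU : GSup A U) : GSup g U := by
  obtain ⟨α, h0, h1, h2, h3⟩ := hU
  have key : ∀ i, ∑ q, α q * A q i = (∑ q, α q * lam q * g q i) * mu i := fun i => by
    rw [Finset.sum_mul]
    exact Finset.sum_congr rfl fun q _ => by rw [h]; ring
  refine ⟨fun q => α q * lam q, fun q => mul_nonneg (h0 q) (hl q).le, fun i => ?_, fun q => ?_,
    fun i => ?_⟩
  · have := h1 i
    rw [key] at this
    exact nonneg_of_mul_nonneg_left this (hm i)
  · rw [h2]; simp [(hl q).ne']
  · rw [h3, key]; simp [(hm i).ne']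

lemma gSup_scale {g A : Q → Fin 3 → ℝ} {lam : Q → ℝ} {mu : Fin 3 → ℝ} (hl : ∀ q, 0 < lam q)
    (hm : ∀ i, 0 < mu i) (h : ∀ q i, A q i = lam q * g q i / mu i) (U : Set (Fin 3 ⊕ Q)) :
    GSup A U ↔ GSup g U := by
  refine ⟨GSup.scale hl (fun i => inv_pos.2 (hm i)) (by simpa [div_eq_mul_inv] using h),
    GSup.scale (fun q => inv_pos.2 (hl q)) hm fun q i => ?_⟩
  have := (hl q).ne'
  have := (hm i).ne'
  rw [h]; field_simp

/-- Coordinates of the Gale dual points of `A`, normalised to a standard simplex. -/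
def dualPt (e : Q ≃ Fin (d + 1)) (A : Q → Fin 3 → ℝ) : Fin 3 ⊕ Q → Fin d → ℝ :=
  Sum.elim (fun i j => A (e.symm j.succ) i) (fun q j => if e q = j.succ then 1 else 0)

/-- Values at the simplex vertices of an affine function. -/
def affVal (e : Q ≃ Fin (d + 1)) (a : Fin d → ℝ) (c : ℝ) (q : Q) : ℝ :=
  Fin.cases c (fun j => a j + c) (e q)

lemma exists_affVal (e : Q ≃ Fin (d + 1)) (lam : Q → ℝ) : ∃ a c, affVal e a c = lam := by
  refine ⟨fun j => lam (e.symm j.succ) - lam (e.symm 0), lam (e.symm 0), funext fun q => ?_⟩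
  obtain ⟨t, rfl⟩ := e.symm.surjective q
  simp only [affVal, Equiv.apply_symm_apply]
  refine Fin.cases ?_ (fun j => ?_) t <;> simp

lemma affVal_inr (e : Q ≃ Fin (d + 1)) (A : Q → Fin 3 → ℝ) (a : Fin d → ℝ) (c : ℝ) (q : Q) :
    a ⬝ᵥ dualPt e A (.inr q) + c = affVal e a c q := by
  obtain ⟨t, rfl⟩ := e.symm.surjective q
  simp only [affVal, Equiv.apply_symm_apply, dualPt, Sum.elim_inr, dotProduct]
  refine Fin.cases ?_ (fun j => ?_) t
  · simp [(Fin.succ_ne_zero _).symm]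
  · simp

lemma affVal_inl (e : Q ≃ Fin (d + 1)) {A : Q → Fin 3 → ℝ} (hA : ∀ i, ∑ q, A q i = 1)
    (a : Fin d → ℝ) (c : ℝ) (i : Fin 3) :
    a ⬝ᵥ dualPt e A (.inl i) + c = ∑ q, affVal e a c q * A q i := by
  have h1 := hA i
  rw [← Equiv.sum_comp e.symm, Fin.sum_univ_succ] at h1 ⊢
  simp only [affVal, Equiv.apply_symm_apply, dualPt, Sum.elim_inl, dotProduct, Fin.cases_zero,
    Fin.cases_succ, add_mul, Finset.sum_add_distrib]
  rw [← Finset.mul_sum]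
  linear_combination (-c) * h1

lemma affSup_dualPt {n : ℕ} (e : Q ≃ Fin (d + 1)) (φ : Fin n ≃ Fin 3 ⊕ Q) {A : Q → Fin 3 → ℝ}
    (hA : ∀ i, ∑ q, A q i = 1) (S : Set (Fin n)) :
    AffSup (fun p => dualPt e A (φ p)) S ↔ GSup A {k | φ.symm k ∉ S} := by
  have key : ∀ a c, ((∀ p, 0 ≤ a ⬝ᵥ dualPt e A (φ p) + c) ∧
      ∀ p, p ∈ S ↔ a ⬝ᵥ dualPt e A (φ p) + c = 0) ↔
      (∀ q, 0 ≤ affVal e a c q) ∧ (∀ i, 0 ≤ ∑ q, affVal e a c q * A q i) ∧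
      (∀ q, φ.symm (.inr q) ∉ S ↔ affVal e a c q ≠ 0) ∧
      ∀ i, φ.symm (.inl i) ∉ S ↔ ∑ q, affVal e a c q * A q i ≠ 0 := by
    intro a c
    simp only [← affVal_inl e hA]
    simp only [← affVal_inr e A]
    rw [← φ.symm.forall_congr_right, ← φ.symm.forall_congr_right (q := fun p => p ∈ S ↔ _)]
    simp only [Equiv.apply_symm_apply, Sum.forall, ne_eq, not_iff_not]
    tauto
  constructor
  · rintro ⟨a, c, h⟩
    exact ⟨affVal e a c, (key a c).1 h⟩
  · rintro ⟨lam, h⟩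
    obtain ⟨a, c, rfl⟩ := exists_affVal e lam
    exact ⟨a, c, (key a c).2 h⟩

/-- Index bijection underlying the flattening of configurations. -/
def flatEquiv (n d : ℕ) : Fin n × Fin d ≃ Fin (d * n) :=
  finProdFinEquiv.trans (finCongr (mul_comm n d))

lemma flatEquiv_apply {n d : ℕ} (p : Fin n) (c : Fin d) : flatEquiv n d (p, c) = flatIdx p c := by
  ext
  simp [flatEquiv, flatIdx, finProdFinEquiv]
  ring

lemma SE.flat {n d : ℕ} (R : Set (Fin n → Fin d → ℝ)) :
    SE {x : Fin n × Fin d → ℝ | (fun p c => x (p, c)) ∈ R} (flat R) :=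
  SE.of_equiv (flatEquiv n d) fun x => by
    simp only [_root_.flat, Set.mem_ofPred_eq, flatEquiv_apply]

/-- Normalised configurations with the same supports as `g₀`. -/
def galeNormal (g₀ : Q → Fin 3 → ℝ) : Set (Q × Fin 3 → ℝ) :=
  {x | (∀ i, ∑ q, x (q, i) = 1) ∧ ∀ U, GSup (fun q i => x (q, i)) U ↔ GSup g₀ U}

lemma SE.galeNormal {g₀ : Q → Fin 3 → ℝ} (hu : GSup g₀ Set.univ) :
    SE {x : Q × Fin 3 → ℝ | ∀ U, GSup (fun q i => x (q, i)) U ↔ GSup g₀ U} (galeNormal g₀) := by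
  let T : Set (Q × Fin 3 ⊕ (Q ⊕ Fin 3) → ℝ) := {x |
    (∀ U, GSup (fun q i => x (.inl (q, i))) U ↔ GSup g₀ U) ∧ (∀ k, 0 < x (.inr k)) ∧
    ∀ i, ∑ q, x (.inr (.inl q)) * x (.inl (q, i)) = x (.inr (.inr i))}
  let T' : Set (Q × Fin 3 ⊕ (Q ⊕ Fin 3) → ℝ) := {x |
    ((∀ i, ∑ q, x (.inl (q, i)) = 1) ∧ ∀ U, GSup (fun q i => x (.inl (q, i))) U ↔ GSup g₀ U) ∧
      ∀ k, 0 < x (.inr k)}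
  have s1 : SE {x : Q × Fin 3 → ℝ | ∀ U, GSup (fun q i => x (q, i)) U ↔ GSup g₀ U} T := by
    refine SE.fiber (Equiv.refl _) (fun x y => (∀ k, 0 < y k) ∧
      ∀ i, ∑ q, y (.inl q) * x (q, i) = y (.inr i)) ?_ (fun x y => Iff.rfl) ?_
    · have hsum : ∀ i, IsAff (fun (x : Q × Fin 3 → ℝ) (y : Q ⊕ Fin 3 → ℝ) =>
          ∑ q, y (.inl q) * x (q, i)) := by
        intro i
        refine ⟨inferInstance, Sum.elim (fun q x => x (q, i)) (fun _ _ => 0), fun _ => 0, ?_,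
          PolyFun.const 0, fun x y => ?_⟩
        · rintro (q | j)
          exacts [PolyFun.coord _, PolyFun.const 0]
        · simp [Fintype.sum_sum_type, mul_comm]
      refine AffCond.and (AffCond.all fun k => ?_) (AffCond.all fun i => ?_)
      · exact AffCond.lt (IsAff.const 0) (IsAff.fib k)
      · exact AffCond.eq (hsum i) (IsAff.fib _)
    · intro x hx
      obtain ⟨lam, h0, h1, h2, h3⟩ := (hx Set.univ).2 hu
      refine ⟨Sum.elim lam fun i => ∑ q, lam q * x (q, i), ?_, fun i => rfl⟩
      rintro (q | i)
      · exact lt_of_le_of_ne (h0 q) ((h2 q).1 trivial).symm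
      · exact lt_of_le_of_ne (h1 i) ((h3 i).1 trivial).symm
  have s2 : SE (_root_.galeNormal g₀) T' := by
    refine SE.fiber (Equiv.refl _) (fun x y => ∀ k, 0 < y k)
      (AffCond.all fun k => ?_) (fun x y => Iff.rfl) fun x _ => ⟨fun _ => 1, fun _ => one_pos⟩
    exact AffCond.lt (IsAff.const 0) (IsAff.fib k)
  refine (s1.trans ?_).trans s2.symm
  refine SE.rational
    (fun x => Sum.elim (fun qi => x (.inr (.inl qi.1)) * x (.inl qi) / x (.inr (.inr qi.2)))
      fun k => x (.inr k))
    (fun x => Sum.elim (fun qi => x (.inl qi) * x (.inr (.inr qi.2)) / x (.inr (.inl qi.1)))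
      fun k => x (.inr k)) ?_ ?_ ?_ ?_ ?_ ?_
  · rintro (qi | k)
    · exact ⟨_, _, (PolyFun.coord (.inr (.inl qi.1))).mul (PolyFun.coord (.inl qi)),
        PolyFun.coord (.inr (.inr qi.2)), fun x hx => ⟨(hx.2.1 _).ne', rfl⟩⟩
    · exact ⟨_, _, PolyFun.coord (.inr k), PolyFun.const 1, fun x _ => by simp⟩
  · rintro (qi | k)
    · exact ⟨_, _, (PolyFun.coord (.inl qi)).mul (PolyFun.coord (.inr (.inr qi.2))),
        PolyFun.coord (.inr (.inl qi.1)), fun x hx => ⟨(hx.2 _).ne', rfl⟩⟩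
    · exact ⟨_, _, PolyFun.coord (.inr k), PolyFun.const 1, fun x _ => by simp⟩
  · rintro x ⟨h1, h2, h3⟩
    refine ⟨⟨fun i => ?_, fun U => ?_⟩, h2⟩
    · simp only [Sum.elim_inl]
      rw [← Finset.sum_div, h3, div_self (h2 _).ne']
    · rw [← h1]
      exact gSup_scale (fun q => h2 (.inl q)) (fun i => h2 (.inr i)) (fun q i => rfl) U
  · rintro x ⟨⟨h1, h2⟩, h3⟩
    have h4 : ∀ q, x (.inr (.inl q)) ≠ 0 := fun q => (h3 _).ne'
    refine ⟨fun U => ?_, h3, fun i => ?_⟩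
    · rw [← h2]
      refine (gSup_scale (fun q => h3 (.inl q)) (fun i => h3 (.inr i)) (fun q i => ?_) U).symm
      have := h4 q
      have := (h3 (.inr i)).ne'
      simp only [Sum.elim_inl]
      field_simp
    · simp only [Sum.elim_inl, Sum.elim_inr]
      have : ∀ q, x (.inr (.inl q)) * (x (.inl (q, i)) * x (.inr (.inr i)) / x (.inr (.inl q))) =
          x (.inl (q, i)) * x (.inr (.inr i)) := fun q => by
        have := h4 q
        field_simp
      rw [Finset.sum_congr rfl fun q _ => this q, ← Finset.sum_mul, h1, one_mul]
  · rintro x ⟨h1, h2, h3⟩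
    funext k
    rcases k with ⟨q, i⟩ | k
    · have := (h2 (.inl q)).ne'
      have := (h2 (.inr i)).ne'
      simp only [Sum.elim_inl, Sum.elim_inr]
      field_simp
    · rfl
  · rintro x ⟨h1, h2⟩
    funext k
    rcases k with ⟨q, i⟩ | k
    · have := (h2 (.inl q)).ne'
      have := (h2 (.inr i)).ne'
      simp only [Sum.elim_inl, Sum.elim_inr]
      field_simp
    · rfl

end Gale

section GaleRealization

variable {Q : Type} [Fintype Q] {d : ℕ}

lemma affineIndependent_dualPt {n : ℕ} (e : Q ≃ Fin (d + 1)) (φ : Fin n ≃ Fin 3 ⊕ Q)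
    (A : Q → Fin 3 → ℝ) {B : Finset (Fin n)} (hB : ∀ p ∈ B, ∃ q, φ p = .inr q) :
    AffineIndependent ℝ (fun p : ↥B => dualPt e A (φ p)) := by
  classical
  rw [affineIndependent_iff]
  intro s w hw hwx i hi
  obtain ⟨q, hq⟩ := hB i i.2
  obtain ⟨a, c, hac⟩ := exists_affVal e (Pi.single q 1)
  have key : ∑ k ∈ s, w k * (a ⬝ᵥ dualPt e A (φ k) + c) = 0 := by
    have h1 : a ⬝ᵥ ∑ k ∈ s, w k • dualPt e A (φ k) = 0 := by
      have := congrArg (fun z => a ⬝ᵥ z) hwx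
      simpa using this
    simp only [dotProduct_sum, dotProduct_smul, smul_eq_mul] at h1
    simp only [mul_add, Finset.sum_add_distrib]
    rw [h1, ← Finset.sum_mul, hw]
    simp
  rw [Finset.sum_eq_single i] at key
  · rw [hq, affVal_inr, hac] at key
    simpa using key
  · intro k _ hk
    obtain ⟨q', hq'⟩ := hB k k.2
    rw [hq', affVal_inr, hac, Pi.single_apply, if_neg, mul_zero]
    rintro rfl
    exact hk (Subtype.ext (φ.injective (hq'.trans hq.symm)))
  · exact fun h => absurd hi h

/-- The normalised configurations are stably equivalent to the realization space of the dual
polytope. -/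
theorem exists_polytope_of_gale {g₀ : Q → Fin 3 → ℝ} (e : Q ≃ Fin (d + 1))
    (h1 : ∀ k, GSup g₀ {k}ᶜ)
    (h3 : ∀ U, GSup g₀ U → U.Nonempty → ∀ c : Fin 3 → ℝ,
      (∀ k ∈ U, c ⬝ᵥ galeVec g₀ k = 0) → c = 0)
    (h4 : ∀ k l, k ≠ l → ∃ T, GSup g₀ T ∧ l ∈ T ∧ k ∉ T ∧ ¬ GSup g₀ (T \ {l})) :
    ∃ (n : ℕ) (v : Fin n → Fin d → ℝ) (B : Finset (Fin n)),
      IsPolytopeVertexList v ∧ IsSimplicialVertexList v ∧ B.card = d + 1 ∧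
      AffineIndependent ℝ (fun i : ↥B => v i) ∧
      SE {x : Q × Fin 3 → ℝ | ∀ U, GSup (fun q i => x (q, i)) U ↔ GSup g₀ U}
        (flat (polytopeRealizationSpace v B)) := by
  classical
  have hu : GSup g₀ Set.univ := by
    have := ((depSupp_galeVec g₀ _).2 (h1 (.inl 0))).union ((depSupp_galeVec g₀ _).2 (h1 (.inl 1)))
    rw [depSupp_galeVec] at this
    convert this
    ext k
    by_cases hk : k = .inl 0
    · subst hk; simp
    · simp [hk]
  -- a normalised configuration
  obtain ⟨lam, p0, p1, p2, p3⟩ := id hu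
  have hlam : ∀ q, 0 < lam q := fun q => lt_of_le_of_ne (p0 q) ((p2 q).1 trivial).symm
  set mu : Fin 3 → ℝ := fun i => ∑ q, lam q * g₀ q i with hmu
  have hmu' : ∀ i, 0 < mu i := fun i => lt_of_le_of_ne (p1 i) ((p3 i).1 trivial).symm
  set A₀ : Q → Fin 3 → ℝ := fun q i => lam q * g₀ q i / mu i with hA₀
  have hA₀s : ∀ U, GSup A₀ U ↔ GSup g₀ U := gSup_scale hlam hmu' fun _ _ => rfl
  have hA₀1 : ∀ i, ∑ q, A₀ q i = 1 := fun i => by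
    simp only [hA₀]
    rw [← Finset.sum_div]
    exact div_self (hmu' i).ne'
  have h3' : ∀ U, GSup A₀ U → U.Nonempty → ∀ c : Fin 3 → ℝ,
      (∀ k ∈ U, c ⬝ᵥ galeVec A₀ k = 0) → c = 0 := by
    intro U hU hne c hc
    have := h3 U ((hA₀s U).1 hU) hne (fun i => c i / mu i) (by
      rintro (i | q) hk
      · have := hc _ hk
        simp only [galeVec, Sum.elim_inl, dotProduct_neg, dotProduct_single, mul_one] at this ⊢
        rw [neg_eq_zero] at this ⊢
        rw [this, zero_div]
      · have := hc _ hk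
        simp only [galeVec, Sum.elim_inr, dotProduct] at this ⊢
        have e1 : ∑ i, c i * A₀ q i = lam q * ∑ i, c i / mu i * g₀ q i := by
          rw [Finset.mul_sum]
          refine Finset.sum_congr rfl fun i _ => ?_
          simp only [hA₀]
          have := (hmu' i).ne'
          field_simp
        rw [e1] at this
        exact (mul_eq_zero.1 this).resolve_left (hlam q).ne')
    funext i
    have := congrFun this i
    simpa [(hmu' i).ne'] using this
  let φ : Fin (Fintype.card (Fin 3 ⊕ Q)) ≃ Fin 3 ⊕ Q := (Fintype.equivFin _).symm
  set n := Fintype.card (Fin 3 ⊕ Q) with hn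
  set v : Fin n → Fin d → ℝ := fun p => dualPt e A₀ (φ p) with hv
  set B : Finset (Fin n) := Finset.univ.image (fun q => φ.symm (.inr q)) with hB
  have hBmem : ∀ p ∈ B, ∃ q, φ p = .inr q := by
    intro p hp
    obtain ⟨q, -, rfl⟩ := Finset.mem_image.1 hp
    exact ⟨q, by simp⟩
  have hcard : B.card = d + 1 := by
    rw [hB, Finset.card_image_of_injective Finset.univ
      (f := fun q => φ.symm (.inr q)) (φ.symm.injective.comp Sum.inr_injective),
      Finset.card_univ, Fintype.card_congr e, Fintype.card_fin]
  have haff : AffineIndependent ℝ (fun i : ↥B => v i) := affineIndependent_dualPt e φ A₀ hBmem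
  -- configurations with the right supports are convexly independent
  have hsingle : ∀ A : Q → Fin 3 → ℝ, (∀ i, ∑ q, A q i = 1) → (∀ U, GSup A U ↔ GSup g₀ U) →
      ∀ p, AffSup (fun p => dualPt e A (φ p)) {p} := by
    intro A hA1 hA p
    rw [affSup_dualPt e φ hA1, hA]
    convert h1 (φ p) using 1
    ext k
    simp [Equiv.symm_apply_eq]
  have hface : ∀ A : Q → Fin 3 → ℝ, (∀ i, ∑ q, A q i = 1) → (∀ U, GSup A U ↔ GSup g₀ U) →
      ∀ S : Finset (Fin n), IsVertexSetOfFace (fun p => dualPt e A (φ p)) S ↔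
        GSup g₀ {k | φ.symm k ∉ (↑S : Set (Fin n))} := by
    intro A hA1 hA S
    have h := hsingle A hA1 hA
    rw [isVertexSetOfFace_iff (injective_of_affSup h) (fun i => mem_extremePoints_of_affSup (h i)),
      affSup_dualPt e φ hA1, hA]
  have hv1 := hsingle A₀ hA₀1 hA₀s
  refine ⟨n, v, B, ⟨injective_of_affSup hv1, fun i => mem_extremePoints_of_affSup (hv1 i), ?_⟩,
    ?_, hcard, haff, ?_⟩
  · have := haff.affineSpan_eq_top_iff_card_eq_finrank_add_one.2 (by simp [hcard])
    rw [eq_top_iff, ← this]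
    refine affineSpan_mono ℝ ?_
    rintro _ ⟨i, rfl⟩
    exact ⟨i, rfl⟩
  · refine isSimplicialVertexList_of fun S hS hSu w hwS hw hwx => ?_
    have hS' := (affSup_dualPt e φ hA₀1 S).1 hS
    have hval : ∀ a c, ∑ p, w p * (a ⬝ᵥ v p + c) = 0 := by
      intro a c
      have h1 : a ⬝ᵥ ∑ p, w p • v p = 0 := by rw [hwx]; simp
      simp only [dotProduct_sum, dotProduct_smul, smul_eq_mul] at h1
      simp only [mul_add, Finset.sum_add_distrib]
      rw [h1, ← Finset.sum_mul, hw]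
      simp
    have hval' : ∀ q, w (φ.symm (.inr q)) + ∑ i, w (φ.symm (.inl i)) * A₀ q i = 0 := by
      intro q
      obtain ⟨a, c, hac⟩ := exists_affVal e (Pi.single q 1)
      have := hval a c
      rw [← Equiv.sum_comp φ.symm, Fintype.sum_sum_type] at this
      simp only [hv, Equiv.apply_symm_apply, affVal_inr, affVal_inl e hA₀1, hac] at this
      simp only [Pi.single_apply, ite_mul, one_mul, zero_mul, mul_ite, mul_one, mul_zero,
        Finset.sum_ite_eq', Finset.mem_univ, if_true] at this
      linarith
    have hc := h3' _ hS' (by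
      obtain ⟨p, hp⟩ := (Set.ne_univ_iff_exists_notMem S).1 hSu
      exact ⟨φ p, by simpa using hp⟩) (fun i => w (φ.symm (.inl i))) (by
      rintro (i | q) hk
      · have := hwS _ hk
        simp [galeVec, this]
      · have h0 := hwS _ hk
        have := hval' q
        rw [h0, zero_add] at this
        exact this)
    intro p
    obtain ⟨k, rfl⟩ := φ.symm.surjective p
    rcases k with i | q
    · exact congrFun hc i
    · have := hval' q
      have h0 : ∀ i, w (φ.symm (.inl i)) = 0 := congrFun hc
      simpa [h0] using this
  · refine ((SE.galeNormal hu).trans ?_).trans (SE.flat _)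
    -- coordinates of configurations fixing the simplex
    have hrep : ∀ x : Fin n → Fin d → ℝ, (∀ i ∈ B, x i = v i) → ∃ A : Q → Fin 3 → ℝ,
        (∀ i, ∑ q, A q i = 1) ∧ x = fun p => dualPt e A (φ p) := by
      intro x hx
      refine ⟨fun q i => Fin.cases (1 - ∑ j, x (φ.symm (.inl i)) j)
        (fun j => x (φ.symm (.inl i)) j) (e q), fun i => ?_, ?_⟩
      · rw [← Equiv.sum_comp e.symm, Fin.sum_univ_succ]
        simp
      · funext p j
        obtain ⟨k, rfl⟩ := φ.symm.surjective p
        rcases k with i | q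
        · simp [dualPt]
        · rw [hx _ (Finset.mem_image.2 ⟨q, Finset.mem_univ _, rfl⟩)]
          simp [hv, dualPt]
    have hmem : ∀ A : Q → Fin 3 → ℝ, (∀ i, ∑ q, A q i = 1) →
        ((fun p => dualPt e A (φ p)) ∈ polytopeRealizationSpace v B ↔
          ∀ U, GSup A U ↔ GSup g₀ U) := by
      intro A hA1
      have hfix : ∀ i ∈ B, dualPt e A (φ i) = v i := by
        intro i hi
        obtain ⟨q, hq⟩ := hBmem i hi
        simp only [hv, hq, dualPt, Sum.elim_inr]
      constructor
      · rintro ⟨-, hext, hf⟩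
        set x : Fin n → Fin d → ℝ := fun p => dualPt e A (φ p) with hx
        have hinj : Function.Injective x := by
          intro p p' hpp
          by_contra hne
          obtain ⟨T, t1, t2, t3, t4⟩ := h4 (φ p) (φ p') (fun h => hne (φ.injective h))
          let S : Finset (Fin n) := Finset.univ.filter fun r => φ r ∉ T
          have hS : IsVertexSetOfFace v S := by
            rw [hface A₀ hA₀1 hA₀s]
            convert t1 using 1
            ext k
            simp [S]
          have hS' := (hf S).2 hS
          have hpS : p ∈ S := by simpa [S] using t3
          have him : x '' ↑(insert p' S) = x '' ↑S := by
            rw [Finset.coe_insert, Set.image_insert_eq, Set.insert_eq_of_mem]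
            exact ⟨p, hpS, hpp⟩
          have hS2 : IsVertexSetOfFace x (insert p' S) := by
            obtain ⟨F, hF1, hF2⟩ := hS'
            exact ⟨F, hF1, by rw [him]; exact hF2⟩
          have hS3 := (hf _).1 hS2
          rw [hface A₀ hA₀1 hA₀s] at hS3
          refine t4 ?_
          convert hS3 using 1
          ext k
          simp only [S, Set.mem_sdiff, Set.mem_singleton_iff, Finset.coe_insert, Set.mem_insert_iff,
            Set.mem_ofPred_eq, Finset.coe_filter, Finset.mem_univ, true_and,
            Equiv.apply_symm_apply, Equiv.symm_apply_eq]
          tauto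
        intro U
        have h5 := hf (Finset.univ.filter fun r => φ r ∉ U)
        rw [isVertexSetOfFace_iff hinj hext, affSup_dualPt e φ hA1, hface A₀ hA₀1 hA₀s] at h5
        have e1 : {k | φ.symm k ∉ (↑(Finset.univ.filter fun r => φ r ∉ U) : Set (Fin n))} = U := by
          ext k; simp
        rwa [e1] at h5
      · intro hA
        refine ⟨hfix, fun i => mem_extremePoints_of_affSup (hsingle A hA1 hA i), fun S => ?_⟩
        rw [hface A hA1 hA, hface A₀ hA₀1 hA₀s]
    refine SE.rational (fun x pc => dualPt e (fun q i => x (q, i)) (φ pc.1) pc.2)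
      (fun y qi => Fin.cases (1 - ∑ j, y (φ.symm (.inl qi.2), j))
        (fun j => y (φ.symm (.inl qi.2), j)) (e qi.1)) ?_ ?_ ?_ ?_ ?_ ?_
    · rintro ⟨p, c⟩
      refine ⟨_, _, ?_, PolyFun.const 1, fun x _ => ⟨one_ne_zero, (div_one _).symm⟩⟩
      change PolyFun fun x => dualPt e (fun q i => x (q, i)) (φ p) c
      rcases φ p with i | q
      · exact PolyFun.coord _
      · exact PolyFun.const _
    · rintro ⟨q, i⟩
      refine ⟨_, _, ?_, PolyFun.const 1, fun x _ => ⟨one_ne_zero, (div_one _).symm⟩⟩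
      change PolyFun fun y : Fin n × Fin d → ℝ => Fin.cases (motive := fun _ => ℝ)
        (1 - ∑ j, y (φ.symm (.inl i), j)) (fun j => y (φ.symm (.inl i), j)) (e q)
      refine Fin.cases ?_ (fun j => ?_) (e q)
      · exact (PolyFun.const 1).sub (PolyFun.sum _ fun j => PolyFun.coord _)
      · exact PolyFun.coord _
    · rintro x ⟨k1, k2⟩
      exact (hmem _ k1).2 k2
    · intro y hy
      obtain ⟨A, hA1, hyA⟩ := hrep _ hy.1
      have hy' : (fun p => dualPt e A (φ p)) ∈ polytopeRealizationSpace v B := hyA ▸ hy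
      have hq : ∀ q i, (Fin.cases (1 - ∑ j, y (φ.symm (.inl i), j))
          (fun j => y (φ.symm (.inl i), j)) (e q) : ℝ) = A q i := by
        intro q i
        have hpt : ∀ j, y (φ.symm (.inl i), j) = A (e.symm j.succ) i := fun j => by
          have := congrFun (congrFun hyA (φ.symm (.inl i))) j
          simpa [dualPt] using this
        obtain ⟨t, rfl⟩ := e.symm.surjective q
        rw [Equiv.apply_symm_apply]
        simp only [hpt]
        have := hA1 i
        rw [← Equiv.sum_comp e.symm, Fin.sum_univ_succ] at this
        refine Fin.cases ?_ (fun j => ?_) t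
        · simp only [Fin.cases_zero]; linarith
        · simp only [Fin.cases_succ]
      have hA := (hmem A hA1).1 hy'
      refine ⟨fun i => ?_, fun U => ?_⟩
      · simp only [hq]; exact hA1 i
      · simp only [hq]; exact hA U
    · rintro x ⟨k1, k2⟩
      funext ⟨q, i⟩
      obtain ⟨t, rfl⟩ := e.symm.surjective q
      have := k1 i
      rw [← Equiv.sum_comp e.symm, Fin.sum_univ_succ] at this
      simp only [Equiv.apply_symm_apply, dualPt, Sum.elim_inl]
      refine Fin.cases ?_ (fun j => ?_) t
      · simp only [Fin.cases_zero]; linarith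
      · simp only [Fin.cases_succ]
    · intro y hy
      funext ⟨p, j⟩
      obtain ⟨A, hA1, hyA⟩ := hrep _ hy.1
      have hyp := congrFun (congrFun hyA p) j
      obtain ⟨k, rfl⟩ := φ.symm.surjective p
      rcases k with i | q
      · simp [dualPt]
      · simp only [Equiv.apply_symm_apply, dualPt, Sum.elim_inr] at hyp ⊢
        exact hyp.symm

end GaleRealization

/-! ### Polytopes from configurations with a given pattern -/

section SpecRealization

lemma Simplicial3.depSupp_compl {I : Type} [Fintype I] {G : I → Fin 3 → ℝ} (hG : Simplicial3 G)
    {S : Set I} (hS : PosCirc G S) {k : I} (hk : k ∉ S) : DepSupp G {k}ᶜ := by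
  refine depSupp_of_cover fun j hj => ?_
  by_cases hjS : j ∈ S
  · exact ⟨S, fun i hi h => hk (h ▸ hi), hjS, hS.depSupp⟩
  · obtain ⟨i, -, hi⟩ := hG.pivot hS hjS
    refine ⟨_, ?_, Set.mem_insert _ _, hi.depSupp⟩
    rintro x (rfl | hx) h
    · exact hj h
    · exact hk (h ▸ hx.1)

lemma Simplicial3.dotProduct_eq_zero {I : Type} [Fintype I] {G : I → Fin 3 → ℝ}
    (hG : Simplicial3 G) {U : Set I} (hU : DepSupp G U) (hne : U.Nonempty) {c : Fin 3 → ℝ}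
    (hc : ∀ k ∈ U, c ⬝ᵥ G k = 0) : c = 0 := by
  obtain ⟨j, hj⟩ := hne
  obtain ⟨T, hTU, -, hT⟩ := hU.exists_minimal hj
  obtain ⟨i, j, k, l, hd, rfl⟩ := hG.exists_four hT
  obtain ⟨s, h1, -⟩ := PosCirc.D3_signs hd hT
  have hD : D3 (G j) (G k) (G l) ≠ 0 := by rintro h; rw [h] at h1; simp at h1
  have ej := hc j (hTU (by simp))
  have ek := hc k (hTU (by simp))
  have el := hc l (hTU (by simp))
  simp only [dotProduct, Fin.sum_univ_three] at ej ek el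
  have key : ∀ i, D3 (G j) (G k) (G l) * c i = 0 := by
    intro i
    simp only [D3]
    fin_cases i <;> simp only [Fin.zero_eta, Fin.mk_one, Fin.reduceFinMk]
    · linear_combination (G k 1 * G l 2 - G k 2 * G l 1) * ej -
        (G j 1 * G l 2 - G j 2 * G l 1) * ek + (G j 1 * G k 2 - G j 2 * G k 1) * el
    · linear_combination -(G k 0 * G l 2 - G k 2 * G l 0) * ej +
        (G j 0 * G l 2 - G j 2 * G l 0) * ek - (G j 0 * G k 2 - G j 2 * G k 0) * el
    · linear_combination (G k 0 * G l 1 - G k 1 * G l 0) * ej -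
        (G j 0 * G l 1 - G j 1 * G l 0) * ek + (G j 0 * G k 1 - G j 1 * G k 0) * el
  ext i
  simpa [hD] using key i

lemma Simplicial3.exists_separating {I : Type} [Fintype I] {G : I → Fin 3 → ℝ}
    (hG : Simplicial3 G) {k l : I} (hkl : k ≠ l) (hk : DepSupp G {k}ᶜ) :
    ∃ T, DepSupp G T ∧ l ∈ T ∧ k ∉ T ∧ ¬ DepSupp G (T \ {l}) := by
  obtain ⟨T, hTU, hl, hT⟩ := hk.exists_minimal (j := l) (fun h => hkl h.symm)
  refine ⟨T, hT.depSupp, hl, fun h => hTU h rfl, fun h => ?_⟩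
  have h4 := hG _ hT.depSupp hT.nonempty
  have hne : (T \ {l}).Nonempty := by
    refine Set.nonempty_of_ncard_ne_zero ?_
    have := Set.ncard_diff_singleton_add_one hl (Set.toFinite T)
    omega
  have := hT.eq_of_subset h Set.sdiff_subset hne
  rw [← this] at hl
  exact hl.2 rfl

lemma depSupp_reindex {I K M : Type} [Fintype I] [Fintype K] [AddCommGroup M] [Module ℝ M]
    (e : I ≃ K) (G : K → M) (U : Set I) :
    DepSupp (fun i => G (e i)) U ↔ DepSupp G (e.symm ⁻¹' U) := by
  constructor
  · rintro ⟨c, h1, h2, h3⟩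
    refine ⟨fun k => c (e.symm k), fun k => h1 _, ?_, fun k => h3 _⟩
    rw [← h2, ← e.sum_comp]
    simp
  · rintro ⟨c, h1, h2, h3⟩
    refine ⟨fun i => c (e i), fun i => h1 _, ?_, fun i => ?_⟩
    · rw [← h2, ← e.sum_comp]
    · rw [← h3]; simp

variable {A' Λ J : Type}

/-- The configuration whose first three white vectors are the standard basis. -/
def ext3 (w : (A' ⊕ (Λ ⊕ J)) × Fin 3 → ℝ) : (Fin 3 ⊕ A') ⊕ (Λ ⊕ J) → Fin 3 → ℝ
  | .inl (.inl i) => Pi.single i 1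
  | .inl (.inr a) => fun c => w (.inl a, c)
  | .inr u => fun c => w (.inr u, c)

/-- Configurations with pattern `P` contained in an open half-space, whose first three white
vectors are the standard basis. -/
def specSet (P : Pattern (Fin 3 ⊕ A') Λ J) : Set ((A' ⊕ (Λ ⊕ J)) × Fin 3 → ℝ) :=
  {w | P.Spec (ext3 w) ∧ ∃ ψ : Fin 3 → ℝ, ∀ i, 0 < ψ ⬝ᵥ ext3 w i}

variable [Fintype A'] [Fintype Λ] [Fintype J]

/-- The sign by which a vector enters the Gale diagram. -/
def flipSign : (A' ⊕ (Λ ⊕ J)) × Fin 3 → ℝ := fun q => Sum.elim (fun _ => -1) (fun _ => 1) q.1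

/-- The Gale diagram of a configuration. -/
def flipped (w : (A' ⊕ (Λ ⊕ J)) × Fin 3 → ℝ) : (A' ⊕ (Λ ⊕ J)) × Fin 3 → ℝ :=
  fun q => flipSign q * w q

lemma flipSign_sq (q : (A' ⊕ (Λ ⊕ J)) × Fin 3) : flipSign q * flipSign q = 1 := by
  rcases q with ⟨a | u, c⟩ <;> simp [flipSign]

lemma flipped_flipped (w : (A' ⊕ (Λ ⊕ J)) × Fin 3 → ℝ) : flipped (flipped w) = w := by
  ext q; simp only [flipped]; rw [← mul_assoc, flipSign_sq, one_mul]

lemma sgn_ext3 (w : (A' ⊕ (Λ ⊕ J)) × Fin 3 → ℝ) :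
    sgn (ext3 w) = fun i => galeVec (fun q c => flipped w (q, c)) (Equiv.sumAssoc _ _ _ i) := by
  funext i
  rcases i with (i | a) | u
  · simp [sgn, eps, ext3, galeVec]
  · ext c; simp [sgn, eps, ext3, galeVec, flipped, flipSign]
  · ext c; simp [sgn, eps, ext3, galeVec, flipped, flipSign]

lemma gSup_flipped (w : (A' ⊕ (Λ ⊕ J)) × Fin 3 → ℝ) (U : Set (Fin 3 ⊕ (A' ⊕ (Λ ⊕ J)))) :
    GSup (fun q c => flipped w (q, c)) U ↔
      DepSupp (sgn (ext3 w)) (Equiv.sumAssoc _ _ _ ⁻¹' U) := by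
  rw [sgn_ext3, ← depSupp_galeVec, depSupp_reindex]
  simp only [← Set.preimage_comp, Equiv.self_comp_symm, Set.preimage_id]

/-- A configuration with a good pattern has a circuit avoiding any given vector. -/
lemma Pattern.Good.exists_circ_avoiding {A : Type} [Fintype A] {P : Pattern A Λ J} (hP : P.Good)
    {V : A ⊕ (Λ ⊕ J) → Fin 3 → ℝ} (hV : P.Spec V) {ψ : Fin 3 → ℝ} (hψ : ∀ i, 0 < ψ ⬝ᵥ V i)
    {x a a' : A} (h1 : x ≠ a) (h2 : x ≠ a') (h3 : a ≠ a')
    (e1 : P.om x a = P.om a a') (e2 : P.om a' x = P.om a a') (e3 : P.chi x a a' = P.om a a')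
    (k : A ⊕ (Λ ⊕ J)) : ∃ S, PosCirc (sgn V) S ∧ k ∉ S := by
  obtain ⟨l, -⟩ := hP.exists_color x
  obtain ⟨j₁, hj₁⟩ := hP.both_sides l 1 (Or.inl rfl)
  obtain ⟨j₂, hj₂⟩ := hP.both_sides l (-1) (Or.inr rfl)
  have hj : j₁ ≠ j₂ := by rintro rfl; rw [hj₁] at hj₂; norm_num at hj₂
  rcases k with b | m | j
  · obtain ⟨b', hb⟩ := hP.exists_other b
    obtain ⟨l, rfl⟩ := hP.exists_color b'
    obtain ⟨j₁, hj₁⟩ := hP.both_sides l 1 (Or.inl rfl)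
    obtain ⟨j₂, hj₂⟩ := hP.both_sides l (-1) (Or.inr rfl)
    exact ⟨_, circ_cbb hP hV hψ (l := l) (j := j₁) (j' := j₂) (by rw [hj₁, hj₂]), by simpa using hb⟩
  · exact ⟨_, circ_wwwb hP hV j₁ h1 h2 h3 e1 e2 e3, by simp⟩
  · by_cases h : j = j₁
    · exact ⟨_, circ_wwwb hP hV j₂ h1 h2 h3 e1 e2 e3, by simp [h, hj]⟩
    · exact ⟨_, circ_wwwb hP hV j₁ h1 h2 h3 e1 e2 e3, by simp [h]⟩

/-- Nonempty spaces of configurations with a good pattern are stably equivalent to realization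
spaces of simplicial polytopes. -/
theorem exists_polytope_of_spec {P : Pattern (Fin 3 ⊕ A') Λ J} (hP : P.Good)
    (e1 : P.om (.inl 0) (.inl 1) = 1) (e2 : P.om (.inl 1) (.inl 2) = 1)
    (e3 : P.om (.inl 2) (.inl 0) = 1) (e4 : P.chi (.inl 0) (.inl 1) (.inl 2) = 1)
    (hne : (specSet P).Nonempty) :
    ∃ (d n : ℕ) (v : Fin n → Fin d → ℝ) (B : Finset (Fin n)),
      IsPolytopeVertexList v ∧ IsSimplicialVertexList v ∧ B.card = d + 1 ∧
      AffineIndependent ℝ (fun i : ↥B => v i) ∧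
      SE (specSet P) (flat (polytopeRealizationSpace v B)) := by
  classical
  obtain ⟨w₀, hV₀, ψ₀, hψ₀⟩ := hne
  have h1 : (Sum.inl 0 : Fin 3 ⊕ A') ≠ .inl 1 := by simp
  have h2 : (Sum.inl 0 : Fin 3 ⊕ A') ≠ .inl 2 := by simp
  have h3 : (Sum.inl 1 : Fin 3 ⊕ A') ≠ .inl 2 := by simp
  have hS := hV₀.simplicial3 hP hψ₀
  have hcompl : ∀ k, DepSupp (sgn (ext3 w₀)) {k}ᶜ := fun k => by
    obtain ⟨S, hS1, hS2⟩ := hP.exists_circ_avoiding hV₀ hψ₀ h1 h2 h3 (e1.trans e2.symm)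
      (e3.trans e2.symm) (e4.trans e2.symm) k
    exact hS.depSupp_compl hS1 hS2
  obtain ⟨l, -⟩ := hP.exists_color (.inl 0)
  have : Nonempty (A' ⊕ (Λ ⊕ J)) := ⟨.inr (.inl l)⟩
  obtain ⟨d, hd⟩ : ∃ d, Fintype.card (A' ⊕ (Λ ⊕ J)) = d + 1 :=
    ⟨_, (Nat.sub_add_cancel Fintype.card_pos).symm⟩
  have hsurj : ∀ U : Set (Fin 3 ⊕ A' ⊕ Λ ⊕ J), ∀ T : Set ((Fin 3 ⊕ A') ⊕ (Λ ⊕ J)),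
      U = (Equiv.sumAssoc _ _ _).symm ⁻¹' T → Equiv.sumAssoc _ _ _ ⁻¹' U = T := by
    rintro U T rfl
    rw [← Set.preimage_comp, Equiv.symm_comp_self, Set.preimage_id]
  obtain ⟨n, v, B, q1, q2, q3, q4, q5⟩ :=
    exists_polytope_of_gale (g₀ := fun q c => flipped w₀ (q, c)) (Fintype.equivFinOfCardEq hd)
      (fun k => by
        rw [gSup_flipped, hsurj _ {(Equiv.sumAssoc _ _ _).symm k}ᶜ]
        · exact hcompl _
        · ext; simp)
      (fun U hU hne c hc => by
        rw [gSup_flipped] at hU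
        refine hS.dotProduct_eq_zero hU (hne.preimage (Equiv.surjective _)) fun k hk => ?_
        rw [sgn_ext3]
        exact hc _ hk)
      (fun k l hkl => by
        obtain ⟨T, t1, t2, t3, t4⟩ := hS.exists_separating
          (k := (Equiv.sumAssoc _ _ _).symm k) (l := (Equiv.sumAssoc _ _ _).symm l)
          (by simpa using hkl) (hcompl _)
        refine ⟨(Equiv.sumAssoc _ _ _).symm ⁻¹' T, ?_, t2, t3, ?_⟩
        · rw [gSup_flipped, hsurj _ _ rfl]; exact t1
        · rw [gSup_flipped, hsurj _ (T \ {(Equiv.sumAssoc _ _ _).symm l})]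
          · exact t4
          · ext; simp)
  refine ⟨d, n, v, B, q1, q2, q3, q4, SE.trans ?_ q5⟩
  have key : ∀ w : (A' ⊕ (Λ ⊕ J)) × Fin 3 → ℝ, w ∈ specSet P ↔
      ∀ U, GSup (fun q c => flipped w (q, c)) U ↔ GSup (fun q c => flipped w₀ (q, c)) U := by
    intro w
    refine (depSupp_iff_spec (V := ext3 w) hP hV₀ hψ₀ h1 h2 h3 (e1.trans e2.symm)
      (e3.trans e2.symm) (e4.trans e2.symm) rfl rfl rfl).symm.trans ?_
    simp only [gSup_flipped]
    exact ⟨fun h U => h _, fun h U => by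
      have := h ((Equiv.sumAssoc _ _ _).symm ⁻¹' U); rwa [hsurj _ _ rfl] at this⟩
  have rat : ∀ (S : Set ((A' ⊕ (Λ ⊕ J)) × Fin 3 → ℝ)) (k : (A' ⊕ (Λ ⊕ J)) × Fin 3),
      ∃ p q : ((A' ⊕ (Λ ⊕ J)) × Fin 3 → ℝ) → ℝ, PolyFun p ∧ PolyFun q ∧
        ∀ x ∈ S, q x ≠ 0 ∧ flipped x k = p x / q x := fun S k =>
    ⟨fun x => flipSign k * x k, fun _ => 1, (PolyFun.const _).mul (PolyFun.coord _),
      PolyFun.const _, fun x _ => ⟨one_ne_zero, by simp [flipped]⟩⟩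
  refine SE.rational flipped flipped (rat _) (rat _) (fun w hw => (key w).1 hw) (fun x hx => ?_)
    (fun w _ => flipped_flipped w) (fun w _ => flipped_flipped w)
  rw [key, flipped_flipped]
  exact hx

end SpecRealization

/-! ### Adding the coloured vectors to a configuration -/

section Tower

section AffineDeterminants

variable {ι κ : Type} [Finite κ] {u v w : (ι → ℝ) → (κ → ℝ) → Fin 3 → ℝ}

/-- A vector depending affinely on the fibre variables. -/
def AffVec (u : (ι → ℝ) → (κ → ℝ) → Fin 3 → ℝ) : Prop := ∀ c, IsAff fun x y => u x y c

/-- A vector depending polynomially on the base variables alone. -/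
def PolyVec (u : (ι → ℝ) → (κ → ℝ) → Fin 3 → ℝ) : Prop :=
  ∃ p : Fin 3 → (ι → ℝ) → ℝ, (∀ c, PolyFun (p c)) ∧ ∀ x y, u x y = fun c => p c x

lemma PolyVec.affVec (h : PolyVec u) : AffVec u := by
  obtain ⟨p, hp, h⟩ := h
  intro c
  simp only [h]
  exact IsAff.of_poly (hp c)

lemma PolyVec.D3₃ (hu : PolyVec u) (hv : PolyVec v) (hw : AffVec w) :
    IsAff fun x y => D3 (u x y) (v x y) (w x y) := by
  obtain ⟨p, hp, hu⟩ := hu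
  obtain ⟨q, hq, hv⟩ := hv
  have : (fun x y => D3 (u x y) (v x y) (w x y)) = fun x y =>
      (p 1 x * q 2 x - p 2 x * q 1 x) * w x y 0 + (p 2 x * q 0 x - p 0 x * q 2 x) * w x y 1 +
      (p 0 x * q 1 x - p 1 x * q 0 x) * w x y 2 := by
    funext x y; simp only [hu, hv, D3]; ring
  rw [this]
  exact ((IsAff.poly_mul (((hp 1).mul (hq 2)).sub ((hp 2).mul (hq 1))) (hw 0)).add
    (IsAff.poly_mul (((hp 2).mul (hq 0)).sub ((hp 0).mul (hq 2))) (hw 1))).add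
    (IsAff.poly_mul (((hp 0).mul (hq 1)).sub ((hp 1).mul (hq 0))) (hw 2))

lemma PolyVec.D3₂ (hu : PolyVec u) (hv : AffVec v) (hw : PolyVec w) :
    IsAff fun x y => D3 (u x y) (v x y) (w x y) := by
  have := (PolyVec.D3₃ hu hw hv).neg
  simpa only [← D3_swap₂] using this

lemma AffVec.dot {ψ : (ι → ℝ) → (κ → ℝ) → Fin 3 → ℝ} (hψ : PolyVec ψ) (hu : AffVec u) :
    IsAff fun x y => ψ x y ⬝ᵥ u x y := by
  obtain ⟨p, hp, hψ⟩ := hψ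
  simp only [hψ, dotProduct, Fin.sum_univ_three]
  exact ((IsAff.poly_mul (hp 0) (hu 0)).add (IsAff.poly_mul (hp 1) (hu 1))).add
    (IsAff.poly_mul (hp 2) (hu 2))

end AffineDeterminants

variable {A Λ J : Type}

/-- Restriction of a pattern to some of the colours. -/
def Pattern.comap {Λ' : Type} (P : Pattern A Λ J) (f : Λ' → Λ) : Pattern A Λ' J where
  home := fun l => P.home (f l)
  om := P.om
  chi := P.chi
  sg := fun l => P.sg (f l)

/-- Reindexing of the colours. -/
def mapCo {Λ' : Type} (f : Λ' → Λ) : A ⊕ (Λ' ⊕ J) → A ⊕ (Λ ⊕ J) := Sum.map id (Sum.map f id)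

lemma Pattern.hm_comap {Λ' : Type} (P : Pattern A Λ J) (f : Λ' → Λ) (u : A ⊕ (Λ' ⊕ J)) :
    (P.comap f).hm u = P.hm (mapCo f u) := by
  rcases u with a | l | j <;> rfl

lemma Pattern.Spec.comap {Λ' : Type} {P : Pattern A Λ J} {V : A ⊕ (Λ ⊕ J) → Fin 3 → ℝ}
    (h : P.Spec V) (f : Λ' → Λ) : (P.comap f).Spec fun i => V (mapCo f i) where
  own := fun l j => h.own (f l) j
  forB := fun a a' u j ha hu => h.forB a a' _ j ha (by rwa [← P.hm_comap])
  ownFor := fun l a' u hl hu => h.ownFor (f l) a' _ hl (by rwa [← P.hm_comap])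
  forFor := fun a a' a'' u v h1 h2 h3 hu hv => h.forFor a a' a'' _ _ h1 h2 h3
    (by rwa [← P.hm_comap]) (by rwa [← P.hm_comap])

/-- The requirements on the white and black vectors and the functional `ψ` of a configuration
with pattern `P`. -/
structure Pattern.Base (P : Pattern A Λ J) (W : A → Fin 3 → ℝ) (b : J → Fin 3 → ℝ)
    (ψ : Fin 3 → ℝ) : Prop where
  wwb : ∀ a a' j, a ≠ a' → 0 < P.om a a' * D3 (W a) (W a') (b j)
  www : ∀ a a' a'', a ≠ a' → a ≠ a'' → a' ≠ a'' → 0 < P.chi a a' a'' * D3 (W a) (W a') (W a'')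
  rel : ∀ l j k, P.sg l j = 1 → P.sg l k = -1 → 0 < D3 (W (P.home l)) (b j) (b k)
  psi : ∀ a, 0 < ψ ⬝ᵥ W a

/-- Combinatorial conditions for adding coloured vectors. -/
structure Pattern.Pre (P : Pattern A Λ J) : Prop where
  om_cases : ∀ a a', P.om a a' = 1 ∨ P.om a a' = -1
  sg_cases : ∀ l j, P.sg l j = 1 ∨ P.sg l j = -1
  exists_other : ∀ a : A, ∃ a', a ≠ a'
  both_sides : ∀ l s, s = 1 ∨ s = -1 → ∃ j, P.sg l j = s

/-- The configuration of given white, coloured and black vectors. -/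
def vecs (W : A → Fin 3 → ℝ) (c : Λ → Fin 3 → ℝ) (b : J → Fin 3 → ℝ) :
    A ⊕ (Λ ⊕ J) → Fin 3 → ℝ := Sum.elim W (Sum.elim c b)

lemma eventually_affine_pos {a : ℝ} (ha : 0 < a) (b : ℝ) :
    ∀ᶠ s in Filter.atTop, 0 < a * s + b := by
  filter_upwards [Filter.eventually_gt_atTop (-b / a)] with s hs
  rw [div_lt_iff₀ ha] at hs
  linarith

/-- In the pencil of a white vector, the black vectors are linearly ordered. -/
lemma exists_slope {W f : Fin 3 → ℝ} {b : J → Fin 3 → ℝ} {o : ℝ} (ho : o = 1 ∨ o = -1)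
    (h : ∀ j, 0 < o * D3 W f (b j)) :
    ∃ F : J → ℝ, ∀ j k, (0 < D3 W (b j) (b k) ↔ F j < F k) := by
  by_cases hJ : IsEmpty J
  · exact ⟨0, fun j => hJ.elim j⟩
  obtain ⟨i⟩ := not_isEmpty_iff.1 hJ
  have ho2 : o * o = 1 := by rcases ho with rfl | rfl <;> norm_num
  refine ⟨fun j => D3 W (b i) (b j) / (o * D3 W f (b j)), fun j k => ?_⟩
  have hj := h j
  have hk := h k
  have hi := h i
  beta_reduce
  rw [div_lt_div_iff₀ hj hk, ← sub_pos (b := D3 W (b i) (b j) * _)]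
  have key : D3 W (b i) (b k) * (o * D3 W f (b j)) - D3 W (b i) (b j) * (o * D3 W f (b k)) =
      (o * D3 W f (b i)) * D3 W (b j) (b k) := by
    have := D3_plucker W f (b i) (b j) (b k)
    rw [D3_swap₂ W f (b i)] at this
    linear_combination o * this
  rw [key, mul_pos_iff_of_pos_left hi]

lemma exists_color_direction [Finite J] {P : Pattern A (Option Λ) J} (hP : P.Pre)
    {W : A → Fin 3 → ℝ} {b : J → Fin 3 → ℝ} {ψ : Fin 3 → ℝ} (h : P.Base W b ψ) :
    ∃ j₀ k₀, (∀ j, P.sg none j * D3 (W (P.home none)) (b j₀ + b k₀) (b j) < 0) := by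
  obtain ⟨a', ha'⟩ := hP.exists_other (P.home none)
  obtain ⟨F, hF⟩ := exists_slope (hP.om_cases _ _) (fun j => h.wwb _ a' j ha')
  obtain ⟨j₁, hj₁⟩ := hP.both_sides none 1 (Or.inl rfl)
  obtain ⟨k₁, hk₁⟩ := hP.both_sides none (-1) (Or.inr rfl)
  obtain ⟨j₀, hj₀, hmax⟩ := Set.exists_max_image {j | P.sg none j = 1} F (Set.toFinite _) ⟨_, hj₁⟩
  obtain ⟨k₀, hk₀, hmin⟩ := Set.exists_min_image {j | P.sg none j = -1} F (Set.toFinite _) ⟨_, hk₁⟩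
  refine ⟨j₀, k₀, fun j => ?_⟩
  have hadd : D3 (W (P.home none)) (b j₀ + b k₀) (b j) =
      D3 (W (P.home none)) (b j₀) (b j) + D3 (W (P.home none)) (b k₀) (b j) := by
    simp only [D3, Pi.add_apply]; ring
  rw [hadd]
  rcases hP.sg_cases none j with hj | hj
  · have h1 := h.rel none j k₀ hj hk₀
    have h2 := (hF j₀ j).not.2 (not_lt.2 (hmax j hj))
    rw [D3_swap₂] at h1
    rw [hj]
    linarith
  · have h1 := h.rel none j₀ j hj₀ hj
    have h2 := (hF j k₀).not.2 (not_lt.2 (hmin j hj))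
    rw [D3_swap₂] at h2
    rw [hj]
    linarith

lemma D3_line₂ (u v n w : Fin 3 → ℝ) (s : ℝ) :
    D3 u (s • v - n) w = D3 u v w * s + -D3 u n w := by
  simp only [D3, Pi.sub_apply, Pi.smul_apply, smul_eq_mul]; ring

lemma D3_line₃ (u v n w : Fin 3 → ℝ) (s : ℝ) :
    D3 u w (s • v - n) = D3 u w v * s + -D3 u w n := by
  simp only [D3, Pi.sub_apply, Pi.smul_apply, smul_eq_mul]; ring

lemma exists_new_color [Finite A] [Finite Λ] [Finite J] {P : Pattern A (Option Λ) J} (hP : P.Pre)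
    {W : A → Fin 3 → ℝ} {c : Λ → Fin 3 → ℝ} {b : J → Fin 3 → ℝ} {ψ : Fin 3 → ℝ}
    (h : P.Base W b ψ) (hV : (P.comap some).Spec (vecs W c b)) :
    ∃ c₀ : Fin 3 → ℝ, P.Spec (vecs W (fun l => l.elim c₀ c) b) ∧ 0 < ψ ⬝ᵥ c₀ := by
  obtain ⟨j₀, k₀, hn⟩ := exists_color_direction hP h
  set n := b j₀ + b k₀ with hndef
  set a := P.home none with ha
  let V : ℝ → A ⊕ (Option Λ ⊕ J) → Fin 3 → ℝ := fun s =>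
    vecs W (fun l => l.elim (s • W a - n) c) b
  have old : ∀ u : A ⊕ (Option Λ ⊕ J), (u = co none) ∨ ∃ u', u = mapCo some u' := by
    rintro (x | (_ | l) | j)
    · exact Or.inr ⟨.inl x, rfl⟩
    · exact Or.inl rfl
    · exact Or.inr ⟨co l, rfl⟩
    · exact Or.inr ⟨bl j, rfl⟩
  have hVold : ∀ s u, V s (mapCo some u) = vecs W c b u := by
    rintro s (x | l | j) <;> rfl
  have hVw : ∀ s x, V s (wh x) = W x := fun _ _ => rfl
  have hVb : ∀ s j, V s (bl j) = b j := fun _ _ => rfl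
  have hVn : ∀ s, V s (co none) = s • W a - n := fun _ => rfl
  have hVs : ∀ s l, V s (co (some l)) = c l := fun _ _ => rfl
  have e1 : ∀ᶠ s in Filter.atTop, ∀ l j,
      0 < P.sg l j * D3 (V s (wh (P.home l))) (V s (co l)) (V s (bl j)) := by
    refine Filter.eventually_all.2 fun l => Filter.eventually_all.2 fun j => ?_
    rcases l with _ | l
    · refine Filter.Eventually.of_forall fun s => ?_
      rw [hVw, hVn, hVb, D3_line₂, ← ha, D3_self₁]
      have := hn j
      linarith
    · exact Filter.Eventually.of_forall fun s => hV.own l j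
  have e2 : ∀ᶠ s in Filter.atTop, ∀ x a' u j, x ≠ a' → P.hm u = some a' →
      0 < P.om x a' * D3 (V s (wh x)) (V s u) (V s (bl j)) := by
    refine Filter.eventually_all.2 fun x => Filter.eventually_all.2 fun a' =>
      Filter.eventually_all.2 fun u => Filter.eventually_all.2 fun j =>
      Filter.eventually_imp_distrib_left.2 fun hx => Filter.eventually_imp_distrib_left.2 fun hu => ?_
    rcases old u with rfl | ⟨u, rfl⟩
    · obtain rfl : a = a' := Option.some.inj hu
      filter_upwards [eventually_affine_pos (h.wwb x a j hx) (P.om x a * -D3 (W x) n (b j))] with s hs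
      rw [hVw, hVn, hVb, D3_line₂]
      linarith
    · refine Filter.Eventually.of_forall fun s => ?_
      rw [hVold]
      exact hV.forB x a' u j hx (by rwa [P.hm_comap])
  have e3 : ∀ᶠ s in Filter.atTop, ∀ l a' u, P.home l ≠ a' → P.hm u = some a' →
      0 < P.om (P.home l) a' * D3 (V s (wh (P.home l))) (V s (co l)) (V s u) := by
    refine Filter.eventually_all.2 fun l => Filter.eventually_all.2 fun a' =>
      Filter.eventually_all.2 fun u =>
      Filter.eventually_imp_distrib_left.2 fun hx => Filter.eventually_imp_distrib_left.2 fun hu => ?_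
    rcases old u with rfl | ⟨u, rfl⟩
    · obtain rfl : a = a' := Option.some.inj hu
      rcases l with _ | l
      · exact absurd rfl hx
      · have := hV.ownFor l a (wh a) hx rfl
        filter_upwards [eventually_affine_pos this
          (P.om (P.home (some l)) a * -D3 (W (P.home (some l))) (c l) n)] with s hs
        rw [hVw, hVn, hVs, D3_line₃]
        refine hs.trans_eq ?_
        simp only [vecs, Sum.elim_inl, Sum.elim_inr, Pattern.comap]
        ring
    · refine Filter.Eventually.of_forall fun s => ?_
      rw [hVold]
      rcases l with _ | l
      · rw [hVw, hVn, D3_line₂, ← ha, D3_self₁, ← D3_swap₂, hndef]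
        have k1 := hV.forB a a' u j₀ hx (by rwa [P.hm_comap])
        have k2 := hV.forB a a' u k₀ hx (by rwa [P.hm_comap])
        have : D3 (W a) (vecs W c b u) (b j₀ + b k₀) = D3 (W a) (vecs W c b u) (b j₀) +
            D3 (W a) (vecs W c b u) (b k₀) := by simp only [D3, Pi.add_apply]; ring
        rw [this]
        simp only [vecs, Sum.elim_inl, Sum.elim_inr, Pattern.comap] at k1 k2 ⊢
        linarith
      · exact hV.ownFor l a' u hx (by rwa [P.hm_comap])
  have e4 : ∀ᶠ s in Filter.atTop, ∀ x a' a'' u v, x ≠ a' → x ≠ a'' → a' ≠ a'' → P.hm u = some a' →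
      P.hm v = some a'' → 0 < P.chi x a' a'' * D3 (V s (wh x)) (V s u) (V s v) := by
    refine Filter.eventually_all.2 fun x => Filter.eventually_all.2 fun a' =>
      Filter.eventually_all.2 fun a'' => Filter.eventually_all.2 fun u =>
      Filter.eventually_all.2 fun v =>
      Filter.eventually_imp_distrib_left.2 fun h1 => Filter.eventually_imp_distrib_left.2 fun h2 =>
      Filter.eventually_imp_distrib_left.2 fun h3 => Filter.eventually_imp_distrib_left.2 fun hu =>
      Filter.eventually_imp_distrib_left.2 fun hv => ?_
    rcases old u with rfl | ⟨u, rfl⟩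
    · obtain rfl : a = a' := Option.some.inj hu
      rcases old v with rfl | ⟨v, rfl⟩
      · exact absurd (Option.some.inj hv) h3
      · have := hV.forFor x a a'' (wh a) v h1 h2 h3 rfl (by rwa [P.hm_comap])
        filter_upwards [eventually_affine_pos this
          (P.chi x a a'' * -D3 (W x) n (vecs W c b v))] with s hs
        rw [hVold, hVw, hVn, D3_line₂]
        refine hs.trans_eq ?_
        simp only [vecs, Sum.elim_inl, Pattern.comap]
        ring
    · rcases old v with rfl | ⟨v, rfl⟩
      · obtain rfl : a = a'' := Option.some.inj hv
        have := hV.forFor x a' a u (wh a) h1 h2 h3 (by rwa [P.hm_comap]) rfl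
        filter_upwards [eventually_affine_pos this
          (P.chi x a' a * -D3 (W x) (vecs W c b u) n)] with s hs
        rw [hVold, hVw, hVn, D3_line₃]
        refine hs.trans_eq ?_
        simp only [vecs, Sum.elim_inl, Pattern.comap]
        ring
      · refine Filter.Eventually.of_forall fun s => ?_
        rw [hVold, hVold]
        exact hV.forFor x a' a'' u v h1 h2 h3 (by rwa [P.hm_comap]) (by rwa [P.hm_comap])
  have e5 : ∀ᶠ s in Filter.atTop, 0 < ψ ⬝ᵥ ((s : ℝ) • W a - n) := by
    filter_upwards [eventually_affine_pos (h.psi a) (-(ψ ⬝ᵥ n))] with s hs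
    rw [dotProduct_sub, dotProduct_smul, smul_eq_mul]
    linarith
  obtain ⟨s, h1, h2, h3, h4, h5⟩ := (e1.and (e2.and (e3.and (e4.and e5)))).exists
  exact ⟨_, ⟨h1, h2, h3, h4⟩, h5⟩

variable {κ : Type} (W : (κ → ℝ) → A → Fin 3 → ℝ) (b : (κ → ℝ) → J → Fin 3 → ℝ)
  (ψ : (κ → ℝ) → Fin 3 → ℝ) (S : Set (κ → ℝ))

/-- The configurations with pattern `P` whose white and black vectors are parametrised by `S`. -/
def towerSet (P : Pattern A Λ J) : Set (κ ⊕ Λ × Fin 3 → ℝ) :=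
  {z | (fun k => z (.inl k)) ∈ S ∧
    P.Spec (vecs (W fun k => z (.inl k)) (fun l c => z (.inr (l, c))) (b fun k => z (.inl k))) ∧
    ∀ l, 0 < (ψ fun k => z (.inl k)) ⬝ᵥ fun c => z (.inr (l, c))}

variable {W b ψ S}

lemma towerSet_mono {Λ' : Type} {P : Pattern A Λ J} (f : Λ' → Λ) {z : κ ⊕ Λ × Fin 3 → ℝ}
    (hz : z ∈ towerSet W b ψ S P) :
    (fun i => z (Sum.map id (Prod.map f id) i)) ∈ towerSet W b ψ S (P.comap f) := by
  obtain ⟨h1, h2, h3⟩ := hz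
  refine ⟨h1, ?_, fun l => h3 _⟩
  have := h2.comap f
  convert this using 1
  funext i
  rcases i with a | l | j <;> rfl

/-- Forgetting the last coloured vector. -/
def optionEquiv (κ Λ : Type) : κ ⊕ Option Λ × Fin 3 ≃ (κ ⊕ Λ × Fin 3) ⊕ Fin 3 where
  toFun := Sum.elim (fun k => .inl (.inl k))
    fun p => p.1.elim (.inr p.2) fun l => .inl (.inr (l, p.2))
  invFun := Sum.elim (Sum.map id (Prod.map some id)) fun c => .inr (none, c)
  left_inv := by rintro (k | ⟨_ | l, c⟩) <;> rfl
  right_inv := by rintro ((k | ⟨l, c⟩) | c) <;> rfl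

/-- The coloured vectors can be added without changing the stable equivalence class. -/
theorem SE.tower [Finite A] [Finite J] [Finite κ]
    (hW : ∀ a c, PolyFun fun x => W x a c) (hb : ∀ j c, PolyFun fun x => b x j c)
    (hψ : ∀ c, PolyFun fun x => ψ x c) (Λ : Type) [Finite Λ] :
    ∀ P : Pattern A Λ J, P.Pre → (∀ x ∈ S, P.Base (W x) (b x) (ψ x)) →
      SE S (towerSet W b ψ S P) := by
  suffices key : Finite Λ → ∀ P : Pattern A Λ J, P.Pre →
      (∀ x ∈ S, P.Base (W x) (b x) (ψ x)) → SE S (towerSet W b ψ S P) from key inferInstance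
  induction Λ using Finite.induction_empty_option with
  | of_equiv e ih =>
    rename_i α β
    intro _ P hP hS
    have hfin : Finite α := Finite.of_equiv β e.symm
    refine (ih hfin (P.comap e) ⟨hP.1, fun l => hP.2 _, hP.3, fun l => hP.4 _⟩ fun x hx =>
      ⟨(hS x hx).1, (hS x hx).2, fun l => (hS x hx).3 _, (hS x hx).4⟩).trans ?_
    refine SE.of_equiv ((Equiv.refl _).sumCongr (e.prodCongr (Equiv.refl _))) fun z => ⟨fun hz => ?_,
      fun hz => ?_⟩
    · exact towerSet_mono e hz
    · have := towerSet_mono e.symm hz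
      have e1 : (P.comap e).comap e.symm = P := by
        cases P
        simp [Pattern.comap]
      rw [e1] at this
      convert this using 1
      funext i
      rcases i with k | ⟨l, c⟩ <;> simp
  | h_empty =>
    intro _ P hP hS
    refine SE.of_equiv (Equiv.sumEmpty _ _).symm fun z => ⟨fun hz => hz.1, fun hz => ⟨hz, ?_,
      fun l => l.elim⟩⟩
    have hB := hS _ hz
    refine ⟨fun l => l.elim, ?_, fun l => l.elim, ?_⟩
    · rintro a a' (x | x | j) k h1 h2
      · cases Option.some.inj h2
        exact hB.wwb _ _ _ h1
      · exact x.elim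
      · cases h2
    · rintro a a' a'' (x | x | x) (y | y | y) h1 h2 h3 hu hv
      · cases Option.some.inj hu
        cases Option.some.inj hv
        exact hB.www _ _ _ h1 h2 h3
      all_goals first | exact x.elim | exact y.elim | (cases hu; done) | (cases hv; done)
  | h_option ih =>
    rename_i Λ _
    intro _ P hP hS
    refine (ih inferInstance (P.comap some) ⟨hP.1, fun l => hP.2 _, hP.3, fun l => hP.4 _⟩ fun x hx =>
      ⟨(hS x hx).1, (hS x hx).2, fun l => (hS x hx).3 _, (hS x hx).4⟩).trans ?_
    let V : (κ ⊕ Λ × Fin 3 → ℝ) → (Fin 3 → ℝ) → A ⊕ (Option Λ ⊕ J) → Fin 3 → ℝ := fun x y =>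
      vecs (W fun k => x (.inl k)) (fun l => l.elim y fun l c => x (.inr (l, c)))
        (b fun k => x (.inl k))
    have hin : ∀ k : κ, PolyFun fun x : κ ⊕ Λ × Fin 3 → ℝ => x (.inl k) := fun k => PolyFun.coord _
    have pw : ∀ a, PolyVec fun x y => V x y (wh a) := fun a =>
      ⟨fun c x => W (fun k => x (.inl k)) a c, fun c => (hW a c).comp hin, fun _ _ => rfl⟩
    have pb : ∀ j, PolyVec fun x y => V x y (bl j) := fun j =>
      ⟨fun c x => b (fun k => x (.inl k)) j c, fun c => (hb j c).comp hin, fun _ _ => rfl⟩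
    have pc : ∀ l, PolyVec fun x y => V x y (co (some l)) := fun l =>
      ⟨fun c x => x (.inr (l, c)), fun c => PolyFun.coord _, fun _ _ => rfl⟩
    have pψ : PolyVec fun (x : κ ⊕ Λ × Fin 3 → ℝ) (_ : Fin 3 → ℝ) => ψ fun k => x (.inl k) :=
      ⟨fun c x => ψ (fun k => x (.inl k)) c, fun c => (hψ c).comp hin, fun _ _ => rfl⟩
    have an : AffVec fun x y => V x y (co none) := fun c => IsAff.fib c
    have pu : ∀ u, u ≠ co none → PolyVec fun x y => V x y u := by
      rintro (a | (_ | l) | j) hu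
      exacts [pw a, absurd rfl hu, pc l, pb j]
    have au : ∀ u, AffVec fun x y => V x y u := fun u => by
      by_cases hu : u = co none
      · rw [hu]; exact an
      · exact (pu u hu).affVec
    refine SE.fiber (optionEquiv κ Λ) (fun x y => P.Spec (V x y) ∧
      ∀ l : Option Λ, 0 < (ψ fun k => x (.inl k)) ⬝ᵥ V x y (co l)) ?_ (fun x y => ?_) fun x hx => ?_
    · refine AffCond.and ?_ (AffCond.all fun l => ?_)
      · refine AffCond.congr (Q := fun x y =>
          (∀ l j, 0 < P.sg l j * D3 (V x y (wh (P.home l))) (V x y (co l)) (V x y (bl j))) ∧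
          (∀ a a' u j, a ≠ a' → P.hm u = some a' →
            0 < P.om a a' * D3 (V x y (wh a)) (V x y u) (V x y (bl j))) ∧
          (∀ l a' u, P.home l ≠ a' → P.hm u = some a' →
            0 < P.om (P.home l) a' * D3 (V x y (wh (P.home l))) (V x y (co l)) (V x y u)) ∧
          (∀ a a' a'' u v, a ≠ a' → a ≠ a'' → a' ≠ a'' → P.hm u = some a' → P.hm v = some a'' →
            0 < P.chi a a' a'' * D3 (V x y (wh a)) (V x y u) (V x y v)))
          (fun x y => ⟨fun h => ⟨h.1, h.2, h.3, h.4⟩, fun h => ⟨h.1, h.2.1, h.2.2.1, h.2.2.2⟩⟩) ?_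
        refine AffCond.and (AffCond.all fun l => AffCond.all fun j => ?_) (AffCond.and
          (AffCond.all fun a => AffCond.all fun a' => AffCond.all fun u => AffCond.all fun j =>
            AffCond.imp fun _ => AffCond.imp fun _ => ?_) (AffCond.and
          (AffCond.all fun l => AffCond.all fun a' => AffCond.all fun u => AffCond.imp fun hl =>
            AffCond.imp fun hu => ?_)
          (AffCond.all fun a => AffCond.all fun a' => AffCond.all fun a'' => AffCond.all fun u =>
            AffCond.all fun v => AffCond.imp fun _ => AffCond.imp fun _ => AffCond.imp fun h3 =>
            AffCond.imp fun hu => AffCond.imp fun hv => ?_)))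
        · exact AffCond.lt (IsAff.const 0) (IsAff.poly_mul (PolyFun.const _)
            (PolyVec.D3₂ (pw _) (au _) (pb _)))
        · exact AffCond.lt (IsAff.const 0) (IsAff.poly_mul (PolyFun.const _)
            (PolyVec.D3₂ (pw _) (au _) (pb _)))
        · refine AffCond.lt (IsAff.const 0) (IsAff.poly_mul (PolyFun.const _) ?_)
          by_cases h : u = co none
          · refine PolyVec.D3₃ (pw _) (pu _ ?_) (au _)
            rintro h'
            subst h
            cases Sum.inl.inj (Sum.inr.inj h')
            exact hl (Option.some.inj hu)
          · exact PolyVec.D3₂ (pw _) (au _) (pu _ h)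
        · refine AffCond.lt (IsAff.const 0) (IsAff.poly_mul (PolyFun.const _) ?_)
          by_cases h : u = co none
          · refine PolyVec.D3₂ (pw _) (au _) (pu _ ?_)
            rintro rfl
            subst h
            exact h3 (Option.some.inj (hu.symm.trans hv))
          · exact PolyVec.D3₃ (pw _) (pu _ h) (au _)
      · exact AffCond.lt (IsAff.const 0) (AffVec.dot pψ (au _))
    · have hV : (vecs (W fun k => x (.inl k))
          (fun l c => Sum.elim x y (optionEquiv κ Λ (.inr (l, c)))) (b fun k => x (.inl k))) =
          V x y := by
        funext i
        rcases i with a | (_ | l) | j <;> rfl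
      constructor
      · intro h
        refine ⟨?_, ?_⟩
        · have := towerSet_mono some h
          convert this using 1
          funext i
          rcases i with k | ⟨l, c⟩ <;> rfl
        · obtain ⟨-, h2, h3⟩ := h
          rw [← hV]
          refine ⟨h2, h3⟩
      · rintro ⟨h1, h2, h3⟩
        refine ⟨h1.1, ?_, ?_⟩
        · exact hV.symm ▸ h2
        · rw [← hV] at h3; exact h3
    · obtain ⟨h1, h2, h3⟩ := hx
      obtain ⟨c₀, k1, k2⟩ := exists_new_color hP (hS _ h1) h2
      refine ⟨c₀, k1, ?_⟩
      rintro (_ | l)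
      · exact k2
      · exact h3 l

end Tower

/-! ### Points and lines of four pencils -/

section Pencils

/-- Four pencils of lines in the plane: vertical lines, horizontal lines, lines through the
origin, and lines of slope one. -/
inductive Pencil
  | X | Y | R | D
  deriving DecidableEq

namespace Pencil

/-- The side of the line with parameter `θ` on which the point `(x, y)` lies. -/
def ev : Pencil → ℝ → ℝ → ℝ → ℝ
  | X, θ, x, _ => x - θ
  | Y, θ, _, y => y - θ
  | R, θ, x, y => y - θ * x
  | D, θ, x, y => y - x - θ

/-- The parameter of the line through the point `(x, y)`. -/
def val : Pencil → ℝ → ℝ → ℝ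
  | X, x, _ => x
  | Y, _, y => y
  | R, x, y => y / x
  | D, x, y => y - x

/-- A lower bound for the parameters of the points with `0 < x < y`. -/
def lb : Pencil → ℝ
  | R => 1
  | _ => 0

lemma lb_lt_val (a : Pencil) {x y : ℝ} (hx : 0 < x) (hxy : x < y) : a.lb < a.val x y := by
  cases a
  · exact hx
  · exact hx.trans hxy
  · exact (one_lt_div hx).2 hxy
  · exact sub_pos.2 hxy

lemma ev_pos (a : Pencil) {θ x y : ℝ} (hx : 0 < x) : 0 < a.ev θ x y ↔ θ < a.val x y := by
  cases a
  · exact sub_pos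
  · exact sub_pos
  · exact sub_pos.trans (lt_div_iff₀ hx).symm
  · exact sub_pos

lemma ev_neg (a : Pencil) {θ x y : ℝ} (hx : 0 < x) : a.ev θ x y < 0 ↔ a.val x y < θ := by
  cases a
  · exact sub_neg
  · exact sub_neg
  · exact sub_neg.trans (div_lt_iff₀ hx).symm
  · exact sub_neg

lemma ev_zero (a : Pencil) {θ x y : ℝ} (hx : 0 < x) : a.ev θ x y = 0 ↔ θ = a.val x y := by
  have h1 := a.ev_pos (θ := θ) (y := y) hx
  have h2 := a.ev_neg (θ := θ) (y := y) hx
  rcases lt_trichotomy θ (a.val x y) with h | h | h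
  · exact iff_of_false (h1.2 h).ne' h.ne
  · refine iff_of_true (le_antisymm (not_lt.1 fun h' => ?_) (not_lt.1 fun h' => ?_)) h
    · exact (h1.1 h').ne h
    · exact (h2.1 h').ne' h
  · exact iff_of_false (h2.2 h).ne h.ne'

lemma isAff_ev {ι κ : Type} [Finite κ] (a : Pencil) {θ x y : (ι → ℝ) → (κ → ℝ) → ℝ}
    (hθ : IsAff θ) {p q : (ι → ℝ) → ℝ} (hp : PolyFun p) (hq : PolyFun q)
    (hx : ∀ u v, x u v = p u) (hy : ∀ u v, y u v = q u) :
    IsAff fun u v => a.ev (θ u v) (x u v) (y u v) := by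
  simp only [hx, hy]
  cases a
  · exact (IsAff.of_poly hp).sub hθ
  · exact (IsAff.of_poly hq).sub hθ
  · exact (IsAff.of_poly hq).sub (hθ.mul_poly hp)
  · exact ((IsAff.of_poly hq).sub (IsAff.of_poly hp)).sub hθ

lemma isAff_ev' {ι κ : Type} [Finite κ] (a : Pencil) {θ x y : (ι → ℝ) → (κ → ℝ) → ℝ}
    {p : (ι → ℝ) → ℝ} (hp : PolyFun p) (hθ : ∀ u v, θ u v = p u) (hx : IsAff x) (hy : IsAff y) :
    IsAff fun u v => a.ev (θ u v) (x u v) (y u v) := by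
  simp only [hθ]
  cases a
  · exact hx.sub (IsAff.of_poly hp)
  · exact hy.sub (IsAff.of_poly hp)
  · exact hy.sub (IsAff.poly_mul hp hx)
  · exact (hy.sub hx).sub (IsAff.of_poly hp)

end Pencil

/-- Prescribed pencils for lines, and prescribed sides for points and lines. -/
structure LineSys (Λ J : Type) where
  ty : Λ → Pencil
  sg : Λ → J → SignType

variable {Λ J : Type}

/-- The configurations of lines and points above the diagonal which lie as prescribed. -/
def LineSys.space (L : LineSys Λ J) : Set (Λ ⊕ J × Bool → ℝ) :=
  {z | (∀ j, 0 < z (.inr (j, false)) ∧ z (.inr (j, false)) < z (.inr (j, true))) ∧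
    (∀ l, (L.ty l).lb < z (.inl l)) ∧
    ∀ l j, SignType.sign ((L.ty l).ev (z (.inl l)) (z (.inr (j, false))) (z (.inr (j, true)))) =
      L.sg l j}

/-- The configurations of points which are ordered compatibly with `L`. -/
def LineSys.points (L : LineSys Λ J) : Set (J × Bool → ℝ) :=
  {z | (∀ j, 0 < z (j, false) ∧ z (j, false) < z (j, true)) ∧
    ∀ l j k, L.sg l j = -1 → L.sg l k = 1 →
      (L.ty l).val (z (j, false)) (z (j, true)) < (L.ty l).val (z (k, false)) (z (k, true))}

lemma SE.points_space [Finite Λ] [Finite J] (L : LineSys Λ J) (h0 : ∀ l j, L.sg l j ≠ 0) :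
    SE L.points L.space := by
  have := Fintype.ofFinite J
  refine SE.fiber (Equiv.sumComm _ _) (fun x θ => (∀ l, (L.ty l).lb < θ l) ∧
    ∀ l j, SignType.sign ((L.ty l).ev (θ l) (x (j, false)) (x (j, true))) = L.sg l j) ?_ ?_ ?_
  · refine AffCond.and (AffCond.all fun l => ?_) (AffCond.all fun l => AffCond.all fun j => ?_)
    · exact AffCond.lt (IsAff.const _) (IsAff.fib l)
    · exact AffCond.sign _ (Pencil.isAff_ev _ (IsAff.fib l) (PolyFun.coord _) (PolyFun.coord _)
        (fun _ _ => rfl) (fun _ _ => rfl))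
  · intro x θ
    constructor
    · rintro ⟨h1, h2, h3⟩
      refine ⟨⟨h1, fun l j k hj hk => ?_⟩, h2, h3⟩
      have e1 := h3 l j
      have e2 := h3 l k
      rw [hj, sign_eq_neg_one_iff, Pencil.ev_neg _ (h1 j).1] at e1
      rw [hk, sign_eq_one_iff, Pencil.ev_pos _ (h1 k).1] at e2
      exact e1.trans e2
    · rintro ⟨⟨h1, -⟩, h2, h3⟩
      exact ⟨h1, h2, h3⟩
  · rintro x ⟨h1, h2⟩
    have key : ∀ l, ∃ θ, (L.ty l).lb < θ ∧ ∀ j,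
        SignType.sign ((L.ty l).ev θ (x (j, false)) (x (j, true))) = L.sg l j := by
      intro l
      classical
      obtain ⟨θ, t1, t2⟩ := Order.exists_between_finsets
        (lo := insert (L.ty l).lb ((Finset.univ.filter fun j => L.sg l j = -1).image fun j =>
          (L.ty l).val (x (j, false)) (x (j, true))))
        (hi := (Finset.univ.filter fun j => L.sg l j = 1).image fun j =>
          (L.ty l).val (x (j, false)) (x (j, true))) (by
        intro s hs t ht
        simp only [Finset.mem_insert, Finset.mem_image, Finset.mem_filter, Finset.mem_univ,
          true_and] at hs ht
        obtain ⟨k, hk, rfl⟩ := ht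
        rcases hs with rfl | ⟨j, hj, rfl⟩
        · exact Pencil.lb_lt_val _ (h1 k).1 (h1 k).2
        · exact h2 l j k hj hk)
      refine ⟨θ, t1 _ (Finset.mem_insert_self _ _), fun j => ?_⟩
      rcases h : L.sg l j with _ | _ | _
      · exact absurd h (h0 l j)
      · refine sign_neg ((Pencil.ev_neg _ (h1 j).1).2 (t1 _ ?_))
        exact Finset.mem_insert_of_mem (Finset.mem_image.2 ⟨j, by simpa using h, rfl⟩)
      · refine sign_pos ((Pencil.ev_pos _ (h1 j).1).2 (t2 _ ?_))
        exact Finset.mem_image.2 ⟨j, by simpa using h, rfl⟩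
    choose θ h3 h4 using key
    exact ⟨θ, h3, h4⟩

end Pencils

/-! ### The pattern of a rich system of points and lines -/

section Whites

/-- Five white vectors, the first three of which are the coordinate vectors. -/
abbrev White := Fin 3 ⊕ Bool

namespace White

/-- The pencil of lines through a white vector. -/
def pen : White → Pencil := Sum.elim ![.Y, .X, .R] fun _ => .D

/-- The orientation of the pencil of a white vector. -/
def orient : White → SignType := Sum.elim ![1, -1, -1] fun s => if s then -1 else 1

/-- Model vectors. -/
def model : White → Fin 3 → ℤ :=
  Sum.elim (fun i j => if i = j then 1 else 0) fun s => if s then ![-1, -1, 1] else ![2, 1, 1]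

/-- Integral determinants. -/
def det (u v w : Fin 3 → ℤ) : ℤ :=
  u 0 * (v 1 * w 2 - v 2 * w 1) - u 1 * (v 0 * w 2 - v 2 * w 0) + u 2 * (v 0 * w 1 - v 1 * w 0)

/-- Orientation of two white vectors and a black vector. -/
def om (a a' : White) : SignType := if det a.model a'.model ![1, 2, 3] < 0 then -1 else 1

/-- Orientation of three white vectors. -/
def chi (a a' a'' : White) : SignType := if det a.model a'.model a''.model < 0 then -1 else 1

lemma om_cases (a a' : White) : om a a' = 1 ∨ om a a' = -1 := by
  unfold om
  split_ifs <;> simp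

lemma chi_cases (a a' a'' : White) : chi a a' a'' = 1 ∨ chi a a' a'' = -1 := by
  unfold chi
  split_ifs <;> simp

lemma orient_cases : ∀ a : White, a.orient = 1 ∨ a.orient = -1 := by decide

lemma om_anti : ∀ a a' : White, a ≠ a' → om a' a = - om a a' := by decide

set_option maxRecDepth 10000 in
lemma chi_rot : ∀ x y z : White, x ≠ y → x ≠ z → y ≠ z → chi y z x = chi x y z := by decide +kernel

set_option maxRecDepth 10000 in
lemma chi_swap : ∀ x y z : White, x ≠ y → x ≠ z → y ≠ z → chi y x z = - chi x y z := by
  decide +kernel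

set_option maxRecDepth 10000 in
lemma not_all : ∀ x y z : White, x ≠ y → x ≠ z → y ≠ z → om x y = - chi x y z →
    om y z = - chi x y z → om z x ≠ - chi x y z := by decide +kernel

set_option maxRecDepth 10000 in
lemma white_white : ∀ a a' : White, a ≠ a' →
    (∃ x, x ≠ a ∧ x ≠ a' ∧ om x a = om a a' ∧ om a' x = om a a' ∧ chi x a a' = om a a') ∨
    (om a a' = - a.orient ∧ om a' a = a'.orient) ∨
    (om a a' = a.orient ∧ om a' a = - a'.orient) := by decide +kernel

lemma white_color : ∀ a h : White, a ≠ h → om h a = - h.orient → - om a h = a.orient →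
    (h.pen ≠ .X ∧ a.pen ≠ .X ∧ h.pen ≠ a.pen) ∨ h.pen = a.pen := by decide +kernel

end White

variable {Λ J : Type}

/-- Conditions on a system of points and lines ensuring that its pattern is good. -/
structure LineSys.Rich (L : LineSys Λ J) : Prop where
  ne_zero : ∀ l j, L.sg l j ≠ 0
  low : ∃ j, ∀ l, L.sg l j = -1
  high : ∃ j₂, (∀ l, L.sg l j₂ = 1) ∧ ∀ a, ∃ l, L.ty l = a ∧ ∀ j, j ≠ j₂ → L.sg l j = -1
  mixed : ∀ t a, t ≠ .X → a ≠ .X → t ≠ a → ∀ l, L.ty l = t →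
    ∃ j, L.sg l j = -1 ∧ ∃ l', L.ty l' = a ∧ L.sg l' j = 1

/-- Each line occurs as a coloured vector for every white vector of its type. -/
abbrev LineSys.Col (L : LineSys Λ J) : Type := {q : Λ × White // L.ty q.1 = q.2.pen}

/-- The pattern of a system of points and lines. -/
def LineSys.pattern (L : LineSys Λ J) : Pattern White L.Col J where
  home l := l.1.2
  om a a' := (White.om a a' : ℝ)
  chi a a' a'' := (White.chi a a' a'' : ℝ)
  sg l j := ((l.1.2.orient * L.sg l.1.1 j : SignType) : ℝ)

lemma signType_cast_inj {s t : SignType} : (s : ℝ) = t ↔ s = t := by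
  cases s <;> cases t <;> simp <;> norm_num

lemma signType_cast_one {s : SignType} : (s : ℝ) = 1 ↔ s = 1 := by
  cases s <;> simp; norm_num

lemma signType_cast_neg_one {s : SignType} : (s : ℝ) = -1 ↔ s = -1 := by
  cases s <;> simp ; norm_num

lemma signType_cast_cases {s : SignType} (h : s = 1 ∨ s = -1) : (s : ℝ) = 1 ∨ (s : ℝ) = -1 := by
  rcases h with rfl | rfl <;> simp

namespace LineSys.Rich

variable {L : LineSys Λ J} (hL : L.Rich)
include hL

lemma sg_cases (l : Λ) (j : J) : L.sg l j = 1 ∨ L.sg l j = -1 := by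
  have := hL.ne_zero l j
  revert this
  cases L.sg l j <;> simp

lemma exists_line (a : Pencil) : ∃ l, L.ty l = a := by
  obtain ⟨_, _, h⟩ := hL.high
  obtain ⟨l, hl, -⟩ := h a
  exact ⟨l, hl⟩

lemma exists_side (a a' : Pencil) (s : SignType) (hs : s = 1 ∨ s = -1) (j : J) :
    (∃ l, L.ty l = a ∧ L.sg l j = s) ∨ ∃ l, L.ty l = a' ∧ L.sg l j = -s := by
  obtain ⟨j₂, h1, h2⟩ := hL.high
  obtain ⟨l, rfl, h3⟩ := h2 a
  obtain ⟨l', rfl, h4⟩ := h2 a'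
  by_cases hj : j = j₂
  · subst hj
    rcases hs with rfl | rfl
    · exact .inl ⟨l, rfl, h1 _⟩
    · exact .inr ⟨l', rfl, by simpa using h1 _⟩
  · rcases hs with rfl | rfl
    · exact .inr ⟨l', rfl, h4 _ hj⟩
    · exact .inl ⟨l, rfl, h3 _ hj⟩

end LineSys.Rich

lemma LineSys.Rich.good {L : LineSys Λ J} (hL : L.Rich) : L.pattern.Good where
  om_cases a a' := signType_cast_cases (White.om_cases a a')
  chi_cases a a' a'' := signType_cast_cases (White.chi_cases a a' a'')
  sg_cases l j := by
    refine signType_cast_cases ?_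
    rcases l.1.2.orient_cases with h | h <;> rcases hL.sg_cases l.1.1 j with h' | h' <;>
      simp [h, h']
  om_anti a a' h := by
    change (White.om a' a : ℝ) = - (White.om a a' : ℝ)
    rw [White.om_anti a a' h, SignType.coe_neg]
  chi_rot x y z h1 h2 h3 := by
    change (White.chi y z x : ℝ) = (White.chi x y z : ℝ)
    rw [White.chi_rot x y z h1 h2 h3]
  chi_swap x y z h1 h2 h3 := by
    change (White.chi y x z : ℝ) = - (White.chi x y z : ℝ)
    rw [White.chi_swap x y z h1 h2 h3, SignType.coe_neg]
  not_all x y z h1 h2 h3 := by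
    change (White.om x y : ℝ) = - (White.chi x y z : ℝ) → (White.om y z : ℝ) =
      - (White.chi x y z : ℝ) → (White.om z x : ℝ) = - (White.chi x y z : ℝ) → False
    rw [← SignType.coe_neg, signType_cast_inj, signType_cast_inj, signType_cast_inj]
    exact White.not_all x y z h1 h2 h3
  exists_color a := by
    obtain ⟨l, hl⟩ := hL.exists_line a.pen
    exact ⟨⟨(l, a), hl⟩, rfl⟩
  exists_other := by decide
  both_sides l s hs := by
    obtain ⟨j₁, h1⟩ := hL.low
    obtain ⟨j₂, h2, -⟩ := hL.high
    change ∃ j, ((l.1.2.orient * L.sg l.1.1 j : SignType) : ℝ) = s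
    rcases l.1.2.orient_cases with h | h <;> rcases hs with rfl | rfl <;> rw [h]
    · exact ⟨j₂, by simp [h2]⟩
    · exact ⟨j₁, by simp [h1]⟩
    · exact ⟨j₁, by simp [h1]⟩
    · exact ⟨j₂, by simp [h2]⟩
  white_white a a' j h := by
    change (∃ x, x ≠ a ∧ x ≠ a' ∧ (White.om x a : ℝ) = (White.om a a' : ℝ) ∧
      (White.om a' x : ℝ) = (White.om a a' : ℝ) ∧ (White.chi x a a' : ℝ) = (White.om a a' : ℝ)) ∨
      (∃ l : L.Col, l.1.2 = a ∧ ((l.1.2.orient * L.sg l.1.1 j : SignType) : ℝ) =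
        (White.om a a' : ℝ)) ∨
      ∃ l : L.Col, l.1.2 = a' ∧ ((l.1.2.orient * L.sg l.1.1 j : SignType) : ℝ) =
        (White.om a' a : ℝ)
    simp only [signType_cast_inj]
    rcases White.white_white a a' h with h | ⟨h1, h2⟩ | ⟨h1, h2⟩
    · exact .inl h
    · rcases hL.exists_side a.pen a'.pen (-1) (by simp) j with ⟨l, h3, h4⟩ | ⟨l, h3, h4⟩
      · exact .inr (.inl ⟨⟨(l, a), h3⟩, rfl, by simp [h1, h4]⟩)
      · exact .inr (.inr ⟨⟨(l, a'), h3⟩, rfl, by simp [h2, h4]⟩)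
    · rcases hL.exists_side a.pen a'.pen 1 (by simp) j with ⟨l, h3, h4⟩ | ⟨l, h3, h4⟩
      · exact .inr (.inl ⟨⟨(l, a), h3⟩, rfl, by simp [h1, h4]⟩)
      · exact .inr (.inr ⟨⟨(l, a'), h3⟩, rfl, by simp [h2, h4]⟩)
  white_color a l j h := by
    obtain ⟨⟨q, w⟩, hq⟩ := l
    change a ≠ w at h
    change L.ty q = w.pen at hq
    change (∃ l₀ : L.Col, l₀.1.2 = a ∧ ((l₀.1.2.orient * L.sg l₀.1.1 j : SignType) : ℝ) =
        - (White.om a w : ℝ)) ∨ ((w.orient * L.sg q j : SignType) : ℝ) = (White.om w a : ℝ) ∨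
      ∃ j₂, ((w.orient * L.sg q j₂ : SignType) : ℝ) = (White.om w a : ℝ) ∧
        ∃ l₀ : L.Col, l₀.1.2 = a ∧ ((l₀.1.2.orient * L.sg l₀.1.1 j₂ : SignType) : ℝ) =
          - (White.om a w : ℝ)
    rw [← SignType.coe_neg]
    simp only [signType_cast_inj]
    have e1 : White.om w a = w.orient ∨ White.om w a = - w.orient := by
      rcases White.om_cases w a with h | h <;> rcases w.orient_cases with h' | h' <;> simp [h, h']
    have e2 : - White.om a w = a.orient ∨ - White.om a w = - a.orient := by
      rcases White.om_cases a w with h | h <;> rcases a.orient_cases with h' | h' <;> simp [h, h']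
    obtain ⟨j₁, h1⟩ := hL.low
    obtain ⟨j₂, h2, h3⟩ := hL.high
    obtain ⟨k, hk, hk'⟩ := h3 a.pen
    rcases e1 with e1 | e1 <;> rcases e2 with e2 | e2
    · exact .inr (.inr ⟨j₂, by simp [h2, e1], ⟨⟨(k, a), hk⟩, rfl, by simp [h2, e2]⟩⟩)
    · by_cases hj : j = j₂
      · exact .inr (.inl (by simp [hj, h2, e1]))
      · exact .inl ⟨⟨(k, a), hk⟩, rfl, by simp [hk' j hj, e2]⟩
    · rcases White.white_color a w h e1 e2 with ⟨g1, g2, g3⟩ | g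
      · obtain ⟨i, g4, l', g5, g6⟩ := hL.mixed _ _ g1 g2 g3 q hq
        exact .inr (.inr ⟨i, by simp [g4, e1], ⟨⟨(l', a), g5⟩, rfl, by simp [g6, e2]⟩⟩)
      · rcases hL.sg_cases q j with hs | hs
        · exact .inl ⟨⟨(q, a), hq.trans g⟩, rfl, by simp [hs, e2]⟩
        · exact .inr (.inl (by simp [hs, e1]))
    · exact .inr (.inr ⟨j₁, by simp [h1, e1], ⟨⟨(k, a), hk⟩, rfl, by simp [h1, e2]⟩⟩)

end Whites

/-! ### From rich systems of points and lines to polytopes -/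

section Stages

variable {Λ J : Type}

/-- In the pencil of `w`, the black vectors are ordered compatibly with the lines of type `t`. -/
def LineSys.Ordered (L : LineSys Λ J) (t : Pencil) (w : Fin 3 → ℝ) (b : J → Fin 3 → ℝ) : Prop :=
  ∀ l j k, L.ty l = t → L.sg l j = -1 → L.sg l k = 1 → 0 < D3 w (b j) (b k)

/-- Conditions on the black vectors and the direction of the line through the last two white
vectors. -/
structure LineSys.Blacks (L : LineSys Λ J) (p q : ℝ) (b : J → Fin 3 → ℝ) : Prop where
  p_pos : 0 < p
  q_pos : 0 < q
  b_pos : ∀ j c, 0 < b j c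
  diag : ∀ j, 0 < p * b j 1 - q * b j 0
  x_ord : L.Ordered .X ![0, 1, 0] b
  y_ord : L.Ordered .Y ![-1, 0, 0] b
  r_ord : L.Ordered .R ![0, 0, 1] b
  d_ord : L.Ordered .D ![-p, -q, 0] b

/-- Conditions on the fourth white vector. -/
structure LineSys.Fourth (L : LineSys Λ J) (p q : ℝ) (b : J → Fin 3 → ℝ) (u : Fin 3 → ℝ) :
    Prop where
  pos : ∀ c, 0 < u c
  pq : 0 < q * u 0 - p * u 1
  h02 : ∀ j, 0 < u 0 * b j 2 - u 2 * b j 0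
  h12 : ∀ j, 0 < u 1 * b j 2 - u 2 * b j 1
  h01 : ∀ j, 0 < u 0 * b j 1 - u 1 * b j 0
  ord : L.Ordered .D (-u) b

/-- Conditions on the fifth white vector. -/
structure LineSys.Fifth (L : LineSys Λ J) (p q : ℝ) (b : J → Fin 3 → ℝ) (u n : Fin 3 → ℝ) :
    Prop where
  neg0 : n 0 < 0
  neg1 : n 1 < 0
  pos2 : 0 < n 2
  p_eq : p = n 2 * u 0 - u 2 * n 0
  q_eq : q = n 2 * u 1 - u 2 * n 1
  h01 : ∀ j, 0 < n 1 * b j 0 - n 0 * b j 1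
  ord : L.Ordered .D n b

/-- The five white vectors. -/
def whites (u n : Fin 3 → ℝ) : White → Fin 3 → ℝ :=
  Sum.elim (fun i => Pi.single i 1) fun s => if s then n else u

/-- Coordinates for the black vectors and two numbers. -/
abbrev BIdx (J : Type) : Type := Bool ⊕ J × Fin 3

/-- The black vectors. -/
def blackOf (x : BIdx J → ℝ) (j : J) (c : Fin 3) : ℝ := x (.inr (j, c))

variable (L : LineSys Λ J)

/-- The space of black vectors. -/
def LineSys.blackSet : Set (BIdx J → ℝ) :=
  {x | L.Blacks (x (.inl false)) (x (.inl true)) (blackOf x)}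

/-- The space of black vectors and a white one. -/
def LineSys.fourthSet : Set (BIdx J ⊕ Fin 3 → ℝ) :=
  {z | (fun i => z (.inl i)) ∈ L.blackSet ∧
    L.Fourth (z (.inl (.inl false))) (z (.inl (.inl true))) (blackOf fun i => z (.inl i))
      fun c => z (.inr c)}

/-- The space of black vectors and two white ones. -/
def LineSys.fifthSet : Set ((BIdx J ⊕ Fin 3) ⊕ Fin 3 → ℝ) :=
  {z | (fun i => z (.inl i)) ∈ L.fourthSet ∧
    L.Fifth (z (.inl (.inl (.inl false)))) (z (.inl (.inl (.inl true))))
      (blackOf fun i => z (.inl (.inl i))) (fun c => z (.inl (.inr c))) fun c => z (.inr c)}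

/-- The space of black and white vectors and a functional. -/
def LineSys.baseSet : Set (((BIdx J ⊕ Fin 3) ⊕ Fin 3) ⊕ Fin 3 → ℝ) :=
  {z | (fun i => z (.inl i)) ∈ L.fifthSet ∧
    (∀ a, 0 < (fun c => z (.inr c)) ⬝ᵥ
      whites (fun c => z (.inl (.inl (.inr c)))) (fun c => z (.inl (.inr c))) a) ∧
    ∀ j, 0 < (fun c => z (.inr c)) ⬝ᵥ blackOf (fun i => z (.inl (.inl (.inl i)))) j}

variable {L}

lemma eventually_small {a : ℝ} (ha : 0 < a) (b : ℝ) :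
    ∀ᶠ ε in nhdsWithin (0 : ℝ) (Set.Ioi 0), 0 < a + ε * b := by
  have : Filter.Tendsto (fun ε : ℝ => a + ε * b) (nhdsWithin 0 (Set.Ioi 0)) (nhds (a + 0 * b)) :=
    (Continuous.tendsto (by fun_prop) 0).mono_left nhdsWithin_le_nhds
  exact this.eventually_const_lt (by simpa using ha)

lemma eventually_small_pos : ∀ᶠ ε in nhdsWithin (0 : ℝ) (Set.Ioi 0), 0 < ε :=
  self_mem_nhdsWithin

lemma D3_add_smul (u u' v w : Fin 3 → ℝ) (s : ℝ) :
    D3 (u + s • u') v w = D3 u v w + s * D3 u' v w := by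
  simp [D3]; ring

lemma LineSys.Ordered.eventually [Finite Λ] [Finite J] {t : Pencil} {w : Fin 3 → ℝ}
    {b : J → Fin 3 → ℝ} (h : L.Ordered t w b) (w' : Fin 3 → ℝ) :
    ∀ᶠ ε in nhdsWithin (0 : ℝ) (Set.Ioi 0), L.Ordered t (w + ε • w') b := by
  simp only [LineSys.Ordered, D3_add_smul, Filter.eventually_all]
  exact fun l j k h1 h2 h3 => eventually_small (h l j k h1 h2 h3) _

lemma LineSys.Blacks.exists_fourth [Finite Λ] [Finite J] {p q : ℝ} {b : J → Fin 3 → ℝ}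
    (h : L.Blacks p q b) : ∃ u, L.Fourth p q b u := by
  have e0 := eventually_small_pos
  have e1 : ∀ᶠ ε in nhdsWithin (0 : ℝ) (Set.Ioi 0), ∀ j, 0 < p * b j 2 + ε * (b j 2 - b j 0) :=
    Filter.eventually_all.2 fun j => eventually_small (mul_pos h.p_pos (h.b_pos _ _)) _
  have e2 : ∀ᶠ ε in nhdsWithin (0 : ℝ) (Set.Ioi 0), ∀ j, 0 < q * b j 2 + ε * (- b j 1) :=
    Filter.eventually_all.2 fun j => eventually_small (mul_pos h.q_pos (h.b_pos _ _)) _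
  have e3 := h.d_ord.eventually ![-1, 0, -1]
  obtain ⟨ε, h0, h1, h2, h3⟩ := (e0.and (e1.and (e2.and e3))).exists
  refine ⟨![p + ε, q, ε], ?_, ?_, fun j => ?_, fun j => ?_, fun j => ?_, ?_⟩
  · have := h.p_pos
    have := h.q_pos
    intro c
    fin_cases c <;> simp <;> linarith
  · have := mul_pos h0 h.q_pos
    simp
    linarith
  · have := h1 j
    simp
    linarith
  · have := h2 j
    simp
    linarith
  · have := h.diag j
    have := mul_pos h0 (h.b_pos j 1)
    simp
    linarith
  · convert h3 using 1
    ext c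
    fin_cases c <;> simp
    ring

lemma LineSys.Fourth.exists_fifth [Finite Λ] [Finite J] {p q : ℝ} {b : J → Fin 3 → ℝ}
    {u : Fin 3 → ℝ} (h : L.Blacks p q b) (hu : L.Fourth p q b u) : ∃ n, L.Fifth p q b u n := by
  have e0 := eventually_small_pos
  have e1 := eventually_small h.p_pos (- u 0)
  have e2 := eventually_small h.q_pos (- u 1)
  have e3 : ∀ᶠ ε in nhdsWithin (0 : ℝ) (Set.Ioi 0), ∀ j, 0 < (p * b j 1 - q * b j 0) +
      ε * (u 1 * b j 0 - u 0 * b j 1) :=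
    Filter.eventually_all.2 fun j => eventually_small (h.diag j) _
  have e4 := h.d_ord.eventually u
  obtain ⟨ε, h0, h1, h2, h3, h4⟩ := (e0.and (e1.and (e2.and (e3.and e4)))).exists
  have hγ := hu.pos 2
  refine ⟨![(ε * u 0 - p) / u 2, (ε * u 1 - q) / u 2, ε], ?_, ?_, h0, ?_, ?_, fun j => ?_, ?_⟩
  · exact div_neg_of_neg_of_pos (by linarith) hγ
  · exact div_neg_of_neg_of_pos (by linarith) hγ
  · simp
    field_simp
    ring
  · simp
    field_simp
    ring
  · have := div_pos (h3 j) hγ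
    refine lt_of_lt_of_eq this ?_
    simp
    field_simp
    ring
  · intro l j k e5 e6 e7
    have := div_pos (h4 l j k e5 e6 e7) hγ
    refine lt_of_lt_of_eq this ?_
    simp [D3]
    field_simp
    ring

lemma LineSys.exists_functional [Finite J] {p q : ℝ} {b : J → Fin 3 → ℝ} {u n : Fin 3 → ℝ}
    (h : L.Blacks p q b) (hu : L.Fourth p q b u) (hn : L.Fifth p q b u n) :
    ∃ ψ : Fin 3 → ℝ, (∀ a, 0 < ψ ⬝ᵥ whites u n a) ∧ ∀ j, 0 < ψ ⬝ᵥ b j := by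
  have e0 := Filter.eventually_gt_atTop (0 : ℝ)
  have e1 := eventually_affine_pos hn.pos2 (n 0 + n 1)
  have e2 := eventually_affine_pos (hu.pos 2) (u 0 + u 1)
  have e3 : ∀ᶠ s in Filter.atTop, ∀ j, 0 < b j 2 * s + (b j 0 + b j 1) :=
    Filter.eventually_all.2 fun j => eventually_affine_pos (h.b_pos j 2) _
  obtain ⟨s, h0, h1, h2, h3⟩ := (e0.and (e1.and (e2.and e3))).exists
  refine ⟨![1, 1, s], ?_, fun j => ?_⟩
  · rintro (i | i)
    · fin_cases i <;> simp [whites, h0]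
    · cases i
      · simp [whites, dotProduct, Fin.sum_univ_three]
        linarith
      · simp [whites, dotProduct, Fin.sum_univ_three]
        linarith
  · have := h3 j
    simp [dotProduct, Fin.sum_univ_three]
    linarith

lemma D3_poly₁ {ι κ : Type} [Finite κ] {u : (ι → ℝ) → (κ → ℝ) → Fin 3 → ℝ} {v w : (ι → ℝ) → Fin 3 → ℝ}
    (hu : AffVec u) (hv : ∀ c, PolyFun fun x => v x c) (hw : ∀ c, PolyFun fun x => w x c) :
    IsAff fun x y => D3 (u x y) (v x) (w x) := by
  refine IsAff.add (IsAff.sub ?_ ?_) ?_ <;> refine IsAff.mul_poly (hu _) ?_ <;>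
    exact PolyFun.sub ((hv _).mul (hw _)) ((hv _).mul (hw _))

lemma LineSys.affCond_ordered {ι κ : Type} [Finite κ] [Finite Λ] [Finite J] (t : Pencil)
    {u : (ι → ℝ) → (κ → ℝ) → Fin 3 → ℝ} {b : (ι → ℝ) → J → Fin 3 → ℝ}
    (hu : AffVec u) (hb : ∀ j c, PolyFun fun x => b x j c) :
    AffCond fun x y => L.Ordered t (u x y) (b x) :=
  AffCond.all fun _ => AffCond.all fun _ => AffCond.all fun _ => AffCond.imp fun _ =>
    AffCond.imp fun _ => AffCond.imp fun _ =>
      AffCond.lt (IsAff.const 0) (D3_poly₁ hu (hb _) (hb _))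

lemma SE.blackSet_fourthSet [Finite Λ] [Finite J] : SE L.blackSet L.fourthSet := by
  refine SE.fiber (Equiv.refl _) (fun x y => L.Fourth (x (.inl false)) (x (.inl true)) (blackOf x) y)
    ?_ (fun x y => Iff.rfl) fun x hx => hx.exists_fourth
  have hy : ∀ (c : Fin 3), IsAff fun (x : BIdx J → ℝ) (y : Fin 3 → ℝ) => y c := IsAff.fib
  refine AffCond.congr (Q := fun x y => (∀ c, 0 < y c) ∧
    0 < x (.inl true) * y 0 - x (.inl false) * y 1 ∧
    (∀ j, 0 < y 0 * blackOf x j 2 - y 2 * blackOf x j 0) ∧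
    (∀ j, 0 < y 1 * blackOf x j 2 - y 2 * blackOf x j 1) ∧
    (∀ j, 0 < y 0 * blackOf x j 1 - y 1 * blackOf x j 0) ∧ L.Ordered .D (-y) (blackOf x))
    (fun x y => ⟨fun h => ⟨h.1, h.2, h.3, h.4, h.5, h.6⟩,
      fun ⟨h1, h2, h3, h4, h5, h6⟩ => ⟨h1, h2, h3, h4, h5, h6⟩⟩) ?_
  refine AffCond.and (AffCond.all fun c => ?_) (AffCond.and ?_ (AffCond.and (AffCond.all fun j => ?_)
    (AffCond.and (AffCond.all fun j => ?_) (AffCond.and (AffCond.all fun j => ?_) ?_))))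
  · exact AffCond.lt (IsAff.const 0) (hy c)
  · exact AffCond.lt (IsAff.const 0)
      (((hy 0).poly_mul (PolyFun.coord _)).sub ((hy 1).poly_mul (PolyFun.coord _)))
  iterate 3
    · exact AffCond.lt (IsAff.const 0)
        (((hy _).mul_poly (PolyFun.coord _)).sub ((hy _).mul_poly (PolyFun.coord _)))
  · exact LineSys.affCond_ordered _ (fun c => (hy c).neg) fun j c => PolyFun.coord _

lemma SE.fourthSet_fifthSet [Finite Λ] [Finite J] : SE L.fourthSet L.fifthSet := by
  refine SE.fiber (Equiv.refl _) (fun x y => L.Fifth (x (.inl (.inl false))) (x (.inl (.inl true)))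
    (blackOf fun i => x (.inl i)) (fun c => x (.inr c)) y)
    ?_ (fun x y => Iff.rfl) fun x hx => hx.2.exists_fifth hx.1
  have hy : ∀ (c : Fin 3), IsAff fun (x : BIdx J ⊕ Fin 3 → ℝ) (y : Fin 3 → ℝ) => y c := IsAff.fib
  refine AffCond.congr (Q := fun x y => y 0 < 0 ∧ y 1 < 0 ∧ 0 < y 2 ∧
    x (.inl (.inl false)) = y 2 * x (.inr 0) - x (.inr 2) * y 0 ∧
    x (.inl (.inl true)) = y 2 * x (.inr 1) - x (.inr 2) * y 1 ∧
    (∀ j, 0 < y 1 * x (.inl (.inr (j, 0))) - y 0 * x (.inl (.inr (j, 1)))) ∧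
    L.Ordered .D y (blackOf fun i => x (.inl i)))
    (fun x y => ⟨fun h => ⟨h.1, h.2, h.3, h.4, h.5, h.6, h.7⟩,
      fun ⟨h1, h2, h3, h4, h5, h6, h7⟩ => ⟨h1, h2, h3, h4, h5, h6, h7⟩⟩) ?_
  refine AffCond.and ?_ (AffCond.and ?_ (AffCond.and ?_ (AffCond.and ?_ (AffCond.and ?_
    (AffCond.and (AffCond.all fun j => ?_) ?_)))))
  · exact AffCond.lt (hy 0) (IsAff.const 0)
  · exact AffCond.lt (hy 1) (IsAff.const 0)
  · exact AffCond.lt (IsAff.const 0) (hy 2)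
  iterate 2
    · exact AffCond.eq (IsAff.base _)
        (((hy _).mul_poly (PolyFun.coord _)).sub ((hy _).poly_mul (PolyFun.coord _)))
  · exact AffCond.lt (IsAff.const 0)
      (((hy _).mul_poly (PolyFun.coord _)).sub ((hy _).mul_poly (PolyFun.coord _)))
  · exact LineSys.affCond_ordered _ hy fun j c => PolyFun.coord _

lemma PolyFun.whites {ι : Type} {u n : (ι → ℝ) → Fin 3 → ℝ} (hu : ∀ c, PolyFun fun x => u x c)
    (hn : ∀ c, PolyFun fun x => n x c) (a : White) (c : Fin 3) :
    PolyFun fun x => whites (u x) (n x) a c := by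
  rcases a with i | _ | _
  · exact PolyFun.const _
  · exact hu c
  · exact hn c

lemma SE.fifthSet_baseSet [Finite Λ] [Finite J] : SE L.fifthSet L.baseSet := by
  refine SE.fiber (Equiv.refl _) (fun x y =>
    (∀ a, 0 < y ⬝ᵥ _root_.whites (fun c => x (.inl (.inr c))) (fun c => x (.inr c)) a) ∧
    ∀ j, 0 < y ⬝ᵥ blackOf (fun i => x (.inl (.inl i))) j)
    ?_ (fun x y => Iff.rfl) fun x hx => LineSys.exists_functional hx.1.1 hx.1.2 hx.2
  have hd : ∀ v : ((BIdx J ⊕ Fin 3) ⊕ Fin 3 → ℝ) → Fin 3 → ℝ, (∀ c, PolyFun fun x => v x c) →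
      AffCond fun x (y : Fin 3 → ℝ) => 0 < y ⬝ᵥ v x := by
    intro v hv
    simp only [dotProduct, Fin.sum_univ_three]
    exact AffCond.lt (IsAff.const 0) ((((IsAff.fib 0).mul_poly (hv 0)).add
      ((IsAff.fib 1).mul_poly (hv 1))).add ((IsAff.fib 2).mul_poly (hv 2)))
  refine AffCond.and (AffCond.all fun a => ?_) (AffCond.all fun j => ?_)
  · exact hd _ fun c => PolyFun.whites (fun c => PolyFun.coord _) (fun c => PolyFun.coord _) a c
  · exact hd _ fun c => PolyFun.coord _

end Stages

/-! ### Realizing rich systems -/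

section Rich

variable {Λ J : Type} {L : LineSys Λ J}

/-- The direction dual to the pencil `t`. -/
def Pencil.dir (p q : ℝ) : Pencil → Fin 3 → ℝ
  | .X => ![0, 1, 0]
  | .Y => ![-1, 0, 0]
  | .R => ![0, 0, 1]
  | .D => ![-p, -q, 0]

lemma Pencil.val_lt_iff (t : Pencil) {p q : ℝ} (hp : 0 < p) (hq : 0 < q) {v w : Fin 3 → ℝ}
    (hv : ∀ c, 0 < v c) (hw : ∀ c, 0 < w c) :
    t.val (q * v 0 / (p * v 2)) (v 1 / v 2) < t.val (q * w 0 / (p * w 2)) (w 1 / w 2) ↔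
      0 < D3 (t.dir p q) v w := by
  have v0 := hv 0
  have v1 := hv 1
  have v2 := hv 2
  have w0 := hw 0
  have w1 := hw 1
  have w2 := hw 2
  have key : ∀ x y z s : ℝ, 0 < s → s * (y - x) = z → (x < y ↔ 0 < z) := by
    rintro x y z s hs rfl
    rw [mul_pos_iff_of_pos_left hs, sub_pos]
  cases t
  · refine key _ _ _ (p * v 2 * w 2 / q) (by positivity) ?_
    simp only [Pencil.val, Pencil.dir, D3]
    simp
    field_simp
  · refine key _ _ _ (v 2 * w 2) (by positivity) ?_
    simp only [Pencil.val, Pencil.dir, D3]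
    simp
    field_simp
  · refine key _ _ _ (v 0 * w 0 * q / p) (by positivity) ?_
    simp only [Pencil.val, Pencil.dir, D3]
    simp
    field_simp
  · refine key _ _ _ (p * v 2 * w 2) (by positivity) ?_
    simp only [Pencil.val, Pencil.dir, D3]
    simp
    field_simp
    ring

/-- The affine point belonging to a black vector. -/
def affPt (p q : ℝ) (b : J → Fin 3 → ℝ) : J × Bool → ℝ :=
  fun i => if i.2 then b i.1 1 / b i.1 2 else q * b i.1 0 / (p * b i.1 2)

lemma LineSys.blacks_iff {p q : ℝ} (hp : 0 < p) (hq : 0 < q) {b : J → Fin 3 → ℝ}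
    (hb : ∀ j c, 0 < b j c) : L.Blacks p q b ↔ affPt p q b ∈ L.points := by
  have key : ∀ t, L.Ordered t (t.dir p q) b ↔ ∀ l j k, L.ty l = t → L.sg l j = -1 →
      L.sg l k = 1 → t.val (affPt p q b (j, false)) (affPt p q b (j, true)) <
        t.val (affPt p q b (k, false)) (affPt p q b (k, true)) := by
    intro t
    refine forall_congr' fun l => forall_congr' fun j => forall_congr' fun k => ?_
    rw [← t.val_lt_iff hp hq (hb j) (hb k)]
    simp [affPt]
  have hd : ∀ j, 0 < p * b j 1 - q * b j 0 ↔ affPt p q b (j, false) < affPt p q b (j, true) := by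
    intro j
    have b2 := hb j 2
    simp only [affPt, Bool.false_eq_true, if_false, if_true]
    rw [div_lt_div_iff₀ (by positivity) b2, sub_pos]
    constructor
    · intro h
      nlinarith
    · intro h
      refine lt_of_mul_lt_mul_right (a := b j 2) ?_ b2.le
      linarith
  constructor
  · intro h
    refine ⟨fun j => ⟨?_, (hd j).1 (h.diag j)⟩, fun l j k => ?_⟩
    · have := hb j 0
      have := hb j 2
      simp only [affPt, Bool.false_eq_true, if_false]
      positivity
    · have h1 := (key .X).1 h.x_ord l j k
      have h2 := (key .Y).1 h.y_ord l j k
      have h3 := (key .R).1 h.r_ord l j k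
      have h4 := (key .D).1 h.d_ord l j k
      generalize L.ty l = t at *
      cases t
      exacts [h1 rfl, h2 rfl, h3 rfl, h4 rfl]
  · rintro ⟨h1, h2⟩
    have h3 : ∀ t, L.Ordered t (t.dir p q) b := fun t => (key t).2 fun l j k h => h ▸ h2 l j k
    exact ⟨hp, hq, hb, fun j => (hd j).2 (h1 j).2, h3 .X, h3 .Y, h3 .R, h3 .D⟩

/-- The black vectors belonging to scaled points. -/
def liftPt (z : J × Bool ⊕ (Bool ⊕ J) → ℝ) : BIdx J → ℝ :=
  Sum.elim (fun s => z (.inr (.inl s))) fun i =>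
    ![z (.inr (.inl false)) * z (.inl (i.1, false)) * z (.inr (.inr i.1)) / z (.inr (.inl true)),
      z (.inl (i.1, true)) * z (.inr (.inr i.1)), z (.inr (.inr i.1))] i.2

lemma SE.points_blackSet [Finite Λ] [Finite J] : SE L.points L.blackSet := by
  have e1 : SE L.points {z : J × Bool ⊕ (Bool ⊕ J) → ℝ | (fun i => z (.inl i)) ∈ L.points ∧
      ∀ i, 0 < z (.inr i)} :=
    SE.fiber (Equiv.refl _) (fun _ y => ∀ i, 0 < y i)
      (AffCond.all fun i => AffCond.lt (IsAff.const 0) (IsAff.fib i)) (fun x y => Iff.rfl)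
      fun x _ => ⟨fun _ => 1, fun _ => one_pos⟩
  refine e1.trans (SE.rational liftPt (fun x => Sum.elim (affPt (x (.inl false)) (x (.inl true))
    (blackOf x)) (Sum.elim (fun s => x (.inl s)) fun j => x (.inr (j, 2)))) ?_ ?_ ?_ ?_ ?_ ?_)
  · rintro (s | ⟨j, c⟩)
    · exact ⟨_, _, PolyFun.coord (.inr (.inl s)), PolyFun.const 1,
        fun x _ => ⟨one_ne_zero, by simp [liftPt]⟩⟩
    · fin_cases c
      · exact ⟨_, _, ((PolyFun.coord _).mul (PolyFun.coord _)).mul (PolyFun.coord _),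
          PolyFun.coord (.inr (.inl true)), fun x hx => ⟨(hx.2 _).ne', rfl⟩⟩
      · exact ⟨_, _, (PolyFun.coord (.inl (j, true))).mul (PolyFun.coord (.inr (.inr j))),
          PolyFun.const 1, fun x _ => ⟨one_ne_zero, by simp [liftPt]⟩⟩
      · exact ⟨_, _, PolyFun.coord (.inr (.inr j)),
          PolyFun.const 1, fun x _ => ⟨one_ne_zero, by simp [liftPt]⟩⟩
  · rintro (⟨j, _ | _⟩ | s | j)
    · refine ⟨_, _, (PolyFun.coord (.inl true)).mul (PolyFun.coord (.inr (j, 0))),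
        (PolyFun.coord (.inl false)).mul (PolyFun.coord (.inr (j, 2))), fun x hx => ⟨?_, ?_⟩⟩
      · exact (mul_pos hx.p_pos (hx.b_pos j 2)).ne'
      · simp [affPt, blackOf]
    · refine ⟨_, _, PolyFun.coord (.inr (j, 1)), PolyFun.coord (.inr (j, 2)),
        fun x hx => ⟨show x (.inr (j, 2)) ≠ 0 from (hx.b_pos j 2).ne', ?_⟩⟩
      simp [affPt, blackOf]
    · exact ⟨_, _, PolyFun.coord (.inl s), PolyFun.const 1,
        fun x _ => ⟨one_ne_zero, by simp⟩⟩
    · exact ⟨_, _, PolyFun.coord (.inr (j, 2)), PolyFun.const 1,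
        fun x _ => ⟨one_ne_zero, by simp⟩⟩
  · rintro x ⟨h1, h2⟩
    have hb : ∀ j c, 0 < blackOf (liftPt x) j c := by
      intro j c
      have := (h1.1 j).1
      have := (h1.1 j).1.trans (h1.1 j).2
      have := h2 (.inl false)
      have := h2 (.inl true)
      have := h2 (.inr j)
      fin_cases c <;> simp [blackOf, liftPt] <;> positivity
    refine (LineSys.blacks_iff (h2 _) (h2 _) hb).2 ?_
    convert h1 using 1
    funext ⟨j, s⟩
    have := (h2 (.inl false)).ne'
    have := (h2 (.inl true)).ne'
    have := (h2 (.inr j)).ne'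
    cases s
    · simp [affPt, blackOf, liftPt]
      field_simp
    · simp [affPt, blackOf, liftPt]
      field_simp
  · intro x hx
    refine ⟨(LineSys.blacks_iff hx.p_pos hx.q_pos hx.b_pos).1 hx, ?_⟩
    rintro ((_ | _) | j)
    · exact hx.p_pos
    · exact hx.q_pos
    · exact hx.b_pos j 2
  · rintro x ⟨h1, h2⟩
    funext i
    rcases i with ⟨j, _ | _⟩ | s | j
    · have := (h2 (.inl false)).ne'
      have := (h2 (.inl true)).ne'
      have := (h2 (.inr j)).ne'
      simp [affPt, blackOf, liftPt]
      field_simp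
    · have := (h2 (.inr j)).ne'
      simp [affPt, blackOf, liftPt]
      field_simp
    · rfl
    · rfl
  · intro x hx
    funext i
    rcases i with s | ⟨j, c⟩
    · rfl
    · have := hx.p_pos.ne'
      have := hx.q_pos.ne'
      have : x (.inr (j, 2)) ≠ 0 := (hx.b_pos j 2).ne'
      fin_cases c
      · simp [affPt, blackOf, liftPt]
        field_simp
      · simp [affPt, blackOf, liftPt]
        field_simp
      · rfl

lemma LineSys.om_mul_D3_pos {p q : ℝ} {b : J → Fin 3 → ℝ} {u n : Fin 3 → ℝ}
    (h : L.Blacks p q b) (hu : L.Fourth p q b u) (hn : L.Fifth p q b u n) {a a' : White}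
    (ha : a ≠ a') (j : J) : 0 < (White.om a a' : ℝ) * D3 (whites u n a) (whites u n a') (b j) := by
  have b0 := h.b_pos j 0
  have b1 := h.b_pos j 1
  have b2 := h.b_pos j 2
  have u0 := hu.h02 j
  have u1 := hu.h12 j
  have u2 := hu.h01 j
  have n01 := hn.h01 j
  have n0 := mul_neg_of_neg_of_pos hn.neg0 b2
  have n1 := mul_neg_of_neg_of_pos hn.neg1 b2
  have n20 := mul_pos hn.pos2 b0
  have n21 := mul_pos hn.pos2 b1
  have hγ : 0 < n 0 * u 1 - n 1 * u 0 := by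
    refine pos_of_mul_pos_right (a := u 2) ?_ (hu.pos 2).le
    have := hu.pq
    rw [hn.p_eq, hn.q_eq] at this
    linarith
  have hNP : 0 < n 0 * (u 1 * b j 2 - u 2 * b j 1) - n 1 * (u 0 * b j 2 - u 2 * b j 0) +
      n 2 * (u 0 * b j 1 - u 1 * b j 0) := by
    have := h.diag j
    have := mul_pos hγ b2
    rw [hn.p_eq, hn.q_eq] at *
    linarith
  rcases a with a | _ | _ <;> rcases a' with a' | _ | _ <;> (try fin_cases a) <;>
    (try fin_cases a') <;> first
    | exact absurd rfl ha
    | (simp [White.om, White.det, White.model, whites, D3]; linarith)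
    | (simp [White.om, White.det, White.model, whites, D3]; done)

lemma LineSys.chi_mul_D3_pos {p q : ℝ} {b : J → Fin 3 → ℝ} {u n : Fin 3 → ℝ}
    (h : L.Blacks p q b) (hu : L.Fourth p q b u) (hn : L.Fifth p q b u n) {a a' a'' : White}
    (ha : a ≠ a') (ha' : a ≠ a'') (ha'' : a' ≠ a'') :
    0 < (White.chi a a' a'' : ℝ) * D3 (whites u n a) (whites u n a') (whites u n a'') := by
  have u0 := hu.pos 0
  have u1 := hu.pos 1
  have u2 := hu.pos 2
  have n0 := hn.neg0
  have n1 := hn.neg1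
  have n2 := hn.pos2
  have hγ : 0 < n 0 * u 1 - n 1 * u 0 := by
    refine pos_of_mul_pos_right (a := u 2) ?_ (hu.pos 2).le
    have := hu.pq
    rw [hn.p_eq, hn.q_eq] at this
    linarith
  have hp := h.p_pos
  have hq := h.q_pos
  rw [hn.p_eq] at hp
  rw [hn.q_eq] at hq
  rcases a with a | _ | _ <;> rcases a' with a' | _ | _ <;> rcases a'' with a'' | _ | _ <;>
    (try fin_cases a) <;> (try fin_cases a') <;> (try fin_cases a'') <;> first
    | exact absurd rfl ha
    | exact absurd rfl ha'
    | exact absurd rfl ha''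
    | (simp [White.chi, White.det, White.model, whites, D3]; linarith)
    | (simp [White.chi, White.det, White.model, whites, D3]; done)

lemma LineSys.orient_mul_D3_neg {p q : ℝ} {b : J → Fin 3 → ℝ} {u n : Fin 3 → ℝ}
    (h : L.Blacks p q b) (hu : L.Fourth p q b u) (hn : L.Fifth p q b u n) (a : White)
    {l : Λ} {j k : J} (hl : L.ty l = a.pen) (hj : L.sg l j = -1) (hk : L.sg l k = 1) :
    (a.orient : ℝ) * D3 (whites u n a) (b j) (b k) < 0 := by
  rcases a with i | _ | _
  · fin_cases i
    · have := h.y_ord l j k hl hj hk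
      simp [whites, White.orient, D3] at this ⊢
      linarith
    · have := h.x_ord l j k hl hj hk
      simp [whites, White.orient, D3] at this ⊢
      linarith
    · have := h.r_ord l j k hl hj hk
      simp [whites, White.orient, D3] at this ⊢
      linarith
  · have := hu.ord l j k hl hj hk
    simp [whites, White.orient, D3] at this ⊢
    linarith
  · have := hn.ord l j k hl hj hk
    simp [whites, White.orient, D3] at this ⊢
    linarith

lemma LineSys.base {p q : ℝ} {b : J → Fin 3 → ℝ} {u n ψ : Fin 3 → ℝ}
    (h : L.Blacks p q b) (hu : L.Fourth p q b u) (hn : L.Fifth p q b u n)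
    (hψ : ∀ a, 0 < ψ ⬝ᵥ whites u n a) : L.pattern.Base (whites u n) b ψ where
  wwb a a' j ha := LineSys.om_mul_D3_pos h hu hn ha j
  www a a' a'' h1 h2 h3 := LineSys.chi_mul_D3_pos h hu hn h1 h2 h3
  psi := hψ
  rel l j k hj hk := by
    obtain ⟨⟨l, a⟩, hl⟩ := l
    change ((a.orient * L.sg l j : SignType) : ℝ) = 1 at hj
    change ((a.orient * L.sg l k : SignType) : ℝ) = -1 at hk
    change 0 < D3 (whites u n a) (b j) (b k)
    rw [signType_cast_one] at hj
    rw [signType_cast_neg_one] at hk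
    have key := fun j k => LineSys.orient_mul_D3_neg h hu hn a (j := j) (k := k) hl
    rcases a.orient_cases with e | e <;> rw [e] at hj hk key
    · have := key k j (by simpa using hk) (by simpa using hj)
      rw [D3_swap₂] at this
      simpa using this
    · have := key j k (neg_eq_iff_eq_neg.1 (by simpa using hj)) (by simpa using hk)
      simpa using this

section Recover

variable {u n : Fin 3 → ℝ} {b : J → Fin 3 → ℝ} {c : L.Col → Fin 3 → ℝ} (hL : L.Rich)
  (hV : L.pattern.Spec (vecs (whites u n) c b)) [Finite Λ] [Finite J]

include hV

lemma LineSys.om_of_spec (a a' : White) (h : a ≠ a') (j : J) :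
    0 < (White.om a a' : ℝ) * D3 (whites u n a) (whites u n a') (b j) :=
  hV.forB a a' (wh a') j h rfl

lemma LineSys.chi_of_spec (a a' a'' : White) (h : a ≠ a' ∧ a ≠ a'' ∧ a' ≠ a'') :
    0 < (White.chi a a' a'' : ℝ) * D3 (whites u n a) (whites u n a') (whites u n a'') :=
  hV.forFor a a' a'' (wh a') (wh a'') h.1 h.2.1 h.2.2 rfl rfl

include hL

lemma LineSys.orient_of_spec (a : White) {l : Λ} {j k : J} (hl : L.ty l = a.pen)
    (hj : L.sg l j = -1) (hk : L.sg l k = 1) :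
    (a.orient : ℝ) * D3 (whites u n a) (b j) (b k) < 0 := by
  have := Fintype.ofFinite L.Col
  have := Fintype.ofFinite J
  have h := hV.black_black hL.good (l := ⟨(l, a), hl⟩) (j := j) (j' := k) (by
    change ((a.orient * L.sg l k : SignType) : ℝ) = - ((a.orient * L.sg l j : SignType) : ℝ)
    rw [hj, hk]
    simp)
  change 0 < ((a.orient * L.sg l j : SignType) : ℝ) * D3 (whites u n a) (b j) (b k) at h
  rw [hj] at h
  simpa using h

lemma LineSys.recover :
    L.Blacks (n 2 * u 0 - u 2 * n 0) (n 2 * u 1 - u 2 * n 1) b ∧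
    L.Fourth (n 2 * u 0 - u 2 * n 0) (n 2 * u 1 - u 2 * n 1) b u ∧
    L.Fifth (n 2 * u 0 - u 2 * n 0) (n 2 * u 1 - u 2 * n 1) b u n := by
  have om := LineSys.om_of_spec hV
  have chi := LineSys.chi_of_spec hV
  have ord := fun a l j k => LineSys.orient_of_spec hL hV a (l := l) (j := j) (k := k)
  have k0 := chi (.inr false) (.inl 1) (.inl 2) (by decide)
  have k1 := chi (.inr false) (.inl 2) (.inl 0) (by decide)
  have k2 := chi (.inr false) (.inl 0) (.inl 1) (by decide)
  have m0 := chi (.inr true) (.inl 1) (.inl 2) (by decide)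
  have m1 := chi (.inr true) (.inl 2) (.inl 0) (by decide)
  have m2 := chi (.inr true) (.inl 0) (.inl 1) (by decide)
  have mp := chi (.inr true) (.inr false) (.inl 1) (by decide)
  have mq := chi (.inr true) (.inr false) (.inl 0) (by decide)
  have mr := chi (.inr true) (.inr false) (.inl 2) (by decide)
  simp [White.chi, White.det, White.model, whites, D3] at k0 k1 k2 m0 m1 m2 mp mq mr
  have b2 := fun j => om (.inl 0) (.inl 1) (by decide) j
  have b0 := fun j => om (.inl 1) (.inl 2) (by decide) j
  have b1 := fun j => om (.inl 2) (.inl 0) (by decide) j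
  have p02 := fun j => om (.inr false) (.inl 1) (by decide) j
  have p12 := fun j => om (.inr false) (.inl 0) (by decide) j
  have p01 := fun j => om (.inr false) (.inl 2) (by decide) j
  have n01 := fun j => om (.inr true) (.inl 2) (by decide) j
  simp [White.om, White.det, White.model, whites, D3] at b0 b1 b2 p02 p12 p01 n01
  have oX := ord (.inl 1)
  have oY := ord (.inl 0)
  have oR := ord (.inl 2)
  have oP := ord (.inr false)
  have oN := ord (.inr true)
  simp only [whites, White.orient, Sum.elim_inl, Sum.elim_inr] at oX oY oR oP oN
  refine ⟨⟨by linarith, by linarith, ?_, fun j => ?_, fun l j k h1 h2 h3 => ?_,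
    fun l j k h1 h2 h3 => ?_, fun l j k h1 h2 h3 => ?_, fun l j k h1 h2 h3 => ?_⟩,
    ⟨?_, ?_, fun j => ?_, fun j => ?_, fun j => ?_, fun l j k h1 h2 h3 => ?_⟩,
    ⟨by linarith, by linarith, by linarith, rfl, rfl, fun j => ?_, fun l j k h1 h2 h3 => ?_⟩⟩
  · intro j c
    fin_cases c
    exacts [b0 j, b1 j, b2 j]
  · have h1 := mul_pos m2 (sub_pos.2 (p01 j))
    have h2 := mul_pos k2 (sub_pos.2 (n01 j))
    linarith
  · have := oX l j k h1 h2 h3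
    simp [D3] at this ⊢
    linarith
  · have := oY l j k h1 h2 h3
    simp [D3] at this ⊢
    linarith
  · have := oR l j k h1 h2 h3
    simp [D3] at this ⊢
    linarith
  · have e1 := oP l j k h1 h2 h3
    have e2 := oN l j k h1 h2 h3
    simp at e1 e2
    have e3 := mul_pos m2 (neg_pos.2 e1)
    have e4 := mul_pos k2 e2
    simp [D3] at e3 e4 ⊢
    linarith
  · intro c
    fin_cases c
    exacts [k0, k1, k2]
  · have := mul_pos k2 (sub_pos.2 mr)
    linarith
  · have := p02 j
    linarith
  · have := p12 j
    linarith
  · have := p01 j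
    linarith
  · have := oP l j k h1 h2 h3
    simp [D3] at this ⊢
    linarith
  · have := n01 j
    linarith
  · have := oN l j k h1 h2 h3
    simp [D3] at this ⊢
    linarith

end Recover

end Rich

/-! ### Polytopes from rich systems -/

section RichPolytope

variable {Λ J : Type} {L : LineSys Λ J}

/-- Coordinates for the white and black vectors and the functional. -/
abbrev BaseIdx (J : Type) : Type := ((BIdx J ⊕ Fin 3) ⊕ Fin 3) ⊕ Fin 3

/-- The white vectors of a base configuration. -/
def baseWhites (x : BaseIdx J → ℝ) : White → Fin 3 → ℝ :=
  whites (fun c => x (.inl (.inl (.inr c)))) fun c => x (.inl (.inr c))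

/-- The black vectors of a base configuration. -/
def baseBlacks (x : BaseIdx J → ℝ) : J → Fin 3 → ℝ := blackOf fun i => x (.inl (.inl (.inl i)))

lemma SE.baseSet_towerSet [Finite Λ] [Finite J] (hL : L.Rich) : SE L.baseSet
    (towerSet baseWhites baseBlacks (fun x c => x (.inr c)) L.baseSet L.pattern) := by
  refine SE.tower (fun a c => PolyFun.whites (fun _ => PolyFun.coord _) (fun _ => PolyFun.coord _)
    a c) (fun _ _ => PolyFun.coord _) (fun _ => PolyFun.coord _) _ _ ⟨hL.good.om_cases,
    hL.good.sg_cases, hL.good.exists_other, hL.good.both_sides⟩ fun x hx => ?_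
  exact LineSys.base hx.1.1.1 hx.1.1.2 hx.1.2 hx.2.1

/-- The configurations with a given pattern together with a positive functional. -/
def psiSet (P : Pattern White L.Col J) :
    Set ((Bool ⊕ (L.Col ⊕ J)) × Fin 3 ⊕ Fin 3 → ℝ) :=
  {z | P.Spec (ext3 fun i => z (.inl i)) ∧
    ∀ i, 0 < (fun c => z (.inr c)) ⬝ᵥ ext3 (fun i => z (.inl i)) i}

lemma ext3_polyFun {A' : Type} (i : (Fin 3 ⊕ A') ⊕ (Λ ⊕ J)) (c : Fin 3) :
    PolyFun fun w : (A' ⊕ (Λ ⊕ J)) × Fin 3 → ℝ => ext3 w i c := by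
  rcases i with (i | a) | u
  · exact PolyFun.const _
  · exact PolyFun.coord _
  · exact PolyFun.coord _

lemma SE.specSet_psiSet [Finite Λ] [Finite J] (P : Pattern White L.Col J) :
    SE (specSet P) (psiSet P) := by
  refine SE.fiber (Equiv.refl _) (fun w ψ => ∀ i, 0 < ψ ⬝ᵥ ext3 w i) (AffCond.all fun i => ?_)
    (fun x y => ?_) fun x hx => hx.2
  · simp only [dotProduct, Fin.sum_univ_three]
    exact AffCond.lt (IsAff.const 0) ((((IsAff.fib 0).mul_poly (ext3_polyFun i 0)).add
      ((IsAff.fib 1).mul_poly (ext3_polyFun i 1))).add ((IsAff.fib 2).mul_poly (ext3_polyFun i 2)))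
  · exact ⟨fun h => ⟨⟨h.1, _, h.2⟩, h.2⟩, fun h => ⟨h.1.1, h.2⟩⟩

lemma ext3_eq_vecs (w : (Bool ⊕ (L.Col ⊕ J)) × Fin 3 → ℝ) :
    ext3 w = vecs (whites (fun c => w (.inl false, c)) fun c => w (.inl true, c))
      (fun l c => w (.inr (.inl l), c)) fun j c => w (.inr (.inr j), c) := by
  funext i
  rcases i with (i | _ | _) | l | j <;> rfl

/-- Reading the vectors off a tower configuration. -/
def fromTower (z : BaseIdx J ⊕ L.Col × Fin 3 → ℝ) :
    (Bool ⊕ (L.Col ⊕ J)) × Fin 3 ⊕ Fin 3 → ℝ :=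
  Sum.elim (fun i => match i with
    | (.inl false, c) => z (.inl (.inl (.inl (.inr c))))
    | (.inl true, c) => z (.inl (.inl (.inr c)))
    | (.inr (.inl l), c) => z (.inr (l, c))
    | (.inr (.inr j), c) => z (.inl (.inl (.inl (.inl (.inr (j, c))))))) fun c => z (.inl (.inr c))

/-- Completing a configuration to a tower configuration. -/
def toTower (z : (Bool ⊕ (L.Col ⊕ J)) × Fin 3 ⊕ Fin 3 → ℝ) : BaseIdx J ⊕ L.Col × Fin 3 → ℝ
  | .inl (.inl (.inl (.inl (.inl false)))) =>
    z (.inl (.inl true, 2)) * z (.inl (.inl false, 0)) -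
      z (.inl (.inl false, 2)) * z (.inl (.inl true, 0))
  | .inl (.inl (.inl (.inl (.inl true)))) =>
    z (.inl (.inl true, 2)) * z (.inl (.inl false, 1)) -
      z (.inl (.inl false, 2)) * z (.inl (.inl true, 1))
  | .inl (.inl (.inl (.inl (.inr (j, c))))) => z (.inl (.inr (.inr j), c))
  | .inl (.inl (.inl (.inr c))) => z (.inl (.inl false, c))
  | .inl (.inl (.inr c)) => z (.inl (.inl true, c))
  | .inl (.inr c) => z (.inr c)
  | .inr (l, c) => z (.inl (.inr (.inl l), c))

lemma isRational_of_polyFun {ι : Type} {S : Set (ι → ℝ)} {f : (ι → ℝ) → ℝ} (hf : PolyFun f) :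
    ∃ p q : (ι → ℝ) → ℝ, PolyFun p ∧ PolyFun q ∧ ∀ x ∈ S, q x ≠ 0 ∧ f x = p x / q x :=
  ⟨f, fun _ => 1, hf, PolyFun.const 1, fun x _ => ⟨one_ne_zero, by simp⟩⟩

lemma SE.towerSet_psiSet [Finite Λ] [Finite J] (hL : L.Rich) :
    SE (towerSet baseWhites baseBlacks (fun x c => x (.inr c)) L.baseSet L.pattern)
      (psiSet L.pattern) := by
  refine SE.rational fromTower toTower ?_ ?_ ?_ ?_ ?_ ?_
  · rintro (⟨(_ | _) | l | j, c⟩ | c) <;> exact isRational_of_polyFun (PolyFun.coord _)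
  · rintro ((((((_ | _) | ⟨j, c⟩) | c) | c) | c) | ⟨l, c⟩)
    · exact isRational_of_polyFun (((PolyFun.coord _).mul (PolyFun.coord _)).sub
        ((PolyFun.coord _).mul (PolyFun.coord _)))
    · exact isRational_of_polyFun (((PolyFun.coord _).mul (PolyFun.coord _)).sub
        ((PolyFun.coord _).mul (PolyFun.coord _)))
    all_goals exact isRational_of_polyFun (PolyFun.coord _)
  · rintro z ⟨h1, h2, h3⟩
    constructor
    · rw [ext3_eq_vecs]
      exact h2
    · rw [ext3_eq_vecs]
      rintro (a | l | j)
      · exact h1.2.1 a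
      · exact h3 l
      · exact h1.2.2 j
  · rintro z ⟨h1, h2⟩
    rw [ext3_eq_vecs] at h1 h2
    obtain ⟨e1, e2, e3⟩ := LineSys.recover hL h1
    exact ⟨⟨⟨⟨e1, e2⟩, e3⟩, fun a => h2 (wh a), fun j => h2 (bl j)⟩, h1, fun l => h2 (co l)⟩
  · rintro z ⟨h1, -⟩
    funext i
    rcases i with (((((_ | _) | ⟨j, c⟩) | c) | c) | c) | ⟨l, c⟩
    · exact h1.1.2.p_eq.symm
    · exact h1.1.2.q_eq.symm
    all_goals rfl
  · rintro z -
    funext i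
    rcases i with ⟨(_ | _) | l | j, c⟩ | c <;> rfl

/-- The points of a rich system are stably equivalent to a realization space. -/
theorem exists_polytope_of_rich [Finite Λ] [Finite J] (hL : L.Rich) (hne : L.points.Nonempty) :
    ∃ (d n : ℕ) (v : Fin n → Fin d → ℝ) (B : Finset (Fin n)),
      IsPolytopeVertexList v ∧ IsSimplicialVertexList v ∧ B.card = d + 1 ∧
      AffineIndependent ℝ (fun i : ↥B => v i) ∧
      SE L.points (flat (polytopeRealizationSpace v B)) := by
  have e : SE L.points (specSet L.pattern) := (((((SE.points_blackSet.trans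
    SE.blackSet_fourthSet).trans SE.fourthSet_fifthSet).trans SE.fifthSet_baseSet).trans
    (SE.baseSet_towerSet hL)).trans (SE.towerSet_psiSet hL)).trans (SE.specSet_psiSet _).symm
  have := Fintype.ofFinite L.Col
  have := Fintype.ofFinite J
  have h1 : White.om (.inl 0) (.inl 1) = 1 := by decide
  have h2 : White.om (.inl 1) (.inl 2) = 1 := by decide
  have h3 : White.om (.inl 2) (.inl 0) = 1 := by decide
  have h4 : White.chi (.inl 0) (.inl 1) (.inl 2) = 1 := by decide
  obtain ⟨d, n, v, B, g1, g2, g3, g4, g5⟩ := exists_polytope_of_spec hL.good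
    (signType_cast_one.2 h1) (signType_cast_one.2 h2) (signType_cast_one.2 h3)
    (signType_cast_one.2 h4) (e.nonempty hne)
  exact ⟨d, n, v, B, g1, g2, g3, g4, e.trans g5⟩

end RichPolytope

/-! ### Extending systems of points and lines -/

section Extend

variable {Λ J Λ' J' : Type}

lemma SE.of_injective {ι ρ : Type} [Finite ρ] (i : ι → ρ) (hi : Function.Injective i)
    {S : Set (ι → ℝ)} {T : Set (ρ → ℝ)} (hTS : ∀ z ∈ T, (fun a => z (i a)) ∈ S)
    (haff : ∀ e : ρ ≃ ι ⊕ ↥(Set.range i)ᶜ, (∀ a, e (i a) = .inl a) →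
      AffCond fun x y => (fun r => Sum.elim x y (e r)) ∈ T)
    (hne : ∀ x ∈ S, ∃ z ∈ T, (fun a => z (i a)) = x) : SE S T := by
  classical
  have := Finite.of_injective i hi
  set e : ρ ≃ ι ⊕ ↥(Set.range i)ᶜ := (((Equiv.ofInjective i hi).sumCongr (Equiv.refl _)).trans
    (Equiv.Set.sumCompl _)).symm with he
  have he' : ∀ a, e (i a) = .inl a := fun a => by
    rw [he, Equiv.symm_apply_eq]
    simp
  refine SE.fiber e (fun x y => (fun r => Sum.elim x y (e r)) ∈ T) (haff e he') (fun x y => ?_)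
    fun x hx => ?_
  · refine ⟨fun h => ⟨?_, h⟩, fun h => h.2⟩
    have := hTS _ h
    simpa [he'] using this
  · obtain ⟨z, hz, rfl⟩ := hne x hx
    refine ⟨fun r => z r, ?_⟩
    convert hz using 1
    funext r
    obtain ⟨s, rfl⟩ := e.symm.surjective r
    rw [Equiv.apply_symm_apply]
    rcases s with a | b
    · have h1 : e.symm (.inl a) = i a := by rw [Equiv.symm_apply_eq, he']
      rw [h1]
      rfl
    · rfl

namespace LineSys

/-- The coordinates of a subsystem. -/
def idx (i : Λ' → Λ) (k : J' → J) : Λ' ⊕ J' × Bool → Λ ⊕ J × Bool := Sum.map i (Prod.map k id)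

/-- Subsystems. -/
def comap (L : LineSys Λ J) (i : Λ' → Λ) (k : J' → J) : LineSys Λ' J' :=
  ⟨fun l => L.ty (i l), fun l j => L.sg (i l) (k j)⟩

lemma comap_space (L : LineSys Λ J) (i : Λ' → Λ) (k : J' → J) {z : Λ ⊕ J × Bool → ℝ}
    (hz : z ∈ L.space) : (fun a => z (idx i k a)) ∈ (L.comap i k).space :=
  ⟨fun j => hz.1 (k j), fun l => hz.2.1 (i l), fun l j => hz.2.2 (i l) (k j)⟩

lemma affCond_of [Finite Λ] [Finite J] (L : LineSys Λ J) {ι κ : Type} [Finite κ]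
    {z : (ι → ℝ) → (κ → ℝ) → Λ ⊕ J × Bool → ℝ} (h : ∀ r, IsAff fun x y => z x y r)
    (he : ∀ l j, IsAff fun x y =>
      (L.ty l).ev (z x y (.inl l)) (z x y (.inr (j, false))) (z x y (.inr (j, true)))) :
    AffCond fun x y => z x y ∈ L.space := by
  refine AffCond.and (AffCond.all fun j => AffCond.and ?_ ?_) (AffCond.and
    (AffCond.all fun l => ?_) (AffCond.all fun l => AffCond.all fun j => ?_))
  · exact AffCond.lt (IsAff.const 0) (h _)
  · exact AffCond.lt (h _) (h _)
  · exact AffCond.lt (IsAff.const _) (h _)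
  · exact AffCond.sign _ (he l j)

end LineSys

open LineSys

lemma SE.addLines [Finite Λ] [Finite J] (L : LineSys Λ J) {i : Λ' → Λ}
    (hi : Function.Injective i)
    (h : ∀ x ∈ (L.comap i id).space, ∃ z ∈ L.space, (fun a => z (idx i id a)) = x) :
    SE (L.comap i id).space L.space := by
  refine SE.of_injective (idx i id) (Sum.map_injective.2 ⟨hi, Function.injective_id.prodMap
    Function.injective_id⟩) (fun z hz => comap_space L i id hz) (fun e he => ?_) h
  have hp : ∀ p, e (.inr p) = .inl (.inr p) := fun p => he (.inr p)
  refine affCond_of L (fun r => IsAff.elim _) fun l j => ?_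
  refine Pencil.isAff_ev _ (IsAff.elim _) (PolyFun.coord (.inr (j, false)))
    (PolyFun.coord (.inr (j, true))) ?_ ?_ <;> intro x y <;> simp [hp]

lemma SE.addPoints [Finite Λ] [Finite J] (L : LineSys Λ J) {k : J' → J}
    (hk : Function.Injective k)
    (h : ∀ x ∈ (L.comap id k).space, ∃ z ∈ L.space, (fun a => z (idx id k a)) = x) :
    SE (L.comap id k).space L.space := by
  refine SE.of_injective (idx id k) (Sum.map_injective.2 ⟨Function.injective_id,
    hk.prodMap Function.injective_id⟩) (fun z hz => comap_space L id k hz) (fun e he => ?_) h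
  have hp : ∀ l, e (.inl l) = .inl (.inl l) := fun l => he (.inl l)
  refine affCond_of L (fun r => IsAff.elim _) fun l j => ?_
  refine Pencil.isAff_ev' _ (PolyFun.coord (.inl l)) ?_ (IsAff.elim _) (IsAff.elim _)
  intro x y
  simp [hp]

namespace LineSys

/-- Adding a line. -/
def addLine (L : LineSys Λ J) (t : Pencil) (s : J → SignType) : LineSys (Option Λ) J :=
  ⟨fun l => l.elim t L.ty, fun l => l.elim s L.sg⟩

/-- Adding a point. -/
def addPoint (L : LineSys Λ J) (s : Λ → SignType) : LineSys Λ (Option J) :=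
  ⟨L.ty, fun l j => j.elim (s l) (L.sg l)⟩

end LineSys

lemma SE.addLine [Finite Λ] [Finite J] (L : LineSys Λ J) (t : Pencil) (s : J → SignType)
    (h : ∀ x ∈ L.space, ∃ θ, t.lb < θ ∧
      ∀ j, SignType.sign (t.ev θ (x (.inr (j, false))) (x (.inr (j, true)))) = s j) :
    SE L.space (L.addLine t s).space := by
  refine SE.addLines (L.addLine t s) (Option.some_injective _) fun x hx => ?_
  obtain ⟨θ, h1, h2⟩ := h x hx
  refine ⟨Sum.elim (fun l => l.elim θ fun l => x (.inl l)) fun p => x (.inr p), ⟨hx.1, ?_, ?_⟩, ?_⟩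
  · rintro (_ | l)
    exacts [h1, hx.2.1 l]
  · rintro (_ | l)
    exacts [h2, hx.2.2 l]
  · funext r
    rcases r with l | p <;> rfl

lemma SE.addPoint [Finite Λ] [Finite J] (L : LineSys Λ J) (s : Λ → SignType)
    (h : ∀ z ∈ L.space, ∃ x y, 0 < x ∧ x < y ∧
      ∀ l, SignType.sign ((L.ty l).ev (z (.inl l)) x y) = s l) :
    SE L.space (L.addPoint s).space := by
  refine SE.addPoints (L.addPoint s) (Option.some_injective _) fun z hz => ?_
  obtain ⟨x, y, h1, h2, h3⟩ := h z hz
  refine ⟨Sum.elim (fun l => z (.inl l)) fun p =>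
    p.1.elim (if p.2 then y else x) fun j => z (.inr (j, p.2)), ⟨?_, hz.2.1, ?_⟩, ?_⟩
  · rintro (_ | j)
    exacts [⟨h1, h2⟩, hz.1 j]
  · rintro l (_ | j)
    exacts [h3 l, hz.2.2 l j]
  · funext r
    rcases r with l | p <;> rfl

end Extend

/-! ### Enriching a system of points and lines -/

section Enrich

variable {Λ J : Type} [Finite Λ] [Finite J]

lemma SE.addPoint_of_scale (L : LineSys Λ J) (c : Pencil → SignType) (p q : ℝ → ℝ)
    (hp : ∀ N, 2 ≤ N → 0 < p N ∧ p N < q N)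
    (h : ∀ N, 2 ≤ N → ∀ (a : Pencil) (θ : ℝ), θ < N → a.lb + N⁻¹ < θ →
      SignType.sign (a.ev θ (p N) (q N)) = c a) :
    SE L.space (L.addPoint fun l => c (L.ty l)).space := by
  refine SE.addPoint L _ fun z hz => ?_
  have key : ∀ᶠ N : ℝ in Filter.atTop, 2 ≤ N ∧ ∀ l, z (.inl l) < N ∧
      (L.ty l).lb + N⁻¹ < z (.inl l) := by
    refine (Filter.eventually_ge_atTop 2).and (Filter.eventually_all.2 fun l =>
      (Filter.eventually_gt_atTop _).and ?_)
    have := tendsto_inv_atTop_zero.eventually (gt_mem_nhds (sub_pos.2 (hz.2.1 l)))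
    filter_upwards [this] with N hN
    linarith
  obtain ⟨N, h2, hN⟩ := key.exists
  exact ⟨p N, q N, (hp N h2).1, (hp N h2).2, fun l => h N h2 _ _ (hN l).1 (hN l).2⟩

private lemma inv_scale {N : ℝ} (h : 2 ≤ N) : 0 < N⁻¹ ∧ N⁻¹ ≤ 1 / 2 ∧ N * N⁻¹ = 1 := by
  have h0 : 0 < N := by linarith
  refine ⟨inv_pos.2 h0, ?_, mul_inv_cancel₀ h0.ne'⟩
  rw [inv_eq_one_div]
  exact one_div_le_one_div_of_le two_pos h

lemma SE.addPoint_low (L : LineSys Λ J) : SE L.space (L.addPoint fun _ => -1).space := by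
  refine SE.addPoint_of_scale L (fun _ => -1) (fun N => N⁻¹ / 2)
    (fun N => N⁻¹ / 2 + N⁻¹ ^ 2 / 4) (fun N h => ?_) fun N h a θ h1 h2 => ?_ <;>
  obtain ⟨e1, e2, e3⟩ := inv_scale h <;> generalize N⁻¹ = e at *
  · exact ⟨by positivity, by nlinarith⟩
  · refine sign_neg ?_
    cases a <;> simp only [Pencil.ev, Pencil.lb] at * <;> nlinarith

lemma SE.addPoint_slim (L : LineSys Λ J) :
    SE L.space (L.addPoint fun l => if L.ty l = .R then 1 else -1).space := by
  refine SE.addPoint_of_scale L (fun a => if a = .R then 1 else -1) (fun N => N⁻¹ ^ 2 / 4)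
    (fun N => N⁻¹ / 2) (fun N h => ?_) fun N h a θ h1 h2 => ?_ <;>
  obtain ⟨e1, e2, e3⟩ := inv_scale h <;> generalize N⁻¹ = e at *
  · exact ⟨by positivity, by nlinarith⟩
  · cases a
    · refine sign_neg ?_
      simp only [Pencil.ev, Pencil.lb] at *
      nlinarith
    · refine sign_neg ?_
      simp only [Pencil.ev, Pencil.lb] at *
      nlinarith
    · refine sign_pos ?_
      simp only [Pencil.ev, Pencil.lb] at *
      nlinarith [mul_lt_mul_of_pos_right h1 e1, mul_pos e1 e1]
    · refine sign_neg ?_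
      simp only [Pencil.ev, Pencil.lb] at *
      nlinarith

/-- Signs of a point far away from the origin. -/
def Pencil.far (s : SignType) : Pencil → SignType
  | X => 1
  | Y => 1
  | R => -1
  | D => s

lemma SE.addPoint_far (L : LineSys Λ J) :
    SE L.space (L.addPoint fun l => (L.ty l).far (-1)).space := by
  refine SE.addPoint_of_scale L (Pencil.far (-1)) (fun N => N)
    (fun N => N + N⁻¹ / 2) (fun N h => ?_) fun N h a θ h1 h2 => ?_ <;>
  obtain ⟨e1, e2, e3⟩ := inv_scale h <;> generalize N⁻¹ = e at *
  · exact ⟨by positivity, by linarith⟩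
  · cases a
    · refine sign_pos ?_
      simp only [Pencil.ev, Pencil.lb] at *
      linarith
    · refine sign_pos ?_
      simp only [Pencil.ev, Pencil.lb] at *
      linarith
    · refine sign_neg ?_
      simp only [Pencil.ev, Pencil.lb] at *
      nlinarith
    · refine sign_neg ?_
      simp only [Pencil.ev, Pencil.lb] at *
      linarith

lemma SE.addPoint_far' (L : LineSys Λ J) :
    SE L.space (L.addPoint fun l => (L.ty l).far 1).space := by
  refine SE.addPoint_of_scale L (Pencil.far 1) (fun N => 2 * N ^ 2)
    (fun N => 2 * N ^ 2 + N) (fun N h => ?_) fun N h a θ h1 h2 => ?_ <;>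
  obtain ⟨e1, e2, e3⟩ := inv_scale h <;> generalize N⁻¹ = e at *
  · exact ⟨by positivity, by linarith⟩
  · cases a
    · refine sign_pos ?_
      simp only [Pencil.ev, Pencil.lb] at *
      nlinarith
    · refine sign_pos ?_
      simp only [Pencil.ev, Pencil.lb] at *
      nlinarith
    · refine sign_neg ?_
      simp only [Pencil.ev, Pencil.lb] at *
      have : (1 + e) * (2 * N ^ 2) < θ * (2 * N ^ 2) :=
        mul_lt_mul_of_pos_right h2 (by positivity)
      nlinarith [mul_assoc N N e]
    · refine sign_pos ?_
      simp only [Pencil.ev, Pencil.lb] at *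
      linarith

lemma SE.addPoint_high (L : LineSys Λ J) : SE L.space (L.addPoint fun _ => 1).space := by
  refine SE.addPoint_of_scale L (fun _ => 1) (fun N => N)
    (fun N => N ^ 3) (fun N h => ?_) fun N h a θ h1 h2 => ?_
  · have h3 : 0 ≤ N * (N - 2) * (N + 2) := by
      have : 0 ≤ N - 2 := by linarith
      positivity
    exact ⟨by linarith, by nlinarith⟩
  · have h3 : 0 ≤ N * (N - 2) * (N + 2) := by
      have : 0 ≤ N - 2 := by linarith
      positivity
    clear h2
    refine sign_pos ?_
    have h4 := mul_lt_mul_of_pos_right h1 (show 0 < N by linarith)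
    have h5 : 0 ≤ N ^ 2 * (N - 1) := by
      have : 0 ≤ N - 1 := by linarith
      positivity
    cases a <;> simp only [Pencil.ev] at * <;> nlinarith

lemma SE.addLine_low (L : LineSys Λ J) (t : Pencil) :
    SE L.space (L.addLine t fun _ => 1).space := by
  refine SE.addLine L t _ fun x hx => ?_
  have := Fintype.ofFinite J
  classical
  obtain ⟨θ, h1, h2⟩ := Order.exists_between_finsets (lo := {t.lb})
    (hi := Finset.univ.image fun j => t.val (x (.inr (j, false))) (x (.inr (j, true)))) (by
      simpa using fun j => Pencil.lb_lt_val t (hx.1 j).1 (hx.1 j).2)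
  refine ⟨θ, h1 _ (by simp), fun j => sign_pos ((Pencil.ev_pos _ (hx.1 j).1).2 (h2 _ ?_))⟩
  exact Finset.mem_image_of_mem _ (Finset.mem_univ j)

lemma SE.addLine_high (L : LineSys Λ J) (t : Pencil) :
    SE L.space (L.addLine t fun _ => -1).space := by
  refine SE.addLine L t _ fun x hx => ?_
  obtain ⟨b, hb⟩ := (Set.finite_range fun j =>
    t.val (x (.inr (j, false))) (x (.inr (j, true)))).bddAbove
  refine ⟨max b t.lb + 1, by linarith [le_max_right b t.lb], fun j =>
    sign_neg ((Pencil.ev_neg _ (hx.1 j).1).2 ?_)⟩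
  have := hb ⟨j, rfl⟩
  beta_reduce at this
  linarith [le_max_left b t.lb]

namespace LineSys

/-- Seven additional elements. -/
abbrev Seven (A : Type) : Type :=
  Option (Option (Option (Option (Option (Option (Option A))))))

/-- Additional points and lines far away from all others. -/
def enrich {Λ J : Type} (L : LineSys Λ J) : LineSys (Seven Λ) (Seven J) :=
  let L := (L.addPoint fun _ => -1).addLine .Y fun _ => 1
  let L := ((L.addPoint fun _ => -1).addLine .D fun _ => 1).addLine .R fun _ => 1
  let L := L.addPoint fun l => if L.ty l = .R then 1 else -1
  let L := L.addPoint fun l => (L.ty l).far (-1)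
  let L := L.addPoint fun l => (L.ty l).far 1
  let L := (L.addPoint fun _ => -1).addLine .X fun _ => -1
  let L := ((L.addLine .Y fun _ => -1).addLine .R fun _ => -1).addLine .D fun _ => -1
  L.addPoint fun _ => 1

lemma se_enrich (L : LineSys Λ J) : SE L.space L.enrich.space := by
  refine (SE.addPoint_low _).trans ?_
  refine (SE.addLine_low _ .Y).trans ?_
  refine (SE.addPoint_low _).trans ?_
  refine (SE.addLine_low _ .D).trans ?_
  refine (SE.addLine_low _ .R).trans ?_
  refine (SE.addPoint_slim _).trans ?_
  refine (SE.addPoint_far _).trans ?_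
  refine (SE.addPoint_far' _).trans ?_
  refine (SE.addPoint_low _).trans ?_
  refine (SE.addLine_high _ .X).trans ?_
  refine (SE.addLine_high _ .Y).trans ?_
  refine (SE.addLine_high _ .R).trans ?_
  exact (SE.addLine_high _ .D).trans (SE.addPoint_high _)

lemma enrich_ne_zero (L : LineSys Λ J) (h0 : ∀ l j, L.sg l j ≠ 0) :
    ∀ l j, L.enrich.sg l j ≠ 0 := by
  have h1 : ∀ a : Pencil, (if a = .R then (1 : SignType) else -1) ≠ 0 := by
    intro a
    split_ifs <;> decide
  have h2 : ∀ a : Pencil, a.far (-1) ≠ 0 := by rintro (_ | _ | _ | _) <;> decide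
  have h3 : ∀ a : Pencil, a.far 1 ≠ 0 := by rintro (_ | _ | _ | _) <;> decide
  have m1 : (-1 : SignType) ≠ 0 := by decide
  have m2 : (1 : SignType) ≠ 0 := by decide
  rintro (_ | _ | _ | _ | _ | _ | _ | l) (_ | _ | _ | _ | _ | _ | _ | j) <;>
  first | exact m1 | exact m2 | exact h1 _ | exact h2 _ | exact h3 _ | exact h0 _ _

lemma enrich_rich (L : LineSys Λ J) (h0 : ∀ l j, L.sg l j ≠ 0) : L.enrich.Rich := by
  refine ⟨L.enrich_ne_zero h0, ⟨some none, ?_⟩, ⟨none, fun l => rfl, fun a => ?_⟩, ?_⟩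
  · rintro (_ | _ | _ | _ | _ | _ | _ | l) <;> rfl
  · refine ⟨match a with
      | .X => some (some (some none))
      | .Y => some (some none)
      | .R => some none
      | .D => none, ?_, ?_⟩
    · cases a <;> rfl
    · rintro (_ | _ | _ | _ | _ | _ | _ | j) hj <;> first | exact absurd rfl hj | (cases a <;> rfl)
  · intro t a ht ha hta l hl
    have key : L.enrich.sg l (some (some (some (some (some (some none)))))) = -1 →
        ∃ j, L.enrich.sg l j = -1 ∧ ∃ l', L.enrich.ty l' = a ∧ L.enrich.sg l' j = 1 := by
      intro h
      refine ⟨_, h, match a with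
        | .X => none
        | .Y => some (some (some (some (some (some none)))))
        | .R => some (some (some (some none)))
        | .D => some (some (some (some (some none)))), ?_⟩
      cases a <;> first | exact absurd rfl ha | exact ⟨rfl, rfl⟩
    rcases l with _ | _ | _ | _ | _ | _ | _ | l
    · exact key rfl
    · exact key rfl
    · exact key rfl
    · exact key rfl
    · cases a
      · exact absurd rfl ha
      · exact ⟨some (some none), rfl, some (some (some (some (some (some none))))), rfl, rfl⟩
      · exact absurd hl.symm hta
      · exact ⟨some (some none), rfl, some (some (some (some (some none)))), rfl, rfl⟩
    · cases a
      · exact absurd rfl ha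
      · exact ⟨some (some (some none)), rfl, some (some (some (some (some (some none))))), rfl, rfl⟩
      · exact ⟨some (some (some (some none))), rfl, some (some (some (some none))), rfl, rfl⟩
      · exact absurd hl.symm hta
    · cases a
      · exact absurd rfl ha
      · exact absurd hl.symm hta
      · exact ⟨some (some (some (some (some none)))), rfl, some (some (some (some none))), rfl, rfl⟩
      · exact ⟨some (some (some (some (some none)))), rfl, some (some (some (some (some none)))),
          rfl, rfl⟩
    · exact key rfl

lemma exists_polytope (L : LineSys Λ J) (h0 : ∀ l j, L.sg l j ≠ 0) (hne : L.space.Nonempty) :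
    ∃ (d n : ℕ) (v : Fin n → Fin d → ℝ) (B : Finset (Fin n)),
      IsPolytopeVertexList v ∧ IsSimplicialVertexList v ∧ B.card = d + 1 ∧
      AffineIndependent ℝ (fun i : ↥B => v i) ∧
      SE L.space (flat (polytopeRealizationSpace v B)) := by
  have h1 := L.se_enrich.trans (SE.points_space L.enrich (L.enrich_ne_zero h0)).symm
  obtain ⟨d, n, v, B, a, b, c, e, h⟩ :=
    exists_polytope_of_rich (L.enrich_rich h0) (h1.nonempty hne)
  exact ⟨d, n, v, B, a, b, c, e, h1.trans h⟩

end LineSys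

end Enrich

/-! ### Scattering points and lines -/

section Scatter

lemma exists_cross {V : Type*} [AddCommGroup V] [Module ℝ V] {C : Set V} (hC : Convex ℝ C)
    {E F : V → ℝ} (hE : ∀ p q : V, ∀ s t : ℝ, s + t = 1 → E (s • p + t • q) = s * E p + t * E q)
    (hF : ∀ p q : V, ∀ s t : ℝ, s + t = 1 → F (s • p + t • q) = s * F p + t * F q)
    {p : Bool → Bool → V} (hp : ∀ a b, p a b ∈ C) (hE1 : ∀ b, 0 < E (p true b))
    (hE2 : ∀ b, E (p false b) < 0) (hF1 : ∀ a, 0 < F (p a true)) (hF2 : ∀ a, F (p a false) < 0) :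
    ∃ z ∈ C, E z = 0 ∧ F z = 0 := by
  have key : ∀ a b : ℝ, 0 < a → b < 0 → ∃ s t : ℝ, 0 < s ∧ 0 < t ∧ s + t = 1 ∧
      s * a + t * b = 0 := by
    intro a b ha hb
    have h : 0 < a - b := by linarith
    refine ⟨-b / (a - b), a / (a - b), div_pos (by linarith) h, div_pos ha h, ?_, ?_⟩
    · field_simp
      ring
    · field_simp
      ring
  choose s t hs ht hst hz using fun b => key _ _ (hE1 b) (hE2 b)
  set r : Bool → V := fun b => s b • p true b + t b • p false b with hr
  have rC : ∀ b, r b ∈ C := fun b => hC (hp _ _) (hp _ _) (hs b).le (ht b).le (hst b)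
  have rE : ∀ b, E (r b) = 0 := fun b => by rw [hr, hE _ _ _ _ (hst b), hz]
  have r1 : 0 < F (r true) := by
    rw [hr, hF _ _ _ _ (hst _)]
    exact add_pos (mul_pos (hs _) (hF1 _)) (mul_pos (ht _) (hF1 _))
  have r2 : F (r false) < 0 := by
    rw [hr, hF _ _ _ _ (hst _)]
    exact add_neg (mul_neg_of_pos_of_neg (hs _) (hF2 _)) (mul_neg_of_pos_of_neg (ht _) (hF2 _))
  obtain ⟨u, w, hu, hw, huw, h⟩ := key _ _ r1 r2
  refine ⟨u • r true + w • r false, hC (rC _) (rC _) hu.le hw.le huw, ?_, ?_⟩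
  · rw [hE _ _ _ _ huw, rE, rE]
    ring
  · rw [hF _ _ _ _ huw, h]

namespace Pencil

/-- The linear part of `ev`. -/
def lin : Pencil → ℝ → ℝ → ℝ → ℝ
  | X, _, x, _ => x
  | Y, _, _, y => y
  | R, θ, x, y => y - θ * x
  | D, _, x, y => y - x

lemma ev_add (a : Pencil) (θ x y ε u v : ℝ) :
    a.ev θ (x + ε * u) (y + ε * v) = a.ev θ x y + ε * a.lin θ u v := by
  cases a <;> simp only [ev, lin] <;> ring

lemma ev_combo (a : Pencil) (θ x y x' y' s t : ℝ) (h : s + t = 1) :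
    a.ev θ (s * x + t * x') (s * y + t * y') = s * a.ev θ x y + t * a.ev θ x' y' := by
  obtain rfl : t = 1 - s := by linarith
  cases a <;> simp only [ev] <;> ring

lemma exists_lin (a b : Pencil) (hab : a ≠ b) {θ η : ℝ} (hθ : a.lb < θ) (hη : b.lb < η) (p q : ℝ) :
    ∃ u v, a.lin θ u v = p ∧ b.lin η u v = q := by
  have key : ∀ a b : Pencil, ∀ θ η p q : ℝ, a ≠ b → a.lb < θ → b.lb < η →
      (∃ u v, b.lin η u v = q ∧ a.lin θ u v = p) → ∃ u v, a.lin θ u v = p ∧ b.lin η u v = q :=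
    fun a b θ η p q _ _ _ ⟨u, v, h1, h2⟩ => ⟨u, v, h2, h1⟩
  have xy : ∀ θ η p q : ℝ, ∃ u v, X.lin θ u v = p ∧ Y.lin η u v = q :=
    fun θ η p q => ⟨p, q, rfl, rfl⟩
  have xr : ∀ θ η p q : ℝ, ∃ u v, X.lin θ u v = p ∧ R.lin η u v = q :=
    fun θ η p q => ⟨p, q + η * p, rfl, by simp only [lin]; ring⟩
  have xd : ∀ θ η p q : ℝ, ∃ u v, X.lin θ u v = p ∧ D.lin η u v = q :=
    fun θ η p q => ⟨p, q + p, rfl, by simp only [lin]; ring⟩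
  have yr : ∀ θ η p q : ℝ, 1 < η → ∃ u v, Y.lin θ u v = p ∧ R.lin η u v = q :=
    fun θ η p q h => ⟨(p - q) / η, p, rfl, by
      have : η ≠ 0 := by linarith
      simp only [lin]; field_simp; ring⟩
  have yd : ∀ θ η p q : ℝ, ∃ u v, Y.lin θ u v = p ∧ D.lin η u v = q :=
    fun θ η p q => ⟨p - q, p, rfl, by simp only [lin]; ring⟩
  have rd : ∀ θ η p q : ℝ, 1 < θ → ∃ u v, R.lin θ u v = p ∧ D.lin η u v = q :=
    fun θ η p q h => ⟨(q - p) / (θ - 1), (q - p) / (θ - 1) + q, by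
      have : θ - 1 ≠ 0 := by linarith
      simp only [lin]; field_simp; ring, by simp only [lin]; ring⟩
  cases a <;> cases b <;> first
    | exact absurd rfl hab | exact xy _ _ _ _ | exact xr _ _ _ _ | exact xd _ _ _ _
    | exact yr _ _ _ _ hη | exact yd _ _ _ _ | exact rd _ _ _ _ hθ
    | (refine key _ _ _ _ _ _ hab hθ hη ?_; first
      | exact xy _ _ _ _ | exact xr _ _ _ _ | exact xd _ _ _ _
      | exact yr _ _ _ _ hθ | exact yd _ _ _ _ | exact rd _ _ _ _ hη)

end Pencil

lemma sign_combo {σ : SignType} {a b s t : ℝ} (hs : 0 ≤ s) (ht : 0 ≤ t) (hst : s + t = 1)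
    (ha : SignType.sign a = σ) (hb : SignType.sign b = σ) : SignType.sign (s * a + t * b) = σ := by
  have hst' : 0 < s ∨ 0 < t := by
    by_contra! h
    linarith
  rcases σ with _ | _ | _
  · have ha' : a = 0 := sign_eq_zero_iff.1 ha
    have hb' : b = 0 := sign_eq_zero_iff.1 hb
    simp [ha', hb']
  · have ha' : a < 0 := sign_eq_neg_one_iff.1 ha
    have hb' : b < 0 := sign_eq_neg_one_iff.1 hb
    refine sign_neg ?_
    rcases hst' with h | h <;> nlinarith
  · have ha' : 0 < a := sign_eq_one_iff.1 ha
    have hb' : 0 < b := sign_eq_one_iff.1 hb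
    refine sign_pos ?_
    rcases hst' with h | h <;> nlinarith

lemma eventually_sign {σ : SignType} {a : ℝ} (b : ℝ) (ha : SignType.sign a = σ) (h0 : σ ≠ 0) :
    ∀ᶠ ε in nhdsWithin (0 : ℝ) (Set.Ioi 0), SignType.sign (a + ε * b) = σ := by
  rcases σ with _ | _ | _
  · exact absurd rfl h0
  · have ha' : a < 0 := sign_eq_neg_one_iff.1 ha
    filter_upwards [eventually_small (neg_pos.2 ha') (-b)] with ε h
    exact sign_neg (by linarith)
  · have ha' : 0 < a := sign_eq_one_iff.1 ha
    filter_upwards [eventually_small ha' b] with ε h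
    exact sign_pos h

/-- The sign given by a boolean. -/
def bsign (s : Bool) : SignType := if s then 1 else -1

lemma bsign_ne_zero (s : Bool) : bsign s ≠ 0 := by
  cases s <;> decide

namespace LineSys

variable {Λ J : Type} [DecidableEq Λ] [DecidableEq J]

/-- Adding two lines parallel to a given one. -/
def doubleLine (L : LineSys Λ J) (l₀ : Λ) (j₀ : J) : LineSys (Λ ⊕ Bool) J :=
  ⟨Sum.elim L.ty fun _ => L.ty l₀, Sum.elim L.sg fun s j => if j = j₀ then bsign s else L.sg l₀ j⟩

/-- Replacing a line by two parallel ones. -/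
def splitLine (L : LineSys Λ J) (l₀ : Λ) (j₀ : J) : LineSys ({l // l ≠ l₀} ⊕ Bool) J :=
  (L.doubleLine l₀ j₀).comap (Sum.map Subtype.val id) id

/-- Adding four points in the sectors formed by two lines through a given point. -/
def quadPoint (L : LineSys Λ J) (l₁ l₂ : Λ) (j₀ : J) : LineSys Λ (J ⊕ Bool × Bool) :=
  ⟨L.ty, fun l => Sum.elim (L.sg l) fun s =>
    if l = l₁ then bsign s.1 else if l = l₂ then bsign s.2 else L.sg l j₀⟩

/-- Replacing a point by four points. -/
def splitPoint (L : LineSys Λ J) (l₁ l₂ : Λ) (j₀ : J) :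
    LineSys Λ ({j // j ≠ j₀} ⊕ Bool × Bool) :=
  (L.quadPoint l₁ l₂ j₀).comap id (Sum.map Subtype.val id)

variable [Finite Λ] [Finite J]

lemma se_splitLine (L : LineSys Λ J) {l₀ : Λ} {j₀ : J} (h0 : L.sg l₀ j₀ = 0)
    (h1 : ∀ j, L.sg l₀ j = 0 → j = j₀) : SE L.space (L.splitLine l₀ j₀).space := by
  have e1 : SE L.space (L.doubleLine l₀ j₀).space := by
    refine SE.addLines (L.doubleLine l₀ j₀) Sum.inl_injective fun x hx => ?_
    set a := L.ty l₀
    set θ := x (.inl l₀)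
    have key : ∀ᶠ ε in nhdsWithin (0 : ℝ) (Set.Ioi 0), 0 < ε ∧ a.lb < θ - ε ∧
        ∀ s : Bool, ∀ j, j ≠ j₀ → SignType.sign (a.ev (θ + if s then -ε else ε)
          (x (.inr (j, false))) (x (.inr (j, true)))) = L.sg l₀ j := by
      refine (eventually_nhdsWithin_of_forall fun ε hε => hε).and (Filter.Eventually.and ?_
        (Filter.eventually_all.2 fun s => Filter.eventually_all.2 fun j => ?_))
      · filter_upwards [eventually_small (sub_pos.2 (hx.2.1 l₀)) (-1)] with ε h
        change 0 < θ - a.lb + _ at h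
        linarith
      · by_cases hj : j = j₀
        · exact Filter.Eventually.of_forall fun ε h => absurd hj h
        · have hs : SignType.sign (a.ev θ (x (.inr (j, false))) (x (.inr (j, true)))) =
            L.sg l₀ j := hx.2.2 l₀ j
          have h2 := eventually_sign ((if s then 1 else -1) *
            if a = .R then x (.inr (j, false)) else 1) hs fun h => hj (h1 j h)
          filter_upwards [h2] with ε h _
          rw [← h]
          congr 1
          cases s <;> cases a <;> simp [Pencil.ev] <;> ring
    obtain ⟨ε, hε, h2, h3⟩ := key.exists
    refine ⟨Sum.elim (Sum.elim (fun l => x (.inl l)) fun s => θ + if s then -ε else ε)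
      fun p => x (.inr p), ⟨hx.1, ?_, ?_⟩, ?_⟩
    · rintro (l | s)
      · exact hx.2.1 l
      · change a.lb < θ + _
        cases s
        · have : a.lb < θ := hx.2.1 l₀
          simpa using this.trans (lt_add_of_pos_right _ hε)
        · simpa [← sub_eq_add_neg] using h2
    · rintro (l | s) j
      · exact hx.2.2 l j
      · rcases eq_or_ne j j₀ with rfl | hj
        · have h4 : a.ev θ (x (.inr (j, false))) (x (.inr (j, true))) = 0 :=
            sign_eq_zero_iff.1 ((hx.2.2 l₀ j).trans h0)
          rw [Pencil.ev_zero _ (hx.1 j).1] at h4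
          refine Eq.trans (?_ : _ = bsign s) (if_pos rfl).symm
          cases s
          · refine sign_neg ((Pencil.ev_neg _ (hx.1 j).1).2 ?_)
            change a.val (x (.inr (j, false))) (x (.inr (j, true))) < θ + ε
            linarith
          · refine sign_pos ((Pencil.ev_pos _ (hx.1 j).1).2 ?_)
            change θ + -ε < a.val (x (.inr (j, false))) (x (.inr (j, true)))
            linarith
        · exact (h3 s j hj).trans (if_neg hj).symm
    · funext r
      rcases r with l | p <;> rfl
  refine e1.trans (SE.symm (SE.addLines (L.doubleLine l₀ j₀)
    (Subtype.val_injective.sumMap Function.injective_id) fun x hx => ?_))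
  set a := L.ty l₀
  set v := a.val (x (.inr (j₀, false))) (x (.inr (j₀, true)))
  have hT : ∀ s : Bool, ∀ j, SignType.sign (a.ev (x (.inl (.inr s)))
      (x (.inr (j, false))) (x (.inr (j, true)))) = if j = j₀ then bsign s else L.sg l₀ j :=
    fun s j => hx.2.2 (.inr s) j
  have lo : x (.inl (.inr true)) < v := by
    rw [← Pencil.ev_pos _ (hx.1 j₀).1, ← sign_eq_one_iff]
    exact (hT true j₀).trans (if_pos rfl)
  have hi : v < x (.inl (.inr false)) := by
    rw [← Pencil.ev_neg _ (hx.1 j₀).1, ← sign_eq_neg_one_iff]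
    exact (hT false j₀).trans (if_pos rfl)
  obtain ⟨w, hw, hw0⟩ : ∃ w : Λ → ℝ, (∀ l h, w l = x (.inl (.inl ⟨l, h⟩))) ∧ w l₀ = v :=
    ⟨fun l => if h : l ≠ l₀ then x (.inl (.inl ⟨l, h⟩)) else v, fun l h => dif_pos h,
      dif_neg (by simp)⟩
  refine ⟨Sum.elim (Sum.elim w fun s => x (.inl (.inr s))) fun p => x (.inr p),
    ⟨hx.1, ?_, ?_⟩, ?_⟩
  · rintro (l | s)
    · change (L.ty l).lb < w l
      by_cases h : l = l₀
      · subst h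
        exact hw0 ▸ Pencil.lb_lt_val a (hx.1 j₀).1 (hx.1 j₀).2
      · exact hw l h ▸ hx.2.1 (.inl ⟨l, h⟩)
    · exact hx.2.1 (.inr s)
  · rintro (l | s) j
    · change SignType.sign ((L.ty l).ev (w l) (x (.inr (j, false))) (x (.inr (j, true)))) = L.sg l j
      by_cases h : l = l₀
      · subst h
        rw [hw0]
        by_cases hj : j = j₀
        · subst hj
          rw [h0]
          exact sign_eq_zero_iff.2 ((Pencil.ev_zero _ (hx.1 j).1).2 rfl)
        · have h2 := hT true j
          have h3 := hT false j
          rw [if_neg hj] at h2 h3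
          have h4 := fun h => hj (h1 j h)
          generalize L.sg l j = σ at *
          rcases σ with _ | _ | _
          · exact absurd rfl h4
          · have h2 := (Pencil.ev_neg _ (hx.1 j).1).1 (sign_eq_neg_one_iff.1 h2)
            exact sign_neg ((Pencil.ev_neg _ (hx.1 j).1).2 (h2.trans lo))
          · have h3 := (Pencil.ev_pos _ (hx.1 j).1).1 (sign_eq_one_iff.1 h3)
            exact sign_pos ((Pencil.ev_pos _ (hx.1 j).1).2 (hi.trans h3))
      · rw [hw l h]
        exact hx.2.2 (.inl ⟨l, h⟩) j
    · exact hx.2.2 (.inr s) j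
  · funext r
    rcases r with (⟨l, h⟩ | s) | p
    · exact hw l h
    · rfl
    · rfl

lemma se_splitPoint (L : LineSys Λ J) {l₁ l₂ : Λ} {j₀ : J} (hty : L.ty l₁ ≠ L.ty l₂)
    (h1 : L.sg l₁ j₀ = 0) (h2 : L.sg l₂ j₀ = 0) (h3 : ∀ l, L.sg l j₀ = 0 → l = l₁ ∨ l = l₂) :
    SE L.space (L.splitPoint l₁ l₂ j₀).space := by
  have hne : l₂ ≠ l₁ := fun h => hty (h ▸ rfl)
  have e1 : SE L.space (L.quadPoint l₁ l₂ j₀).space := by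
    refine SE.addPoints (L.quadPoint l₁ l₂ j₀) Sum.inl_injective fun x hx => ?_
    set p := x (.inr (j₀, false))
    set q := x (.inr (j₀, true))
    have hs : ∀ l, SignType.sign ((L.ty l).ev (x (.inl l)) p q) = L.sg l j₀ :=
      fun l => hx.2.2 l j₀
    choose u v hu hv using fun s : Bool × Bool => Pencil.exists_lin _ _ hty (hx.2.1 l₁) (hx.2.1 l₂)
      (if s.1 then 1 else -1) (if s.2 then 1 else -1)
    have hb : ∀ (s : Bool) {ε : ℝ}, 0 < ε →
        SignType.sign (ε * if s then 1 else -1) = bsign s := by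
      intro s ε hε
      cases s
      · exact sign_neg (by simpa using hε)
      · exact sign_pos (by simpa using hε)
    have key : ∀ᶠ ε in nhdsWithin (0 : ℝ) (Set.Ioi 0), 0 < ε ∧ ∀ s, 0 < p + ε * u s ∧
        0 < q - p + ε * (v s - u s) ∧ ∀ l, l ≠ l₁ → l ≠ l₂ →
          SignType.sign ((L.ty l).ev (x (.inl l)) (p + ε * u s) (q + ε * v s)) = L.sg l j₀ := by
      refine (eventually_nhdsWithin_of_forall fun ε hε => hε).and
        (Filter.eventually_all.2 fun s => (eventually_small (hx.1 j₀).1 _).and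
          ((eventually_small (sub_pos.2 (hx.1 j₀).2) _).and (Filter.eventually_all.2 fun l => ?_)))
      by_cases h : L.sg l j₀ = 0
      · refine Filter.Eventually.of_forall fun ε g1 g2 => ?_
        rcases h3 l h with g | g
        exacts [absurd g g1, absurd g g2]
      · filter_upwards [eventually_sign ((L.ty l).lin (x (.inl l)) (u s) (v s)) (hs l) h] with ε h _ _
        rw [Pencil.ev_add, h]
    obtain ⟨ε, hε, h5⟩ := key.exists
    refine ⟨Sum.elim (fun l => x (.inl l)) fun r => Sum.elim (fun j => x (.inr (j, r.2)))
      (fun s => if r.2 then q + ε * v s else p + ε * u s) r.1, ⟨?_, hx.2.1, ?_⟩, ?_⟩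
    · rintro (j | s)
      · exact hx.1 j
      · refine ⟨(h5 s).1, ?_⟩
        change p + ε * u s < q + ε * v s
        linarith [(h5 s).2.1]
    · rintro l (j | s)
      · exact hx.2.2 l j
      · change SignType.sign ((L.ty l).ev (x (.inl l)) (p + ε * u s) (q + ε * v s)) =
          if l = l₁ then bsign s.1 else if l = l₂ then bsign s.2 else L.sg l j₀
        by_cases g1 : l = l₁
        · subst g1
          rw [if_pos rfl, Pencil.ev_add, hu, sign_eq_zero_iff.1 ((hs l).trans h1), zero_add, hb _ hε]
        · rw [if_neg g1]
          by_cases g2 : l = l₂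
          · subst g2
            rw [if_pos rfl, Pencil.ev_add, hv, sign_eq_zero_iff.1 ((hs l).trans h2), zero_add,
              hb _ hε]
          · rw [if_neg g2, (h5 s).2.2 l g1 g2]
    · funext r
      rcases r with l | p <;> rfl
  refine e1.trans (SE.symm (SE.addPoints (L.quadPoint l₁ l₂ j₀)
    (Subtype.val_injective.sumMap Function.injective_id) fun x hx => ?_))
  have hT : ∀ l s, SignType.sign ((L.ty l).ev (x (.inl l)) (x (.inr (.inr s, false)))
      (x (.inr (.inr s, true)))) =
      if l = l₁ then bsign s.1 else if l = l₂ then bsign s.2 else L.sg l j₀ :=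
    fun l s => hx.2.2 l (.inr s)
  set C : Set (ℝ × ℝ) := {z | 0 < z.1 ∧ 0 < z.2 - z.1 ∧ ∀ l, l ≠ l₁ → l ≠ l₂ →
    SignType.sign ((L.ty l).ev (x (.inl l)) z.1 z.2) = L.sg l j₀} with hC
  have hconv : Convex ℝ C := by
    rintro a ⟨a1, a2, a3⟩ b ⟨b1, b2, b3⟩ s t hs ht hst
    have pos : ∀ {a b : ℝ}, 0 < a → 0 < b → 0 < s * a + t * b := fun ha hb =>
      sign_eq_one_iff.1 (sign_combo hs ht hst (sign_pos ha) (sign_pos hb))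
    refine ⟨pos a1 b1, ?_, fun l g1 g2 => ?_⟩
    · have := pos a2 b2
      simp only [Prod.fst_add, Prod.snd_add, Prod.smul_fst, Prod.smul_snd, smul_eq_mul]
      linarith
    · simp only [Prod.fst_add, Prod.snd_add, Prod.smul_fst, Prod.smul_snd, smul_eq_mul]
      rw [Pencil.ev_combo _ _ _ _ _ _ _ _ hst]
      exact sign_combo hs ht hst (a3 l g1 g2) (b3 l g1 g2)
  obtain ⟨z, ⟨z1, z2, z3⟩, hz1, hz2⟩ := exists_cross hconv
    (E := fun z => (L.ty l₁).ev (x (.inl l₁)) z.1 z.2)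
    (F := fun z => (L.ty l₂).ev (x (.inl l₂)) z.1 z.2)
    (fun p q s t h => Pencil.ev_combo _ _ _ _ _ _ _ _ h)
    (fun p q s t h => Pencil.ev_combo _ _ _ _ _ _ _ _ h)
    (p := fun a b => (x (.inr (.inr (a, b), false)), x (.inr (.inr (a, b), true))))
    (fun a b => ⟨(hx.1 (.inr (a, b))).1, sub_pos.2 (hx.1 (.inr (a, b))).2, fun l g1 g2 => by
      rw [hT, if_neg g1, if_neg g2]⟩)
    (fun b => by rw [← sign_eq_one_iff, hT, if_pos rfl]; rfl)
    (fun b => by rw [← sign_eq_neg_one_iff, hT, if_pos rfl]; rfl)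
    (fun b => by rw [← sign_eq_one_iff, hT, if_neg hne, if_pos rfl]; rfl)
    (fun b => by rw [← sign_eq_neg_one_iff, hT, if_neg hne, if_pos rfl]; rfl)
  obtain ⟨w, hw, hw0⟩ : ∃ w : J → Bool → ℝ, (∀ j h, w j = fun b => x (.inr (.inl ⟨j, h⟩, b))) ∧
      w j₀ = fun b => if b then z.2 else z.1 :=
    ⟨fun j => if h : j ≠ j₀ then fun b => x (.inr (.inl ⟨j, h⟩, b)) else
      fun b => if b then z.2 else z.1, fun l h => dif_pos h, dif_neg (by simp)⟩
  refine ⟨Sum.elim (fun l => x (.inl l)) fun r => Sum.elim (fun j => w j r.2)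
    (fun s => x (.inr (.inr s, r.2))) r.1, ⟨?_, hx.2.1, ?_⟩, ?_⟩
  · rintro (j | s)
    · change 0 < w j false ∧ w j false < w j true
      by_cases h : j = j₀
      · subst h
        rw [hw0]
        exact ⟨z1, sub_pos.1 z2⟩
      · rw [hw j h]
        exact hx.1 (.inl ⟨j, h⟩)
    · exact hx.1 (.inr s)
  · rintro l (j | s)
    · change SignType.sign ((L.ty l).ev (x (.inl l)) (w j false) (w j true)) = L.sg l j
      by_cases h : j = j₀
      · subst h
        rw [hw0]
        change SignType.sign ((L.ty l).ev (x (.inl l)) z.1 z.2) = L.sg l j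
        by_cases g1 : l = l₁
        · subst g1
          rw [h1]
          exact sign_eq_zero_iff.2 hz1
        · by_cases g2 : l = l₂
          · subst g2
            rw [h2]
            exact sign_eq_zero_iff.2 hz2
          · exact z3 l g1 g2
      · rw [hw j h]
        exact hx.2.2 l (.inl ⟨j, h⟩)
    · exact hx.2.2 l (.inr s)
  · funext r
    rcases r with l | ⟨⟨j, h⟩ | s, b⟩
    · rfl
    · exact congrFun (hw j h) b
    · rfl

end LineSys

end Scatter

/-! ### Resolving all incidences -/

section Resolve

namespace LineSys

/-- The points and lines of a system which have incidences are constructed one after another,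
such that each point is constructed on two previous lines, and each line through at most one
previous point. -/
structure Constructible {Λ J : Type} (L : LineSys Λ J) (a : Λ → ℕ) (b : J → ℕ) (N : ℕ) : Prop where
  bound : ∀ l j, L.sg l j = 0 → a l < N ∧ b j < N
  ne : ∀ l j l' j', L.sg l j = 0 → L.sg l' j' = 0 → a l ≠ b j'
  inj_line : ∀ l j l' j', L.sg l j = 0 → L.sg l' j' = 0 → a l = a l' → l = l'
  inj_point : ∀ l j l' j', L.sg l j = 0 → L.sg l' j' = 0 → b j = b j' → j = j'
  line : ∀ l j j', L.sg l j = 0 → L.sg l j' = 0 → b j < a l → b j' < a l → j = j'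
  point : ∀ l j, L.sg l j = 0 → a l < b j → ∃ l', L.ty l' ≠ L.ty l ∧ L.sg l' j = 0 ∧
    a l' < b j ∧ ∀ l'', L.sg l'' j = 0 → a l'' < b j → l'' = l ∨ l'' = l'

lemma exists_resolution (N : ℕ) : ∀ (Λ J : Type) [Finite Λ] [Finite J] (L : LineSys Λ J)
    (a : Λ → ℕ) (b : J → ℕ), L.Constructible a b N →
    ∃ (Λ' J' : Type) (_ : Finite Λ') (_ : Finite J') (L' : LineSys Λ' J'),
      (∀ l j, L'.sg l j ≠ 0) ∧ SE L.space L'.space := by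
  classical
  induction N with
  | zero =>
    intro Λ J _ _ L a b h
    exact ⟨Λ, J, inferInstance, inferInstance, L,
      fun l j h0 => absurd (h.bound l j h0).1 (Nat.not_lt_zero _), SE.refl _⟩
  | succ N ih =>
    intro Λ J _ _ L a b h
    by_cases h1 : ∃ l j, L.sg l j = 0 ∧ a l = N
    · obtain ⟨l₀, j₀, h0, ha⟩ := h1
      have hlt : ∀ l j, L.sg l j = 0 → b j < N := fun l j hj =>
        lt_of_le_of_ne (Nat.lt_succ_iff.1 (h.bound l j hj).2) fun e =>
          h.ne l₀ j₀ l j h0 hj (ha.trans e.symm)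
      have huniq : ∀ j, L.sg l₀ j = 0 → j = j₀ := fun j hj =>
        h.line l₀ j j₀ hj h0 (ha ▸ hlt l₀ j hj) (ha ▸ hlt l₀ j₀ h0)
      have hS : ∀ s j, (L.splitLine l₀ j₀).sg (.inr s) j ≠ 0 := by
        intro s j
        change (if j = j₀ then bsign s else L.sg l₀ j) ≠ 0
        split_ifs with hj
        exacts [bsign_ne_zero s, fun h => hj (huniq j h)]
      have hC : (L.splitLine l₀ j₀).Constructible (Sum.elim (fun l => a l.1) fun _ => 0) b N := by
        refine ⟨?_, ?_, ?_, ?_, ?_, ?_⟩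
        · rintro (l | s) j hj
          · refine ⟨lt_of_le_of_ne (Nat.lt_succ_iff.1 (h.bound l.1 j hj).1) fun e => l.2 ?_,
              hlt l.1 j hj⟩
            exact h.inj_line l.1 j l₀ j₀ hj h0 (e.trans ha.symm)
          · exact absurd hj (hS s j)
        · rintro (l | s) j (l' | s') j' hj hj'
          · exact h.ne l.1 j l'.1 j' hj hj'
          all_goals first | exact absurd hj (hS _ _) | exact absurd hj' (hS _ _)
        · rintro (l | s) j (l' | s') j' hj hj' e
          · rw [Subtype.ext (h.inj_line l.1 j l'.1 j' hj hj' e)]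
          all_goals first | exact absurd hj (hS _ _) | exact absurd hj' (hS _ _)
        · rintro (l | s) j (l' | s') j' hj hj' e
          · exact h.inj_point l.1 j l'.1 j' hj hj' e
          all_goals first | exact absurd hj (hS _ _) | exact absurd hj' (hS _ _)
        · rintro (l | s) j j' hj hj'
          · exact h.line l.1 j j' hj hj'
          · exact absurd hj (hS _ _)
        · rintro (l | s) j hj hlt'
          · obtain ⟨l', e1, e2, e3, e4⟩ := h.point l.1 j hj hlt'
            have hl' : l' ≠ l₀ := by
              rintro rfl
              have := hlt l.1 j hj
              omega
            refine ⟨.inl ⟨l', hl'⟩, e1, e2, e3, ?_⟩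
            rintro (l'' | s) k1 k2
            · rcases e4 l''.1 k1 k2 with k | k
              · exact .inl (congrArg _ (Subtype.ext k))
              · exact .inr (congrArg _ (Subtype.ext k))
            · exact absurd k1 (hS _ _)
          · exact absurd hj (hS _ _)
      obtain ⟨Λ', J', f1, f2, L', g1, g2⟩ := ih _ J (L.splitLine l₀ j₀) _ b hC
      exact ⟨Λ', J', f1, f2, L', g1, (L.se_splitLine h0 huniq).trans g2⟩
    by_cases h2 : ∃ l j, L.sg l j = 0 ∧ b j = N
    · obtain ⟨l₁, j₀, h0, hb⟩ := h2
      have hlt : ∀ l j, L.sg l j = 0 → a l < N := fun l j hj =>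
        lt_of_le_of_ne (Nat.lt_succ_iff.1 (h.bound l j hj).1) fun e => h1 ⟨l, j, hj, e⟩
      obtain ⟨l₂, t1, t2, -, t4⟩ := h.point l₁ j₀ h0 (hb ▸ hlt l₁ j₀ h0)
      have t5 : ∀ l, L.sg l j₀ = 0 → l = l₁ ∨ l = l₂ := fun l hl =>
        t4 l hl (hb ▸ hlt l j₀ hl)
      have hS : ∀ l s, (L.splitPoint l₁ l₂ j₀).sg l (.inr s) ≠ 0 := by
        intro l s
        change (if l = l₁ then bsign s.1 else if l = l₂ then bsign s.2 else L.sg l j₀) ≠ 0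
        split_ifs with k1 k2
        · exact bsign_ne_zero _
        · exact bsign_ne_zero _
        · intro hl
          rcases t5 l hl with k | k
          exacts [k1 k, k2 k]
      have hC : (L.splitPoint l₁ l₂ j₀).Constructible a (Sum.elim (fun j => b j.1) fun _ => 0) N := by
        refine ⟨?_, ?_, ?_, ?_, ?_, ?_⟩
        · rintro l (j | s) hj
          · refine ⟨hlt l j.1 hj, lt_of_le_of_ne (Nat.lt_succ_iff.1 (h.bound l j.1 hj).2)
              fun e => j.2 ?_⟩
            exact h.inj_point l j.1 l₁ j₀ hj h0 (e.trans hb.symm)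
          · exact absurd hj (hS l s)
        · rintro l (j | s) l' (j' | s') hj hj'
          · exact h.ne l j.1 l' j'.1 hj hj'
          all_goals first | exact absurd hj (hS _ _) | exact absurd hj' (hS _ _)
        · rintro l (j | s) l' (j' | s') hj hj' e
          · exact h.inj_line l j.1 l' j'.1 hj hj' e
          all_goals first | exact absurd hj (hS _ _) | exact absurd hj' (hS _ _)
        · rintro l (j | s) l' (j' | s') hj hj' e
          · rw [Subtype.ext (h.inj_point l j.1 l' j'.1 hj hj' e)]
          all_goals first | exact absurd hj (hS _ _) | exact absurd hj' (hS _ _)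
        · rintro l (j | s) (j' | s') hj hj' e e'
          · rw [Subtype.ext (h.line l j.1 j'.1 hj hj' e e')]
          all_goals first | exact absurd hj (hS _ _) | exact absurd hj' (hS _ _)
        · rintro l (j | s) hj
          · exact h.point l j.1 hj
          · exact absurd hj (hS _ _)
      obtain ⟨Λ', J', f1, f2, L', g1, g2⟩ := ih Λ _ (L.splitPoint l₁ l₂ j₀) a _ hC
      exact ⟨Λ', J', f1, f2, L', g1, (L.se_splitPoint t1.symm h0 t2 t5).trans g2⟩
    · refine ih Λ J L a b ⟨fun l j hj => ⟨?_, ?_⟩, h.ne, h.inj_line, h.inj_point, h.line, h.point⟩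
      · exact lt_of_le_of_ne (Nat.lt_succ_iff.1 (h.bound l j hj).1) fun e => h1 ⟨l, j, hj, e⟩
      · exact lt_of_le_of_ne (Nat.lt_succ_iff.1 (h.bound l j hj).2) fun e => h2 ⟨l, j, hj, e⟩

lemma exists_polytope_of_constructible {Λ J : Type} [Finite Λ] [Finite J] (L : LineSys Λ J)
    {a : Λ → ℕ} {b : J → ℕ} {N : ℕ} (h : L.Constructible a b N) (hne : L.space.Nonempty) :
    ∃ (d n : ℕ) (v : Fin n → Fin d → ℝ) (B : Finset (Fin n)),
      IsPolytopeVertexList v ∧ IsSimplicialVertexList v ∧ B.card = d + 1 ∧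
      AffineIndependent ℝ (fun i : ↥B => v i) ∧
      SE L.space (flat (polytopeRealizationSpace v B)) := by
  obtain ⟨Λ', J', _, _, L', h0, h1⟩ := exists_resolution N Λ J L a b h
  obtain ⟨d, n, v, B, a, b, c, e, h2⟩ := exists_polytope L' h0 (h1.nonempty hne)
  exact ⟨d, n, v, B, a, b, c, e, h1.trans h2⟩

end LineSys

end Resolve

/-! ### Ordered chains of numbers with additive and multiplicative proportions -/

section Chains

/-- Sign of a difference of natural numbers. -/
def ncmp (m n : ℕ) : SignType := SignType.sign ((m : ℤ) - n)

lemma ncmp_of_lt {m n : ℕ} (h : m < n) : ncmp m n = -1 := sign_neg (by omega)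
lemma ncmp_of_gt {m n : ℕ} (h : n < m) : ncmp m n = 1 := sign_pos (by omega)
lemma ncmp_self (m : ℕ) : ncmp m m = 0 := by simp [ncmp]
lemma ncmp_eq_zero {m n : ℕ} : ncmp m n = 0 ↔ m = n := by
  rw [ncmp, sign_eq_zero_iff]
  omega

/-- A linear order (given by `rk`) on variables, together with proportions between them: each of
them states `p + s = q + r` or `p * s = q * r`. -/
structure Chain (I G : Type) where
  rk : I → ℕ
  kind : G → Bool
  p : G → I
  q : G → I
  r : G → I
  s : G → I
  rk_inj : Function.Injective rk
  s_inj : Function.Injective s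
  rk_pq : ∀ g, rk (p g) < rk (q g)
  rk_qr : ∀ g, rk (q g) < rk (r g)
  rk_rs : ∀ g, rk (r g) < rk (s g)

variable {I G : Type}

namespace Chain

/-- The solutions of a chain. -/
def space (C : Chain I G) : Set (I → ℝ) :=
  {v | (∀ i, 0 < v i) ∧ (∀ i j, C.rk i < C.rk j → v i < v j) ∧
    ∀ g, if C.kind g then v (C.p g) * v (C.s g) = v (C.q g) * v (C.r g)
      else v (C.p g) + v (C.s g) = v (C.q g) + v (C.r g)}

/-- The abscissa of a point of a proportion. -/
def xsel (C : Chain I G) (g : G) (a b : Bool) : I :=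
  bif a then bif b then C.r g else C.s g else bif b then C.p g else C.q g

/-- Points and lines expressing the proportions of a chain. -/
def system (C : Chain I G) : LineSys (I ⊕ G × Bool × Bool) (G × Bool × Bool) where
  ty := Sum.elim (fun _ => .X) fun h => bif h.2.1 then bif C.kind h.1 then .R else .D else .Y
  sg := Sum.elim (fun i j => ncmp (C.rk (C.xsel j.1 j.2.1 j.2.2)) (C.rk i)) fun h j =>
    ncmp (2 * C.rk (C.s j.1) + (bif h.2.1 then j.2.2 else j.2.1).toNat)
      (2 * C.rk (C.s h.1) + h.2.2.toNat)

lemma system_zero_inl (C : Chain I G) (i : I) (j : G × Bool × Bool) :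
    C.system.sg (.inl i) j = 0 ↔ i = C.xsel j.1 j.2.1 j.2.2 := by
  refine ncmp_eq_zero.trans ⟨fun h => (C.rk_inj h).symm, fun h => by rw [h]⟩

lemma system_zero_inr (C : Chain I G) (h j : G × Bool × Bool) :
    C.system.sg (.inr h) j = 0 ↔ h.1 = j.1 ∧ h.2.2 = bif h.2.1 then j.2.2 else j.2.1 := by
  refine ncmp_eq_zero.trans ⟨fun e => ?_, fun e => by rw [e.1, e.2]⟩
  obtain ⟨h, a, b⟩ := h
  obtain ⟨j, c, d⟩ := j
  have key : C.rk (C.s j) = C.rk (C.s h) ∧ (bif a then d else c) = b := by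
    revert e
    cases a <;> cases b <;> cases c <;> cases d <;> simp <;> omega
  exact ⟨(C.s_inj (C.rk_inj key.1)).symm, key.2.symm⟩

/-- The position of a line in the construction of a proportion. -/
def lineOff (h : Bool × Bool) : ℕ :=
  bif h.1 then bif h.2 then 0 else 6 else bif h.2 then 4 else 2

/-- The position of a point in the construction of a proportion. -/
def pointOff (h : Bool × Bool) : ℕ :=
  bif h.1 then bif h.2 then 3 else 7 else bif h.2 then 1 else 5

lemma lineOff_inj : Function.Injective lineOff := by decide
lemma pointOff_inj : Function.Injective pointOff := by decide
lemma lineOff_le : ∀ h, lineOff h ≤ 6 ∧ lineOff h % 2 = 0 := by decide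
lemma pointOff_le : ∀ h, pointOff h ≤ 7 ∧ pointOff h % 2 = 1 := by decide

lemma constructible_system [Finite I] (C : Chain I G) : ∃ N, C.system.Constructible
    (Sum.elim (fun i => 16 * C.rk i + 15) fun h => 16 * C.rk (C.s h.1) + lineOff h.2)
    (fun j => 16 * C.rk (C.s j.1) + pointOff j.2) N := by
  obtain ⟨M, hM⟩ := (Set.finite_range C.rk).bddAbove
  have hM' : ∀ i, C.rk i ≤ M := fun i => hM ⟨i, rfl⟩
  refine ⟨16 * M + 16, ⟨?_, ?_, ?_, ?_, ?_, ?_⟩⟩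
  · rintro (i | h) j -
    · have := hM' i
      have := hM' (C.s j.1)
      have := pointOff_le j.2
      simp only [Sum.elim_inl]
      omega
    · have := hM' (C.s h.1)
      have := hM' (C.s j.1)
      have := pointOff_le j.2
      have := lineOff_le h.2
      simp only [Sum.elim_inr]
      omega
  · rintro (i | h) - l' j - -
    · have := pointOff_le j.2
      simp only [Sum.elim_inl]
      omega
    · have := pointOff_le j.2
      have := lineOff_le h.2
      simp only [Sum.elim_inr]
      omega
  · rintro (i | h) - (i' | h') - - - e
    · simp only [Sum.elim_inl] at e
      rw [C.rk_inj (show C.rk i = C.rk i' by omega)]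
    · have := lineOff_le h'.2
      simp only [Sum.elim_inl, Sum.elim_inr] at e
      omega
    · have := lineOff_le h.2
      simp only [Sum.elim_inl, Sum.elim_inr] at e
      omega
    · have := lineOff_le h.2
      have := lineOff_le h'.2
      simp only [Sum.elim_inr] at e
      have e1 : C.rk (C.s h.1) = C.rk (C.s h'.1) := by omega
      have e2 : lineOff h.2 = lineOff h'.2 := by omega
      rw [Prod.ext (C.s_inj (C.rk_inj e1)) (lineOff_inj e2)]
  · rintro - j - j' - - e
    have := pointOff_le j.2
    have := pointOff_le j'.2
    beta_reduce at e
    have e1 : C.rk (C.s j.1) = C.rk (C.s j'.1) := by omega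
    have e2 : pointOff j.2 = pointOff j'.2 := by omega
    exact Prod.ext (C.s_inj (C.rk_inj e1)) (pointOff_inj e2)
  · rintro (i | ⟨h, a, b⟩) ⟨g, c, d⟩ ⟨g', c', d'⟩ z z' e e'
    · rw [system_zero_inl] at z z'
      have key : ∀ g c d, i = C.xsel g c d →
          16 * C.rk (C.s g) + pointOff (c, d) < 16 * C.rk i + 15 → i = C.s g ∧ c = true ∧
          d = false := by
        rintro g c d rfl hlt
        have h1 := C.rk_pq g
        have h2 := C.rk_qr g
        have h3 := C.rk_rs g
        cases c <;> cases d <;> simp [xsel, pointOff] at * <;> omega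
      obtain ⟨k1, rfl, rfl⟩ := key g c d z e
      obtain ⟨k2, rfl, rfl⟩ := key g' c' d' z' e'
      rw [C.s_inj (k1.symm.trans k2)]
    · rw [system_zero_inr] at z z'
      obtain ⟨rfl, z⟩ := z
      obtain ⟨rfl, z'⟩ := z'
      simp only [Sum.elim_inr] at *
      have e2 : pointOff (c, d) < lineOff (a, b) := by omega
      have e3 : pointOff (c', d') < lineOff (a, b) := by omega
      have key : ∀ a b c d c' d' : Bool, b = (bif a then d else c) → b = (bif a then d' else c') →
        pointOff (c, d) < lineOff (a, b) → pointOff (c', d') < lineOff (a, b) →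
          c = c' ∧ d = d' := by decide
      obtain ⟨rfl, rfl⟩ := key a b c d c' d' z z' e2 e3
      rfl
  · rintro l ⟨g, c, d⟩ hz hl
    have hcov : ∀ l, C.system.sg l (g, c, d) = 0 → l = .inl (C.xsel g c d) ∨
        l = .inr (g, false, c) ∨ l = .inr (g, true, d) := by
      rintro (i | ⟨h, a, b⟩) h0
      · rw [system_zero_inl] at h0
        exact .inl (congrArg _ h0)
      · rw [system_zero_inr] at h0
        obtain ⟨rfl, h0⟩ := h0
        dsimp only at h0
        subst h0
        cases a
        exacts [.inr (.inl rfl), .inr (.inr rfl)]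
    have z1 : C.system.sg (.inl (C.xsel g c d)) (g, c, d) = 0 := by rw [system_zero_inl]
    have z2 : C.system.sg (.inr (g, false, c)) (g, c, d) = 0 := by rw [system_zero_inr]; exact ⟨rfl, rfl⟩
    have z3 : C.system.sg (.inr (g, true, d)) (g, c, d) = 0 := by rw [system_zero_inr]; exact ⟨rfl, rfl⟩
    have t1 : C.system.ty (.inl (C.xsel g c d)) = .X := rfl
    have t2 : C.system.ty (.inr (g, false, c)) = .Y := rfl
    have t3 : C.system.ty (.inr (g, true, d)) ≠ .X ∧ C.system.ty (.inr (g, true, d)) ≠ .Y := by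
      change (bif C.kind g then Pencil.R else .D) ≠ _ ∧ (bif C.kind g then Pencil.R else .D) ≠ _
      cases C.kind g <;> decide
    generalize ha : (Sum.elim (fun i => 16 * C.rk i + 15) fun h => 16 * C.rk (C.s h.1) + lineOff h.2 :
      I ⊕ G × Bool × Bool → ℕ) = A at *
    have a1 : A (.inl (C.xsel g c d)) = 16 * C.rk (C.xsel g c d) + 15 := by rw [← ha]; rfl
    have a2 : A (.inr (g, false, c)) = 16 * C.rk (C.s g) + lineOff (false, c) := by rw [← ha]; rfl
    have a3 : A (.inr (g, true, d)) = 16 * C.rk (C.s g) + lineOff (true, d) := by rw [← ha]; rfl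
    have fin : ∀ l₁ l₂ l₃ : I ⊕ G × Bool × Bool,
        (∀ l, C.system.sg l (g, c, d) = 0 → l = l₁ ∨ l = l₂ ∨ l = l₃) →
        C.system.sg l₁ (g, c, d) = 0 → C.system.sg l₂ (g, c, d) = 0 →
        A l₁ < 16 * C.rk (C.s g) + pointOff (c, d) → A l₂ < 16 * C.rk (C.s g) + pointOff (c, d) →
        16 * C.rk (C.s g) + pointOff (c, d) ≤ A l₃ → C.system.ty l₁ ≠ C.system.ty l₂ →
        ∃ l', C.system.ty l' ≠ C.system.ty l ∧ C.system.sg l' (g, c, d) = 0 ∧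
          A l' < 16 * C.rk (C.s g) + pointOff (c, d) ∧ ∀ l'', C.system.sg l'' (g, c, d) = 0 →
            A l'' < 16 * C.rk (C.s g) + pointOff (c, d) → l'' = l ∨ l'' = l' := by
      intro l₁ l₂ l₃ hc y1 y2 b1 b2 b3 ht
      rcases hc l hz with rfl | rfl | rfl
      · refine ⟨l₂, ht.symm, y2, b2, fun l'' w1 w2 => ?_⟩
        rcases hc l'' w1 with rfl | rfl | rfl
        exacts [.inl rfl, .inr rfl, by omega]
      · refine ⟨l₁, ht, y1, b1, fun l'' w1 w2 => ?_⟩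
        rcases hc l'' w1 with rfl | rfl | rfl
        exacts [.inr rfl, .inl rfl, by omega]
      · dsimp only at hl
        omega
    have h1 := C.rk_pq g
    have h2 := C.rk_qr g
    have h3 := C.rk_rs g
    clear ha
    cases c <;> cases d <;> simp only [xsel, pointOff, lineOff, cond_true, cond_false] at a1 a2 a3
    · exact fin _ _ _ hcov z1 z2 (by simp only [xsel, pointOff, cond_true, cond_false]; omega)
        (by simp only [pointOff, cond_true, cond_false]; omega)
        (by simp only [pointOff, cond_true, cond_false]; omega) (by rw [t1, t2]; decide)
    · exact fin _ _ _ (fun l h => by have := hcov l h; tauto) z1 z3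
        (by simp only [xsel, pointOff, cond_true, cond_false]; omega)
        (by simp only [pointOff, cond_true, cond_false]; omega)
        (by simp only [pointOff, cond_true, cond_false]; omega) (by rw [t1]; exact t3.1.symm)
    · exact fin _ _ _ (fun l h => by have := hcov l h; tauto) z2 z3
        (by simp only [pointOff, cond_true, cond_false]; omega)
        (by simp only [pointOff, cond_true, cond_false]; omega)
        (by simp only [xsel, pointOff, cond_true, cond_false]; omega) (by rw [t2]; exact t3.2.symm)
    · exact fin _ _ _ (fun l h => by have := hcov l h; tauto) z1 z3
        (by simp only [xsel, pointOff, cond_true, cond_false]; omega)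
        (by simp only [pointOff, cond_true, cond_false]; omega)
        (by simp only [pointOff, cond_true, cond_false]; omega) (by rw [t1]; exact t3.1.symm)

end Chain

end Chains

section Chains

variable {I G : Type}

namespace Chain

private lemma val_range {a : Pencil} (ha : a ≠ .X) {K t x y : ℝ} (hK : 2 ≤ K) (ht : K ^ 5 ≤ t)
    (hx : 1 ≤ x * K) (hx' : x ≤ K) (hy : t ≤ y * K) (hy' : y ≤ t * K) :
    0 < x ∧ x < y ∧ t ≤ a.val x y * K ^ 2 ∧ a.val x y ≤ t * K ^ 2 := by
  have hK0 : 0 < K := by linarith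
  have hK1 : 0 ≤ K - 1 := by linarith
  have h3 : K ^ 3 ≤ K ^ 5 := pow_le_pow_right₀ (by linarith) (by norm_num)
  have h2 : K ^ 2 < K ^ 5 := pow_lt_pow_right₀ (by linarith) (by norm_num)
  have ht0 : 0 < t := lt_of_lt_of_le (by positivity) ht
  have hx0 : 0 < x := by
    by_contra! h
    nlinarith
  have hxy : x < y := by
    by_contra! h
    nlinarith
  have hy0 := hx0.trans hxy
  have e1 : t * K ≤ t * K ^ 2 := by nlinarith [mul_nonneg ht0.le (mul_nonneg hK0.le hK1)]
  have e2 : t * K ≤ y * K ^ 2 := by nlinarith [mul_le_mul_of_nonneg_right hy hK0.le]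
  have e3 : t ≤ t * K := by nlinarith
  refine ⟨hx0, hxy, ?_⟩
  cases a
  · exact absurd rfl ha
  · exact ⟨by simp only [Pencil.val]; linarith, by simp only [Pencil.val]; linarith⟩
  · simp only [Pencil.val]
    constructor
    · rw [div_mul_eq_mul_div, le_div_iff₀ hx0]
      nlinarith
    · rw [div_le_iff₀ hx0]
      nlinarith [mul_le_mul_of_nonneg_left hx (mul_pos ht0 hK0).le]
  · simp only [Pencil.val]
    constructor
    · nlinarith [mul_le_mul_of_nonneg_right hx' (sq_nonneg K), mul_nonneg ht0.le hK1]
    · linarith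

lemma sign_sub_of_mem (C : Chain I G) {v : I → ℝ} (hv : v ∈ C.space) (i j : I) :
    SignType.sign (v i - v j) = ncmp (C.rk i) (C.rk j) := by
  rcases lt_trichotomy (C.rk i) (C.rk j) with h | h | h
  · rw [ncmp_of_lt h]
    exact sign_neg (sub_neg.2 (hv.2.1 i j h))
  · rw [C.rk_inj h, ncmp_self, sub_self, sign_zero]
  · rw [ncmp_of_gt h]
    exact sign_pos (sub_pos.2 (hv.2.1 j i h))

lemma exists_system [Finite I] (C : Chain I G) {v : I → ℝ} (hv : v ∈ C.space) :
    ∃ (θ : G × Bool × Bool → ℝ) (y : G × Bool × Bool → ℝ),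
      (∀ j, v (C.xsel j.1 j.2.1 j.2.2) < y j) ∧ (∀ h, (C.system.ty (.inr h)).lb < θ h) ∧
      ∀ h j, SignType.sign ((C.system.ty (.inr h)).ev (θ h) (v (C.xsel j.1 j.2.1 j.2.2)) (y j)) =
        C.system.sg (.inr h) j := by
  obtain ⟨K, hK, hKv⟩ : ∃ K : ℝ, 2 ≤ K ∧ ∀ i, 1 ≤ v i * K ∧ v i ≤ K := by
    have h1 : ∀ᶠ K : ℝ in Filter.atTop, 2 ≤ K ∧ ∀ i, 1 ≤ v i * K ∧ v i ≤ K := by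
      refine (Filter.eventually_ge_atTop 2).and (Filter.eventually_all.2 fun i =>
        Filter.Eventually.and ?_ (Filter.eventually_ge_atTop _))
      filter_upwards [Filter.eventually_ge_atTop (1 / v i)] with K h
      rw [div_le_iff₀ (hv.1 i)] at h
      linarith
    exact h1.exists
  have hK0 : 0 < K := by linarith
  set t : G → ℝ := fun g => K ^ (5 * (C.rk (C.s g) + 1)) with ht
  set w : G → Bool → I := fun g a => bif a then C.r g else C.p g with hw
  set Y : G → Bool → ℝ := fun g a => if C.kind g then t g * v (w g a) else t g + v (w g a) with hY
  set Q : G → Bool → ℝ := fun g b => bif b then t g else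
    if C.kind g then t g * v (C.p g) / v (C.q g) else t g + v (C.p g) - v (C.q g) with hQ
  have ht5 : ∀ g, K ^ 5 ≤ t g := fun g => pow_le_pow_right₀ (by linarith) (by omega)
  have ht0 : ∀ g, 0 < t g := fun g => by positivity
  have htt : ∀ g h, C.rk (C.s g) < C.rk (C.s h) → t g * K ^ 5 ≤ t h := fun g h hgh => by
    rw [ht, ← pow_add]
    exact pow_le_pow_right₀ (by linarith) (by omega)
  have hKt : ∀ g, K ≤ t g := fun g => (le_self_pow₀ (by linarith) (by norm_num)).trans (ht5 g)
  have hY1 : ∀ g a, t g ≤ Y g a * K ∧ Y g a ≤ t g * K := by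
    intro g a
    have h1 := hKv (w g a)
    have h2 := ht0 g
    have h3 := hKt g
    have h4 := hv.1 (w g a)
    simp only [hY]
    split_ifs
    · constructor <;> nlinarith
    · constructor <;> nlinarith
  have hrange : ∀ (a : Pencil), a ≠ .X → ∀ g c d, 0 < v (C.xsel g c d) ∧
      v (C.xsel g c d) < Y g c ∧ t g ≤ a.val (v (C.xsel g c d)) (Y g c) * K ^ 2 ∧
        a.val (v (C.xsel g c d)) (Y g c) ≤ t g * K ^ 2 := fun a ha g c d =>
    val_range ha hK (ht5 g) (hKv _).1 (hKv _).2 (hY1 g c).1 (hY1 g c).2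
  set θ : G → Bool → Bool → ℝ := fun g a b => bif a then Q g b else Y g b with hθ
  have hty : ∀ h, C.system.ty (.inr h) ≠ .X := by
    rintro ⟨g, a, b⟩
    change (bif a then bif C.kind g then Pencil.R else .D else .Y) ≠ _
    cases a <;> cases C.kind g <;> decide
  have hval : ∀ g a b c d, (C.system.ty (.inr (g, a, b))).val (v (C.xsel g c d)) (Y g c) =
      θ g a (bif a then d else c) := by
    intro g a b c d
    change (bif a then bif C.kind g then Pencil.R else .D else .Y).val _ _ = _
    cases a
    · rfl
    · have h1 := hv.2.2 g
      have h2 := (hv.1 (C.p g)).ne'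
      have h3 := (hv.1 (C.q g)).ne'
      have h4 := (hv.1 (C.r g)).ne'
      have h5 := (hv.1 (C.s g)).ne'
      simp only [hθ, hQ, hY, hw, cond_true]
      cases hk : C.kind g <;> simp only [hk, if_true, if_false, cond_true, cond_false, Pencil.val,
        Bool.false_eq_true] at h1 ⊢
      · cases c <;> cases d <;> simp only [xsel, cond_true, cond_false] <;> linarith
      · cases c <;> cases d <;> simp only [xsel, cond_true, cond_false]
        · field_simp
        · rw [div_eq_div_iff h5 h3, mul_assoc, mul_assoc, mul_comm (v (C.r g)), h1]
        · field_simp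
  have hmono : ∀ g a, θ g a false < θ g a true := by
    intro g a
    have h1 := hv.2.1 _ _ (C.rk_pq g)
    have h2 := hv.2.1 _ _ (C.rk_qr g)
    have h3 := hv.1 (C.q g)
    have h4 := ht0 g
    simp only [hθ, hQ, hY, hw]
    cases a <;> simp only [cond_true, cond_false] <;> split_ifs
    · exact mul_lt_mul_of_pos_left (h1.trans h2) h4
    · linarith
    · rw [div_lt_iff₀ h3]
      exact mul_lt_mul_of_pos_left h1 h4
    · linarith
  have hθr : ∀ h : G × Bool × Bool, (C.system.ty (.inr h)).lb < θ h.1 h.2.1 h.2.2 ∧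
      t h.1 ≤ θ h.1 h.2.1 h.2.2 * K ^ 2 ∧ θ h.1 h.2.1 h.2.2 ≤ t h.1 * K ^ 2 := by
    rintro ⟨g, a, b⟩
    obtain ⟨h1, h2, h3⟩ := hrange _ (hty (g, a, b)) g b b
    have h4 := hval g a b b b
    have h5 := Pencil.lb_lt_val (C.system.ty (.inr (g, a, b))) h1 h2
    simp only [Bool.cond_self] at h4
    rw [h4] at h3 h5
    exact ⟨h5, h3⟩
  have hsep : ∀ g h a b, C.rk (C.s g) < C.rk (C.s h) → a ≤ t g * K ^ 2 → t h ≤ b * K ^ 2 →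
      a < b := by
    intro g h a b hgh ha hb
    have h1 := htt g h hgh
    have h2 : t g * K ^ 4 < t g * K ^ 5 :=
      mul_lt_mul_of_pos_left (pow_lt_pow_right₀ (by linarith) (by norm_num)) (ht0 g)
    have h3 : a * K ^ 2 ≤ t g * K ^ 2 * K ^ 2 := mul_le_mul_of_nonneg_right ha (by positivity)
    refine lt_of_mul_lt_mul_right (a := K ^ 2) ?_ (by positivity)
    calc a * K ^ 2 ≤ t g * K ^ 4 := by linarith [show t g * K ^ 2 * K ^ 2 = t g * K ^ 4 by ring]
      _ < b * K ^ 2 := by linarith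
  refine ⟨fun h => θ h.1 h.2.1 h.2.2, fun j => Y j.1 j.2.1,
    fun j => (hrange .Y (by decide) j.1 j.2.1 j.2.2).2.1, fun h => (hθr h).1, fun h j => ?_⟩
  obtain ⟨h1, h2, h3, h4⟩ := hrange _ (hty h) j.1 j.2.1 j.2.2
  obtain ⟨-, h5, h6⟩ := hθr h
  change _ = ncmp (2 * C.rk (C.s j.1) + (bif h.2.1 then j.2.2 else j.2.1).toNat)
      (2 * C.rk (C.s h.1) + h.2.2.toNat)
  have b1 := (bif h.2.1 then j.2.2 else j.2.1).toNat_le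
  have b2 := h.2.2.toNat_le
  rcases lt_trichotomy (C.rk (C.s j.1)) (C.rk (C.s h.1)) with hlt | heq | hlt
  · rw [ncmp_of_lt (by omega), sign_eq_neg_one_iff, Pencil.ev_neg _ h1]
    exact hsep _ _ _ _ hlt h4 h5
  · obtain ⟨g, a, b⟩ := h
    obtain ⟨g', c, d⟩ := j
    obtain rfl : g' = g := C.s_inj (C.rk_inj heq)
    have h7 := hval g' a b c d
    have h8 := hmono g' a
    dsimp only at *
    generalize (bif a then d else c) = e at *
    rcases lt_trichotomy e b with hlt | rfl | hlt
    · obtain ⟨rfl, rfl⟩ : e = false ∧ b = true := by revert hlt; cases e <;> cases b <;> decide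
      rw [ncmp_of_lt (by simp), sign_eq_neg_one_iff, Pencil.ev_neg _ h1, h7]
      exact h8
    · rw [ncmp_self, sign_eq_zero_iff, Pencil.ev_zero _ h1, h7]
    · obtain ⟨rfl, rfl⟩ : e = true ∧ b = false := by revert hlt; cases e <;> cases b <;> decide
      rw [ncmp_of_gt (by simp), sign_eq_one_iff, Pencil.ev_pos _ h1, h7]
      exact h8
  · rw [ncmp_of_gt (by omega), sign_eq_one_iff, Pencil.ev_pos _ h1]
    exact hsep _ _ _ _ hlt h6 h3

lemma se_system [Finite I] [Finite G] (C : Chain I G) (hcov : ∀ i, ∃ g a b, C.xsel g a b = i) :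
    SE C.space C.system.space := by
  refine SE.fiber (Equiv.sumAssoc _ _ _)
    (fun v y => (∀ j : G × Bool × Bool, y (.inr (j, false)) = v (C.xsel j.1 j.2.1 j.2.2)) ∧
      (∀ j : G × Bool × Bool, v (C.xsel j.1 j.2.1 j.2.2) < y (.inr (j, true))) ∧
      (∀ h, (C.system.ty (.inr h)).lb < y (.inl h)) ∧ ∀ h j, SignType.sign
        ((C.system.ty (.inr h)).ev (y (.inl h)) (v (C.xsel j.1 j.2.1 j.2.2)) (y (.inr (j, true)))) =
          C.system.sg (.inr h) j) ?_ (fun v y => ⟨?_, ?_⟩) fun v hv => ?_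
  · refine AffCond.and (AffCond.all fun j => AffCond.eq (IsAff.fib _) (IsAff.base _))
      (AffCond.and (AffCond.all fun j => AffCond.lt (IsAff.base _) (IsAff.fib _))
      (AffCond.and (AffCond.all fun h => AffCond.lt (IsAff.const _) (IsAff.fib _))
      (AffCond.all fun h => AffCond.all fun j => AffCond.sign _ ?_)))
    rcases C.system.ty (.inr h)
    · exact (IsAff.base _).sub (IsAff.fib _)
    · exact (IsAff.fib _).sub (IsAff.fib _)
    · exact (IsAff.fib _).sub ((IsAff.fib _).mul_poly (PolyFun.coord _))
    · exact ((IsAff.fib _).sub (IsAff.base _)).sub (IsAff.fib _)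
  · rintro ⟨h1, h2, h3⟩
    have hx : ∀ j : G × Bool × Bool, y (.inr (j, false)) = v (C.xsel j.1 j.2.1 j.2.2) := fun j =>
      sub_eq_zero.1 (sign_eq_zero_iff.1 ((h3 (.inl _) j).trans ((C.system_zero_inl _ j).2 rfl)))
    have h1' : ∀ j : G × Bool × Bool, v (C.xsel j.1 j.2.1 j.2.2) < y (.inr (j, true)) :=
      fun j => hx j ▸ (h1 j).2
    have h3' : ∀ h j, SignType.sign ((C.system.ty (.inr h)).ev (y (.inl h))
        (v (C.xsel j.1 j.2.1 j.2.2)) (y (.inr (j, true)))) = C.system.sg (.inr h) j :=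
      fun h j => hx j ▸ h3 (.inr h) j
    refine ⟨⟨fun i => h2 (.inl i), fun i i' hi => ?_, fun g => ?_⟩, hx, h1',
      fun h => h2 (.inr h), h3'⟩
    · obtain ⟨g, a, b, rfl⟩ := hcov i
      have h4 : SignType.sign (y (.inr ((g, a, b), false)) - v i') =
        ncmp (C.rk (C.xsel g a b)) (C.rk i') := h3 (.inl i') (g, a, b)
      rw [hx, ncmp_of_lt hi, sign_eq_neg_one_iff, sub_neg] at h4
      exact h4
    · have hYz : ∀ a b, y (.inr ((g, a, b), true)) = y (.inl (g, false, a)) := fun a b =>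
        sub_eq_zero.1 (sign_eq_zero_iff.1
          ((h3' (g, false, a) (g, a, b)).trans ((C.system_zero_inr _ _).2 ⟨rfl, rfl⟩)))
      have hQz : ∀ a b, (bif C.kind g then Pencil.R else .D).ev (y (.inl (g, true, b)))
          (v (C.xsel g a b)) (y (.inl (g, false, a))) = 0 := fun a b => by
        rw [← hYz a b]
        exact sign_eq_zero_iff.1
          ((h3' (g, true, b) (g, a, b)).trans ((C.system_zero_inr _ _).2 ⟨rfl, rfl⟩))
      have hQ1 : ∀ b, (bif C.kind g then Pencil.R else .D).lb < y (.inl (g, true, b)) :=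
        fun b => h2 (.inr (g, true, b))
      have e1 := hQz false false
      have e2 := hQz false true
      have e3 := hQz true false
      have e4 := hQz true true
      have q1 := hQ1 false
      have q2 := hQ1 true
      cases hk : C.kind g <;> simp only [hk, cond_true, cond_false, xsel, Pencil.ev, Pencil.lb,
        if_true, Bool.false_eq_true, if_false] at *
      · linarith
      · have q3 : y (.inl (g, true, false)) * y (.inl (g, true, true)) ≠ 0 :=
          mul_ne_zero (by linarith) (by linarith)
        refine mul_left_cancel₀ q3 ?_
        rw [sub_eq_zero] at e1 e2 e3 e4
        calc _ = (y (.inl (g, true, true)) * v (C.p g)) * (y (.inl (g, true, false)) * v (C.s g)) := by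
              ring
          _ = (y (.inl (g, true, false)) * v (C.q g)) * (y (.inl (g, true, true)) * v (C.r g)) := by
              rw [← e1, ← e2, ← e3, ← e4]
          _ = _ := by ring
  · rintro ⟨hv, hx, h1, h2, h3⟩
    refine ⟨fun j => ?_, ?_, ?_⟩
    · change 0 < y (.inr (j, false)) ∧ y (.inr (j, false)) < y (.inr (j, true))
      rw [hx]
      exact ⟨hv.1 _, h1 j⟩
    · rintro (i | h)
      exacts [hv.1 i, h2 h]
    · rintro (i | h) j
      · change SignType.sign (y (.inr (j, false)) - v i) = ncmp (C.rk (C.xsel j.1 j.2.1 j.2.2)) _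
        rw [hx]
        exact C.sign_sub_of_mem hv _ _
      · refine Eq.trans ?_ (h3 h j)
        change SignType.sign ((C.system.ty (.inr h)).ev (y (.inl h)) (y (.inr (j, false)))
          (y (.inr (j, true)))) = _
        rw [hx]
  · obtain ⟨θ, y, h1, h2, h3⟩ := C.exists_system hv
    exact ⟨Sum.elim θ fun r => if r.2 then y r.1 else v (C.xsel r.1.1 r.1.2.1 r.1.2.2),
      fun j => rfl, h1, h2, h3⟩

lemma exists_polytope [Finite I] [Finite G] (C : Chain I G)
    (hcov : ∀ i, ∃ g a b, C.xsel g a b = i) (hne : C.space.Nonempty) :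
    ∃ (d n : ℕ) (v : Fin n → Fin d → ℝ) (B : Finset (Fin n)),
      IsPolytopeVertexList v ∧ IsSimplicialVertexList v ∧ B.card = d + 1 ∧
      AffineIndependent ℝ (fun i : ↥B => v i) ∧
      SE C.space (flat (polytopeRealizationSpace v B)) := by
  have h1 := C.se_system hcov
  obtain ⟨N, hN⟩ := C.constructible_system
  obtain ⟨d, n, v, B, a, b, c, e, h2⟩ :=
    LineSys.exists_polytope_of_constructible _ hN (h1.nonempty hne)
  exact ⟨d, n, v, B, a, b, c, e, h1.trans h2⟩

end Chain

end Chains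

/-- A step of a straight-line program on an increasing sequence: either a free new entry, or
the fourth entry of an additive or multiplicative (`true`) proportion. -/
abbrev Instr := Option (Bool × ℕ × ℕ × ℕ)

/-- The `k`-th entry of `w` obeys the instruction. -/
def Instr.Eqn (o : Instr) (w : ℕ → ℝ) (k : ℕ) : Prop :=
  match o with
  | none => True
  | some (b, p, q, r) => if b then w p * w k = w q * w r else w p + w k = w q + w r

def Instr.Below (o : Instr) (k : ℕ) : Prop :=
  ∀ b p q r, o = some (b, p, q, r) → p < q ∧ q < r ∧ r < k

def Sat (n : ℕ) (op : ℕ → Instr) (w : ℕ → ℝ) : Prop :=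
  (∀ k < n, 0 < w k) ∧ (∀ l < n, ∀ k < l, w k < w l) ∧ ∀ k < n, (op k).Eqn w k

def extZero {n : ℕ} (v : Fin n → ℝ) (k : ℕ) : ℝ := if h : k < n then v ⟨k, h⟩ else 0

lemma extZero_val {n : ℕ} (v : Fin n → ℝ) (k : Fin n) : extZero v k = v k := by
  simp [extZero]

lemma extZero_of_lt {n : ℕ} (v : Fin n → ℝ) {k : ℕ} (h : k < n) : extZero v k = v ⟨k, h⟩ := by
  simp [extZero, h]

lemma PolyFun.extZero {n : ℕ} (k : ℕ) : PolyFun (fun v : Fin n → ℝ => extZero v k) := by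
  by_cases h : k < n
  · simpa [_root_.extZero, h] using PolyFun.coord (⟨k, h⟩ : Fin n)
  · simpa [_root_.extZero, h] using PolyFun.const 0

def solSet (n : ℕ) (op : ℕ → Instr) (Ψ : (ℕ → ℝ) → Prop) : Set (Fin n → ℝ) :=
  {v | Sat n op (extZero v) ∧ Ψ (extZero v)}

def DependsBelow (n : ℕ) (Ψ : (ℕ → ℝ) → Prop) : Prop :=
  ∀ w w' : ℕ → ℝ, (∀ k < n, w k = w' k) → Ψ w → Ψ w'

lemma DependsBelow.iff {n : ℕ} {Ψ : (ℕ → ℝ) → Prop} (h : DependsBelow n Ψ) {w w' : ℕ → ℝ}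
    (hw : ∀ k < n, w k = w' k) : Ψ w ↔ Ψ w' :=
  ⟨h w w' hw, h w' w fun k hk => (hw k hk).symm⟩

lemma DependsBelow.mono {n n' : ℕ} {Ψ : (ℕ → ℝ) → Prop} (h : DependsBelow n Ψ) (hn : n ≤ n') :
    DependsBelow n' Ψ := fun w w' hw => h w w' fun k hk => hw k (hk.trans_le hn)

lemma Instr.Eqn.congr {o : Instr} {k : ℕ} (ho : o.Below k) {w w' : ℕ → ℝ}
    (hw : ∀ l ≤ k, w l = w' l) (h : o.Eqn w k) : o.Eqn w' k := by
  rcases o with _ | ⟨b, p, q, r⟩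
  · trivial
  · obtain ⟨h1, h2, h3⟩ := ho b p q r rfl
    simp only [Instr.Eqn] at h ⊢
    rwa [← hw p (by omega), ← hw q (by omega), ← hw r (by omega), ← hw k le_rfl]

lemma Sat.congr {n : ℕ} {op : ℕ → Instr} (hop : ∀ k < n, (op k).Below k) :
    DependsBelow n (Sat n op) := by
  intro w w' hw ⟨h1, h2, h3⟩
  refine ⟨fun k hk => hw k hk ▸ h1 k hk, fun l hl k hk => ?_, fun k hk => ?_⟩
  · rw [← hw l hl, ← hw k (hk.trans hl)]; exact h2 l hl k hk
  · exact (h3 k hk).congr (hop k hk) fun l hl => hw l (hl.trans_lt hk)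

lemma sat_succ {n : ℕ} {op : ℕ → Instr} {o : Instr} {w : ℕ → ℝ} :
    Sat (n + 1) (Function.update op n o) w ↔
      Sat n op w ∧ 0 < w n ∧ (∀ k < n, w k < w n) ∧ o.Eqn w n := by
  have hu : ∀ k < n, Function.update op n o k = op k := fun k hk =>
    Function.update_of_ne hk.ne _ _
  constructor
  · rintro ⟨h1, h2, h3⟩
    refine ⟨⟨fun k hk => h1 k (by omega), fun l hl => h2 l (by omega), fun k hk => ?_⟩,
      h1 n (by omega), h2 n (by omega), ?_⟩
    · have := h3 k (by omega)
      rwa [hu k hk] at this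
    · simpa using h3 n (by omega)
  · rintro ⟨⟨h1, h2, h3⟩, h4, h5, h6⟩
    refine ⟨fun k hk => ?_, fun l hl k hk => ?_, fun k hk => ?_⟩
    · rcases Nat.lt_succ_iff_lt_or_eq.1 hk with hk | rfl
      exacts [h1 k hk, h4]
    · rcases Nat.lt_succ_iff_lt_or_eq.1 hl with hl | rfl
      exacts [h2 l hl k hk, h5 k hk]
    · rcases Nat.lt_succ_iff_lt_or_eq.1 hk with hk | rfl
      · rw [hu k hk]; exact h3 k hk
      · simpa using h6

/-- `V` is stably equivalent to the solutions of a program subject to a condition `Ψ`. -/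
structure Reach {ι : Type} (V : Set (ι → ℝ)) (Ψ : (ℕ → ℝ) → Prop) (n : ℕ) (op : ℕ → Instr) :
    Prop where
  se : SE V (solSet n op Ψ)
  below : ∀ k < n, (op k).Below k

lemma Instr.affCond_eqn {n : ℕ} {o : Instr} (ho : o.Below n) :
    AffCond (fun (x : Fin n → ℝ) (y : Unit → ℝ) =>
      o.Eqn (Function.update (extZero x) n (y ())) n) := by
  rcases o with _ | ⟨b, p, q, r⟩
  · exact AffCond.true
  · obtain ⟨h1, h2, h3⟩ := ho b p q r rfl
    have hp : p ≠ n := by omega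
    have hq : q ≠ n := by omega
    have hr : r ≠ n := by omega
    simp only [Instr.Eqn, Function.update_self, Function.update_of_ne hp,
      Function.update_of_ne hq, Function.update_of_ne hr]
    cases b
    · simp only [Bool.false_eq_true, if_false]
      exact AffCond.eq ((IsAff.of_poly (PolyFun.extZero p)).add (IsAff.fib ()))
        (IsAff.of_poly ((PolyFun.extZero q).add (PolyFun.extZero r)))
    · simp only [if_true]
      exact AffCond.eq (IsAff.poly_mul (PolyFun.extZero p) (IsAff.fib ()))
        (IsAff.of_poly ((PolyFun.extZero q).mul (PolyFun.extZero r)))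

namespace Reach

variable {ι : Type} {V : Set (ι → ℝ)} {Ψ Ψ' : (ℕ → ℝ) → Prop} {n : ℕ} {op : ℕ → Instr}

lemma mono (h : Reach V Ψ n op) (hΨ : ∀ w, Sat n op w → (Ψ w ↔ Ψ' w)) : Reach V Ψ' n op := by
  refine ⟨?_, h.below⟩
  have : solSet n op Ψ' = solSet n op Ψ := by
    ext v
    exact and_congr_right fun hv => (hΨ _ hv).symm
  rw [this]; exact h.se

lemma append [Finite ι] {m : ℕ} (h : Reach V Ψ (m + 1) op) (hΨ : DependsBelow (m + 1) Ψ) (o : Instr)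
    (ho : o.Below (m + 1)) (Θ : (ℕ → ℝ) → Prop)
    (haff : AffCond (fun (x : Fin (m + 1) → ℝ) (y : Unit → ℝ) =>
      Θ (Function.update (extZero x) (m + 1) (y ()))))
    (hex : ∀ w, Sat (m + 1) op w → Ψ w → ∃ c, w m < c ∧
      o.Eqn (Function.update w (m + 1) c) (m + 1) ∧ Θ (Function.update w (m + 1) c)) :
    Reach V (fun w => Ψ w ∧ Θ w) (m + 1 + 1) (Function.update op (m + 1) o) := by
  set n := m + 1 with hn
  refine ⟨h.se.trans ?_, fun k hk => ?_⟩
  swap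
  · rcases Nat.lt_succ_iff_lt_or_eq.1 hk with hk | rfl
    · rw [Function.update_of_ne hk.ne]; exact h.below k hk
    · simpa using ho
  let e : Fin n ⊕ Unit ≃ Fin (n + 1) :=
    ((Equiv.refl _).sumCongr (Equiv.ofUnique Unit (Fin 1))).trans finSumFinEquiv
  have hext : ∀ (x : Fin n → ℝ) (y : Unit → ℝ),
      extZero (fun r => Sum.elim x y (e.symm r)) = Function.update (extZero x) n (y ()) := by
    intro x y
    funext k
    rcases lt_trichotomy k n with hk | rfl | hk
    · rw [extZero_of_lt _ (by omega : k < n + 1), Function.update_of_ne hk.ne, extZero_of_lt _ hk]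
      have : e.symm ⟨k, by omega⟩ = Sum.inl ⟨k, hk⟩ := by
        rw [Equiv.symm_apply_eq]; ext; simp [e]
      rw [this]; rfl
    · rw [extZero_of_lt _ (by omega : n < n + 1), Function.update_self]
      have : e.symm ⟨n, by omega⟩ = Sum.inr () := by
        rw [Equiv.symm_apply_eq]; ext; simp [e]
      rw [this]; rfl
    · rw [Function.update_of_ne hk.ne', extZero, extZero, dif_neg (by omega), dif_neg (by omega)]
  have hag : ∀ (w : ℕ → ℝ) (c : ℝ), ∀ k < n, w k = Function.update w n c k := fun w c k hk =>
    (Function.update_of_ne hk.ne _ _).symm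
  refine SE.fiber e.symm (fun x y => 0 < y () ∧ (∀ k : Fin n, x k < y ()) ∧
      o.Eqn (Function.update (extZero x) n (y ())) n ∧
      Θ (Function.update (extZero x) n (y ()))) ?_ ?_ ?_
  · exact (AffCond.lt (IsAff.const 0) (IsAff.fib ())).and
      ((AffCond.all fun k => AffCond.lt (IsAff.base k) (IsAff.fib ())).and
        ((Instr.affCond_eqn ho).and haff))
  · intro x y
    simp only [solSet, Set.mem_ofPred_eq, hext, sat_succ, Function.update_self]
    rw [← (Sat.congr h.below).iff (hag _ _), ← hΨ.iff (hag _ _)]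
    have : (∀ k < n, Function.update (extZero x) n (y ()) k < y ()) ↔ ∀ k : Fin n, x k < y () := by
      constructor
      · intro H k
        have := H k k.2
        rwa [← hag _ _ _ k.2, extZero_val] at this
      · intro H k hk
        rw [← hag _ _ _ hk, extZero_of_lt _ hk]; exact H _
    rw [this]
    tauto
  · rintro x ⟨hx, hx'⟩
    obtain ⟨c, hc, hc1, hc2⟩ := hex _ hx hx'
    refine ⟨fun _ => c, (hx.1 m (by omega)).trans hc, fun k => ?_, hc1, hc2⟩
    change x k < c
    rw [← extZero_val x k]
    rcases Nat.lt_succ_iff_lt_or_eq.1 k.2 with hk | hk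
    · exact (hx.2.1 m (by omega) _ hk).trans hc
    · rw [hk]; exact hc

lemma append_of_true [Finite ι] {m : ℕ} (h : Reach V Ψ (m + 1) op) (hΨ : DependsBelow (m + 1) Ψ)
    (o : Instr) (ho : o.Below (m + 1))
    (hex : ∀ w, Sat (m + 1) op w → Ψ w → ∃ c, w m < c ∧
      o.Eqn (Function.update w (m + 1) c) (m + 1)) :
    Reach V Ψ (m + 1 + 1) (Function.update op (m + 1) o) :=
  (h.append hΨ o ho (fun _ => True) AffCond.true fun w hw hw' => by
    simpa using hex w hw hw').mono (by simp)

lemma free [Finite ι] {m : ℕ} (h : Reach V Ψ (m + 1) op) (hΨ : DependsBelow (m + 1) Ψ) :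
    Reach V Ψ (m + 1 + 1) (Function.update op (m + 1) none) :=
  h.append_of_true hΨ none (by intro; simp) fun w _ _ => ⟨w m + 1, by linarith, trivial⟩

lemma add [Finite ι] {m p q r : ℕ} (h : Reach V Ψ (m + 1) op) (hΨ : DependsBelow (m + 1) Ψ)
    (hpq : p < q) (hqr : q < r) (hr : r ≤ m)
    (hex : ∀ w, Sat (m + 1) op w → Ψ w → w p + w m < w q + w r) :
    Reach V Ψ (m + 1 + 1) (Function.update op (m + 1) (some (false, p, q, r))) := by
  refine h.append_of_true hΨ _ ?_ fun w hw hw' => ⟨w q + w r - w p, ?_, ?_⟩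
  · rintro b p q r ⟨⟩; omega
  · linarith [hex w hw hw']
  · have hp : p ≠ m + 1 := by omega
    have hq : q ≠ m + 1 := by omega
    have hr : r ≠ m + 1 := by omega
    simp [Instr.Eqn, Function.update_of_ne hp, Function.update_of_ne hq, Function.update_of_ne hr]

lemma mul [Finite ι] {m p q r : ℕ} (h : Reach V Ψ (m + 1) op) (hΨ : DependsBelow (m + 1) Ψ)
    (hpq : p < q) (hqr : q < r) (hr : r ≤ m)
    (hex : ∀ w, Sat (m + 1) op w → Ψ w → w p * w m < w q * w r) :
    Reach V Ψ (m + 1 + 1) (Function.update op (m + 1) (some (true, p, q, r))) := by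
  refine h.append_of_true hΨ _ ?_ fun w hw hw' => ⟨w q * w r / w p, ?_, ?_⟩
  · rintro b p q r ⟨⟩; omega
  · have := hw.1 p (by omega)
    rw [lt_div_iff₀ this]; linarith [hex w hw hw']
  · have hp : p ≠ m + 1 := by omega
    have hq : q ≠ m + 1 := by omega
    have hr : r ≠ m + 1 := by omega
    have := hw.1 p (by omega)
    simp [Instr.Eqn, Function.update_of_ne hp, Function.update_of_ne hq, Function.update_of_ne hr]
    field_simp

end Reach

/-- `op'` of length `n'` continues the program `op` of length `n`. -/
def Extends (n : ℕ) (op : ℕ → Instr) (n' : ℕ) (op' : ℕ → Instr) : Prop :=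
  n ≤ n' ∧ ∀ k < n, op' k = op k

namespace Extends

variable {n n' n'' : ℕ} {op op' op'' : ℕ → Instr}

lemma refl : Extends n op n op := ⟨le_rfl, fun _ _ => rfl⟩

lemma trans (h : Extends n op n' op') (h' : Extends n' op' n'' op'') : Extends n op n'' op'' :=
  ⟨h.1.trans h'.1, fun k hk => (h'.2 k (hk.trans_le h.1)).trans (h.2 k hk)⟩

lemma update (h : Extends n op n' op') (o : Instr) :
    Extends n op (n' + 1) (Function.update op' n' o) :=
  h.trans ⟨n'.le_succ, fun _ hk => Function.update_of_ne hk.ne _ _⟩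

lemma sat (h : Extends n op n' op') {w : ℕ → ℝ} (hw : Sat n' op' w) : Sat n op w :=
  ⟨fun k hk => hw.1 k (hk.trans_le h.1), fun l hl => hw.2.1 l (hl.trans_le h.1),
    fun k hk => h.2 k hk ▸ hw.2.2 k (hk.trans_le h.1)⟩

end Extends

/-- The difference of two entries computes `F` on all solutions of the program. -/
def Computes (n : ℕ) (op : ℕ → Instr) (F : (ℕ → ℝ) → ℝ) : Prop :=
  ∃ i j, i < j ∧ j < n ∧ ∀ w, Sat n op w → w j - w i = F w

lemma Computes.extend {n n' : ℕ} {op op' : ℕ → Instr} {F : (ℕ → ℝ) → ℝ} (h : Computes n op F)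
    (he : Extends n op n' op') : Computes n' op' F := by
  obtain ⟨i, j, hij, hj, h⟩ := h
  exact ⟨i, j, hij, hj.trans_le he.1, fun w hw => h w (he.sat hw)⟩

def Covered (n : ℕ) (op : ℕ → Instr) (k : ℕ) : Prop :=
  ∃ l < n, ∃ b p q r, op l = some (b, p, q, r) ∧ (k = p ∨ k = q ∨ k = r ∨ k = l)

lemma Covered.extend {n n' k : ℕ} {op op' : ℕ → Instr} (h : Covered n op k)
    (he : Extends n op n' op') : Covered n' op' k := by
  obtain ⟨l, hl, b, p, q, r, h, h'⟩ := h
  exact ⟨l, hl.trans_le he.1, b, p, q, r, (he.2 l hl).trans h, h'⟩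

namespace Reach

variable {ι : Type} [Finite ι] {V : Set (ι → ℝ)} {Ψ Ψ' : (ℕ → ℝ) → Prop} {m : ℕ} {op : ℕ → Instr}
  {F G : (ℕ → ℝ) → ℝ}

lemma exists_add (h : Reach V Ψ (m + 1) op) (hΨ : DependsBelow (m + 1) Ψ)
    (hF : Computes (m + 1) op F) (hG : Computes (m + 1) op G) :
    ∃ n op', Extends (m + 1) op (n + 1) op' ∧ Reach V Ψ (n + 1) op' ∧
      Computes (n + 1) op' (fun w => F w + G w) := by
  obtain ⟨i, j, hij, hj, hF⟩ := hF
  obtain ⟨i', j', hij', hj', hG⟩ := hG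
  have h1 := h.free hΨ
  have h2 := h1.add (hΨ.mono (by omega)) hij (by omega : j < m + 1) le_rfl (fun w hw _ => by
    have := hw.2.1 j (by omega) i hij
    linarith)
  have h3 := h2.add (hΨ.mono (by omega)) hij' (by omega : j' < m + 1 + 1) le_rfl (fun w hw _ => by
    have := hw.2.1 j' (by omega) i' hij'
    linarith)
  refine ⟨_, _, ((Extends.refl.update _).update _).update _, h3, m + 1, m + 1 + 1 + 1, by omega,
    by omega, fun w hw => ?_⟩
  simp only [sat_succ, Instr.Eqn, Bool.false_eq_true, if_false] at hw
  obtain ⟨⟨⟨hw, -⟩, -, -, h1⟩, -, -, h2⟩ := hw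
  have := hF w hw
  have := hG w hw
  linarith

lemma exists_mul (h : Reach V Ψ (m + 1) op) (hΨ : DependsBelow (m + 1) Ψ)
    (hF : Computes (m + 1) op F) (hG : Computes (m + 1) op G) :
    ∃ n op', Extends (m + 1) op (n + 1) op' ∧ Reach V Ψ (n + 1) op' ∧
      Computes (n + 1) op' (fun w => F w * G w / w 0) := by
  obtain ⟨i, j, hij, hj, hF⟩ := hF
  obtain ⟨i', j', hij', hj', hG⟩ := hG
  have h1 := h.free hΨ
  have h2 := h1.add (hΨ.mono (by omega)) hij (by omega : j < m + 1) le_rfl (fun w hw _ => by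
    have := hw.2.1 j (by omega) i hij
    linarith)
  have h3 := h2.append (hΨ.mono (by omega)) none (by intro; simp)
    (fun w => w 0 * (w j' - w i') < (w (m + 1) - w 0) * w (m + 1 + 1 + 1) ∧
      w (m + 1) * (w j' - w i') < (w j - w i) * w (m + 1 + 1 + 1)) (by
        have e : ∀ k, k < m + 1 + 1 + 1 → k ≠ m + 1 + 1 + 1 := fun k hk => hk.ne
        have z := @PolyFun.extZero (m + 1 + 1 + 1)
        simp only [Function.update_self, Function.update_of_ne (e 0 (by omega)),
          Function.update_of_ne (e j' (by omega)), Function.update_of_ne (e i' (by omega)),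
          Function.update_of_ne (e j (by omega)), Function.update_of_ne (e i (by omega)),
          Function.update_of_ne (e (m + 1) (by omega))]
        exact (AffCond.lt (IsAff.of_poly ((z 0).mul ((z j').sub (z i'))))
          (IsAff.poly_mul ((z (m + 1)).sub (z 0)) (IsAff.fib ()))).and
          (AffCond.lt (IsAff.of_poly ((z (m + 1)).mul ((z j').sub (z i'))))
          (IsAff.poly_mul ((z j).sub (z i)) (IsAff.fib ())))) (fun w hw _ => by
        have h1 : 0 < w (m + 1) - w 0 := sub_pos.2 (hw.2.1 (m + 1) (by omega) 0 (by omega))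
        have h2 : 0 < w j - w i := sub_pos.2 (hw.2.1 j (by omega) i hij)
        obtain ⟨c, hc⟩ := exists_gt (max (w (m + 1 + 1)) (max (w 0 * (w j' - w i') / (w (m + 1) - w 0))
          (w (m + 1) * (w j' - w i') / (w j - w i))))
        simp only [max_lt_iff, div_lt_iff₀ h1, div_lt_iff₀ h2] at hc
        refine ⟨c, hc.1, trivial, ?_⟩
        have e : ∀ k, k < m + 1 + 1 + 1 → k ≠ m + 1 + 1 + 1 := fun k hk => hk.ne
        simp only [Function.update_self, Function.update_of_ne (e 0 (by omega)),
          Function.update_of_ne (e j' (by omega)), Function.update_of_ne (e i' (by omega)),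
          Function.update_of_ne (e j (by omega)), Function.update_of_ne (e i (by omega)),
          Function.update_of_ne (e (m + 1) (by omega))]
        constructor <;> linarith [hc.2.1, hc.2.2])
  have hΨ' : DependsBelow (m + 4) (fun w => Ψ w ∧
      w 0 * (w j' - w i') < (w (m + 1) - w 0) * w (m + 1 + 1 + 1) ∧
      w (m + 1) * (w j' - w i') < (w j - w i) * w (m + 1 + 1 + 1)) := by
    rintro w w' hw ⟨h1, h2⟩
    refine ⟨hΨ.mono (by omega) w w' hw h1, ?_⟩
    rwa [← hw 0 (by omega), ← hw j' (by omega), ← hw i' (by omega), ← hw j (by omega),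
      ← hw i (by omega), ← hw (m + 1) (by omega), ← hw (m + 1 + 1 + 1) (by omega)]
  have h4 := h3.add (hΨ'.mono (by omega)) hij' (by omega : j' < m + 1 + 1 + 1) le_rfl
    (fun w hw _ => by
      have := hw.2.1 j' (by omega) i' hij'
      linarith)
  have h5 := h4.mul (p := 0) (q := m + 1) (r := m + 1 + 1 + 1) (hΨ'.mono (by omega)) (by omega)
    (by omega) (by omega) (fun w hw hw' => by
      simp only [sat_succ, Instr.Eqn, Bool.false_eq_true, if_false] at hw
      have e : w (m + 1 + 1 + 1 + 1) = w (m + 1 + 1 + 1) + (w j' - w i') := by linarith [hw.2.2.2]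
      change w 0 * w (m + 1 + 1 + 1 + 1) < _
      rw [e]
      linarith [hw'.2.1])
  have h6 := h5.mul (p := 0) (q := m + 1) (r := m + 1 + 1 + 1 + 1) (hΨ'.mono (by omega)) (by omega)
    (by omega) (by omega) (fun w hw hw' => by
      have h1 := hw.1 (m + 1) (by omega)
      have h2 := hw.2.1 (m + 1 + 1 + 1 + 1) (by omega) (m + 1 + 1 + 1) (by omega)
      simp only [sat_succ, Instr.Eqn, Bool.false_eq_true, if_false, if_true] at hw
      nlinarith [hw.2.2.2])
  have h7 := h6.mul (p := 0) (q := m + 1 + 1) (r := m + 1 + 1 + 1) (hΨ'.mono (by omega)) (by omega)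
    (by omega) (by omega) (fun w hw hw' => by
      simp only [sat_succ, Instr.Eqn, Bool.false_eq_true, if_false, if_true] at hw
      obtain ⟨⟨⟨⟨⟨⟨hw, -⟩, -, -, h1⟩, -, -, -⟩, -, -, h3⟩, -, -, h4⟩, -, -, h5⟩ := hw
      have e1 : w (m + 1 + 1) = w (m + 1) + (w j - w i) := by linarith
      have e2 : w (m + 1 + 1 + 1 + 1) = w (m + 1 + 1 + 1) + (w j' - w i') := by linarith
      rw [h5, e1, e2]
      nlinarith [hw'.2.2])
  have h8 := h7.mul (p := 0) (q := m + 1 + 1) (r := m + 1 + 1 + 1 + 1) (hΨ'.mono (by omega))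
    (by omega) (by omega) (by omega) (fun w hw hw' => by
      have h1 := hw.1 (m + 1 + 1) (by omega)
      have h2 := hw.2.1 (m + 1 + 1 + 1 + 1) (by omega) (m + 1 + 1 + 1) (by omega)
      simp only [sat_succ, Instr.Eqn, Bool.false_eq_true, if_false, if_true] at hw
      nlinarith [hw.2.2.2])
  have h9 := h8.free (hΨ'.mono (by omega))
  have h10 := h9.add (p := m + 1 + 1 + 1 + 1 + 1) (q := m + 1 + 1 + 1 + 1 + 1 + 1)
    (r := m + 1 + 1 + 1 + 1 + 1 + 1 + 1 + 1 + 1) (hΨ'.mono (by omega)) (by omega)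
    (by omega) le_rfl (fun w hw _ => by
      have := hw.2.1 (m + 1 + 1 + 1 + 1 + 1 + 1) (by omega) (m + 1 + 1 + 1 + 1 + 1) (by omega)
      linarith)
  have h11 := h10.add (p := m + 1 + 1 + 1 + 1 + 1 + 1 + 1) (q := m + 1 + 1 + 1 + 1 + 1 + 1 + 1 + 1)
    (r := m + 1 + 1 + 1 + 1 + 1 + 1 + 1 + 1 + 1) (hΨ'.mono (by omega)) (by omega)
    (by omega) (by omega) (fun w hw _ => by
      have h0 := hw.1 0 (by omega)
      have ha := hw.2.1 (m + 1 + 1) (by omega) (m + 1) (by omega)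
      have hb := hw.2.1 (m + 1 + 1 + 1 + 1) (by omega) (m + 1 + 1 + 1) (by omega)
      simp only [sat_succ, Instr.Eqn, Bool.false_eq_true, if_false, if_true] at hw
      obtain ⟨⟨⟨⟨⟨⟨-, -, -, h5⟩, -, -, h6⟩, -, -, h7⟩, -, -, h8⟩, -, -, -⟩, -, -, h10⟩ := hw
      have := mul_pos (sub_pos.2 ha) (sub_pos.2 hb)
      refine lt_of_mul_lt_mul_left ?_ h0.le
      nlinarith)
  refine ⟨_, _, (((((((((((Extends.refl.update _).update _).update _).update _).update _).update
    _).update _).update _).update _).update _).update _),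
    h11.mono fun w hw => and_iff_left ?_, m + 1 + 1 + 1 + 1 + 1 + 1 + 1 + 1 + 1 + 1,
    m + 1 + 1 + 1 + 1 + 1 + 1 + 1 + 1 + 1 + 1 + 1, by omega, by omega, fun w hw => ?_⟩
  · have h0 := hw.1 0 (by omega)
    have hE := hw.2.1 (m + 1 + 1 + 1 + 1 + 1) (by omega) (m + 1 + 1 + 1 + 1) (by omega)
    have hB := hw.2.1 (m + 1 + 1 + 1 + 1 + 1 + 1 + 1) (by omega) (m + 1 + 1 + 1 + 1 + 1 + 1)
      (by omega)
    simp only [sat_succ, Instr.Eqn, Bool.false_eq_true, if_false, if_true] at hw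
    obtain ⟨⟨⟨⟨⟨⟨⟨⟨⟨⟨-, -, -, h2⟩, -⟩, -, -, h4⟩, -, -, h5⟩, -, -, h6⟩, -, -, h7⟩, -⟩, -⟩, -⟩, -⟩ :=
      hw
    have := mul_lt_mul_of_pos_left hE h0
    have := mul_lt_mul_of_pos_left hB h0
    have e1 : w j - w i = w (m + 1 + 1) - w (m + 1) := by linarith
    have e2 : w j' - w i' = w (m + 1 + 1 + 1 + 1) - w (m + 1 + 1 + 1) := by linarith
    rw [e1, e2]
    constructor <;> nlinarith
  · have h0 := hw.1 0 (by omega)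
    simp only [sat_succ, Instr.Eqn, Bool.false_eq_true, if_false, if_true] at hw
    obtain ⟨⟨⟨⟨⟨⟨⟨⟨⟨⟨⟨hw, -⟩, -, -, h2⟩, -⟩, -, -, h4⟩, -, -, h5⟩, -, -, h6⟩, -, -, h7⟩, -, -, h8⟩,
      -⟩, -, -, h10⟩, -, -, h11⟩ := hw
    have e1 : F w = w (m + 1 + 1) - w (m + 1) := by linarith [hF w hw]
    have e2 : G w = w (m + 1 + 1 + 1 + 1) - w (m + 1 + 1 + 1) := by linarith [hG w hw]
    change _ = F w * G w / w 0
    rw [e1, e2, eq_div_iff h0.ne']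
    linear_combination (-w 0) * h10 + w 0 * h11 + h5 - h6 - h7 + h8

lemma exists_lt (h : Reach V Ψ (m + 1) op) (hΨ : DependsBelow (m + 1) Ψ)
    (hF : Computes (m + 1) op F) (hG : Computes (m + 1) op G)
    (hΨ' : ∀ w, Sat (m + 1) op w → (Ψ w ↔ F w < G w ∧ Ψ' w)) :
    ∃ n op', Extends (m + 1) op (n + 1) op' ∧ Reach V Ψ' (n + 1) op' := by
  obtain ⟨i, j, hij, hj, hF⟩ := hF
  obtain ⟨i', j', hij', hj', hG⟩ := hG
  have h1 := h.free hΨ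
  have h2 := h1.add (hΨ.mono (by omega)) hij (by omega : j < m + 1) le_rfl (fun w hw _ => by
    have := hw.2.1 j (by omega) i hij
    linarith)
  have h3 := h2.add (hΨ.mono (by omega)) hij' (by omega : j' < m + 1) (by omega) (fun w hw hw' => by
    simp only [sat_succ, Instr.Eqn, Bool.false_eq_true, if_false] at hw
    have := ((hΨ' w hw.1.1).1 hw').1
    linarith [hw.2.2.2, hF w hw.1.1, hG w hw.1.1])
  refine ⟨_, _, ((Extends.refl.update _).update _).update _, h3.mono fun w hw => ?_⟩
  have hlt := hw.2.1 (m + 1 + 1 + 1) (by omega) (m + 1 + 1) (by omega)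
  simp only [sat_succ, Instr.Eqn, Bool.false_eq_true, if_false] at hw
  obtain ⟨⟨⟨hw, -⟩, -, -, h1⟩, -, -, h2⟩ := hw
  rw [hΨ' w hw]
  exact and_iff_right (by linarith [hF w hw, hG w hw])

lemma exists_covered (h : Reach V Ψ (m + 1) op) (hΨ : DependsBelow (m + 1) Ψ) {i : ℕ}
    (hi : i < m + 1) :
    ∃ n op', Extends (m + 1) op (n + 1) op' ∧ Reach V Ψ (n + 1) op' ∧ Covered (n + 1) op' i ∧
      ∀ k, m + 1 ≤ k → k < n + 1 → Covered (n + 1) op' k := by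
  have h1 := (h.free hΨ).free (hΨ.mono (by omega))
  have h2 := h1.add (p := i) (q := m + 1) (r := m + 1 + 1) (hΨ.mono (by omega)) (by omega)
    (by omega) le_rfl (fun w hw _ => by
    have := hw.2.1 (m + 1) (by omega) i hi
    linarith)
  have key : ∀ k, k = i ∨ k = m + 1 ∨ k = m + 1 + 1 ∨ k = m + 1 + 1 + 1 →
      Covered (m + 1 + 1 + 1 + 1) (Function.update (Function.update (Function.update op (m + 1) none)
        (m + 1 + 1) none) (m + 1 + 1 + 1) (some (false, i, m + 1, m + 1 + 1))) k := fun k hk =>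
    ⟨m + 1 + 1 + 1, by omega, false, i, m + 1, m + 1 + 1, by simp, hk⟩
  exact ⟨_, _, ((Extends.refl.update _).update _).update _, h2, key i (Or.inl rfl),
    fun k hk hk' => key k (by omega)⟩

lemma exists_forall_covered (h : Reach V Ψ (m + 1) op) (hΨ : DependsBelow (m + 1) Ψ) :
    ∃ n op', Reach V Ψ (n + 1) op' ∧ ∀ k < n + 1, Covered (n + 1) op' k := by
  suffices H : ∀ l ≤ m + 1, ∃ n op', Extends (m + 1) op (n + 1) op' ∧ Reach V Ψ (n + 1) op' ∧
      ∀ k < n + 1, k < l ∨ m + 1 ≤ k → Covered (n + 1) op' k by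
    obtain ⟨n, op', -, h1, h2⟩ := H (m + 1) le_rfl
    exact ⟨n, op', h1, fun k hk => h2 k hk (by omega)⟩
  intro l
  induction l with
  | zero => exact fun _ => ⟨m, op, Extends.refl, h, fun k hk hk' => by omega⟩
  | succ l ih =>
    intro hl
    obtain ⟨n, op', he, h1, h2⟩ := ih (by omega)
    obtain ⟨n', op'', he', h1', h3, h4⟩ := h1.exists_covered (hΨ.mono he.1)
      (show l < n + 1 by have := he.1; omega)
    refine ⟨n', op'', he.trans he', h1', fun k hk hk' => ?_⟩
    by_cases hkl : k = l
    · exact hkl ▸ h3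
    by_cases hkn : k < n + 1
    · exact (h2 k hkn (by omega)).extend he'
    · exact h4 k (by omega) hk

end Reach

/-- Polynomial terms without subtraction. -/
inductive PosTerm (ι : Type) : Type
  | var (i : ι)
  | add (s t : PosTerm ι)
  | mul (s t : PosTerm ι)

namespace PosTerm

variable {ι : Type}

def eval (y : ι → ℝ) : PosTerm ι → ℝ
  | var i => y i
  | add s t => s.eval y + t.eval y
  | mul s t => s.eval y * t.eval y

lemma exists_pow (i : ι) (d : ℕ) : ∃ t : PosTerm ι, ∀ y, t.eval y = y i ^ (d + 1) := by
  induction d with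
  | zero => exact ⟨var i, fun y => by simp [eval]⟩
  | succ d ih =>
    obtain ⟨t, ht⟩ := ih
    exact ⟨mul t (var i), fun y => by rw [eval, eval, ht, pow_succ (y i) (d + 1)]⟩

lemma exists_nsmul (i : ι) (k : ℕ) : ∃ t : PosTerm ι, ∀ y, t.eval y = (k + 1) * y i := by
  induction k with
  | zero => exact ⟨var i, fun y => by simp [eval]⟩
  | succ k ih =>
    obtain ⟨t, ht⟩ := ih
    exact ⟨add t (var i), fun y => by rw [eval, eval, ht]; push_cast; ring⟩

/-- After clearing denominators, an integer polynomial in the quotients `(aᵢ - bᵢ) / e` is a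
difference of subtraction-free terms. -/
lemma exists_aeval_eq {σ : Type} (g : MvPolynomial σ ℤ) (e : ι) (a b : σ → ι) :
    ∃ (d : ℕ) (F G : PosTerm ι), ∀ y : ι → ℝ, y e ≠ 0 →
      y e ^ (d + 1) * MvPolynomial.aeval (fun i => (y (a i) - y (b i)) / y e) g =
        G.eval y - F.eval y := by
  induction g using MvPolynomial.induction_on with
  | C k =>
    obtain ⟨F, hF⟩ := exists_nsmul e (-k).toNat
    obtain ⟨G, hG⟩ := exists_nsmul e k.toNat
    refine ⟨0, F, G, fun y _ => ?_⟩
    have : (k : ℝ) = (k.toNat : ℝ) - ((-k).toNat : ℝ) := by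
      exact_mod_cast (Int.toNat_sub_toNat_neg k).symm
    rw [hF, hG, MvPolynomial.aeval_C, eq_intCast, this]
    ring
  | add p q hp hq =>
    obtain ⟨d, F, G, h⟩ := hp
    obtain ⟨d', F', G', h'⟩ := hq
    obtain ⟨P, hP⟩ := exists_pow e d
    obtain ⟨P', hP'⟩ := exists_pow e d'
    refine ⟨d + d' + 1, add (mul P' F) (mul P F'), add (mul P' G) (mul P G'), fun y hy => ?_⟩
    simp only [eval, hP, hP', map_add]
    linear_combination y e ^ (d' + 1) * h y hy + y e ^ (d + 1) * h' y hy
  | mul_X p i hp =>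
    obtain ⟨d, F, G, h⟩ := hp
    refine ⟨d + 1, add (mul G (var (b i))) (mul F (var (a i))),
      add (mul G (var (a i))) (mul F (var (b i))), fun y hy => ?_⟩
    simp only [eval, map_mul, MvPolynomial.aeval_X]
    have h2 : y e * ((y (a i) - y (b i)) / y e) = y (a i) - y (b i) := by field_simp
    linear_combination (y e * ((y (a i) - y (b i)) / y e)) * h y hy + (G.eval y - F.eval y) * h2

end PosTerm

/-- The gaps `w₂ - w₁, w₄ - w₃, …`. -/
def gap (L : ℕ) (w : ℕ → ℝ) (l : Fin L) : ℝ := w (2 * l + 2) - w (2 * l + 1)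

def gapRatio (L : ℕ) (w : ℕ → ℝ) (l : Fin L) : ℝ := gap L w l / w 0

lemma gapRatio_congr {L : ℕ} {w w' : ℕ → ℝ} (h : ∀ k < 2 * L + 1, w k = w' k) :
    gapRatio L w = gapRatio L w' := by
  funext l
  simp only [gapRatio, gap]
  rw [h 0 (by omega), h (2 * l + 2) (by omega), h (2 * l + 1) (by omega)]

lemma dependsBelow_gapRatio {L n : ℕ} (hn : 2 * L + 1 ≤ n) (Φ : (Fin L → ℝ) → Prop) :
    DependsBelow n (fun w => Φ (gapRatio L w)) := fun w w' hw h => by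
  change Φ (gapRatio L w')
  rwa [← gapRatio_congr fun k hk => hw k (by omega)]

lemma Computes.congr {n : ℕ} {op : ℕ → Instr} {F G : (ℕ → ℝ) → ℝ} (h : Computes n op F)
    (hFG : ∀ w, Sat n op w → F w = G w) : Computes n op G := by
  obtain ⟨i, j, hij, hj, h⟩ := h
  exact ⟨i, j, hij, hj, fun w hw => (h w hw).trans (hFG w hw)⟩

namespace Reach

variable {ι : Type} [Finite ι] {V : Set (ι → ℝ)} {L : ℕ}

lemma exists_term (t : PosTerm (Fin L)) {Ψ : (ℕ → ℝ) → Prop} {m : ℕ} {op : ℕ → Instr}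
    (hL : 2 * L ≤ m) (h : Reach V Ψ (m + 1) op) (hΨ : DependsBelow (m + 1) Ψ) :
    ∃ n op', Extends (m + 1) op (n + 1) op' ∧ Reach V Ψ (n + 1) op' ∧
      Computes (n + 1) op' (fun w => w 0 * t.eval (gapRatio L w)) := by
  induction t generalizing m op with
  | var l =>
    refine ⟨m, op, Extends.refl, h, 2 * l + 1, 2 * l + 2, by omega, by omega, fun w hw => ?_⟩
    have := hw.1 0 (by omega)
    simp only [PosTerm.eval, gapRatio, gap]
    field_simp
  | add s t hs ht =>
    obtain ⟨n, op', he, h, h1⟩ := hs hL h hΨ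
    have hΨ := hΨ.mono he.1
    obtain ⟨n', op'', he', h, h2⟩ := ht (by have := he.1; omega) h hΨ
    obtain ⟨n₃, op₃, he₃, h, h3⟩ := h.exists_add (hΨ.mono he'.1) (h1.extend he') h2
    exact ⟨n₃, op₃, (he.trans he').trans he₃, h, h3.congr fun w _ => by
      simp only [PosTerm.eval]; ring⟩
  | mul s t hs ht =>
    obtain ⟨n, op', he, h, h1⟩ := hs hL h hΨ
    have hΨ := hΨ.mono he.1
    obtain ⟨n', op'', he', h, h2⟩ := ht (by have := he.1; omega) h hΨ
    obtain ⟨n₃, op₃, he₃, h, h3⟩ := h.exists_mul (hΨ.mono he'.1) (h1.extend he') h2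
    exact ⟨n₃, op₃, (he.trans he').trans he₃, h, h3.congr fun w hw => by
      have := hw.1 0 (by omega)
      simp only [PosTerm.eval]; field_simp⟩

lemma exists_forall_lt (gs : List (PosTerm (Fin L) × PosTerm (Fin L))) {m : ℕ} {op : ℕ → Instr}
    (hL : 2 * L ≤ m) (h : Reach V (fun w => ∀ g ∈ gs,
      g.1.eval (gapRatio L w) < g.2.eval (gapRatio L w)) (m + 1) op) :
    ∃ n op', Reach V (fun _ => True) (n + 1) op' := by
  induction gs generalizing m op with
  | nil => exact ⟨m, op, h.mono (by simp)⟩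
  | cons g gs ih =>
    have hΨ := dependsBelow_gapRatio (show 2 * L + 1 ≤ m + 1 by omega)
      (fun y => ∀ g' ∈ g :: gs, g'.1.eval y < g'.2.eval y)
    obtain ⟨n, op', he, h, h1⟩ := h.exists_term g.1 hL hΨ
    have hΨ := hΨ.mono he.1
    obtain ⟨n', op'', he', h, h2⟩ := h.exists_term g.2 (by have := he.1; omega) hΨ
    obtain ⟨n₃, op₃, he₃, h⟩ := h.exists_lt (hΨ.mono he'.1) (h1.extend he') h2
      (Ψ' := fun w => ∀ g ∈ gs, g.1.eval (gapRatio L w) < g.2.eval (gapRatio L w)) (fun w hw => by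
        rw [List.forall_mem_cons, mul_lt_mul_iff_right₀ (hw.1 0 (by omega))])
    exact ih (by have := he.1; have := he'.1; have := he₃.1; omega) h

end Reach

lemma sat_none {n : ℕ} {v : Fin n → ℝ} :
    Sat n (fun _ => none) (extZero v) ↔ (∀ k, 0 < v k) ∧ ∀ l k, k < l → v k < v l := by
  constructor
  · rintro ⟨h1, h2, -⟩
    refine ⟨fun k => ?_, fun l k hkl => ?_⟩
    · simpa [extZero_val] using h1 k k.2
    · simpa [extZero_val] using h2 l l.2 k hkl
  · rintro ⟨h1, h2⟩
    refine ⟨fun k hk => ?_, fun l hl k hk => ?_, fun _ _ => trivial⟩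
    · rw [extZero_of_lt _ hk]; exact h1 _
    · rw [extZero_of_lt _ hl, extZero_of_lt _ (hk.trans hl)]; exact h2 _ _ hk

lemma exists_sat_gap {L : ℕ} (y : Fin L → ℝ) (hy : ∀ l, 0 < y l) :
    ∃ v : Fin (2 * L + 1) → ℝ, Sat (2 * L + 1) (fun _ => none) (extZero v) ∧
      gap L (extZero v) = y := by
  let s : ℕ → ℝ := fun k => if h : k % 2 = 0 ∧ 0 < k ∧ k / 2 - 1 < L then y ⟨k / 2 - 1, h.2.2⟩ else 1
  have hs : ∀ k, 0 < s k := fun k => by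
    simp only [s]; split_ifs with h
    exacts [hy _, one_pos]
  refine ⟨fun k => ∑ t ∈ Finset.range (k + 1), s t, ?_, ?_⟩
  · rw [sat_none]
    refine ⟨fun k => Finset.sum_pos (fun t _ => hs t) ⟨0, by simp⟩, fun l k hkl => ?_⟩
    refine Finset.sum_lt_sum_of_subset (i := (l : ℕ)) ?_ (by simp) (by simpa using hkl) (hs _)
      fun t _ _ => (hs t).le
    exact Finset.range_mono (by have : (k : ℕ) < l := hkl; omega)
  · funext l
    rw [gap, extZero_of_lt _ (by omega), extZero_of_lt _ (by omega)]
    simp only [Finset.sum_range_succ _ (2 * (l : ℕ) + 2), Finset.sum_range_succ _ (2 * (l : ℕ) + 1)]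
    have : s (2 * l + 2) = y l := by
      have h : (2 * (l : ℕ) + 2) % 2 = 0 ∧ 0 < 2 * (l : ℕ) + 2 ∧ (2 * (l : ℕ) + 2) / 2 - 1 < L := by
        omega
      simp only [s]
      rw [dif_pos h]; congr 1; ext; simp
    rw [← this]; ring

/-- A set in `ℝ^m` is stably equivalent to a set of increasing sequences: points are encoded as
`(aᵢ - bᵢ) / e` for gaps `aᵢ`, `bᵢ`, `e`. -/
lemma reach_of_gap {σ : Type} [Finite σ] {L : ℕ} (V : Set (σ → ℝ)) (e : Fin L) (a b : σ → Fin L)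
    (hab : ∀ i j, a i ≠ b j) (hae : ∀ i, a i ≠ e) (hbe : ∀ i, b i ≠ e)
    (ha : Function.Injective a) (hb : Function.Injective b) :
    Reach V (fun w => (fun i => (gapRatio L w (a i) - gapRatio L w (b i)) / gapRatio L w e) ∈ V)
      (2 * L + 1) (fun _ => none) := by
  refine ⟨?_, fun k _ => by intro; simp⟩
  let T : Set (σ ⊕ Fin (2 * L + 1) → ℝ) := {z | (fun i => z (Sum.inl i)) ∈ V ∧
    Sat (2 * L + 1) (fun _ => none) (extZero fun k => z (Sum.inr k)) ∧
    ∀ i, gap L (extZero fun k => z (Sum.inr k)) (a i) - gap L (extZero fun k => z (Sum.inr k)) (b i) =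
      z (Sum.inl i) * gap L (extZero fun k => z (Sum.inr k)) e}
  have hpos : ∀ w : ℕ → ℝ, Sat (2 * L + 1) (fun _ => none) w → ∀ l, 0 < gap L w l := fun w hw l =>
    sub_pos.2 (hw.2.1 (2 * l + 2) (by omega) (2 * l + 1) (by omega))
  have hgap : ∀ l, PolyFun (fun v : Fin (2 * L + 1) → ℝ => gap L (extZero v) l) := fun l =>
    (PolyFun.extZero _).sub (PolyFun.extZero _)
  have hext : ∀ k, IsAff (fun (_ : σ → ℝ) (v : Fin (2 * L + 1) → ℝ) => extZero v k) := fun k => by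
    by_cases h : k < 2 * L + 1
    · simpa [extZero, h] using IsAff.fib (⟨k, h⟩ : Fin (2 * L + 1))
    · simpa [extZero, h] using IsAff.const 0
  have hgap' : ∀ l, IsAff (fun (_ : σ → ℝ) (v : Fin (2 * L + 1) → ℝ) => gap L (extZero v) l) :=
    fun l => (hext _).sub (hext _)
  have h1 : SE V T := by
    refine SE.fiber (Equiv.refl _) (fun x v => Sat (2 * L + 1) (fun _ => none) (extZero v) ∧
      ∀ i, gap L (extZero v) (a i) - gap L (extZero v) (b i) = x i * gap L (extZero v) e) ?_ ?_ ?_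
    · refine AffCond.and ?_ (AffCond.all fun i => AffCond.eq ((hgap' _).sub (hgap' _))
        (IsAff.poly_mul (PolyFun.coord i) (hgap' _)))
      simp only [sat_none]
      exact (AffCond.all fun k => AffCond.lt (IsAff.const 0) (IsAff.fib k)).and
        (AffCond.all fun l => AffCond.all fun k => AffCond.imp fun _ =>
          AffCond.lt (IsAff.fib k) (IsAff.fib l))
    · intro x v
      simp [T]
    · intro x _
      classical
      let y : Fin L → ℝ := fun l => if h : ∃ i, a i = l then x h.choose + (|x h.choose| + 1) else
        if h : ∃ i, b i = l then |x h.choose| + 1 else 1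
      have hya : ∀ i, y (a i) = x i + (|x i| + 1) := fun i => by
        have h : ∃ i', a i' = a i := ⟨i, rfl⟩
        simp only [y]
        rw [dif_pos h, ha h.choose_spec]
      have hyb : ∀ i, y (b i) = |x i| + 1 := fun i => by
        have h : ∃ i', b i' = b i := ⟨i, rfl⟩
        have h' : ¬ ∃ i', a i' = b i := fun ⟨j, hj⟩ => hab _ _ hj
        simp only [y]
        rw [dif_neg h', dif_pos h, hb h.choose_spec]
      have hye : y e = 1 := by
        have h : ¬ ∃ i', b i' = e := fun ⟨j, hj⟩ => hbe _ hj
        have h' : ¬ ∃ i', a i' = e := fun ⟨j, hj⟩ => hae _ hj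
        simp only [y]
        rw [dif_neg h', dif_neg h]
      have hy : ∀ l, 0 < y l := fun l => by
        simp only [y]
        split_ifs with h1 h2
        · linarith [neg_abs_le (x h1.choose)]
        · positivity
        · exact one_pos
      obtain ⟨v, hv, hv'⟩ := exists_sat_gap y hy
      refine ⟨v, hv, fun i => ?_⟩
      rw [hv', hya, hyb, hye]; ring
  refine h1.trans (SE.symm ?_)
  have hrat : ∀ w : ℕ → ℝ, Sat (2 * L + 1) (fun _ => none) w → ∀ x : σ → ℝ,
      (∀ i, gap L w (a i) - gap L w (b i) = x i * gap L w e) ↔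
        x = fun i => (gapRatio L w (a i) - gapRatio L w (b i)) / gapRatio L w e := fun w hw x => by
    rw [funext_iff]
    refine forall_congr' fun i => ?_
    have h0 := (hw.1 0 (by omega)).ne'
    have he := (hpos w hw e).ne'
    simp only [gapRatio]
    rw [← sub_div, div_div_div_cancel_right₀ h0, eq_div_iff he, eq_comm]
  refine SE.fiber (Equiv.sumComm _ _) (fun v x =>
    ∀ i, gap L (extZero v) (a i) - gap L (extZero v) (b i) = x i * gap L (extZero v) e) ?_ ?_ ?_
  · exact AffCond.all fun i => AffCond.eq (IsAff.of_poly ((hgap _).sub (hgap _)))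
      (IsAff.mul_poly (IsAff.fib i) (hgap e))
  · intro v x
    simp only [T, solSet, Set.mem_ofPred_eq, Equiv.sumComm_apply, Sum.swap_inl, Sum.swap_inr,
      Sum.elim_inl, Sum.elim_inr]
    constructor
    · rintro ⟨h1, h2, h3⟩
      refine ⟨⟨h2, ?_⟩, h3⟩
      rwa [← (hrat _ h2 x).1 h3]
    · rintro ⟨⟨h2, h1⟩, h3⟩
      refine ⟨?_, h2, h3⟩
      rwa [← (hrat _ h2 x).1 h3] at h1
  · rintro v ⟨hv, -⟩
    exact ⟨_, (hrat _ hv _).2 rfl⟩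

/-- The chain described by a program. -/
def progChain {n : ℕ} {op : ℕ → Instr} (hop : ∀ k < n, (op k).Below k) :
    Chain (Fin n) {k : Fin n // (op k).isSome} :=
  have hb : ∀ g : {k : Fin n // (op k).isSome}, ((op g.1).get g.2).2.1 < ((op g.1).get g.2).2.2.1 ∧
      ((op g.1).get g.2).2.2.1 < ((op g.1).get g.2).2.2.2 ∧ ((op g.1).get g.2).2.2.2 < (g.1 : ℕ) :=
    fun g => hop g.1 g.1.2 ((op g.1).get g.2).1 _ _ _ (by simp)
  { rk := fun i => i
    kind := fun g => ((op g.1).get g.2).1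
    p := fun g => ⟨((op g.1).get g.2).2.1, by have := hb g; omega⟩
    q := fun g => ⟨((op g.1).get g.2).2.2.1, by have := hb g; omega⟩
    r := fun g => ⟨((op g.1).get g.2).2.2.2, by have := hb g; omega⟩
    s := fun g => g.1
    rk_inj := Fin.val_injective
    s_inj := Subtype.val_injective
    rk_pq := fun g => (hb g).1
    rk_qr := fun g => (hb g).2.1
    rk_rs := fun g => (hb g).2.2 }

lemma progChain_space {n : ℕ} {op : ℕ → Instr} (hop : ∀ k < n, (op k).Below k) :
    (progChain hop).space = solSet n op (fun _ => True) := by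
  ext v
  have h : ∀ g : {k : Fin n // (op k).isSome}, (op g.1).Eqn (extZero v) g.1 ↔
      if (progChain hop).kind g then
        v ((progChain hop).p g) * v ((progChain hop).s g) =
          v ((progChain hop).q g) * v ((progChain hop).r g)
      else v ((progChain hop).p g) + v ((progChain hop).s g) =
          v ((progChain hop).q g) + v ((progChain hop).r g) := fun g => by
    have e : op g.1 = some (((op g.1).get g.2).1, ((progChain hop).p g : ℕ),
        ((progChain hop).q g : ℕ), ((progChain hop).r g : ℕ)) := by simp [progChain]
    rw [e]
    simp only [Instr.Eqn, extZero_val]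
    rfl
  constructor
  · rintro ⟨h1, h2, h3⟩
    refine ⟨⟨fun k hk => ?_, fun l hl k hk => ?_, fun k hk => ?_⟩, trivial⟩
    · rw [extZero_of_lt _ hk]; exact h1 _
    · rw [extZero_of_lt _ hl, extZero_of_lt _ (hk.trans hl)]; exact h2 _ _ hk
    · by_cases hs : (op k).isSome
      · exact (h ⟨⟨k, hk⟩, hs⟩).2 (h3 _)
      · rw [Option.not_isSome_iff_eq_none.1 hs]; trivial
  · rintro ⟨⟨h1, h2, h3⟩, -⟩
    refine ⟨fun k => ?_, fun k l hkl => ?_, fun g => (h g).1 (h3 _ g.1.2)⟩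
    · simpa [extZero_val] using h1 k k.2
    · simpa [extZero_val] using h2 l l.2 k hkl

lemma progChain_covered {n : ℕ} {op : ℕ → Instr} (hop : ∀ k < n, (op k).Below k) {i : Fin n}
    (h : Covered n op i) : ∃ g a b, (progChain hop).xsel g a b = i := by
  obtain ⟨l, hl, b, p, q, r, h, hi⟩ := h
  refine ⟨⟨⟨l, hl⟩, by simp [h]⟩, ?_⟩
  rcases hi with hi | hi | hi | hi
  · exact ⟨false, true, by ext; simp [Chain.xsel, progChain, h, hi]⟩
  · exact ⟨false, false, by ext; simp [Chain.xsel, progChain, h, hi]⟩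
  · exact ⟨true, true, by ext; simp [Chain.xsel, progChain, h, hi]⟩
  · exact ⟨true, false, by ext; simp [Chain.xsel, progChain, hi]⟩

lemma MvPolynomial.eq_zero_of_isOpen {m : ℕ} {V : Set (Fin m → ℝ)} (hV : IsOpen V)
    (hne : V.Nonempty) (f : MvPolynomial (Fin m) ℤ)
    (hf : ∀ x ∈ V, MvPolynomial.aeval x f = (0 : ℝ)) : f = 0 := by
  obtain ⟨x, hx⟩ := hne
  obtain ⟨ε, hε, hball⟩ := Metric.isOpen_iff.1 hV x hx
  have h0 : MvPolynomial.map (algebraMap ℤ ℝ) f = 0 := by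
    refine MvPolynomial.funext_set (fun i => Metric.ball (x i) ε) (fun i => ?_) fun y hy => ?_
    · rw [Real.ball_eq_Ioo]; exact Set.Ioo_infinite (by linarith)
    · rw [MvPolynomial.eval_map, ← MvPolynomial.aeval_def, map_zero]
      exact hf y (hball (by rwa [ball_pi x hε]))
  exact MvPolynomial.map_injective _ (algebraMap ℤ ℝ).injective_int (by rw [h0, map_zero])

lemma exists_chain {m : ℕ} {V : Set (Fin m → ℝ)} (hV : IsPrimaryBasicSemialgebraicZ V)
    (hVne : V.Nonempty) (hVopen : IsOpen V) :
    ∃ (I G : Type) (_ : Finite I) (_ : Finite G) (C : Chain I G),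
      (∀ i, ∃ g a b, C.xsel g a b = i) ∧ SE V C.space := by
  obtain ⟨k, l, f, g, rfl⟩ := hV
  set V := {x : Fin m → ℝ | (∀ i, MvPolynomial.aeval x (f i) = (0 : ℝ)) ∧
    ∀ j, (0 : ℝ) < MvPolynomial.aeval x (g j)} with hV
  have hf : ∀ i, f i = 0 := fun i =>
    MvPolynomial.eq_zero_of_isOpen hVopen hVne _ fun x hx => hx.1 i
  let L := 2 * m + 1
  let e : Fin L := ⟨2 * m, by omega⟩
  let a : Fin m → Fin L := fun i => ⟨i, by omega⟩
  let b : Fin m → Fin L := fun i => ⟨m + i, by omega⟩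
  have h := reach_of_gap V e a b (fun i j h => by simp [a, b] at h; omega)
    (fun i h => by simp [a, e] at h; omega) (fun i h => by simp [b, e] at h; omega)
    (fun i j h => by simpa [a, Fin.ext_iff] using h) (fun i j h => by simpa [b, Fin.ext_iff] using h)
  choose d F G hFG using fun j => PosTerm.exists_aeval_eq (g j) e a b
  obtain ⟨n, op, h⟩ := Reach.exists_forall_lt (List.ofFn fun j => (F j, G j)) le_rfl
    (h.mono fun w hw => by
      have he : 0 < gapRatio L w e := div_pos
        (sub_pos.2 (hw.2.1 (2 * (e : ℕ) + 2) (by omega) (2 * e + 1) (by omega))) (hw.1 0 (by omega))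
      simp only [hV, Set.mem_ofPred_eq, hf, map_zero, List.forall_mem_ofFn_iff, true_and,
        implies_true]
      refine forall_congr' fun j => ?_
      rw [← sub_pos (a := PosTerm.eval _ (G j)), ← hFG j _ he.ne',
        mul_pos_iff_of_pos_left (pow_pos he _)])
  obtain ⟨n, op, h, hc⟩ := h.exists_forall_covered fun _ _ _ _ => trivial
  exact ⟨_, _, inferInstance, inferInstance, progChain h.below,
    fun i => progChain_covered h.below (hc i i.2), progChain_space h.below ▸ h.se⟩

/-- **Universality for simplicial polytopes** (Theorem 1.1(iv)).
Every nonempty open primary basic semialgebraic set defined over `ℤ` is stably equivalent to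
the realization space of some simplicial polytope. -/
theorem universality_simplicial_polytopes (m : ℕ) (V : Set (Fin m → ℝ))
    (hV : IsPrimaryBasicSemialgebraicZ V) (hVne : V.Nonempty) (hVopen : IsOpen V) :
    ∃ (d n : ℕ) (v : Fin n → Fin d → ℝ) (B : Finset (Fin n)),
      IsPolytopeVertexList v ∧
      IsSimplicialVertexList v ∧
      B.card = d + 1 ∧
      AffineIndependent ℝ (fun i : ↥B => v i) ∧
      StablyEquivalent ⟨m, V⟩ ⟨d * n, flat (polytopeRealizationSpace v B)⟩ := by
  obtain ⟨I, G, _, _, C, hcov, hC⟩ := exists_chain hV hVne hVopen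
  obtain ⟨d, n, v, B, h1, h2, h3, h4, h5⟩ := C.exists_polytope hcov (hC.nonempty hVne)
  exact ⟨d, n, v, B, h1, h2, h3, h4, (hC.trans h5).stablyEquivalent⟩
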